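/- Let F be a number field and ψ a nontrivial character of a finite abelian group G = Gal(K/F), and suppose to each prime 𝔭 of F (unramified in K) we attach ψ(Frob_𝔭). Then ∑_{q_𝔭 ≤ x} ψ(Frob_𝔭)/q_𝔭 = C + o(1) as x → ∞ for some constant C (generalized Mertens theorem for nontrivial characters). -/

import Mathlib

namespace Mert

open NumberField Finset

section AF
variable (E : Type*) [Field E] [NumberField E]

/-- ideals of norm exactly k -/
noncomputable def idl (k : ℕ) : Finset (Ideal (𝓞 E)) :=
  (Ideal.finite_setOfPred_absNorm_eq (S := 𝓞 E) k).toFinset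

/-- number of ideals of norm k -/
noncomputable def aE (k : ℕ) : ℕ := (idl E k).card

theorem fin_primes (k : ℕ) : {P : Ideal (𝓞 E) | P.IsPrime ∧ P ≠ ⊥ ∧ Ideal.absNorm P ≤ k}.Finite :=
  (Ideal.finite_setOfPred_absNorm_le (S := 𝓞 E) k).subset (fun _ h => h.2.2)

/-- nonzero primes of norm at most k -/
noncomputable def prm (k : ℕ) : Finset (Ideal (𝓞 E)) := (fin_primes E k).toFinset

/-- von Mangoldt coefficient of the Dedekind zeta function -/
noncomputable def lamE (k : ℕ) : ℝ :=
  ∑ P ∈ prm E k, ∑ j ∈ Icc 1 k, if Ideal.absNorm P ^ j = k then Real.log (Ideal.absNorm P) else 0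

/-- number of primes of norm k -/
noncomputable def cE (k : ℕ) : ℕ := ((prm E k).filter (fun P => Ideal.absNorm P = k)).card

variable {E}

@[simp] theorem mem_idl {k : ℕ} {I : Ideal (𝓞 E)} : I ∈ idl E k ↔ Ideal.absNorm I = k := by
  simp [idl]

@[simp] theorem mem_prm {k : ℕ} {P : Ideal (𝓞 E)} :
    P ∈ prm E k ↔ P.IsPrime ∧ P ≠ ⊥ ∧ Ideal.absNorm P ≤ k := by
  simp [prm]

theorem aE_eq_card (k : ℕ) : aE E k = Nat.card {I : Ideal (𝓞 E) // Ideal.absNorm I = k} := by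
  rw [aE, ← Nat.card_eq_finsetCard]
  exact Nat.card_congr (Equiv.subtypeEquivRight fun I => mem_idl)

theorem two_le_norm {P : Ideal (𝓞 E)} (hP : P.IsPrime) (h0 : P ≠ ⊥) : 2 ≤ Ideal.absNorm P := by
  have h1 : Ideal.absNorm P ≠ 0 := by rwa [Ne, Ideal.absNorm_eq_zero_iff]
  have h2 : Ideal.absNorm P ≠ 1 := by rw [Ne, Ideal.absNorm_eq_one_iff]; exact hP.ne_top
  omega

theorem aE_one : aE E 1 = 1 := by
  rw [aE, Finset.card_eq_one]
  exact ⟨⊤, by ext I; simp [Ideal.absNorm_eq_one_iff]⟩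

theorem card_dvd {D : Ideal (𝓞 E)} (hD : D ≠ ⊥) {k : ℕ} [DecidablePred (fun I => D ∣ I)] :
    (((idl E k).filter (fun I => D ∣ I)).card : ℕ) =
      if Ideal.absNorm D ∣ k then aE E (k / Ideal.absNorm D) else 0 := by
  have hD1 : 0 < Ideal.absNorm D := Nat.pos_of_ne_zero (by rwa [Ne, Ideal.absNorm_eq_zero_iff])
  split_ifs with h
  · symm
    refine Finset.card_bij (fun I _ => D * I) ?_ ?_ ?_
    · intro I hI
      rw [mem_idl] at hI
      simp [hI, Nat.mul_div_cancel' h]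
    · intro I _ J _ hIJ
      exact mul_left_cancel₀ (by simpa using hD) hIJ
    · intro I hI
      obtain ⟨hI, J, rfl⟩ := by simpa using hI
      refine ⟨J, ?_, rfl⟩
      rw [mem_idl, ← hI, map_mul, Nat.mul_div_cancel_left _ hD1]
  · rw [Finset.card_eq_zero, Finset.filter_eq_empty_iff]
    rintro I hI ⟨J, rfl⟩
    rw [mem_idl] at hI
    exact h ⟨_, by rw [← hI, map_mul]⟩

theorem pow_dvd_iff_count {I P : Ideal (𝓞 E)} (hI : I ≠ ⊥) (hP : P.IsPrime) (h0 : P ≠ ⊥) (j : ℕ)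
    [DecidableEq (Ideal (𝓞 E))] :
    P ^ j ∣ I ↔ j ≤ (UniqueFactorizationMonoid.normalizedFactors I).count P := by
  have hirr : Irreducible P := (Ideal.prime_of_isPrime h0 hP).irreducible
  rw [pow_dvd_iff_le_emultiplicity,
    UniqueFactorizationMonoid.emultiplicity_eq_count_normalizedFactors hirr (by simpa using hI),
    normalize_eq, Nat.cast_le]

open Classical in
theorem log_norm_eq (I : Ideal (𝓞 E)) (k : ℕ) (hk : k ≠ 0) (hI : Ideal.absNorm I = k) :
    Real.log k = ∑ P ∈ prm E k, ∑ j ∈ Icc 1 k,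
      if P ^ j ∣ I then Real.log (Ideal.absNorm P) else 0 := by
  have hI0 : I ≠ ⊥ := by rw [Ne, ← Ideal.absNorm_eq_zero_iff, hI]; exact hk
  set nf := UniqueFactorizationMonoid.normalizedFactors I with hnf
  have h1 : I = ∏ P ∈ nf.toFinset, P ^ nf.count P := by
    conv_lhs => rw [← Ideal.prod_normalizedFactors_eq_self hI0, Finset.prod_multiset_count]
  have hmem : ∀ P ∈ nf.toFinset, P ∈ prm E k := by
    intro P hP
    rw [Multiset.mem_toFinset] at hP
    have hprime := UniqueFactorizationMonoid.prime_of_normalized_factor P hP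
    have hdvd := UniqueFactorizationMonoid.dvd_of_mem_normalizedFactors hP
    rw [mem_prm]
    refine ⟨Ideal.isPrime_of_prime hprime, by simpa using hprime.ne_zero, ?_⟩
    rw [← hI]
    exact Nat.le_of_dvd (by omega) (map_dvd _ hdvd)
  have h2 : Real.log k = ∑ P ∈ nf.toFinset, nf.count P * Real.log (Ideal.absNorm P) := by
    conv_lhs => rw [← hI, h1]
    rw [map_prod, Nat.cast_prod, Real.log_prod]
    · refine Finset.sum_congr rfl fun P _ => ?_
      rw [map_pow, Nat.cast_pow, Real.log_pow]
    · intro P hP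
      have := mem_prm.1 (hmem P hP)
      have := two_le_norm this.1 this.2.1
      rw [map_pow]
      positivity
  rw [h2, Finset.sum_subset (fun P hP => hmem P hP)]
  · refine Finset.sum_congr rfl fun P hP => ?_
    obtain ⟨hp, hp0, hle⟩ := mem_prm.1 hP
    rw [← Finset.sum_filter, Finset.sum_const, nsmul_eq_mul]
    congr 2
    have : (Icc 1 k).filter (fun j => P ^ j ∣ I) = Icc 1 (nf.count P) := by
      ext j
      simp only [mem_filter, mem_Icc, pow_dvd_iff_count hI0 hp hp0, ← hnf]
      have hk2 : nf.count P < k := by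
        have h3 := (pow_dvd_iff_count hI0 hp hp0 (nf.count P)).2 le_rfl
        have h4 := Nat.le_of_dvd (by omega) (map_dvd Ideal.absNorm h3)
        rw [hI, map_pow] at h4
        have h5 := Nat.pow_le_pow_left (two_le_norm hp hp0) (nf.count P)
        have h6 := Nat.lt_two_pow_self (n := nf.count P)
        omega
      omega
    rw [this]; simp
  · intro P _ hP
    rw [Multiset.mem_toFinset, ← Multiset.count_eq_zero] at hP
    simp [hP]

theorem lamE_eq {u k : ℕ} (huk : u ≤ k) :
    lamE E u = ∑ P ∈ prm E k, ∑ j ∈ Icc 1 k,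
      if Ideal.absNorm P ^ j = u then Real.log (Ideal.absNorm P) else 0 := by
  have hpk : prm E u ⊆ prm E k := fun P hP => by
    rw [mem_prm] at *; exact ⟨hP.1, hP.2.1, hP.2.2.trans huk⟩
  rw [lamE]
  have key : ∀ P ∈ prm E k, ∀ j, 1 ≤ j → Ideal.absNorm P ^ j = u → P ∈ prm E u ∧ j ≤ u := by
    intro P hP j hj h
    obtain ⟨hp, hp0, hle⟩ := mem_prm.1 hP
    have h2 := two_le_norm hp hp0
    constructor
    · rw [mem_prm]
      refine ⟨hp, hp0, ?_⟩
      rw [← h]; exact Nat.le_self_pow (by omega) _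
    · rw [← h]; exact (Nat.lt_pow_self (by omega)).le
  rw [Finset.sum_subset hpk]
  · refine Finset.sum_congr rfl fun P hP => ?_
    refine Finset.sum_subset (Finset.Icc_subset_Icc_right huk) ?_
    intro j hj hj'
    rw [if_neg]
    intro h
    rw [mem_Icc] at hj hj'
    exact hj' ⟨hj.1, (key P hP j hj.1 h).2⟩
  · intro P hP hP'
    refine Finset.sum_eq_zero fun j hj => ?_
    rw [if_neg]
    intro h
    exact hP' (key P hP j (mem_Icc.1 hj).1 h).1

/-- a log = a * Λ -/
theorem aE_log (k : ℕ) (hk : k ≠ 0) :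
    (aE E k : ℝ) * Real.log k = ∑ x ∈ k.divisorsAntidiagonal, lamE E x.1 * aE E x.2 := by
  classical
  have h1 : (aE E k : ℝ) * Real.log k = ∑ P ∈ prm E k, ∑ j ∈ Icc 1 k,
      Real.log (Ideal.absNorm P) * ((idl E k).filter (fun I => P ^ j ∣ I)).card := by
    have : (aE E k : ℝ) * Real.log k = ∑ I ∈ idl E k, Real.log k := by
      rw [Finset.sum_const, aE, nsmul_eq_mul]
    have h3 : ∑ I ∈ idl E k, Real.log k = ∑ I ∈ idl E k, ∑ P ∈ prm E k, ∑ j ∈ Icc 1 k,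
      (if P ^ j ∣ I then Real.log (Ideal.absNorm P) else 0 : ℝ) := by
      exact Finset.sum_congr rfl (fun I hI => log_norm_eq I k hk (mem_idl.1 hI))
    rw [this, h3, Finset.sum_comm]
    refine Finset.sum_congr rfl fun P hP => ?_
    rw [Finset.sum_comm]
    refine Finset.sum_congr rfl fun j hj => ?_
    rw [← Finset.sum_filter (M := ℝ), Finset.sum_const, nsmul_eq_mul, mul_comm]
  have h2 : ∀ x ∈ k.divisorsAntidiagonal, lamE E x.1 * aE E x.2 =
      ∑ P ∈ prm E k, ∑ j ∈ Icc 1 k,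
        (if Ideal.absNorm P ^ j = x.1 then Real.log (Ideal.absNorm P) else 0) * aE E x.2 := by
    intro x hx
    have hx1 : x.1 ≤ k := Nat.le_of_dvd (by omega) (Nat.fst_mem_divisors_of_mem_antidiagonal hx |> Nat.dvd_of_mem_divisors)
    rw [lamE_eq hx1, Finset.sum_mul]
    simp_rw [Finset.sum_mul]
  rw [h1, Finset.sum_congr (g := fun x : ℕ × ℕ => ∑ P ∈ prm E k, ∑ j ∈ Icc 1 k,
        (if Ideal.absNorm P ^ j = x.1 then Real.log (Ideal.absNorm P) else 0) * (aE E x.2 : ℝ)) rfl h2,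
    Finset.sum_comm (s := k.divisorsAntidiagonal)]
  refine Finset.sum_congr rfl fun P hP => ?_
  rw [Finset.sum_comm (s := k.divisorsAntidiagonal)]
  refine Finset.sum_congr rfl fun j hj => ?_
  obtain ⟨hp, hp0, hle⟩ := mem_prm.1 hP
  rw [card_dvd (by simpa using pow_ne_zero j hp0), map_pow]
  split_ifs with h
  · rw [Finset.sum_eq_single (Ideal.absNorm P ^ j, k / Ideal.absNorm P ^ j)]
    · simp
    · rintro ⟨x, y⟩ hx hne
      rw [Nat.mem_divisorsAntidiagonal] at hx
      rw [if_neg, zero_mul]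
      intro h3
      apply hne
      simp only at hx h3
      have hx0 : 0 < x := Nat.pos_of_ne_zero (fun h => by simp [h] at hx; exact hk hx.1.symm)
      rw [h3, ← hx.1, Nat.mul_div_cancel_left _ hx0]
    · intro h3
      exact absurd (Nat.mem_divisorsAntidiagonal.2 ⟨Nat.mul_div_cancel' h, hk⟩) h3
  · symm
    simp only [Nat.cast_zero, mul_zero]
    refine Finset.sum_eq_zero ?_
    rintro ⟨x, y⟩ hx
    rw [Nat.mem_divisorsAntidiagonal] at hx
    rw [if_neg, zero_mul]
    intro h3
    exact h ⟨y, by rw [h3]; exact hx.1.symm⟩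

theorem lamE_nonneg (k : ℕ) : 0 ≤ lamE E k := by
  refine Finset.sum_nonneg fun P hP => Finset.sum_nonneg fun j _ => ?_
  split_ifs
  · exact Real.log_natCast_nonneg _
  · exact le_rfl

theorem prod_norm_le {p : ℕ} (hp : p.Prime) (S : Finset (Ideal (𝓞 E)))
    (hS : ∀ P ∈ S, P.IsPrime ∧ P ≠ ⊥ ∧ ∃ e, Ideal.absNorm P = p ^ e) :
    ∏ P ∈ S, Ideal.absNorm P ≤ p ^ Module.finrank ℚ E := by
  have h1 : ∏ P ∈ S, P ∣ Ideal.span {(p : 𝓞 E)} := by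
    refine Finset.prod_primes_dvd _ (fun P hP => Ideal.prime_of_isPrime (hS P hP).2.1 (hS P hP).1) ?_
    intro P hP
    obtain ⟨h1, h2, e, he⟩ := hS P hP
    rw [Ideal.dvd_span_singleton]
    have h3 := Ideal.absNorm_mem P
    rw [he, Nat.cast_pow] at h3
    exact h1.mem_of_pow_mem e h3
  have h2 := map_dvd Ideal.absNorm h1
  rw [map_prod, Ideal.absNorm_span_natCast, RingOfIntegers.rank] at h2
  exact Nat.le_of_dvd (pow_pos hp.pos _) h2

theorem lamE_le (k : ℕ) : lamE E k ≤ Module.finrank ℚ E * ArithmeticFunction.vonMangoldt k := by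
  by_cases hk : IsPrimePow k
  · obtain ⟨p, e, hp, he, rfl⟩ := hk
    have hp' := hp.nat_prime
    rw [ArithmeticFunction.vonMangoldt_apply_pow he.ne', ArithmeticFunction.vonMangoldt_apply_prime hp']
    have hQ : ∃ Q : Ideal (𝓞 E) → Prop, ∀ P, Q P ↔ ∃ j ∈ Icc 1 (p ^ e), Ideal.absNorm P ^ j = p ^ e :=
      ⟨_, fun P => Iff.rfl⟩
    obtain ⟨Q, hQ⟩ := hQ
    classical
    set S := (prm E (p ^ e)).filter Q with hS
    have hSS : ∀ P ∈ S, P.IsPrime ∧ P ≠ ⊥ ∧ ∃ e, Ideal.absNorm P = p ^ e := by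
      intro P hP
      rw [hS, mem_filter, hQ] at hP
      obtain ⟨h1, j, hj, hj'⟩ := hP
      obtain ⟨h1, h2, h3⟩ := mem_prm.1 h1
      refine ⟨h1, h2, ?_⟩
      have : Ideal.absNorm P ∣ p ^ e := by
        rw [← hj']; exact dvd_pow_self _ (by have := mem_Icc.1 hj; omega)
      obtain ⟨i, _, hi⟩ := (Nat.dvd_prime_pow hp').1 this
      exact ⟨i, hi⟩
    have hle := prod_norm_le hp' S hSS
    have h1 : lamE E (p ^ e) ≤ ∑ P ∈ S, Real.log (Ideal.absNorm P) := by
      rw [lamE, hS, Finset.sum_filter (M := ℝ)]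
      refine Finset.sum_le_sum fun P hP => ?_
      obtain ⟨h1, h2, h3⟩ := mem_prm.1 hP
      have h4 := two_le_norm h1 h2
      split_ifs with h
      · obtain ⟨j, hj, hj'⟩ := (hQ P).1 h
        rw [Finset.sum_eq_single j]
        · rw [if_pos hj']
        · intro i hi hne
          rw [if_neg]
          intro h5
          exact hne (Nat.pow_right_injective h4 (h5.trans hj'.symm))
        · intro h; exact absurd hj h
      · refine (Finset.sum_eq_zero ?_).le
        intro j hj
        rw [if_neg]
        intro h5; exact h ((hQ P).2 ⟨j, hj, h5⟩)
    refine h1.trans ?_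
    rw [← Real.log_prod, ← Nat.cast_prod, ← Real.log_pow]
    · apply Real.log_le_log
      · have : 0 < ∏ P ∈ S, Ideal.absNorm P := Finset.prod_pos fun P hP => by
          have := two_le_norm (hSS P hP).1 (hSS P hP).2.1; omega
        exact_mod_cast this
      · exact_mod_cast hle
    · intro P hP
      have := two_le_norm (hSS P hP).1 (hSS P hP).2.1
      positivity
  · rw [ArithmeticFunction.vonMangoldt_apply, if_neg hk, mul_zero, lamE]
    refine (Finset.sum_eq_zero fun P hP => Finset.sum_eq_zero fun j hj => ?_).le
    rw [if_neg]
    intro h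
    apply hk
    obtain ⟨h1, h2, h3⟩ := mem_prm.1 hP
    have := h1.isMaximal h2
    obtain ⟨p, e, he, _, hp, h5⟩ := Ideal.exists_prime_and_absNorm_eq_pow P
    rw [← h, h5]
    exact (hp.isPrimePow.pow he.ne').pow (by have := mem_Icc.1 hj; omega)

theorem lamE_prime {p : ℕ} (hp : p.Prime) : lamE E p = cE E p * Real.log p := by
  classical
  rw [lamE, cE, ← nsmul_eq_mul, ← Finset.sum_const, Finset.sum_filter]
  refine Finset.sum_congr rfl fun P hP => ?_
  obtain ⟨h1, h2, h3⟩ := mem_prm.1 hP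
  have h4 := two_le_norm h1 h2
  rw [Finset.sum_eq_single 1]
  · rw [pow_one]; split_ifs with h
    · rw [h]
    · rfl
  · intro j hj hne
    rw [if_neg]
    intro h
    have := (Nat.Prime.eq_one_of_pow (h ▸ hp))
    exact hne this
  · intro h
    exact absurd (mem_Icc.2 ⟨le_rfl, hp.one_lt.le⟩) h

end AF
end Mert


namespace Mert

open NumberField Finset Filter Topology

/-- completely multiplicative bounded functions -/
structure CM (f : ℕ → ℂ) : Prop where
  one : f 1 = 1
  mul : ∀ a b, f (a * b) = f a * f b
  bd : ∀ a, ‖f a‖ ≤ 1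

section AN
variable (E : Type*) [Field E] [NumberField E]

/-- twisted Dedekind coefficients -/
noncomputable def aT (f : ℕ → ℂ) (k : ℕ) : ℂ := aE E k * f k

/-- twisted von Mangoldt coefficients -/
noncomputable def lT (f : ℕ → ℂ) (k : ℕ) : ℂ := lamE E k * f k

/-- coefficients of the logarithm -/
noncomputable def gT (f : ℕ → ℂ) (k : ℕ) : ℂ := (lamE E k / Real.log k : ℝ) * f k

variable {E}

open NumberField.Ideal in
theorem aE_summable {s : ℂ} (hs : 1 < s.re) : LSeriesSummable (fun k => ((aE E k : ℝ) : ℂ)) s := by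
  have hlim : Tendsto (fun n : ℕ ↦ (∑ k ∈ Icc 1 n, (aE E k : ℝ)) / n) atTop
      (𝓝 (dedekindZeta_residue E)) := by
    refine ((Ideal.tendsto_norm_le_div_atTop₀ E).comp tendsto_natCast_atTop_atTop).congr fun n ↦ ?_
    simp only [Function.comp_apply, Nat.cast_le, ← Nat.cast_sum, aE_eq_card]
    congr
    rw [← add_left_inj 1, ← Ideal.card_norm_le_eq_card_norm_le_add_one,
      show Finset.Icc 1 n = Finset.Ioc 0 n from Finset.Icc_succ_left_eq_Ioc _ _,
      show 1 = Nat.card {I : Ideal (𝓞 E) // Ideal.absNorm I = 0} by simp [Ideal.absNorm_eq_zero_iff],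
      Finset.sum_Ioc_add_eq_sum_Icc (n.zero_le),
      ← Finset.card_preimage_eq_sum_card_image_eq (fun k _ ↦ Ideal.finite_setOfPred_absNorm_eq k)]
    simp [Set.coe_eq_subtype]
  refine LSeriesSummable_of_sum_norm_bigO_and_nonneg ?_ (fun _ => Nat.cast_nonneg _) zero_le_one hs
  exact Asymptotics.isBigO_atTop_natCast_rpow_of_tendsto_div_rpow (by simpa using hlim)

theorem summable_of_le {f g : ℕ → ℂ} {s : ℂ} (hg : LSeriesSummable g s) (h : ∀ k, k ≠ 0 → ‖f k‖ ≤ ‖g k‖) :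
    LSeriesSummable f s := by
  rw [LSeriesSummable, ← summable_norm_iff] at *
  refine Summable.of_nonneg_of_le (fun _ => norm_nonneg _) (fun k => ?_) hg
  rcases eq_or_ne k 0 with rfl | hk
  · simp
  · exact LSeries.norm_term_le s (h k hk)

theorem aT_summable {f : ℕ → ℂ} (hf : CM f) {s : ℂ} (hs : 1 < s.re) : LSeriesSummable (aT E f) s := by
  refine summable_of_le (aE_summable (E := E) hs) fun k _ => ?_
  rw [aT, norm_mul]
  simpa using mul_le_of_le_one_right (norm_nonneg (aE E k : ℂ)) (hf.bd k)

theorem lam_summable {s : ℂ} (hs : 1 < s.re) : LSeriesSummable (fun k => ((lamE E k : ℝ) : ℂ)) s := by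
  have := (ArithmeticFunction.LSeriesSummable_vonMangoldt hs).smul (Module.finrank ℚ E : ℂ)
  refine summable_of_le this fun k _ => ?_
  have h1 := lamE_le (E := E) k
  have h2 := lamE_nonneg (E := E) k
  rw [Pi.smul_apply, smul_eq_mul, norm_mul, Complex.norm_real, Complex.norm_real, Real.norm_of_nonneg h2,
    Real.norm_of_nonneg ArithmeticFunction.vonMangoldt_nonneg]
  simpa using h1

theorem lT_summable {f : ℕ → ℂ} (hf : CM f) {s : ℂ} (hs : 1 < s.re) : LSeriesSummable (lT E f) s := by
  refine summable_of_le (lam_summable (E := E) hs) fun k _ => ?_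
  rw [lT, norm_mul]
  simpa using mul_le_of_le_one_right (norm_nonneg ((lamE E k : ℝ) : ℂ)) (hf.bd k)

theorem lamE_one : lamE E 1 = 0 := by
  have h1 := lamE_le (E := E) 1
  have h2 := lamE_nonneg (E := E) 1
  simp at h1
  linarith

theorem log2_mul_le {k : ℕ} : Real.log 2 * (lamE E k / Real.log k) ≤ lamE E k := by
  rcases Nat.lt_or_ge k 2 with hk | hk
  · interval_cases k
    · simpa using lamE_nonneg (E := E) 0
    · simpa using lamE_nonneg (E := E) 1
  · have h2 := lamE_nonneg (E := E) k
    have h3 : Real.log 2 ≤ Real.log k := Real.log_le_log (by norm_num) (by exact_mod_cast hk)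
    have h4 : 0 < Real.log 2 := Real.log_pos (by norm_num)
    rw [mul_div_assoc', div_le_iff₀ (by linarith), mul_comm]
    exact mul_le_mul_of_nonneg_left h3 h2

theorem gT_summable {f : ℕ → ℂ} (hf : CM f) {s : ℂ} (hs : 1 < s.re) : LSeriesSummable (gT E f) s := by
  have := (lam_summable (E := E) hs).smul ((Real.log 2 : ℂ)⁻¹)
  refine summable_of_le this fun k _ => ?_
  have h1 := log2_mul_le (E := E) (k := k)
  have h4 : 0 < Real.log 2 := Real.log_pos (by norm_num)
  have h5 : 0 ≤ lamE E k / Real.log k := div_nonneg (lamE_nonneg k) (Real.log_natCast_nonneg _)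
  have h6 : lamE E k / Real.log k ≤ (Real.log 2)⁻¹ * lamE E k := by
    rw [inv_mul_eq_div, le_div_iff₀ h4]; linarith
  rw [gT, norm_mul, Pi.smul_apply, smul_eq_mul, norm_mul, norm_inv, Complex.norm_real, Complex.norm_real,
    Complex.norm_real, Real.norm_of_nonneg h5, Real.norm_of_nonneg h4.le, Real.norm_of_nonneg (lamE_nonneg k)]
  exact (mul_le_of_le_one_right h5 (hf.bd k)).trans h6

theorem absc_lt {g : ℕ → ℂ} (h : ∀ s : ℂ, 1 < s.re → LSeriesSummable g s) {s : ℂ} (hs : 1 < s.re) :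
    LSeries.abscissaOfAbsConv g < s.re := by
  have : LSeries.abscissaOfAbsConv g ≤ (1 : ℝ) :=
    LSeries.abscissaOfAbsConv_le_of_forall_lt_LSeriesSummable fun y hy => h _ (by simpa using hy)
  exact this.trans_lt (by exact_mod_cast hs)

theorem logMul_aT {f : ℕ → ℂ} (hf : CM f) (k : ℕ) (hk : k ≠ 0) :
    LSeries.logMul (aT E f) k = LSeries.convolution (lT E f) (aT E f) k := by
  rw [LSeries.convolution_def, LSeries.logMul, aT]
  have h := aE_log (E := E) k hk
  have h1 : Complex.log k * (aE E k * f k) = ((aE E k * Real.log k : ℝ) : ℂ) * f k := by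
    push_cast; ring
  rw [h1, h, Complex.ofReal_sum, Finset.sum_mul]
  refine Finset.sum_congr rfl fun x hx => ?_
  rw [lT, aT, ← (Nat.mem_divisorsAntidiagonal.1 hx).1, hf.mul]
  push_cast; ring

theorem L_hasDeriv {f : ℕ → ℂ} (hf : CM f) {s : ℂ} (hs : 1 < s.re) :
    HasDerivAt (LSeries (aT E f)) (-(LSeries (lT E f) s * LSeries (aT E f) s)) s := by
  have h := LSeries_hasDerivAt (absc_lt (fun s hs => aT_summable (E := E) hf hs) hs)
  rw [LSeries_congr (fun {k} hk => logMul_aT hf k hk),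
    LSeries_convolution' (lT_summable hf hs) (aT_summable hf hs)] at h
  exact h

theorem G_hasDeriv {f : ℕ → ℂ} (hf : CM f) {s : ℂ} (hs : 1 < s.re) :
    HasDerivAt (LSeries (gT E f)) (-(LSeries (lT E f) s)) s := by
  have h := LSeries_hasDerivAt (absc_lt (fun s hs => gT_summable (E := E) hf hs) hs)
  have h2 : ∀ {k : ℕ}, k ≠ 0 → LSeries.logMul (gT E f) k = lT E f k := by
    intro k hk
    rw [LSeries.logMul, gT, lT]
    rcases eq_or_ne k 1 with rfl | hk1
    · simp [lamE_one]
    · have : Real.log k ≠ 0 := (Real.log_pos (by exact_mod_cast (by omega : 1 < k))).ne'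
      rw [← Complex.natCast_log, ← mul_assoc, ← Complex.ofReal_mul, mul_div_cancel₀ _ this]
  rw [LSeries_congr h2] at h
  exact h

/-- L = exp G -/
theorem L_eq_exp {f : ℕ → ℂ} (hf : CM f) {s : ℝ} (hs : 1 < s) :
    LSeries (aT E f) s = Complex.exp (LSeries (gT E f) s) := by
  set w : ℝ → ℂ := fun x => LSeries (aT E f) x * Complex.exp (-LSeries (gT E f) x) with hw
  have hd : ∀ x ∈ Set.Ioi (1:ℝ), HasDerivAt w 0 x := by
    intro x hx
    have hx' : 1 < (x : ℂ).re := by simpa using hx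
    have h1 := (L_hasDeriv (E := E) hf hx').comp_ofReal
    have h2 := (G_hasDeriv (E := E) hf hx').comp_ofReal
    have h3 := h1.mul h2.neg.cexp
    have h4 : -(LSeries (lT E f) x * LSeries (aT E f) x) * Complex.exp (-LSeries (gT E f) x) +
      LSeries (aT E f) x * (Complex.exp (-LSeries (gT E f) x) * - -LSeries (lT E f) x) = 0 := by ring
    exact h4 ▸ h3
  have hconst : ∀ x ∈ Set.Ioi (1:ℝ), w x = w s := by
    intro x hx
    exact (convex_Ioi (1:ℝ)).is_const_of_fderivWithin_eq_zero (𝕜 := ℝ)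
      (fun y hy => (hd y hy).differentiableAt.differentiableWithinAt)
      (fun y hy => by
        rw [fderivWithin_of_isOpen isOpen_Ioi hy]
        ext
        simpa using (hd y hy).deriv) hx hs
  have hlim : Tendsto w atTop (𝓝 1) := by
    have h2 : ((2:ℝ):ℂ).re = 2 := by simp
    have h1 := LSeries.tendsto_atTop (f := aT E f) ((absc_lt (fun s hs => aT_summable (E := E) hf hs) (s := (2:ℝ)) (by norm_num)).trans (EReal.coe_lt_top _))
    have h2 := LSeries.tendsto_atTop (f := gT E f) ((absc_lt (fun s hs => gT_summable (E := E) hf hs) (s := (2:ℝ)) (by norm_num)).trans (EReal.coe_lt_top _))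
    have h3 := h1.mul ((Complex.continuous_exp.tendsto _).comp h2.neg)
    simpa [aT, gT, hf.one, aE_one, lamE_one] using h3
  have h1 : w s = 1 := by
    refine tendsto_nhds_unique (tendsto_const_nhds.congr' ?_) hlim
    filter_upwards [eventually_gt_atTop 1] with x hx
    exact (hconst x hx).symm
  have h2 : w s = LSeries (aT E f) s * Complex.exp (-LSeries (gT E f) s) := rfl
  rw [h1, Complex.exp_neg] at h2
  field_simp at h2
  exact h2.symm

end AN
end Mert


namespace Mert

open NumberField Finset Filter Topology MeasureTheory

/-- smoothed summatory function -/
noncomputable def Ssum (a : ℕ → ℂ) (h : ℝ → ℝ) (Y : ℝ) : ℂ :=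
  ∑' k : ℕ, if k = 0 then 0 else a k * (h (Real.log k - Y) : ℂ)

/-- admissible weights -/
structure Wt (h : ℝ → ℝ) (b : ℝ) : Prop where
  cont : Continuous h
  nonneg : ∀ z, 0 ≤ h z
  supp : ∀ z, h z ≠ 0 → 0 ≤ z ∧ z ≤ b
  bpos : 0 ≤ b
  norm : ∫ z, h z * Real.exp z = 1

/-- counting estimates -/
def Cnt (a : ℕ → ℂ) (h : ℝ → ℝ) (b ρ C δ : ℝ) (M : ℂ) : Prop :=
  ∀ Y, -b ≤ Y → ‖Ssum a h Y - M * ρ * Real.exp Y‖ ≤ ρ * C * Real.exp ((1 - δ) * Y)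

/-- Mellin transform of the weight -/
noncomputable def Hm (h : ℝ → ℝ) (s : ℝ) : ℝ := ∫ z, h z * Real.exp (s * z)

namespace Wt
variable {h : ℝ → ℝ} {b : ℝ} (w : Wt h b)
include w

theorem eq_zero {z : ℝ} (hz : z < 0 ∨ b < z) : h z = 0 := by
  by_contra h0
  have := w.supp z h0
  rcases hz with hz | hz <;> linarith

theorem cpt : HasCompactSupport h :=
  HasCompactSupport.intro (K := Set.Icc 0 b) isCompact_Icc fun z hz => by
    by_contra h0; exact hz (w.supp z h0)

theorem integ (g : ℝ → ℝ) (hg : Continuous g) : Integrable (fun z => h z * g z) :=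
  (w.cont.mul hg).integrable_of_hasCompactSupport (w.cpt.mul_right)

theorem Hm_one : Hm h 1 = 1 := by simpa [Hm] using w.norm

theorem Hm_ge {s : ℝ} (hs : 1 ≤ s) : 1 ≤ Hm h s := by
  rw [← w.norm, Hm]
  refine integral_mono (w.integ _ (by fun_prop)) (w.integ _ (by fun_prop)) fun z => ?_
  by_cases h0 : h z = 0
  · simp [h0]
  · have := w.supp z h0
    refine mul_le_mul_of_nonneg_left (Real.exp_le_exp.2 ?_) (w.nonneg z)
    nlinarith

theorem Hm_lip {s s' : ℝ} (hs : s ∈ Set.Icc (1:ℝ) 2) (hs' : s' ∈ Set.Icc (1:ℝ) 2) :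
    |Hm h s - Hm h s'| ≤ b * Real.exp b * |s - s'| := by
  have key : ∀ z ∈ Set.Icc 0 b, |Real.exp (s * z) - Real.exp (s' * z)| ≤
      b * Real.exp b * |s - s'| * Real.exp z := by
    intro z hz
    have h1 : |Real.exp ((s-1) * z) - Real.exp ((s'-1) * z)| ≤ Real.exp b * |(s-1) * z - (s'-1) * z| := by
      have := Convex.norm_image_sub_le_of_norm_deriv_le (f := Real.exp) (C := Real.exp b) (s := Set.Iic b)
        (fun x _ => Real.differentiable_exp x) (fun x hx => by
          rw [Real.deriv_exp, Real.norm_of_nonneg (Real.exp_pos x).le]; exact Real.exp_le_exp.2 hx)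
        (convex_Iic b) (x := (s'-1) * z) (y := (s-1) * z)
        (by simp only [Set.mem_Iic]; nlinarith [hs'.1, hs'.2, hz.1, hz.2])
        (by simp only [Set.mem_Iic]; nlinarith [hs.1, hs.2, hz.1, hz.2])
      simpa using this
    have h2 : Real.exp (s * z) - Real.exp (s' * z) =
        (Real.exp ((s-1) * z) - Real.exp ((s'-1) * z)) * Real.exp z := by
      rw [sub_mul, ← Real.exp_add, ← Real.exp_add]; ring_nf
    rw [h2, abs_mul, abs_of_pos (Real.exp_pos z)]
    refine mul_le_mul_of_nonneg_right (h1.trans ?_) (Real.exp_pos z).le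
    rw [← sub_mul, abs_mul, abs_of_nonneg hz.1, show s - 1 - (s' - 1) = s - s' by ring]
    have := mul_le_mul_of_nonneg_left hz.2 (mul_nonneg (Real.exp_pos b).le (abs_nonneg (s - s')))
    linarith
  rw [Hm, Hm, ← integral_sub (w.integ _ (by fun_prop)) (w.integ _ (by fun_prop))]
  have hb := norm_integral_le_of_norm_le (μ := volume)
    (f := fun z => h z * Real.exp (s * z) - h z * Real.exp (s' * z))
    (g := fun z => b * Real.exp b * |s - s'| * (h z * Real.exp z))
    ((w.integ (fun z => Real.exp z) (by fun_prop)).const_mul _) (Eventually.of_forall fun z => ?_)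
  · rw [Real.norm_eq_abs, integral_const_mul, w.norm, mul_one] at hb
    exact hb
  · by_cases h0 : h z = 0
    · simp [h0]
    · rw [← mul_sub, norm_mul, Real.norm_of_nonneg (w.nonneg z), Real.norm_eq_abs]
      have := mul_le_mul_of_nonneg_left (key z (w.supp z h0)) (w.nonneg z)
      linarith

theorem Hm_le {s : ℝ} (hs : s ∈ Set.Icc (1:ℝ) 2) : Hm h s ≤ 1 + b * Real.exp b := by
  have h1 := w.Hm_lip hs (s' := 1) (by norm_num)
  rw [w.Hm_one] at h1
  have h2 := le_abs_self (Hm h s - 1)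
  have h3 : |s - 1| ≤ 1 := by rw [abs_of_nonneg (by linarith [hs.1])]; linarith [hs.2]
  have h4 : 0 ≤ b * Real.exp b := mul_nonneg w.bpos (Real.exp_pos b).le
  nlinarith

theorem shift (k : ℕ) (hk : k ≠ 0) (s : ℝ) :
    Integrable (fun Y => h (Real.log k - Y) * Real.exp (-s * Y)) ∧
    ∫ Y, h (Real.log k - Y) * Real.exp (-s * Y) = (k:ℝ) ^ (-s) * Hm h s := by
  have hk' : (0:ℝ) < k := by exact_mod_cast Nat.pos_of_ne_zero hk
  have h1 : ∀ Y, h (Real.log k - Y) * Real.exp (-s * Y) =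
      (fun z => (k:ℝ) ^ (-s) * (h z * Real.exp (s * z))) (Real.log k - Y) := by
    intro Y
    simp only
    rw [Real.rpow_def_of_pos hk', mul_left_comm, ← Real.exp_add]
    ring_nf
  constructor
  · simp_rw [h1]
    exact ((w.integ (fun z => Real.exp (s * z)) (by fun_prop)).const_mul _).comp_sub_left _
  · simp_rw [h1]
    rw [integral_sub_left_eq_self (fun z => (k:ℝ) ^ (-s) * (h z * Real.exp (s * z))) volume (Real.log k),
      integral_const_mul, Hm]

theorem Ssum_zero (a : ℕ → ℂ) {Y : ℝ} (hY : Y < -b) : Ssum a h Y = 0 := by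
  rw [Ssum]
  convert tsum_zero with k
  split_ifs with hk
  · rfl
  · rw [w.eq_zero, Complex.ofReal_zero, mul_zero]
    right
    have := Real.log_natCast_nonneg k
    linarith

theorem fin_support (a : ℕ → ℂ) (Y : ℝ) :
    (Function.support fun k : ℕ => if k = 0 then 0 else a k * (h (Real.log k - Y) : ℂ)).Finite := by
  refine (Set.finite_Iic ⌊Real.exp (b + Y)⌋₊).subset fun k hk => ?_
  rw [Function.mem_support] at hk
  split_ifs at hk with h0
  · exact absurd rfl hk
  · rw [Set.mem_Iic]
    apply Nat.le_floor
    have h1 : h (Real.log k - Y) ≠ 0 := fun h2 => hk (by simp [h2])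
    have h2 := (w.supp _ h1).2
    rw [← Real.log_le_iff_le_exp (by exact_mod_cast Nat.pos_of_ne_zero h0)]
    linarith

theorem Ssum_meas (a : ℕ → ℂ) : AEStronglyMeasurable (Ssum a h) volume := by
  refine aestronglyMeasurable_of_tendsto_ae atTop
    (f := fun N Y => ∑ k ∈ range N, if k = 0 then 0 else a k * (h (Real.log k - Y) : ℂ)) ?_ ?_
  · intro N
    refine Continuous.aestronglyMeasurable (continuous_finsetSum _ fun k _ => ?_)
    split_ifs
    · exact continuous_const
    · have := w.cont
      fun_prop
  · refine Eventually.of_forall fun Y => ?_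
    exact (summable_of_hasFiniteSupport (w.fin_support a Y)).hasSum.tendsto_sum_nat

theorem mellin (a : ℕ → ℂ) {s : ℝ} (hs : LSeriesSummable a s) :
    ∫ Y, Ssum a h Y * Real.exp (-s * Y) = LSeries a s * Hm h s := by
  set F : ℕ → ℝ → ℂ := fun k Y => (if k = 0 then 0 else a k * (h (Real.log k - Y) : ℂ)) * Real.exp (-s * Y)
  have hF : ∀ k, k ≠ 0 → F k = fun Y => a k * ((h (Real.log k - Y) * Real.exp (-s * Y) : ℝ) : ℂ) := by
    intro k hk; ext Y; simp only [F, if_neg hk]; push_cast; ring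
  have hF0 : F 0 = fun _ => 0 := by ext Y; simp [F]
  have hI : ∀ k, Integrable (F k) := by
    intro k
    rcases eq_or_ne k 0 with rfl | hk
    · rw [hF0]; exact integrable_zero _ _ _
    · rw [hF k hk]; exact ((w.shift k hk s).1.ofReal).const_mul _
  have hterm : ∀ k, k ≠ 0 → LSeries.term a s k = a k * ((k:ℝ) ^ (-s) : ℝ) := by
    intro k hk
    rw [LSeries.term_of_ne_zero hk, Complex.ofReal_cpow (Nat.cast_nonneg k)]
    push_cast
    rw [Complex.cpow_neg, div_eq_mul_inv]
  have hintg : ∀ k, ∫ Y, F k Y = LSeries.term a s k * Hm h s := by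
    intro k
    rcases eq_or_ne k 0 with rfl | hk
    · simp [hF0]
    · rw [hF k hk, integral_const_mul, integral_complex_ofReal, (w.shift k hk s).2, hterm k hk]
      push_cast; ring
  have hnorm : ∀ k, ∫ Y, ‖F k Y‖ = ‖LSeries.term a s k‖ * Hm h s := by
    intro k
    rcases eq_or_ne k 0 with rfl | hk
    · simp [hF0]
    · rw [hF k hk, hterm k hk, norm_mul, Complex.norm_real, Real.norm_of_nonneg (by positivity), mul_assoc,
        ← (w.shift k hk s).2, ← integral_const_mul]
      refine integral_congr_ae (Eventually.of_forall fun Y => ?_)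
      simp only [norm_mul, Complex.norm_real]
      rw [Real.norm_of_nonneg (w.nonneg _), Real.norm_of_nonneg (Real.exp_pos _).le]
  have hsum := hasSum_integral_of_summable_integral_norm hI (by
    simp_rw [hnorm]; exact (hs.norm).mul_right _)
  simp_rw [hintg] at hsum
  have h2 := (hs.hasSum.mul_right (Hm h s : ℂ)).unique hsum
  rw [LSeries, h2]
  refine integral_congr_ae (Eventually.of_forall fun Y => ?_)
  simp only [F]
  rw [tsum_mul_right, Ssum]

end Wt
end Mert


namespace Mert

open NumberField Finset Filter Topology MeasureTheory

theorem exp_lip {x y c : ℝ} (hx : x ≤ c) (hy : y ≤ c) : |Real.exp x - Real.exp y| ≤ Real.exp c * |x - y| := by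
  have := Convex.norm_image_sub_le_of_norm_deriv_le (f := Real.exp) (C := Real.exp c) (s := Set.Iic c)
    (fun x _ => Real.differentiable_exp x) (fun x hx => by
      rw [Real.deriv_exp, Real.norm_of_nonneg (Real.exp_pos x).le]; exact Real.exp_le_exp.2 hx)
    (convex_Iic c) (x := y) (y := x) hy hx
  simpa using this

/-- Remainder term. -/
noncomputable def Er (a : ℕ → ℂ) (h : ℝ → ℝ) (b ρ : ℝ) (M : ℂ) (s : ℝ) : ℂ :=
  ∫ Y in Set.Ioi (-b), (Ssum a h Y - M * ρ * Real.exp Y) * Real.exp (-s * Y)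

theorem exp_neg_int {c : ℝ} (hc : 0 < c) (b : ℝ) :
    IntegrableOn (fun Y : ℝ => Real.exp (-c * Y)) (Set.Ioi (-b)) ∧
    ∫ Y in Set.Ioi (-b), Real.exp (-c * Y) = Real.exp (c * b) / c := by
  constructor
  · exact integrableOn_exp_mul_Ioi (by linarith) _
  · rw [integral_exp_mul_Ioi (by linarith)]
    rw [show -c * -b = c * b by ring]
    field_simp

section
variable {a : ℕ → ℂ} {h : ℝ → ℝ} {b ρ C δ : ℝ} {M : ℂ}
  (w : Wt h b) (hc : Cnt a h b ρ C δ M) (hρ : 0 < ρ) (hC : 1 ≤ C) (hδ : 0 < δ) (hδ1 : δ ≤ 1)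
include w hc hρ hC hδ hδ1

theorem D_bound {s Y : ℝ} (hs : s ∈ Set.Icc (1:ℝ) 2) (hY : -b < Y) :
    ‖(Ssum a h Y - M * ρ * Real.exp Y) * Real.exp (-s * Y)‖ ≤ ρ * C * Real.exp b * Real.exp (-δ * Y) := by
  rw [norm_mul, Complex.norm_real, Real.norm_of_nonneg (Real.exp_pos _).le]
  refine (mul_le_mul_of_nonneg_right (hc Y hY.le) (Real.exp_pos _).le).trans ?_
  rw [mul_assoc, mul_assoc (ρ * C), ← Real.exp_add, ← Real.exp_add]
  refine mul_le_mul_of_nonneg_left (Real.exp_le_exp.2 ?_) (by positivity)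
  have := w.bpos
  nlinarith [hs.1, hs.2]

theorem D_integ {s : ℝ} (hs : s ∈ Set.Icc (1:ℝ) 2) :
    IntegrableOn (fun Y => (Ssum a h Y - M * ρ * Real.exp Y) * Real.exp (-s * Y)) (Set.Ioi (-b)) := by
  refine Integrable.mono' (((exp_neg_int hδ b).1).const_mul (ρ * C * Real.exp b)) ?_ ?_
  · refine AEStronglyMeasurable.mul (AEStronglyMeasurable.sub (w.Ssum_meas a).restrict ?_) ?_
    · exact Continuous.aestronglyMeasurable (by fun_prop)
    · exact Continuous.aestronglyMeasurable (by fun_prop)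
  · refine (ae_restrict_mem measurableSet_Ioi).mono fun Y hY => ?_
    exact D_bound w hc hρ hC hδ hδ1 hs hY

theorem Er_bound {s : ℝ} (hs : s ∈ Set.Icc (1:ℝ) 2) :
    ‖Er a h b ρ M s‖ ≤ ρ * C * (Real.exp (2 * b) / δ) := by
  have := norm_integral_le_of_norm_le (((exp_neg_int hδ b).1).const_mul (ρ * C * Real.exp b))
    ((ae_restrict_mem measurableSet_Ioi).mono fun Y hY => D_bound w hc hρ hC hδ hδ1 hs hY)
  refine this.trans ?_
  rw [integral_const_mul, (exp_neg_int hδ b).2, mul_assoc]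
  refine mul_le_mul_of_nonneg_left ?_ (by positivity)
  rw [← mul_div_assoc, ← Real.exp_add]
  gcongr
  have := w.bpos
  nlinarith

theorem Er_lip {s s' : ℝ} (hs : s ∈ Set.Icc (1:ℝ) 2) (hs' : s' ∈ Set.Icc (1:ℝ) 2) :
    ‖Er a h b ρ M s - Er a h b ρ M s'‖ ≤ ρ * C * ((b + 2 / δ) * Real.exp (3 * b) * (2 / δ)) * |s - s'| := by
  have hb := w.bpos
  rw [Er, Er, ← integral_sub (D_integ w hc hρ hC hδ hδ1 hs) (D_integ w hc hρ hC hδ hδ1 hs')]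
  have hd2 : 0 < δ / 2 := by linarith
  have key : ∀ Y, -b < Y → ‖(Ssum a h Y - M * ρ * Real.exp Y) * Real.exp (-s * Y) -
      (Ssum a h Y - M * ρ * Real.exp Y) * Real.exp (-s' * Y)‖ ≤
      ρ * C * ((b + 2 / δ) * Real.exp (2 * b)) * |s - s'| * Real.exp (-(δ / 2) * Y) := by
    intro Y hY
    rw [← mul_sub, norm_mul, ← Complex.ofReal_sub, Complex.norm_real, Real.norm_eq_abs]
    have h1 : |Real.exp (-s * Y) - Real.exp (-s' * Y)| ≤ Real.exp (b - Y) * (|s - s'| * |Y|) := by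
      refine (exp_lip (c := b - Y) ?_ ?_).trans (le_of_eq ?_)
      · nlinarith [hs.1, hs.2]
      · nlinarith [hs'.1, hs'.2]
      · rw [← abs_mul]; congr 1; rw [← abs_neg]; congr 1; ring
    have h2 : |Y| ≤ (b + 2 / δ) * Real.exp (b / 2) * Real.exp (δ / 2 * Y) := by
      have e1 : 1 ≤ Real.exp (b / 2) * Real.exp (δ / 2 * Y) := by
        rw [← Real.exp_add]; apply Real.one_le_exp; nlinarith
      have e2 := Real.add_one_le_exp (δ / 2 * Y)
      have e3 : Y ≤ 2 / δ * Real.exp (δ / 2 * Y) := by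
        have : Y = 2 / δ * (δ / 2 * Y) := by field_simp
        have h3 : δ / 2 * Y ≤ Real.exp (δ / 2 * Y) := by linarith
        calc Y = 2 / δ * (δ / 2 * Y) := this
          _ ≤ _ := mul_le_mul_of_nonneg_left h3 (by positivity)
      have e4 : 1 ≤ Real.exp (b/2) := Real.one_le_exp (by linarith)
      have e5 : 0 < 2 / δ := by positivity
      have e6 := Real.exp_pos (δ / 2 * Y)
      rw [abs_le]
      constructor
      · nlinarith
      · have : 2 / δ * Real.exp (δ / 2 * Y) ≤ 2 / δ * Real.exp (b/2) * Real.exp (δ / 2 * Y) := by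
          refine mul_le_mul_of_nonneg_right ?_ e6.le
          nlinarith
        have h7 : 0 ≤ b * Real.exp (b/2) * Real.exp (δ / 2 * Y) := by positivity
        nlinarith
    calc _ ≤ (ρ * C * Real.exp ((1 - δ) * Y)) * (Real.exp (b - Y) * (|s - s'| *
          ((b + 2 / δ) * Real.exp (b / 2) * Real.exp (δ / 2 * Y)))) := by
          refine mul_le_mul (hc Y hY.le) (h1.trans ?_) (abs_nonneg _) (by positivity)
          gcongr
      _ = ρ * C * ((b + 2 / δ) * (Real.exp ((1 - δ) * Y) * Real.exp (b - Y) * Real.exp (b/2) *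
          Real.exp (δ / 2 * Y))) * |s - s'| := by ring
      _ ≤ ρ * C * ((b + 2 / δ) * (Real.exp (2 * b) * Real.exp (-(δ / 2) * Y))) * |s - s'| := by
          have h5 : Real.exp ((1 - δ) * Y) * Real.exp (b - Y) * Real.exp (b/2) *
              Real.exp (δ / 2 * Y) ≤ Real.exp (2 * b) * Real.exp (-(δ / 2) * Y) := by
            rw [← Real.exp_add, ← Real.exp_add, ← Real.exp_add, ← Real.exp_add]
            apply Real.exp_le_exp.2
            nlinarith
          gcongr
      _ = _ := by ring
  have := norm_integral_le_of_norm_le (((exp_neg_int hd2 b).1).const_mul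
    (ρ * C * ((b + 2 / δ) * Real.exp (2 * b)) * |s - s'|))
    ((ae_restrict_mem measurableSet_Ioi).mono fun Y hY => key Y hY)
  refine this.trans ?_
  rw [integral_const_mul, (exp_neg_int hd2 b).2]
  have e1 : Real.exp (δ / 2 * b) ≤ Real.exp b := Real.exp_le_exp.2 (by nlinarith)
  calc _ ≤ ρ * C * ((b + 2 / δ) * Real.exp (2 * b)) * |s - s'| * (Real.exp b / (δ / 2)) := by gcongr
    _ = ρ * C * ((b + 2 / δ) * (Real.exp (2 * b) * Real.exp b) * (2 / δ)) * |s - s'| := by field_simp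
    _ = _ := by rw [← Real.exp_add]; ring_nf

theorem L_formula {s : ℝ} (hs : 1 < s) (hs2 : s ≤ 2) (hL : LSeriesSummable a s) :
    LSeries a s * Hm h s = M * ρ * (Real.exp ((s - 1) * b) / (s - 1) : ℝ) + Er a h b ρ M s := by
  rw [← w.mellin a hL]
  have h1 : ∫ Y, Ssum a h Y * Real.exp (-s * Y) = ∫ Y in Set.Ici (-b), Ssum a h Y * Real.exp (-s * Y) := by
    rw [setIntegral_eq_integral_of_forall_compl_eq_zero]
    intro Y hY
    rw [w.Ssum_zero a (not_le.1 hY), zero_mul]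
  rw [h1, integral_Ici_eq_integral_Ioi]
  have h2 := exp_neg_int (c := s - 1) (by linarith) b
  have h3 : ∀ Y, Ssum a h Y * Real.exp (-s * Y) = M * ρ * ((Real.exp (-(s-1) * Y) : ℝ) : ℂ) +
      (Ssum a h Y - M * ρ * Real.exp Y) * Real.exp (-s * Y) := by
    intro Y
    rw [show -(s-1) * Y = Y + -s * Y by ring, Real.exp_add]
    push_cast
    ring
  simp_rw [h3]
  have h4 : IntegrableOn (fun Y => ((Real.exp (-(s-1) * Y) : ℝ) : ℂ)) (Set.Ioi (-b)) := h2.1.ofReal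
  rw [integral_add (h4.const_mul _) (D_integ w hc hρ hC hδ hδ1 ⟨hs.le, hs2⟩), integral_const_mul,
    integral_complex_ofReal, h2.2, Er]

end

theorem quot_lip {f f' : ℂ} {H H' A B x : ℝ} (hH : 1 ≤ H) (hH' : 1 ≤ H') (hx : 0 ≤ x)
    (h1 : ‖f - f'‖ ≤ A * x) (h2 : ‖f'‖ ≤ A) (h3 : |H - H'| ≤ B * x) : ‖f / H - f' / H'‖ ≤ A * (1 + B) * x := by
  have hA : 0 ≤ A := (norm_nonneg _).trans h2
  have hHp : 0 < H := by linarith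
  have hHp' : 0 < H' := by linarith
  have e : f / H - f' / H' = (f - f') / H - f' * ((H - H' : ℝ) : ℂ) / (H * H') := by
    have : (H : ℂ) ≠ 0 := by exact_mod_cast hHp.ne'
    have : (H' : ℂ) ≠ 0 := by exact_mod_cast hHp'.ne'
    push_cast
    field_simp
    ring
  rw [e]
  refine (norm_sub_le _ _).trans ?_
  rw [norm_div, norm_div, norm_mul, norm_mul, Complex.norm_real, Complex.norm_real, Complex.norm_real,
    Real.norm_of_nonneg hHp.le, Real.norm_of_nonneg hHp'.le, Real.norm_eq_abs]
  have e1 : ‖f - f'‖ / H ≤ A * x := (div_le_self (norm_nonneg _) hH).trans h1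
  have e2 : ‖f'‖ * |H - H'| / (H * H') ≤ A * (B * x) := by
    refine (div_le_self (by positivity) (by nlinarith)).trans ?_
    exact mul_le_mul h2 h3 (abs_nonneg _) hA
  linarith

theorem L_facts (b δ : ℝ) (hb : 0 ≤ b) (hδ : 0 < δ) (hδ1 : δ ≤ 1) : ∃ K : ℝ, 1 ≤ K ∧
    ∀ (a : ℕ → ℂ) (h : ℝ → ℝ) (ρ C : ℝ) (M : ℂ), Wt h b → Cnt a h b ρ C δ M → 0 < ρ → 1 ≤ C → ‖M‖ ≤ 1 →
    (∀ s : ℝ, 1 < s → LSeriesSummable a s) →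
    (∀ s : ℝ, 1 < s → s ≤ 2 → ‖(s - 1 : ℝ) * LSeries a s - M * ρ‖ ≤ ρ * C * K * (s - 1)) ∧
    (∀ s s' : ℝ, 1 < s → s ≤ 2 → 1 < s' → s' ≤ 2 →
      ‖(s - 1 : ℝ) * LSeries a s - (s' - 1 : ℝ) * LSeries a s'‖ ≤ ρ * C * K * |s - s'|) ∧
    (M = 0 → ∀ s s' : ℝ, 1 < s → s ≤ 2 → 1 < s' → s' ≤ 2 →
      ‖LSeries a s‖ ≤ ρ * C * K ∧ ‖LSeries a s - LSeries a s'‖ ≤ ρ * C * K * |s - s'|) := by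
  set K1 := (b + 2 / δ) * Real.exp (3 * b) * (2 / δ) with hK1
  have hd2 : 2 ≤ 2 / δ := by rw [le_div_iff₀ hδ]; linarith
  have hK1' : Real.exp (2 * b) / δ ≤ K1 := by
    have e1 : Real.exp (2 * b) ≤ Real.exp (3 * b) := Real.exp_le_exp.2 (by linarith)
    have e2 : 1 / δ ≤ (b + 2 / δ) * (2 / δ) := by
      have : 1 / δ ≤ 2 / δ := by gcongr; norm_num
      nlinarith
    calc Real.exp (2 * b) / δ = Real.exp (2 * b) * (1 / δ) := by ring
      _ ≤ Real.exp (3 * b) * ((b + 2 / δ) * (2 / δ)) := by gcongr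
      _ = K1 := by rw [hK1]; ring
  have hK0 : 0 ≤ K1 := le_trans (by positivity) hK1'
  set A := Real.exp b * (1 + b) + 2 * K1 with hA
  have heb := Real.one_le_exp hb
  have hA1 : 1 ≤ A := by nlinarith
  set B := b * Real.exp b
  have hB0 : 0 ≤ B := by positivity
  refine ⟨A * (1 + B), by nlinarith, fun a h ρ C M w hc hρ hC hM hL => ?_⟩
  have hρC : 0 < ρ * C := by positivity
  have hEb : ∀ s ∈ Set.Icc (1:ℝ) 2, ‖Er a h b ρ M s‖ ≤ ρ * C * K1 := fun s hs =>
    (Er_bound w hc hρ hC hδ hδ1 hs).trans (mul_le_mul_of_nonneg_left hK1' hρC.le)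
  have hEl : ∀ s ∈ Set.Icc (1:ℝ) 2, ∀ s' ∈ Set.Icc (1:ℝ) 2,
      ‖Er a h b ρ M s - Er a h b ρ M s'‖ ≤ ρ * C * K1 * |s - s'| :=
    fun s hs s' hs' => Er_lip w hc hρ hC hδ hδ1 hs hs'
  set N : ℝ → ℂ := fun s => M * ρ * (Real.exp ((s - 1) * b) : ℝ) + (s - 1 : ℝ) * Er a h b ρ M s with hN
  have hNb : ∀ s ∈ Set.Icc (1:ℝ) 2, ‖N s‖ ≤ ρ * C * A := by
    intro s hs
    refine (norm_add_le _ _).trans ?_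
    rw [norm_mul, norm_mul, norm_mul, Complex.norm_real, Complex.norm_real, Complex.norm_real,
      Real.norm_of_nonneg hρ.le, Real.norm_of_nonneg (Real.exp_pos _).le, Real.norm_of_nonneg (by linarith [hs.1])]
    have e1 : Real.exp ((s - 1) * b) ≤ Real.exp b := Real.exp_le_exp.2 (by nlinarith [hs.2])
    have e2 : ‖M‖ * ρ * Real.exp ((s - 1) * b) ≤ 1 * ρ * Real.exp b := by gcongr
    have e3 : (s - 1) * ‖Er a h b ρ M s‖ ≤ 1 * (ρ * C * K1) := by
      refine mul_le_mul (by linarith [hs.2]) (hEb s hs) (norm_nonneg _) zero_le_one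
    have e4 : ρ * Real.exp b ≤ ρ * C * (Real.exp b * (1 + b)) := by
      rw [mul_assoc]; refine mul_le_mul_of_nonneg_left ?_ hρ.le
      nlinarith [mul_nonneg hb (Real.exp_pos b).le, mul_nonneg (sub_nonneg.2 hC) (mul_nonneg hb (Real.exp_pos b).le), mul_nonneg (sub_nonneg.2 hC) (Real.exp_pos b).le]
    have e5 : 0 ≤ ρ * C * K1 := by positivity
    rw [hA]
    linarith
  have hNl : ∀ s ∈ Set.Icc (1:ℝ) 2, ∀ s' ∈ Set.Icc (1:ℝ) 2, ‖N s - N s'‖ ≤ ρ * C * A * |s - s'| := by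
    intro s hs s' hs'
    have e : N s - N s' = M * ρ * ((Real.exp ((s - 1) * b) - Real.exp ((s' - 1) * b) : ℝ) : ℂ) +
        ((s - 1 : ℝ) * (Er a h b ρ M s - Er a h b ρ M s') + ((s - s' : ℝ) : ℂ) * Er a h b ρ M s') := by
      simp only [hN]; push_cast; ring
    rw [e]
    refine (norm_add_le _ _).trans ((add_le_add le_rfl (norm_add_le _ _)).trans ?_)
    rw [norm_mul, norm_mul, norm_mul, norm_mul, Complex.norm_real, Complex.norm_real, Complex.norm_real,
      Complex.norm_real, Real.norm_of_nonneg hρ.le, Real.norm_of_nonneg (r := s - 1) (by linarith [hs.1]),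
      Real.norm_eq_abs, Real.norm_eq_abs]
    have e1 : |Real.exp ((s - 1) * b) - Real.exp ((s' - 1) * b)| ≤ Real.exp b * (b * |s - s'|) := by
      refine (exp_lip (c := b) (by nlinarith [hs.2]) (by nlinarith [hs'.2])).trans (le_of_eq ?_)
      rw [← sub_mul, abs_mul, abs_of_nonneg hb, sub_sub_sub_cancel_right]; ring
    have e2 : ‖M‖ * ρ * |Real.exp ((s - 1) * b) - Real.exp ((s' - 1) * b)| ≤
        1 * ρ * (Real.exp b * (b * |s - s'|)) := by gcongr
    have e3 : (s - 1) * ‖Er a h b ρ M s - Er a h b ρ M s'‖ ≤ 1 * (ρ * C * K1 * |s - s'|) :=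
      mul_le_mul (by linarith [hs.2]) (hEl s hs s' hs') (norm_nonneg _) zero_le_one
    have e4 : |s - s'| * ‖Er a h b ρ M s'‖ ≤ |s - s'| * (ρ * C * K1) :=
      mul_le_mul_of_nonneg_left (hEb s' hs') (abs_nonneg _)
    have e5 : ρ * (Real.exp b * b) ≤ ρ * C * (Real.exp b * (1 + b)) := by
      rw [mul_assoc]; refine mul_le_mul_of_nonneg_left ?_ hρ.le
      nlinarith [mul_nonneg hb (Real.exp_pos b).le, mul_nonneg (sub_nonneg.2 hC) (mul_nonneg hb (Real.exp_pos b).le), mul_nonneg (sub_nonneg.2 hC) (Real.exp_pos b).le]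
    have e6 := mul_le_mul_of_nonneg_right e5 (abs_nonneg (s - s'))
    rw [hA]
    linarith
  have hdiv : ∀ s : ℝ, 1 < s → s ≤ 2 → (s - 1 : ℝ) * LSeries a s = N s / Hm h s := by
    intro s hs hs2
    have hf := L_formula w hc hρ hC hδ hδ1 hs hs2 (hL s hs)
    have hH : (Hm h s : ℂ) ≠ 0 := by exact_mod_cast (by linarith [w.Hm_ge hs.le] : Hm h s ≠ 0)
    have hs0 : ((s : ℂ) - 1) ≠ 0 := by
      rw [sub_ne_zero]; exact_mod_cast hs.ne'
    rw [eq_div_iff hH, mul_assoc, hf]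
    simp only [hN]
    push_cast
    field_simp
  have hN1 : N 1 / Hm h 1 = M * ρ := by simp [hN, w.Hm_one]
  have i1 : (1:ℝ) ∈ Set.Icc (1:ℝ) 2 := by norm_num
  refine ⟨fun s hs hs2 => ?_, fun s s' hs hs2 hs' hs2' => ?_, fun hM0 s s' hs hs2 hs' hs2' => ?_⟩
  · rw [hdiv s hs hs2, ← hN1, ← mul_assoc]
    have := quot_lip (w.Hm_ge hs.le) (w.Hm_ge le_rfl) (abs_nonneg (s - 1)) (hNl s ⟨hs.le, hs2⟩ 1 i1) (hNb 1 i1)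
      (w.Hm_lip ⟨hs.le, hs2⟩ i1)
    rwa [abs_of_pos (by linarith : 0 < s - 1)] at this
  · rw [hdiv s hs hs2, hdiv s' hs' hs2', ← mul_assoc]
    exact quot_lip (w.Hm_ge hs.le) (w.Hm_ge hs'.le) (abs_nonneg (s - s')) (hNl s ⟨hs.le, hs2⟩ s' ⟨hs'.le, hs2'⟩)
      (hNb s' ⟨hs'.le, hs2'⟩) (w.Hm_lip ⟨hs.le, hs2⟩ ⟨hs'.le, hs2'⟩)
  · have hq : ∀ s : ℝ, 1 < s → s ≤ 2 → LSeries a s = Er a h b ρ M s / Hm h s := by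
      intro s hs hs2
      have hf := L_formula w hc hρ hC hδ hδ1 hs hs2 (hL s hs)
      have hH : (Hm h s : ℂ) ≠ 0 := by exact_mod_cast (by linarith [w.Hm_ge hs.le] : Hm h s ≠ 0)
      rw [eq_div_iff hH, hf, hM0]; simp
    have hKA : ρ * C * K1 ≤ ρ * C * A := by
      refine mul_le_mul_of_nonneg_left ?_ hρC.le
      have : 0 ≤ Real.exp b * (1 + b) := by positivity
      rw [hA]; linarith
    constructor
    · rw [hq s hs hs2, norm_div, Complex.norm_real, Real.norm_of_nonneg (by linarith [w.Hm_ge hs.le])]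
      refine (div_le_self (norm_nonneg _) (w.Hm_ge hs.le)).trans ((hEb s ⟨hs.le, hs2⟩).trans (hKA.trans ?_))
      refine mul_le_mul_of_nonneg_left ?_ hρC.le
      nlinarith
    · rw [hq s hs hs2, hq s' hs' hs2', ← mul_assoc]
      refine quot_lip (w.Hm_ge hs.le) (w.Hm_ge hs'.le) (abs_nonneg (s - s'))
        ((hEl s ⟨hs.le, hs2⟩ s' ⟨hs'.le, hs2'⟩).trans (mul_le_mul_of_nonneg_right hKA (abs_nonneg _)))
        ((hEb s' ⟨hs'.le, hs2'⟩).trans hKA) (w.Hm_lip ⟨hs.le, hs2⟩ ⟨hs'.le, hs2'⟩)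

end Mert


namespace Mert

open NumberField Finset Filter Topology MeasureTheory

theorem rpow_lip {k : ℕ} (hk : k ≠ 0) {s s' : ℝ} (hs : 1 ≤ s) (hs' : 1 ≤ s') :
    |(k:ℝ) ^ (-s) - (k:ℝ) ^ (-s')| ≤ Real.log k / k * |s - s'| := by
  have hk' : (0:ℝ) < k := by exact_mod_cast Nat.pos_of_ne_zero hk
  have hl := Real.log_natCast_nonneg k
  rw [Real.rpow_def_of_pos hk', Real.rpow_def_of_pos hk']
  refine (exp_lip (c := - Real.log k) (by nlinarith) (by nlinarith)).trans (le_of_eq ?_)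
  rw [Real.exp_neg, Real.exp_log hk', ← mul_sub, abs_mul, abs_of_nonneg hl,
    show -s - -s' = -(s - s') by ring, abs_neg]
  ring

theorem rpow_le_inv {k : ℕ} (hk : k ≠ 0) {s : ℝ} (hs : 1 ≤ s) : (k:ℝ) ^ (-s) ≤ 1 / k := by
  have hk' : (1:ℝ) ≤ k := by exact_mod_cast Nat.one_le_iff_ne_zero.2 hk
  rw [one_div, ← Real.rpow_neg_one]
  exact Real.rpow_le_rpow_of_exponent_le hk' (by linarith)

/-- non-prime von Mangoldt sum -/
noncomputable def R0 : ℝ := ∑' k : ℕ, (if k.Prime then 0 else ArithmeticFunction.vonMangoldt k) / k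

theorem R0_summable : Summable fun k : ℕ => (if k.Prime then 0 else ArithmeticFunction.vonMangoldt k) / (k:ℝ) := by
  have := ArithmeticFunction.vonMangoldt.summable_residueClass_non_primes_div (q := 1) (0 : ZMod 1)
  refine this.congr fun k => ?_
  congr 1
  split_ifs
  · rfl
  · rw [ArithmeticFunction.vonMangoldt.residueClass, Set.indicator_of_mem]
    exact Subsingleton.elim _ _

theorem R0_nonneg : 0 ≤ R0 := tsum_nonneg fun k => by
  split_ifs
  · simp
  · exact div_nonneg ArithmeticFunction.vonMangoldt_nonneg (Nat.cast_nonneg k)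

section
variable (E : Type*) [Field E] [NumberField E]

/-- Prime coefficients. -/
noncomputable def uT (f : ℕ → ℂ) (k : ℕ) : ℂ := if k.Prime then cE E k * f k else 0

/-- Prime sum -/
noncomputable def U (f : ℕ → ℂ) (s : ℝ) : ℂ := ∑' k : ℕ, uT E f k * (((k:ℝ) ^ (-s) : ℝ) : ℂ)

/-- log of the L-function -/
noncomputable def G (f : ℕ → ℂ) (s : ℝ) : ℂ := LSeries (gT E f) s

variable {E}

theorem cE_le {p : ℕ} (hp : p.Prime) : cE E p ≤ Module.finrank ℚ E := by
  have h1 := lamE_le (E := E) p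
  rw [lamE_prime hp, ArithmeticFunction.vonMangoldt_apply_prime hp] at h1
  have : 0 < Real.log p := Real.log_pos (by exact_mod_cast hp.one_lt)
  exact_mod_cast le_of_mul_le_mul_right h1 this

theorem uT_le {f : ℕ → ℂ} (hf : ∀ k, ‖f k‖ ≤ 1) (k : ℕ) : ‖uT E f k‖ ≤ Module.finrank ℚ E := by
  rw [uT]
  split_ifs with hp
  · rw [norm_mul, Complex.norm_natCast]
    have := cE_le (E := E) hp
    calc (cE E k : ℝ) * ‖f k‖ ≤ Module.finrank ℚ E * 1 := by
          gcongr
          exact hf k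
      _ = _ := mul_one _
  · simp

theorem U_summable {f : ℕ → ℂ} (hf : ∀ k, ‖f k‖ ≤ 1) {s : ℝ} (hs : 1 < s) :
    Summable fun k : ℕ => uT E f k * (((k:ℝ) ^ (-s) : ℝ) : ℂ) := by
  refine Summable.of_norm_bounded (g := fun k : ℕ => (Module.finrank ℚ E : ℝ) * (k:ℝ) ^ (-s))
    ((Real.summable_nat_rpow.2 (by linarith)).mul_left _) fun k => ?_
  rw [norm_mul, Complex.norm_real, Real.norm_of_nonneg (by positivity)]
  gcongr
  exact uT_le hf k

theorem term_eq (a : ℕ → ℂ) (ha : a 0 = 0) (s : ℝ) (k : ℕ) :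
    LSeries.term a s k = a k * (((k:ℝ) ^ (-s) : ℝ) : ℂ) := by
  rcases eq_or_ne k 0 with rfl | hk
  · simp [ha]
  rw [LSeries.term_of_ne_zero hk, Complex.ofReal_cpow (Nat.cast_nonneg k)]
  push_cast
  rw [Complex.cpow_neg, div_eq_mul_inv]

theorem gT_zero (f : ℕ → ℂ) : gT E f 0 = 0 := by simp [gT]

theorem GU_eq {f : ℕ → ℂ} (hf : CM f) {s : ℝ} (hs : 1 < s) :
    Summable (fun k : ℕ => (gT E f k - uT E f k) * (((k:ℝ) ^ (-s) : ℝ) : ℂ)) ∧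
    G E f s - U E f s = ∑' k : ℕ, (gT E f k - uT E f k) * (((k:ℝ) ^ (-s) : ℝ) : ℂ) := by
  have h1 := gT_summable (E := E) hf (s := s) (by simpa using hs)
  have h2 : Summable fun k : ℕ => gT E f k * (((k:ℝ) ^ (-s) : ℝ) : ℂ) :=
    Summable.congr h1 (fun k => term_eq _ (gT_zero f) s k)
  have h3 := U_summable (E := E) hf.bd hs
  refine ⟨(h2.sub h3).congr fun k => by ring, ?_⟩
  rw [G, U, LSeries, tsum_congr (term_eq _ (gT_zero f) s), ← h2.tsum_sub h3]
  exact tsum_congr fun k => by ring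

theorem gu_prime (f : ℕ → ℂ) {p : ℕ} (hp : p.Prime) : gT E f p - uT E f p = 0 := by
  have : Real.log p ≠ 0 := (Real.log_pos (by exact_mod_cast hp.one_lt)).ne'
  rw [gT, uT, if_pos hp, lamE_prime hp, mul_div_cancel_right₀ _ this]
  simp

theorem gu_bound {f : ℕ → ℂ} (hf : CM f) (k : ℕ) :
    ‖gT E f k - uT E f k‖ * Real.log k ≤
      Module.finrank ℚ E * (if k.Prime then 0 else ArithmeticFunction.vonMangoldt k) ∧
    ‖gT E f k - uT E f k‖ ≤
      Module.finrank ℚ E * (if k.Prime then 0 else ArithmeticFunction.vonMangoldt k) / Real.log 2 := by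
  by_cases hp : k.Prime
  · simp [gu_prime f hp, hp]
  rw [if_neg hp, uT, if_neg hp, sub_zero]
  have h4 : 0 < Real.log 2 := Real.log_pos (by norm_num)
  have hn := lamE_nonneg (E := E) k
  have hle := lamE_le (E := E) k
  have hl := Real.log_natCast_nonneg k
  have h1 : ‖gT E f k‖ ≤ lamE E k / Real.log k := by
    rw [gT, norm_mul, Complex.norm_real, Real.norm_of_nonneg (div_nonneg hn hl)]
    exact mul_le_of_le_one_right (div_nonneg hn hl) (hf.bd k)
  constructor
  · refine (mul_le_mul_of_nonneg_right h1 hl).trans (le_trans ?_ hle)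
    rcases eq_or_ne (Real.log k) 0 with h0 | h0
    · simp [h0, hn]
    · rw [div_mul_cancel₀ _ h0]
  · rw [le_div_iff₀ h4]
    refine (mul_le_mul_of_nonneg_right h1 h4.le).trans ?_
    have := log2_mul_le (E := E) (k := k)
    linarith

theorem GU_bound {f : ℕ → ℂ} (hf : CM f) {s : ℝ} (hs : 1 < s) :
    ‖G E f s - U E f s‖ ≤ Module.finrank ℚ E * (R0 / Real.log 2) := by
  obtain ⟨h1, h2⟩ := GU_eq (E := E) hf hs
  rw [h2]
  have h4 : 0 < Real.log 2 := Real.log_pos (by norm_num)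
  have h5 : HasSum (fun k : ℕ => Module.finrank ℚ E * ((if k.Prime then 0 else
      ArithmeticFunction.vonMangoldt k) / (k:ℝ) / Real.log 2)) (Module.finrank ℚ E * (R0 / Real.log 2)) :=
    (R0_summable.hasSum.div_const _).mul_left _
  refine tsum_of_norm_bounded h5 fun k => ?_
  rw [norm_mul, Complex.norm_real, Real.norm_of_nonneg (by positivity)]
  rcases eq_or_ne k 0 with rfl | hk
  · simp [gT, uT, Nat.not_prime_zero]
  refine (mul_le_mul (gu_bound hf k).2 (rpow_le_inv hk hs.le) (by positivity)
    ((norm_nonneg _).trans (gu_bound (E := E) hf k).2)).trans (le_of_eq ?_)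
  ring

theorem GU_lip {f : ℕ → ℂ} (hf : CM f) {s s' : ℝ} (hs : 1 < s) (hs' : 1 < s') :
    ‖(G E f s - U E f s) - (G E f s' - U E f s')‖ ≤ Module.finrank ℚ E * R0 * |s - s'| := by
  obtain ⟨h1, h2⟩ := GU_eq (E := E) hf hs
  obtain ⟨h1', h2'⟩ := GU_eq (E := E) hf hs'
  rw [h2, h2', ← h1.tsum_sub h1']
  have h5 : HasSum (fun k : ℕ => Module.finrank ℚ E * ((if k.Prime then 0 else
      ArithmeticFunction.vonMangoldt k) / (k:ℝ)) * |s - s'|) (Module.finrank ℚ E * R0 * |s - s'|) :=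
    (R0_summable.hasSum.mul_left _).mul_right _
  refine tsum_of_norm_bounded h5 fun k => ?_
  rw [← mul_sub, norm_mul, ← Complex.ofReal_sub, Complex.norm_real, Real.norm_eq_abs]
  rcases eq_or_ne k 0 with rfl | hk
  · simp [gT, uT, Nat.not_prime_zero]
  refine (mul_le_mul_of_nonneg_left (rpow_lip hk hs.le hs'.le) (norm_nonneg _)).trans ?_
  have hk' : (0:ℝ) < k := by exact_mod_cast Nat.pos_of_ne_zero hk
  have := mul_le_mul_of_nonneg_right (gu_bound (E := E) hf k).1
    (mul_nonneg (inv_nonneg.2 hk'.le) (abs_nonneg (s - s')))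
  calc _ = ‖gT E f k - uT E f k‖ * Real.log k * ((k:ℝ)⁻¹ * |s - s'|) := by ring
    _ ≤ _ := this
    _ = _ := by ring

end
end Mert


namespace Mert

open NumberField Finset Filter Topology MeasureTheory

theorem CM_one : CM (fun _ => (1:ℂ)) := ⟨rfl, by simp, by simp⟩

section
variable (E : Type*) [Field E] [NumberField E]

/-- Regularity near 1 of the twisted zeta function, with relative constants. -/
structure Reg (f : ℕ → ℂ) (ρ C : ℝ) (M : ℂ) : Prop where
  cm : CM f
  rpos : 0 < ρ
  C1 : 1 ≤ C
  res : ∀ s : ℝ, 1 < s → s ≤ 2 → ‖(s - 1 : ℝ) * LSeries (aT E f) s - M * ρ‖ ≤ ρ * C * (s - 1)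
  lip : ∀ s s' : ℝ, 1 < s → s ≤ 2 → 1 < s' → s' ≤ 2 →
      ‖(s - 1 : ℝ) * LSeries (aT E f) s - (s' - 1 : ℝ) * LSeries (aT E f) s'‖ ≤ ρ * C * |s - s'|
  zero : M = 0 → ∀ s s' : ℝ, 1 < s → s ≤ 2 → 1 < s' → s' ≤ 2 →
      ‖LSeries (aT E f) s‖ ≤ ρ * C ∧ ‖LSeries (aT E f) s - LSeries (aT E f) s'‖ ≤ ρ * C * |s - s'|

variable {E}

theorem G_one_real {s : ℝ} (hs : 1 < s) : (G E (fun _ => 1) s).im = 0 ∧ 0 ≤ (G E (fun _ => 1) s).re := by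
  have h1 := gT_summable (E := E) CM_one (s := s) (by simpa using hs)
  have h2 : G E (fun _ => 1) s = ((∑' k : ℕ, lamE E k / Real.log k * (k:ℝ) ^ (-s) : ℝ) : ℂ) := by
    rw [G, LSeries, Complex.ofReal_tsum]
    refine tsum_congr fun k => ?_
    rw [term_eq _ (gT_zero _)]
    simp [gT]
  rw [h2]
  refine ⟨Complex.ofReal_im _, ?_⟩
  rw [Complex.ofReal_re]
  refine tsum_nonneg fun k => ?_
  have := lamE_nonneg (E := E) k
  have := Real.log_natCast_nonneg k
  positivity

theorem norm_L {f : ℕ → ℂ} (hf : CM f) {s : ℝ} (hs : 1 < s) :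
    ‖LSeries (aT E f) s‖ = Real.exp (G E f s).re := by
  rw [L_eq_exp hf hs, Complex.norm_exp, G]

theorem L_one {s : ℝ} (hs : 1 < s) :
    LSeries (aT E (fun _ => 1)) s = (Real.exp (G E (fun _ => 1) s).re : ℝ) := by
  rw [L_eq_exp CM_one hs, Complex.ofReal_exp]
  congr 1
  apply Complex.ext
  · simp [G]
  · simpa [G] using (G_one_real (E := E) hs).1

theorem log_lip {x y c : ℝ} (hc : 0 < c) (hx : c ≤ x) (hy : c ≤ y) : |Real.log x - Real.log y| ≤ |x - y| / c := by
  wlog hxy : y ≤ x with H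
  · rw [abs_sub_comm, abs_sub_comm x y]; exact H hc hy hx (le_of_not_ge hxy)
  have hy0 : 0 < y := by linarith
  have hx0 : 0 < x := by linarith
  rw [abs_of_nonneg (sub_nonneg.2 (Real.log_le_log hy0 hxy)), abs_of_nonneg (sub_nonneg.2 hxy),
    ← Real.log_div hx0.ne' hy0.ne']
  have := Real.log_le_sub_one_of_pos (div_pos hx0 hy0)
  refine this.trans ?_
  rw [div_sub_one hy0.ne']
  exact div_le_div_of_nonneg_left (by linarith) hc hy

/-- the zeta residue function. -/
theorem vv_bounds {ρ C : ℝ} (r : Reg E (fun _ => 1) ρ C 1) {s : ℝ} (hs : 1 < s) (hs2 : s ≤ 1 + 1 / (2 * C)) :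
    ρ / 2 ≤ (s - 1) * Real.exp (G E (fun _ => 1) s).re ∧ (s - 1) * Real.exp (G E (fun _ => 1) s).re ≤ 2 * ρ := by
  have hC := r.C1
  have h1 : 1 / (2 * C) ≤ 1 := by rw [div_le_one (by linarith)]; linarith
  have h2 := r.res s hs (by linarith)
  rw [L_one hs, ← Complex.ofReal_mul, one_mul, ← Complex.ofReal_sub, Complex.norm_real, Real.norm_eq_abs] at h2
  have h3 : ρ * C * (s - 1) ≤ ρ / 2 := by
    calc ρ * C * (s - 1) ≤ ρ * C * (1 / (2 * C)) := by
          have := r.rpos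
          gcongr
          linarith
      _ = ρ / 2 := by have : C ≠ 0 := by linarith
                      field_simp
  have := abs_le.1 (h2.trans h3)
  have := r.rpos
  constructor <;> linarith

theorem G_princ {ρ C : ℝ} (r : Reg E (fun _ => 1) ρ C 1) {s s' : ℝ} (hs : 1 < s) (hs2 : s ≤ 1 + 1 / (2 * C))
    (hs' : 1 < s') (hs2' : s' ≤ 1 + 1 / (2 * C)) :
    ‖G E (fun _ => 1) s - G E (fun _ => 1) s' - ((Real.log (1 / (s - 1)) - Real.log (1 / (s' - 1)) : ℝ) : ℂ)‖ ≤
      2 * C * |s - s'| := by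
  have hC := r.C1
  have h1 : 1 / (2 * C) ≤ 1 := by rw [div_le_one (by linarith)]; linarith
  have hρ := r.rpos
  have e : ∀ s : ℝ, 1 < s → G E (fun _ => 1) s = ((Real.log ((s - 1) * Real.exp (G E (fun _ => 1) s).re) +
      Real.log (1 / (s - 1)) : ℝ) : ℂ) := by
    intro s hs
    have h3 : Real.log ((s - 1) * Real.exp (G E (fun _ => 1) s).re) + Real.log (1 / (s - 1)) =
        (G E (fun _ => 1) s).re := by
      rw [Real.log_mul (by linarith) (Real.exp_pos _).ne', Real.log_exp, one_div, Real.log_inv]; ring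
    rw [h3]
    apply Complex.ext
    · simp
    · simpa using (G_one_real (E := E) hs).1
  rw [e s hs, e s' hs', ← Complex.ofReal_sub, ← Complex.ofReal_sub, Complex.norm_real, Real.norm_eq_abs]
  have h2 := r.lip s s' hs (by linarith) hs' (by linarith)
  rw [L_one hs, L_one hs', ← Complex.ofReal_mul, ← Complex.ofReal_mul, ← Complex.ofReal_sub, Complex.norm_real,
    Real.norm_eq_abs] at h2
  have h3 := log_lip (c := ρ / 2) (by linarith) (vv_bounds r hs hs2).1 (vv_bounds r hs' hs2').1
  calc _ = _ := by congr 1; ring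
    _ ≤ _ := h3
    _ ≤ (ρ * C * |s - s'|) / (ρ / 2) := by gcongr
    _ = _ := by field_simp

theorem U_princ {ρ C : ℝ} (r : Reg E (fun _ => 1) ρ C 1) {s s' : ℝ} (hs : 1 < s) (hs2 : s ≤ 1 + 1 / (2 * C))
    (hs' : 1 < s') (hs2' : s' ≤ 1 + 1 / (2 * C)) :
    ‖U E (fun _ => 1) s - U E (fun _ => 1) s' - ((Real.log (1 / (s - 1)) - Real.log (1 / (s' - 1)) : ℝ) : ℂ)‖ ≤
      (2 * C + Module.finrank ℚ E * R0) * |s - s'| := by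
  have h1 := G_princ r hs hs2 hs' hs2'
  have h2 := GU_lip (E := E) CM_one hs hs'
  calc _ = ‖(G E (fun _ => 1) s - G E (fun _ => 1) s' -
      ((Real.log (1 / (s - 1)) - Real.log (1 / (s' - 1)) : ℝ) : ℂ)) - ((G E (fun _ => 1) s - U E (fun _ => 1) s) -
      (G E (fun _ => 1) s' - U E (fun _ => 1) s'))‖ := by congr 1; ring
    _ ≤ _ := norm_sub_le _ _
    _ ≤ _ := by rw [add_mul]; exact add_le_add h1 h2

theorem rho_lower {ρ C : ℝ} (r : Reg E (fun _ => 1) ρ C 1) : 1 / (4 * C) ≤ ρ := by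
  have hC := r.C1
  have hs : (1:ℝ) < 1 + 1 / (2 * C) := by have : 0 < 1 / (2 * C) := by positivity
                                          linarith
  have h1 := (vv_bounds r hs le_rfl).2
  have h2 := Real.one_le_exp (G_one_real (E := E) hs).2
  have h3 : (0:ℝ) < 1 / (2 * C) := by positivity
  have h4 : 1 / (2 * C) ≤ 2 * ρ := by
    refine le_trans ?_ h1
    rw [add_sub_cancel_left]
    exact le_mul_of_one_le_right h3.le h2
  have : 1 / (4 * C) = 1 / (2 * C) / 2 := by field_simp; norm_num
  rw [this]; linarith

theorem prime_sum_le {s : ℝ} (hs : 1 < s) :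
    Summable (fun k : ℕ => if k.Prime then (k:ℝ) ^ (-s) else 0) ∧
    Real.exp (∑' k : ℕ, if k.Prime then (k:ℝ) ^ (-s) else 0) ≤ ‖riemannZeta s‖ := by
  have hs' : 1 < (s : ℂ).re := by simpa using hs
  have hsum : Summable (fun k : ℕ => if k.Prime then (k:ℝ) ^ (-s) else 0) := by
    refine Summable.of_nonneg_of_le (fun k => by positivity) (fun k => ?_)
      (Real.summable_nat_rpow.2 (by linarith : -s < -1))
    split_ifs
    · exact le_rfl
    · positivity
  refine ⟨hsum, ?_⟩
  rw [← riemannZeta_eulerProduct_exp_log hs', Complex.norm_exp]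
  apply Real.exp_le_exp.2
  have h1 : Summable fun p : Nat.Primes => -Complex.log (1 - (p:ℂ) ^ (-(s:ℂ))) := by
    have := DirichletCharacter.summable_neg_log_one_sub_mul_prime_cpow (1 : DirichletCharacter ℂ 1) hs'
    refine this.congr fun p => ?_
    rw [MulChar.one_apply (isUnit_of_subsingleton _), one_mul]
  rw [Complex.re_tsum h1]
  have h2 : ∑' k : ℕ, (if k.Prime then (k:ℝ) ^ (-s) else 0) = ∑' p : Nat.Primes, ((p:ℕ):ℝ) ^ (-s) := by
    rw [show (∑' p : Nat.Primes, ((p:ℕ):ℝ) ^ (-s)) = ∑' p : {p : ℕ | p.Prime}, ((p:ℕ):ℝ) ^ (-s) from rfl,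
      tsum_subtype {p : ℕ | p.Prime} (fun k : ℕ => (k:ℝ) ^ (-s))]
    refine tsum_congr fun k => ?_
    simp [Set.indicator_apply]
  rw [h2]
  have h3 : Summable fun p : Nat.Primes => ((p:ℕ):ℝ) ^ (-s) :=
    (Real.summable_nat_rpow.2 (by linarith : -s < -1)).comp_injective Subtype.val_injective
  refine h3.tsum_le_tsum (fun p => ?_) (Complex.hasSum_re h1.hasSum).summable
  have hp : (1:ℝ) < (p:ℕ) := by exact_mod_cast p.2.one_lt
  have e : (1 - (p:ℂ) ^ (-(s:ℂ))) = ((1 - ((p:ℕ):ℝ) ^ (-s) : ℝ) : ℂ) := by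
    push_cast [Complex.ofReal_cpow (Nat.cast_nonneg (p:ℕ))]
    rfl
  have hlt : ((p:ℕ):ℝ) ^ (-s) < 1 := Real.rpow_lt_one_of_one_lt_of_neg hp (by linarith)
  rw [e, Complex.neg_re, Complex.log_ofReal_re]
  have := Real.log_le_sub_one_of_pos (by linarith : 0 < 1 - ((p:ℕ):ℝ) ^ (-s))
  linarith

theorem zeta_le : ∃ K : ℝ, 1 ≤ K ∧ ∀ s : ℝ, 1 < s → s ≤ 2 → ‖riemannZeta s‖ ≤ K / (s - 1) := by
  have h0 := riemannZeta_residue_one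
  have hc : Continuous (fun s : ℂ => Function.update (fun s => (s - 1) * riemannZeta s) 1 1 s) := by
    rw [continuous_iff_continuousAt]
    intro s
    rcases eq_or_ne s 1 with rfl | hs
    · rw [continuousAt_update_same]; exact h0
    · rw [continuousAt_update_of_ne hs]
      exact ((continuous_sub_right (1:ℂ)).continuousAt).mul (differentiableAt_riemannZeta hs).continuousAt
  have hc2 : ContinuousOn (fun s : ℝ => Function.update (fun s : ℂ => (s - 1) * riemannZeta s) 1 1 (s:ℂ))
      (Set.Icc 1 2) := (hc.comp Complex.continuous_ofReal).continuousOn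
  obtain ⟨K, hK⟩ := isCompact_Icc.exists_bound_of_continuousOn hc2
  refine ⟨max K 1, le_max_right _ _, fun s hs hs2 => ?_⟩
  have h1 := hK s ⟨hs.le, hs2⟩
  have hne : (s:ℂ) ≠ 1 := by exact_mod_cast hs.ne'
  rw [Function.update_of_ne hne, norm_mul, ← Complex.ofReal_one, ← Complex.ofReal_sub, Complex.norm_real,
    Real.norm_of_nonneg (by linarith)] at h1
  rw [le_div_iff₀ (by linarith), mul_comm]
  exact h1.trans (le_max_left _ _)

theorem rho_upper (d : ℕ) : ∃ K : ℝ, 1 ≤ K ∧ ∀ (E : Type*) [Field E] [NumberField E], Module.finrank ℚ E = d →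
    ∀ ρ C : ℝ, Reg E (fun _ => 1) ρ C 1 → ρ ≤ (K * C) ^ (d + 1) := by
  obtain ⟨K, hK1, hK⟩ := zeta_le
  set R := Real.exp (d * (R0 / Real.log 2))
  have hR : 1 ≤ R := Real.one_le_exp (by
    have := R0_nonneg
    have h4 : 0 < Real.log 2 := Real.log_pos (by norm_num)
    positivity)
  refine ⟨R * (2 * K), by nlinarith, fun E _ _ hd ρ C r => ?_⟩
  have hC := r.C1
  have h3 : (0:ℝ) < 1 / (2 * C) := by positivity
  set s := 1 + 1 / (2 * C) with hsd
  have hs : 1 < s := by linarith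
  have hs2 : s ≤ 2 := by
    have : 1 / (2 * C) ≤ 1 := by rw [div_le_one (by linarith)]; linarith
    linarith
  have h1 := (vv_bounds r hs le_rfl).1
  obtain ⟨p1, p2⟩ := prime_sum_le hs
  set P := ∑' k : ℕ, if k.Prime then (k:ℝ) ^ (-s) else 0
  have hU : ‖U E (fun _ => 1) s‖ ≤ d * P := by
    refine tsum_of_norm_bounded (p1.hasSum.mul_left (d:ℝ)) fun k => ?_
    rw [norm_mul, Complex.norm_real, Real.norm_of_nonneg (by positivity)]
    split_ifs with hp
    · refine mul_le_mul_of_nonneg_right ?_ (by positivity)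
      rw [← hd]; exact uT_le (by simp) k
    · simp [uT, hp]
  have hG : (G E (fun _ => 1) s).re ≤ d * P + d * (R0 / Real.log 2) := by
    have h5 := GU_bound (E := E) CM_one hs
    rw [hd] at h5
    have h6 := Complex.re_le_norm (G E (fun _ => 1) s)
    have h7 := norm_add_le (G E (fun _ => 1) s - U E (fun _ => 1) s) (U E (fun _ => 1) s)
    rw [sub_add_cancel] at h7
    linarith
  have hz : Real.exp P ≤ 2 * K * C := by
    refine p2.trans ((hK s hs hs2).trans (le_of_eq ?_))
    rw [hsd]; field_simp; ring
  have hE : Real.exp (G E (fun _ => 1) s).re ≤ (2 * K * C) ^ d * R := by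
    refine (Real.exp_le_exp.2 hG).trans ?_
    rw [Real.exp_add, Real.exp_nat_mul]
    gcongr
  have h8 : ρ ≤ Real.exp (G E (fun _ => 1) s).re := by
    have : (s - 1) * Real.exp (G E (fun _ => 1) s).re ≤ 1 / 2 * Real.exp (G E (fun _ => 1) s).re := by
      refine mul_le_mul_of_nonneg_right ?_ (Real.exp_pos _).le
      rw [hsd, add_sub_cancel_left]
      exact one_div_le_one_div_of_le (by norm_num) (by linarith)
    linarith
  refine h8.trans (hE.trans ?_)
  have hb : 1 ≤ 2 * K * C := by nlinarith
  have e1 : R * (2 * K) * C = R * (2 * K * C) := by ring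
  rw [e1, mul_pow R, mul_comm]
  have e2 : R ≤ R ^ (d + 1) := le_self_pow₀ hR (by omega)
  have e3 : (2 * K * C) ^ d ≤ (2 * K * C) ^ (d + 1) := pow_le_pow_right₀ hb (by omega)
  have e4 : 0 ≤ (2 * K * C) ^ d := by positivity
  exact mul_le_mul e2 e3 e4 (by positivity)

end
end Mert


namespace Mert

open NumberField Finset Filter Topology MeasureTheory

section
variable {E : Type*} [Field E] [NumberField E] {E' : Type*} [Field E'] [NumberField E']

theorem CM.pow {f : ℕ → ℂ} (hf : CM f) (j : ℕ) : CM (fun k => f k ^ j) :=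
  ⟨by simp [hf.one], fun a b => by rw [hf.mul, mul_pow], fun a => by
    rw [norm_pow]; exact pow_le_one₀ (norm_nonneg _) (hf.bd a)⟩

/-- Splitting relation for a relative cyclic extension, outside a finite bad set. -/
def Rel (E : Type*) [Field E] [NumberField E] (E' : Type*) [Field E'] [NumberField E']
    (χ : ℕ → ℂ) (t : ℕ) (bad : Finset ℕ) : Prop :=
  ∀ p : ℕ, p.Prime → p ∉ bad → (cE E' p : ℂ) = (∑ j ∈ range t, χ p ^ j) * cE E p

theorem Rel_sum {χ : ℕ → ℂ} (hχ : CM χ) {t : ℕ} {bad : Finset ℕ} (h : Rel E E' χ t bad) {s : ℝ} (hs : 1 < s) :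
    ‖∑ j ∈ range t, U E (fun k => χ k ^ j) s - U E' (fun _ => 1) s‖ ≤
      bad.card * (t * Module.finrank ℚ E + Module.finrank ℚ E' : ℝ) := by
  have h1 : ∀ j ∈ range t, Summable fun k : ℕ => uT E (fun k => χ k ^ j) k * (((k:ℝ) ^ (-s) : ℝ) : ℂ) :=
    fun j _ => U_summable (hχ.pow j).bd hs
  have h2 : Summable fun k : ℕ => uT E' (fun _ => 1) k * (((k:ℝ) ^ (-s) : ℝ) : ℂ) :=
    U_summable CM_one.bd hs
  have e : ∑ j ∈ range t, U E (fun k => χ k ^ j) s - U E' (fun _ => 1) s =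
      ∑' k : ℕ, (∑ j ∈ range t, uT E (fun k => χ k ^ j) k * (((k:ℝ) ^ (-s) : ℝ) : ℂ) -
        uT E' (fun _ => 1) k * (((k:ℝ) ^ (-s) : ℝ) : ℂ)) := by
    rw [(summable_sum h1).tsum_sub h2, Summable.tsum_finsetSum h1]
    rfl
  rw [e, tsum_eq_sum (s := bad)]
  · refine (norm_sum_le _ _).trans ?_
    rw [← nsmul_eq_mul]
    refine Finset.sum_le_card_nsmul _ _ _ fun k _ => ?_
    have hk : ‖(((k:ℝ) ^ (-s) : ℝ) : ℂ)‖ ≤ 1 := by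
      rw [Complex.norm_real, Real.norm_of_nonneg (by positivity)]
      rcases Nat.eq_zero_or_pos k with rfl | hk
      · rw [Nat.cast_zero, Real.zero_rpow (by linarith)]; norm_num
      · exact Real.rpow_le_one_of_one_le_of_nonpos (by exact_mod_cast hk) (by linarith)
    refine (norm_sub_le _ _).trans (add_le_add ?_ ?_)
    · refine (norm_sum_le _ _).trans ?_
      have := Finset.sum_le_card_nsmul (range t) (fun j => ‖uT E (fun k => χ k ^ j) k * (((k:ℝ) ^ (-s) : ℝ) : ℂ)‖)
        (Module.finrank ℚ E : ℝ) (fun j _ => by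
          rw [norm_mul, ← mul_one (Module.finrank ℚ E : ℝ)]
          exact mul_le_mul (uT_le (hχ.pow j).bd k) hk (norm_nonneg _) (Nat.cast_nonneg _))
      simpa using this
    · rw [norm_mul, ← mul_one (Module.finrank ℚ E' : ℝ)]
      exact mul_le_mul (uT_le CM_one.bd k) hk (norm_nonneg _) (Nat.cast_nonneg _)
  · intro k hk
    by_cases hp : k.Prime
    · simp only [uT, if_pos hp, mul_one]
      rw [h k hp hk, Finset.sum_mul, Finset.sum_mul, ← Finset.sum_sub_distrib]
      exact Finset.sum_eq_zero fun j _ => by ring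
    · simp [uT, hp]

theorem re_pow_le {z : ℂ} (hz : ‖z‖ = 1 ∨ z = 0) (j : ℕ) : 1 - (z ^ j).re ≤ j ^ 2 * (1 - z.re) := by
  rcases hz with hz | hz
  · have h1 : ∀ w : ℂ, ‖w‖ = 1 → ‖1 - w‖ ^ 2 = 2 * (1 - w.re) := by
      intro w hw
      have h2 : ‖w‖ ^ 2 = w.re ^ 2 + w.im ^ 2 := by
        rw [← Complex.normSq_eq_norm_sq, Complex.normSq_apply]; ring
      rw [← Complex.normSq_eq_norm_sq, Complex.normSq_apply]
      simp only [Complex.sub_re, Complex.one_re, Complex.sub_im, Complex.one_im]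
      rw [hw] at h2
      linarith
    have h3 : ‖1 - z ^ j‖ ≤ j * ‖1 - z‖ := by
      induction j with
      | zero => simp
      | succ j ih =>
        have : 1 - z ^ (j+1) = (1 - z) + z * (1 - z ^ j) := by ring
        rw [this]
        refine (norm_add_le _ _).trans ?_
        rw [norm_mul, hz]
        push_cast
        linarith
    have h4 := h1 (z ^ j) (by rw [norm_pow, hz, one_pow])
    have h5 := h1 z hz
    have h6 : ‖1 - z ^ j‖ ^ 2 ≤ (j * ‖1 - z‖) ^ 2 := by gcongr
    rw [mul_pow, h4, h5] at h6
    linarith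
  · subst hz
    rcases Nat.eq_zero_or_pos j with rfl | hj
    · simp
    · have : (1:ℝ) ≤ j := by exact_mod_cast hj
      simp [hj.ne']
      nlinarith

theorem U_re {f : ℕ → ℂ} (hf : ∀ k, ‖f k‖ ≤ 1) {s : ℝ} (hs : 1 < s) :
    HasSum (fun k : ℕ => (if k.Prime then (cE E k : ℝ) * (f k).re else 0) * (k:ℝ) ^ (-s)) (U E f s).re := by
  have := Complex.hasSum_re (U_summable (E := E) hf hs).hasSum
  refine this.congr_fun fun k => ?_
  rw [Complex.re_mul_ofReal, uT]
  split_ifs <;> simp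

theorem U_pow_re {χ : ℕ → ℂ} (hχ : CM χ) (hz : ∀ k, ‖χ k‖ = 1 ∨ χ k = 0) (j : ℕ) {s : ℝ} (hs : 1 < s) :
    (U E (fun _ => 1) s).re - (U E (fun k => χ k ^ j) s).re ≤
      j ^ 2 * ((U E (fun _ => 1) s).re - (U E χ s).re) := by
  have h1 := (U_re (E := E) CM_one.bd hs).sub (U_re (E := E) (hχ.pow j).bd hs)
  have h2 := ((U_re (E := E) CM_one.bd hs).sub (U_re (E := E) hχ.bd hs)).mul_left ((j:ℝ) ^ 2)
  refine hasSum_le (fun k => ?_) h1 h2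
  split_ifs with hp
  · have := mul_le_mul_of_nonneg_left (re_pow_le (hz k) j)
      (mul_nonneg (Nat.cast_nonneg (cE E k)) (Real.rpow_nonneg (Nat.cast_nonneg k) (-s)) : (0:ℝ) ≤ _)
    simp only [Complex.one_re]
    linarith
  · simp

theorem GU_re {f : ℕ → ℂ} (hf : CM f) {s : ℝ} (hs : 1 < s) :
    |(G E f s).re - (U E f s).re| ≤ Module.finrank ℚ E * (R0 / Real.log 2) := by
  rw [← Complex.sub_re]
  exact (Complex.abs_re_le_norm _).trans (GU_bound hf hs)

theorem U_one_upper {ρ C : ℝ} (r : Reg E (fun _ => 1) ρ C 1) {s : ℝ} (hs : 1 < s) (hs2 : s ≤ 1 + 1 / (2 * C)) :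
    (U E (fun _ => 1) s).re ≤ Real.log (1 / (s - 1)) + (Real.log (2 * ρ) + Module.finrank ℚ E * (R0 / Real.log 2)) := by
  have h1 := (vv_bounds r hs hs2).2
  have h2 := abs_le.1 (GU_re (E := E) CM_one hs)
  have hρ := r.rpos
  have h3 := Real.log_le_log (mul_pos (by linarith) (Real.exp_pos _)) h1
  rw [Real.log_mul (by linarith) (Real.exp_pos _).ne', Real.log_exp] at h3
  rw [one_div, Real.log_inv]
  linarith

theorem U_one_lower {ρ C : ℝ} (r : Reg E (fun _ => 1) ρ C 1) {s : ℝ} (hs : 1 < s) (hs2 : s ≤ 1 + 1 / (2 * C)) :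
    Real.log (1 / (s - 1)) + (Real.log (ρ / 2) - Module.finrank ℚ E * (R0 / Real.log 2)) ≤ (U E (fun _ => 1) s).re := by
  have h1 := (vv_bounds r hs hs2).1
  have h2 := abs_le.1 (GU_re (E := E) CM_one hs)
  have hρ := r.rpos
  have h3 := Real.log_le_log (by linarith) h1
  rw [Real.log_mul (by linarith) (Real.exp_pos _).ne', Real.log_exp] at h3
  rw [one_div, Real.log_inv]
  linarith

/-- no pole -/
theorem no_pole {χ : ℕ → ℂ} (hz : ∀ k, ‖χ k‖ = 1 ∨ χ k = 0) {t : ℕ} (ht : 2 ≤ t) {bad : Finset ℕ}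
    (h : Rel E E' χ t bad) {ρ C ρ' C' : ℝ} {M : ℂ} (r1 : Reg E (fun _ => 1) ρ C 1)
    (r : Reg E χ ρ C M) (r' : Reg E' (fun _ => 1) ρ' C' 1) : M = 0 := by
  by_contra hM
  have hMp : 0 < ‖M‖ := norm_pos_iff.2 hM
  have hρ := r.rpos
  have hC := r.C1
  have hC' := r'.C1
  set D := (Module.finrank ℚ E : ℝ) * (R0 / Real.log 2)
  -- eventually in s
  have key : ∃ c : ℝ, ∀ s : ℝ, 1 < s → s ≤ 1 + 1 / (2 * C) → s ≤ 1 + 1 / (2 * C') → s ≤ 1 + ‖M‖ / (2 * C) →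
      Real.log (1 / (s - 1)) ≤ c := by
    refine ⟨(∑ j ∈ range t, (j:ℝ) ^ 2) * ((Real.log (2 * ρ) + D) - (Real.log (ρ * ‖M‖ / 2) - D)) +
      bad.card * (t * Module.finrank ℚ E + Module.finrank ℚ E' : ℝ) +
      (Real.log (2 * ρ') + Module.finrank ℚ E' * (R0 / Real.log 2)) - t * (Real.log (ρ / 2) - D),
      fun s hs h1 h2 h3 => ?_⟩
    have hs2 : s ≤ 2 := by
      have : 1 / (2 * C) ≤ 1 := by rw [div_le_one (by linarith)]; linarith
      linarith
    have hχ : Real.log (1 / (s - 1)) + (Real.log (ρ * ‖M‖ / 2) - D) ≤ (U E χ s).re := by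
      have a1 := r.res s hs hs2
      have a2 : ρ * C * (s - 1) ≤ ρ * ‖M‖ / 2 := by
        calc ρ * C * (s - 1) ≤ ρ * C * (‖M‖ / (2 * C)) := by gcongr; linarith
          _ = _ := by field_simp
      have a3 : ρ * ‖M‖ / 2 ≤ (s - 1) * Real.exp (G E χ s).re := by
        have a4 := norm_sub_norm_le (M * ρ) ((s - 1 : ℝ) * LSeries (aT E χ) s)
        rw [norm_sub_rev (M * ρ), norm_mul, norm_mul, norm_L r.cm hs, Complex.norm_real, Complex.norm_real,
          Real.norm_of_nonneg hρ.le, Real.norm_of_nonneg (by linarith)] at a4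
        linarith
      have a5 := abs_le.1 (GU_re (E := E) r.cm hs)
      have a6 := Real.log_le_log (by positivity) a3
      rw [Real.log_mul (by linarith) (Real.exp_pos _).ne', Real.log_exp] at a6
      rw [one_div, Real.log_inv]
      linarith
    have b1 := U_one_upper r1 hs h1
    have b0 := U_one_lower r1 hs h1
    have b2 := U_one_upper r' hs h2
    have b3 : ∀ j ∈ range t, Real.log (1 / (s - 1)) + (Real.log (ρ / 2) - D) -
        (j:ℝ) ^ 2 * ((Real.log (2 * ρ) + D) - (Real.log (ρ * ‖M‖ / 2) - D)) ≤ (U E (fun k => χ k ^ j) s).re := by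
      intro j _
      have c1 := U_pow_re (E := E) r.cm hz j hs
      have c2 : (j:ℝ) ^ 2 * ((U E (fun _ => 1) s).re - (U E χ s).re) ≤
          (j:ℝ) ^ 2 * ((Real.log (2 * ρ) + D) - (Real.log (ρ * ‖M‖ / 2) - D)) := by
        refine mul_le_mul_of_nonneg_left ?_ (by positivity)
        linarith
      linarith
    have b4 := Finset.sum_le_sum b3
    rw [Finset.sum_sub_distrib, Finset.sum_const, card_range, nsmul_eq_mul, ← Finset.sum_mul] at b4
    have b5 := (Complex.re_le_norm _).trans (Rel_sum r.cm h hs)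
    rw [Complex.sub_re, Complex.re_sum] at b5
    have hlog : 0 ≤ Real.log (1 / (s - 1)) := by
      apply Real.log_nonneg
      rw [le_div_iff₀ (by linarith)]; linarith
    have ht' : (2:ℝ) ≤ t := by exact_mod_cast ht
    nlinarith
  obtain ⟨c, hc⟩ := key
  set m := min (min (1 / (2 * C)) (1 / (2 * C'))) (min (‖M‖ / (2 * C)) (Real.exp (-(c+1)))) with hm
  have hm0 : 0 < m := by
    rw [hm]; simp only [lt_min_iff]
    exact ⟨⟨by positivity, by positivity⟩, by positivity, Real.exp_pos _⟩
  have l1 : m ≤ 1 / (2 * C) := (min_le_left _ _).trans (min_le_left _ _)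
  have l2 : m ≤ 1 / (2 * C') := (min_le_left _ _).trans (min_le_right _ _)
  have l3 : m ≤ ‖M‖ / (2 * C) := (min_le_right _ _).trans (min_le_left _ _)
  have l4 : m ≤ Real.exp (-(c+1)) := (min_le_right _ _).trans (min_le_right _ _)
  have := hc (1 + m) (by linarith) (by linarith) (by linarith) (by linarith)
  rw [add_sub_cancel_left, one_div, Real.log_inv] at this
  have h5 := Real.log_le_log hm0 l4
  rw [Real.log_exp] at h5
  linarith

/-- lower bound -/
theorem L_lower {χ : ℕ → ℂ} {t : ℕ} (ht : 2 ≤ t) {bad : Finset ℕ}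
    (h : Rel E E' χ t bad) {ρ C ρ' C' B : ℝ} (r1 : Reg E (fun _ => 1) ρ C 1)
    (r : ∀ j, 0 < j → j < t → Reg E (fun k => χ k ^ j) ρ C 0) (r' : Reg E' (fun _ => 1) ρ' C' 1)
    (hB : (bad.card + R0 / Real.log 2) * (t * Module.finrank ℚ E + Module.finrank ℚ E' : ℝ) ≤ B)
    {s : ℝ} (hs : 1 < s) (hs1 : s ≤ 1 + 1 / (2 * C)) (hs2 : s ≤ 1 + 1 / (2 * C')) :
    ρ * C ≤ 16 * C' * (ρ * C) ^ t * Real.exp B * ‖LSeries (aT E χ) s‖ := by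
  have hρ := r1.rpos
  have hC := r1.C1
  have hC' := r'.C1
  have hρ' := r'.rpos
  have hχ : CM χ := by simpa using (r 1 one_pos (by omega)).cm
  have hs3 : s ≤ 2 := by
    have : 1 / (2 * C) ≤ 1 := by rw [div_le_one (by linarith)]; linarith
    linarith
  have h0 := (Complex.abs_re_le_norm _).trans (Rel_sum hχ h hs)
  have h1 : (G E' (fun _ => 1) s).re - B ≤ ∑ j ∈ range t, (G E (fun k => χ k ^ j) s).re := by
    have a1 := (abs_le.1 (GU_re (E := E') CM_one hs)).2
    have a2 : ∀ j ∈ range t, (U E (fun k => χ k ^ j) s).re - Module.finrank ℚ E * (R0 / Real.log 2) ≤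
        (G E (fun k => χ k ^ j) s).re := by
      intro j _
      have := (abs_le.1 (GU_re (E := E) (hχ.pow j) hs)).1
      linarith
    have a3 := Finset.sum_le_sum a2
    rw [Finset.sum_sub_distrib, Finset.sum_const, card_range, nsmul_eq_mul] at a3
    have a4 := (abs_le.1 h0).1
    rw [Complex.sub_re, Complex.re_sum] at a4
    nlinarith
  have h2 := Real.exp_le_exp.2 h1
  rw [Real.exp_sub, Real.exp_sum] at h2
  obtain ⟨u, rfl⟩ : ∃ u, t = u + 2 := ⟨t - 2, by omega⟩
  rw [Finset.prod_range_succ', Finset.prod_range_succ'] at h2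
  have h3 : ∏ k ∈ range u, Real.exp (G E (fun k_1 => χ k_1 ^ (k + 1 + 1)) s).re ≤ (ρ * C) ^ u := by
    have := Finset.prod_le_prod (s := range u) (f := fun k => Real.exp (G E (fun k_1 => χ k_1 ^ (k + 1 + 1)) s).re)
      (g := fun _ => ρ * C) (fun _ _ => (Real.exp_pos _).le) (fun k hk => by
        have rr := r (k + 1 + 1) (by omega) (by have := mem_range.1 hk; omega)
        rw [← norm_L rr.cm hs]
        exact (rr.zero rfl s s hs hs3 hs hs3).1)
    simpa using this
  have h4 := (vv_bounds r1 hs hs1).2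
  have h5 := (vv_bounds r' hs hs2).1
  have h6 := rho_lower r'
  simp only [pow_zero, zero_add, pow_one] at h2
  rw [norm_L hχ hs]
  set x := Real.exp (G E χ s).re
  set P := ∏ k ∈ range u, Real.exp (G E (fun k_1 => χ k_1 ^ (k + 1 + 1)) s).re
  set z := Real.exp (G E (fun _ => 1) s).re
  set z' := Real.exp (G E' (fun _ => 1) s).re
  have hx : 0 < x := Real.exp_pos _
  have hz0 : 0 < z := Real.exp_pos _
  have hP : 0 < P := Finset.prod_pos fun _ _ => Real.exp_pos _
  have heB := Real.exp_pos B
  rw [div_le_iff₀ heB] at h2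
  have hs0 : 0 < s - 1 := by linarith
  have k1 : 1 / (8 * C') ≤ (ρ * C) ^ u * x * (2 * ρ) * Real.exp B := by
    calc 1 / (8 * C') = 1 / (4 * C') / 2 := by field_simp; norm_num
      _ ≤ (s - 1) * z' := by linarith
      _ ≤ (s - 1) * (P * x * z * Real.exp B) := mul_le_mul_of_nonneg_left h2 hs0.le
      _ = P * x * ((s - 1) * z) * Real.exp B := by ring
      _ ≤ _ := by gcongr
  have k2 : 1 ≤ 8 * C' * ((ρ * C) ^ u * x * (2 * ρ) * Real.exp B) := by
    rwa [div_le_iff₀' (by positivity)] at k1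
  calc ρ * C = (ρ * C) * 1 := by ring
    _ ≤ (ρ * C) * (8 * C' * ((ρ * C) ^ u * x * (2 * (ρ * C)) * Real.exp B)) := by
        refine mul_le_mul_of_nonneg_left (k2.trans ?_) (by positivity)
        gcongr
        nlinarith
    _ = _ := by ring

/-- Lipschitz bound for the prime sum twisted by a nonprincipal character. -/
theorem U_nonprinc {χ : ℕ → ℂ} {ρ C Λ S : ℝ} (r : Reg E χ ρ C 0) (hS : S ≤ 2)
    (hΛ : ∀ s : ℝ, 1 < s → s ≤ S → ρ * C ≤ Λ * ‖LSeries (aT E χ) s‖) {s s' : ℝ}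
    (hs : 1 < s) (hs2 : s < S) (hs' : 1 < s') (hs2' : s' < S) :
    ‖U E χ s - U E χ s'‖ ≤ (Λ + Module.finrank ℚ E * R0) * |s - s'| := by
  have hd : ∀ x : ℝ, 1 < x → HasDerivAt (fun x : ℝ => G E χ x) (-(LSeries (lT E χ) x)) x := fun x hx =>
    (G_hasDeriv r.cm (s := x) (by simpa using hx)).comp_ofReal
  have hd2 : ∀ x : ℝ, 1 < x → HasDerivAt (fun x : ℝ => LSeries (aT E χ) x)
      (-(LSeries (lT E χ) x * LSeries (aT E χ) x)) x := fun x hx =>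
    (L_hasDeriv r.cm (s := x) (by simpa using hx)).comp_ofReal
  have hρC : 0 < ρ * C := mul_pos r.rpos (by linarith [r.C1])
  have hb : ∀ x ∈ Set.Ioo (1:ℝ) S, ‖-(LSeries (lT E χ) x)‖ ≤ Λ := by
    intro x hx
    have h1 : ‖-(LSeries (lT E χ) x * LSeries (aT E χ) x)‖ ≤ ρ * C := by
      refine HasDerivAt.le_of_lip' (hd2 x hx.1) hρC.le ?_
      filter_upwards [Ioo_mem_nhds hx.1 hx.2] with y hy
      exact (r.zero rfl y x hy.1 (by linarith [hy.2]) hx.1 (by linarith [hx.2])).2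
    have h2 := hΛ x hx.1 hx.2.le
    rw [norm_neg, norm_mul] at h1
    rw [norm_neg]
    have h3 : 0 < ‖LSeries (aT E χ) x‖ := by rw [norm_L r.cm hx.1]; exact Real.exp_pos _
    exact le_of_mul_le_mul_right (h1.trans h2) h3
  have hG : ‖G E χ s - G E χ s'‖ ≤ Λ * ‖s - s'‖ :=
    Convex.norm_image_sub_le_of_norm_hasDerivWithin_le (s := Set.Ioo (1:ℝ) S)
      (fun x hx => (hd x hx.1).hasDerivWithinAt) hb (convex_Ioo 1 S) ⟨hs', hs2'⟩ ⟨hs, hs2⟩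
  have h2 := GU_lip (E := E) r.cm hs hs'
  rw [Real.norm_eq_abs] at hG
  calc _ = ‖(G E χ s - G E χ s') - ((G E χ s - U E χ s) - (G E χ s' - U E χ s'))‖ := by congr 1; ring
    _ ≤ _ := norm_sub_le _ _
    _ ≤ _ := by rw [add_mul]; exact add_le_add hG h2

end
end Mert

open NumberField Finset Filter Topology MeasureTheory
open scoped Pointwise
namespace Mert

section tile
variable {V ι : Type*} [NormedAddCommGroup V] [NormedSpace ℝ V] [FiniteDimensional ℝ V]
  [MeasurableSpace V] [BorelSpace V] [Fintype ι]

theorem tile (μ : Measure V) [μ.IsAddHaarMeasure] (b : Module.Basis ι ℝ V) (g : V → ℝ) (hg : Continuous g)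
    {R : ℝ} (hR : ∀ x, R < ‖x‖ → g x = 0) {S : Set V} (hS : MeasurableSet S) (hSf : μ S ≠ ⊤) {ε : ℝ}
    (hε : ∀ x, ∀ p ∈ ZSpan.fundamentalDomain b, |g (x + p) - g x| ≤ ε * S.indicator 1 (x + p)) (c : V) :
    |μ.real (ZSpan.fundamentalDomain b) * ∑' l : Submodule.span ℤ (Set.range b), g (c + l) - ∫ x, g x ∂μ|
      ≤ ε * μ.real S := by
  have hfd := ZSpan.isAddFundamentalDomain b μ
  set P := ZSpan.fundamentalDomain b with hP
  have hcs : HasCompactSupport g := by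
    refine HasCompactSupport.of_support_subset_isCompact (isCompact_closedBall (0:V) R) ?_
    intro x hx
    by_contra h
    exact hx (hR x (by simpa using h))
  have hgi : Integrable (fun x => g (c + x)) μ := by
    have : Integrable g μ := hg.integrable_of_hasCompactSupport hcs
    exact this.comp_add_left c
  have hPm : MeasurableSet P := ZSpan.fundamentalDomain_measurableSet b
  have hPb : Bornology.IsBounded P := ZSpan.fundamentalDomain_isBounded b
  have hPf : μ P ≠ ⊤ := hPb.measure_lt_top.ne
  haveI : VAddInvariantMeasure (Submodule.span ℤ (Set.range b)) V μ :=
    inferInstanceAs (VAddInvariantMeasure (Submodule.span ℤ (Set.range b)).toAddSubgroup V μ)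
  have hsum := hfd.sum_restrict
  have H1 : HasSum (fun l : Submodule.span ℤ (Set.range b) => ∫ x in l +ᵥ P, g (c + x) ∂μ) (∫ x, g x ∂μ) := by
    have := hasSum_integral_measure (μ := fun l : Submodule.span ℤ (Set.range b) => μ.restrict (l +ᵥ P))
      (f := fun x => g (c + x)) (by rw [hsum]; exact hgi)
    rw [hsum, integral_add_left_eq_self] at this
    exact this
  have hfin : (Function.support fun l : Submodule.span ℤ (Set.range b) => g (c + l)).Finite := by
    have h1 := ZSpan.setFinite_inter b (Metric.isBounded_closedBall (x := (0:V)) (r := R + ‖c‖))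
    refine Set.Finite.of_finite_image (f := fun l => (l : V)) (h1.subset ?_) Subtype.val_injective.injOn
    rintro _ ⟨l, hl, rfl⟩
    refine ⟨?_, l.2⟩
    by_contra h
    apply hl
    apply hR
    have h2 : R + ‖c‖ < ‖(l:V)‖ := by simpa using h
    have h3 : ‖(l:V)‖ ≤ ‖c + l‖ + ‖c‖ := by
      calc ‖(l:V)‖ = ‖c + l - c‖ := by congr 1; abel
        _ ≤ _ := norm_sub_le _ _
    linarith
  have H2 : HasSum (fun l : Submodule.span ℤ (Set.range b) => μ.real P * g (c + l))
      (μ.real P * ∑' l : Submodule.span ℤ (Set.range b), g (c + l)) :=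
    (summable_of_hasFiniteSupport hfin).hasSum.mul_left _
  have hind : Integrable (fun x => ε * S.indicator (1 : V → ℝ) (c + x)) μ := by
    have h0 : Integrable (S.indicator (1 : V → ℝ)) μ :=
      (integrable_indicator_iff hS).2 (integrableOn_const hSf)
    exact (h0.comp_add_left c).const_mul ε
  have H3 : HasSum (fun l : Submodule.span ℤ (Set.range b) =>
      ∫ x in l +ᵥ P, ε * S.indicator (1 : V → ℝ) (c + x) ∂μ) (ε * μ.real S) := by
    have := hasSum_integral_measure (μ := fun l : Submodule.span ℤ (Set.range b) => μ.restrict (l +ᵥ P))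
      (f := fun x => ε * S.indicator (1 : V → ℝ) (c + x)) (by rw [hsum]; exact hind)
    rw [hsum, integral_const_mul, integral_add_left_eq_self (fun x => S.indicator (1 : V → ℝ) x),
      integral_indicator_one hS] at this
    exact this
  have hb : ∀ l : Submodule.span ℤ (Set.range b), ‖μ.real P * g (c + l) - ∫ x in l +ᵥ P, g (c + x) ∂μ‖ ≤
      ∫ x in l +ᵥ P, ε * S.indicator (1 : V → ℝ) (c + x) ∂μ := by
    intro l
    have hm : μ.real (l +ᵥ P) = μ.real P := by
      simp only [Measure.real, measure_vadd]
    have hlm : MeasurableSet (l +ᵥ P) := hPm.const_vadd l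
    have e : μ.real P * g (c + l) - ∫ x in l +ᵥ P, g (c + x) ∂μ = ∫ x in l +ᵥ P, (g (c + l) - g (c + x)) ∂μ := by
      rw [integral_sub _ hgi.integrableOn]
      · rw [setIntegral_const, hm, smul_eq_mul]
      · refine integrableOn_const ?_
        rw [measure_vadd]; exact hPf
    rw [e]
    refine norm_integral_le_of_norm_le hind.integrableOn ?_
    refine (ae_restrict_iff' hlm).2 (Eventually.of_forall fun x hx => ?_)
    obtain ⟨p, hp, rfl⟩ := hx
    have := hε (c + l) p hp
    have e2 : c + ((l:V) +ᵥ p) = c + l + p := by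
      rw [add_assoc]; rfl
    beta_reduce
    rw [e2, Real.norm_eq_abs, abs_sub_comm]
    exact this
  have hd := H2.sub H1
  rw [← Real.norm_eq_abs, ← hd.tsum_eq]
  exact tsum_of_norm_bounded H3 hb
end tile
end Mert

open NumberField Finset Filter Topology MeasureTheory
open scoped Pointwise
namespace Mert

section avg
variable {G : Type*} [AddCommGroup G]

/-- average of a function over representatives of a finite quotient -/
noncomputable def avg (N : AddSubgroup G) (f : G → ℂ) : ℂ := (∑ᶠ r : G ⧸ N, f (Quotient.out r)) / N.index

theorem finq (N : AddSubgroup G) (hN : N.index ≠ 0) : Finite (G ⧸ N) :=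
  have : N.FiniteIndex := ⟨hN⟩
  inferInstance

/-- decomposition of a group into cosets -/
noncomputable def cosetEq (Λ : AddSubgroup G) : (G ⧸ Λ) × Λ ≃ G where
  toFun q := Quotient.out q.1 + q.2
  invFun x := (x, ⟨-Quotient.out (x : G ⧸ Λ) + x, QuotientAddGroup.eq.1 (QuotientAddGroup.out_eq' _)⟩)
  left_inv := by
    rintro ⟨r, l⟩
    have h : ((Quotient.out r + l : G) : G ⧸ Λ) = r := by
      conv_rhs => rw [← QuotientAddGroup.out_eq' r]
      rw [QuotientAddGroup.eq]
      simp
    refine Prod.ext h ?_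
    refine Subtype.ext ?_
    simp only [h]
    abel
  right_inv x := by simp

theorem avg_eq (N : AddSubgroup G) [Fintype (G ⧸ N)] (f : G → ℂ) :
    avg N f = (∑ r : G ⧸ N, f (Quotient.out r)) / Fintype.card (G ⧸ N) := by
  rw [avg, finsum_eq_sum_of_fintype, AddSubgroup.index, Nat.card_eq_fintype_card]

theorem avg_le (Λ N : AddSubgroup G) (h : Λ ≤ N) (hΛ : Λ.index ≠ 0) (f : G → ℂ)
    (hf : ∀ x, ∀ n ∈ N, f (x + n) = f x) : avg Λ f = avg N f := by
  have h1 : Finite (G ⧸ Λ) := finq Λ hΛ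
  have hN : N.index ≠ 0 := fun h0 => hΛ (Nat.eq_zero_of_zero_dvd (h0 ▸ AddSubgroup.index_dvd_of_le h))
  have h2 : Finite (G ⧸ N) := finq N hN
  have : Fintype (G ⧸ N) := Fintype.ofFinite _
  have : Fintype (G ⧸ Λ) := Fintype.ofFinite _
  let e := AddSubgroup.quotientEquivProdOfLE h
  have h3 : Finite (N ⧸ Λ.addSubgroupOf N) := by
    have : Finite ((G ⧸ N) × (N ⧸ Λ.addSubgroupOf N)) := Finite.of_equiv _ e
    exact Finite.prod_right (G ⧸ N)
  have : Fintype (N ⧸ Λ.addSubgroupOf N) := Fintype.ofFinite _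
  have hfs : ∀ x y : G, (x : G ⧸ N) = y → f x = f y := by
    intro x y hxy
    have := QuotientAddGroup.eq.1 hxy
    have h4 := hf x _ this
    rw [← h4]; congr 1; abel
  rw [avg_eq, avg_eq]
  have hs : ∑ r : G ⧸ Λ, f (Quotient.out r) = ∑ q : (G ⧸ N) × (N ⧸ Λ.addSubgroupOf N), f (Quotient.out q.1) := by
    refine Fintype.sum_equiv e _ _ fun r => ?_
    apply hfs
    have e1 : (e r).1 = ((Quotient.out r : G) : G ⧸ N) := by
      conv_lhs => rw [← QuotientAddGroup.out_eq' r]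
      rfl
    rw [QuotientAddGroup.out_eq', e1]
  rw [hs, Fintype.sum_prod_type, Fintype.card_congr e, Fintype.card_prod]
  have hc : (Fintype.card (N ⧸ Λ.addSubgroupOf N) : ℂ) ≠ 0 := by simp
  have hc' : (Fintype.card (G ⧸ N) : ℂ) ≠ 0 := by simp
  simp only [sum_const, card_univ, nsmul_eq_mul, ← mul_sum]
  push_cast
  field_simp

theorem avg_norm (N : AddSubgroup G) (hN : N.index ≠ 0) (f : G → ℂ) (hf : ∀ x, ‖f x‖ ≤ 1) : ‖avg N f‖ ≤ 1 := by
  have h2 : Finite (G ⧸ N) := finq N hN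
  have : Fintype (G ⧸ N) := Fintype.ofFinite _
  rw [avg_eq, norm_div, Complex.norm_natCast, div_le_one (by simp [Fintype.card_pos])]
  refine (norm_sum_le _ _).trans ?_
  refine (sum_le_sum fun i _ => hf _).trans ?_
  simp

theorem avg_one (N : AddSubgroup G) (hN : N.index ≠ 0) (f : G → ℂ) (hf : ∀ x, f x = 1) : avg N f = 1 := by
  have h2 : Finite (G ⧸ N) := finq N hN
  have : Fintype (G ⧸ N) := Fintype.ofFinite _
  rw [avg_eq]; simp [hf]

variable {V ι : Type*} [NormedAddCommGroup V] [NormedSpace ℝ V] [FiniteDimensional ℝ V]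
  [MeasurableSpace V] [BorelSpace V] [Fintype ι]

theorem avg_tile (μ : Measure V) [μ.IsAddHaarMeasure] (b : Module.Basis ι ℝ V) (g : V → ℝ) (hg : Continuous g)
    {R : ℝ} (hR : ∀ x, R < ‖x‖ → g x = 0) {S : Set V} (hS : MeasurableSet S) (hSf : μ S ≠ ⊤) {ε : ℝ}
    (hε : ∀ x, ∀ p ∈ ZSpan.fundamentalDomain b, |g (x + p) - g x| ≤ ε * S.indicator 1 (x + p))
    (e : G →+ V) (he : Function.Injective e) (Λ N : AddSubgroup G) (hΛN : Λ ≤ N) (hΛ : Λ.index ≠ 0)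
    (hmap : Λ.map e = (Submodule.span ℤ (Set.range b)).toAddSubgroup) (f : G → ℂ)
    (hf : ∀ x, ∀ n ∈ N, f (x + n) = f x) (hf1 : ∀ x, ‖f x‖ ≤ 1) :
    (Function.support fun x : G => g (e x)).Finite ∧
    ‖((μ.real (ZSpan.fundamentalDomain b) / Λ.index : ℝ) : ℂ) * ∑' x : G, f x * g (e x)
      - avg N f * (∫ x, g x ∂μ : ℝ)‖ ≤ ε * μ.real S := by
  have h1 : Finite (G ⧸ Λ) := finq Λ hΛ
  have : Fintype (G ⧸ Λ) := Fintype.ofFinite _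
  obtain ⟨eq, heq⟩ : ∃ eq : G ≃ (G ⧸ Λ) × Λ, ∀ (r : G ⧸ Λ) (l : Λ), eq.symm (r, l) = Quotient.out r + l :=
    ⟨(cosetEq Λ).symm, fun r l => rfl⟩
  obtain ⟨eL, heL⟩ : ∃ eL : Λ ≃ Submodule.span ℤ (Set.range b), ∀ l : Λ, ((eL l : V)) = e l :=
    ⟨(AddSubgroup.equivMapOfInjective Λ e he).toEquiv.trans (Equiv.setCongr (by rw [hmap]; rfl)), fun l => rfl⟩
  have hfinL : ∀ c : V, (Function.support fun l : Submodule.span ℤ (Set.range b) => g (c + l)).Finite := by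
    intro c
    have h1 := ZSpan.setFinite_inter b (Metric.isBounded_closedBall (x := (0:V)) (r := R + ‖c‖))
    refine Set.Finite.of_finite_image (f := fun l => (l : V)) (h1.subset ?_) Subtype.val_injective.injOn
    rintro _ ⟨l, hl, rfl⟩
    refine ⟨?_, l.2⟩
    by_contra h
    apply hl
    apply hR
    have h2 : R + ‖c‖ < ‖(l:V)‖ := by simpa using h
    have h3 : ‖(l:V)‖ ≤ ‖c + l‖ + ‖c‖ := by
      calc ‖(l:V)‖ = ‖c + l - c‖ := by congr 1; abel
        _ ≤ _ := norm_sub_le _ _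
    linarith
  have hfinΛ : ∀ c : V, (Function.support fun l : Λ => g (c + e l)).Finite := by
    intro c
    have := (hfinL c).preimage (f := eL) eL.injective.injOn
    refine this.subset fun l hl => ?_
    simpa [heL] using hl
  have hfin : (Function.support fun x : G => g (e x)).Finite := by
    have : (Function.support fun q : (G ⧸ Λ) × Λ => g (e (eq.symm q))).Finite := by
      have h5 : (⋃ r : G ⧸ Λ, (fun l => (r, l)) '' (Function.support fun l : Λ => g (e (Quotient.out r) + e l))).Finite :=
        Set.finite_iUnion fun r => (hfinΛ _).image _
      refine h5.subset ?_
      rintro ⟨r, l⟩ hq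
      refine Set.mem_iUnion.2 ⟨r, l, ?_, rfl⟩
      simpa [heq] using hq
    refine (this.image eq.symm).subset ?_
    intro x hx
    exact ⟨eq x, by simpa using hx, by simp⟩
  refine ⟨hfin, ?_⟩
  have hfp : ∀ x, ∀ n ∈ Λ, f (x + n) = f x := fun x n hn => hf x n (hΛN hn)
  have hsum : ∑' x : G, f x * g (e x) = ∑ r : G ⧸ Λ, f (Quotient.out r) *
      ((∑' l : Submodule.span ℤ (Set.range b), g (e (Quotient.out r) + l) : ℝ) : ℂ) := by
    have hsm : Summable fun x : G => f x * g (e x) := by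
      refine summable_of_hasFiniteSupport (hfin.subset ?_)
      intro x hx h0
      apply hx
      simp only at h0
      simp [h0]
    have hsm2 : Summable fun q : (G ⧸ Λ) × Λ => f (eq.symm q) * g (e (eq.symm q)) := hsm.comp_injective eq.symm.injective
    rw [← eq.symm.tsum_eq, hsm2.tsum_prod, tsum_fintype]
    refine sum_congr rfl fun r _ => ?_
    rw [Complex.ofReal_tsum, ← tsum_mul_left, ← eL.tsum_eq]
    refine tsum_congr fun l => ?_
    rw [heq, hfp _ _ l.2, heL, map_add]
  have hΛc : (Λ.index : ℂ) ≠ 0 := by exact_mod_cast hΛ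
  have hΛr : (0:ℝ) < Λ.index := by positivity
  have hcard : Fintype.card (G ⧸ Λ) = Λ.index := by rw [AddSubgroup.index, Nat.card_eq_fintype_card]
  rw [← avg_le Λ N hΛN hΛ f hf, avg_eq, hcard, hsum]
  have key : ((μ.real (ZSpan.fundamentalDomain b) / Λ.index : ℝ) : ℂ) * ∑ r : G ⧸ Λ, f (Quotient.out r) *
      ((∑' l : Submodule.span ℤ (Set.range b), g (e (Quotient.out r) + l) : ℝ) : ℂ)
      - (∑ r : G ⧸ Λ, f (Quotient.out r)) / Λ.index * (∫ x, g x ∂μ : ℝ) =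
      (∑ r : G ⧸ Λ, f (Quotient.out r) * ((μ.real (ZSpan.fundamentalDomain b) *
        (∑' l : Submodule.span ℤ (Set.range b), g (e (Quotient.out r) + l)) - ∫ x, g x ∂μ : ℝ) : ℂ)) / Λ.index := by
    rw [eq_div_iff hΛc, sub_mul, Finset.mul_sum, Finset.sum_mul, Finset.sum_div, Finset.sum_mul, Finset.sum_mul,
      ← Finset.sum_sub_distrib]
    refine sum_congr rfl fun r _ => ?_
    push_cast
    field_simp
  rw [key, norm_div, Complex.norm_natCast, div_le_iff₀ hΛr]
  refine (norm_sum_le _ _).trans ?_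
  have : ∀ r ∈ (univ : Finset (G ⧸ Λ)), ‖f (Quotient.out r) * ((μ.real (ZSpan.fundamentalDomain b) *
        (∑' l : Submodule.span ℤ (Set.range b), g (e (Quotient.out r) + l)) - ∫ x, g x ∂μ : ℝ) : ℂ)‖ ≤ ε * μ.real S := by
    intro r _
    rw [norm_mul, Complex.norm_real, Real.norm_eq_abs]
    have t := tile μ b g hg hR hS hSf hε (e (Quotient.out r))
    calc _ ≤ 1 * _ := mul_le_mul_of_nonneg_right (hf1 _) (abs_nonneg _)
      _ ≤ _ := by rw [one_mul]; exact t
  refine (sum_le_sum this).trans ?_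
  rw [sum_const, card_univ, hcard, nsmul_eq_mul, mul_comm]
end avg
end Mert

open NumberField Finset Filter Topology MeasureTheory
open scoped Pointwise
namespace Mert
open NumberField.mixedEmbedding NumberField.InfinitePlace

section geom
open scoped Classical
variable (E : Type*) [Field E] [NumberField E]

/-- diagonal scaling of the mixed space -/
noncomputable def sc (a : InfinitePlace E → ℝ) : mixedSpace E →ₗ[ℝ] mixedSpace E :=
  LinearMap.mulLeft ℝ (mixedSpaceOfRealSpace a)

variable {E}

theorem np_sc {a : InfinitePlace E → ℝ} (ha : ∀ w, 0 < a w) (w : InfinitePlace E) (x : mixedSpace E) :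
    normAtPlace w (sc E a x) = a w * normAtPlace w x := by
  rw [sc, LinearMap.mulLeft_apply, map_mul, normAtPlace_mixedSpaceOfRealSpace (ha w).le]

theorem det_sc (a : InfinitePlace E → ℝ) : LinearMap.det (sc E a) = ∏ w, a w ^ w.mult := by
  let d : index E → ℝ := fun i => match i with
    | Sum.inl w => a w.1
    | Sum.inr p => a p.1.1
  have h1 : LinearMap.toMatrix (stdBasis E) (stdBasis E) (sc E a) = Matrix.diagonal d := by
    ext i j
    rw [LinearMap.toMatrix_apply]
    have h2 : ∀ x, (stdBasis E).repr (sc E a x) i = d i * (stdBasis E).repr x i := by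
      intro x
      rcases i with w | ⟨w, k⟩
      · simp [sc, mixedSpaceOfRealSpace_apply, d]
      · fin_cases k
        · simp [sc, mixedSpaceOfRealSpace_apply, d]
        · simp [sc, mixedSpaceOfRealSpace_apply, d]
    rw [h2, Module.Basis.repr_self, Matrix.diagonal_apply, Finsupp.single_apply]
    by_cases h : i = j
    · simp [h]
    · simp [h, Ne.symm h]
  rw [← LinearMap.det_toMatrix (stdBasis E), h1, Matrix.det_diagonal, Fintype.prod_sum_type,
    Fintype.prod_prod_type, InfinitePlace.prod_eq_prod_mul_prod]
  congr 1
  · exact Finset.prod_congr rfl fun w _ => by simp [d, InfinitePlace.mult, w.2]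
  · refine Finset.prod_congr rfl fun w _ => ?_
    have := InfinitePlace.not_isReal_iff_isComplex.2 w.2
    simp [d, InfinitePlace.mult, this]

theorem det_pos {a : InfinitePlace E → ℝ} (ha : ∀ w, 0 < a w) : 0 < ∏ w, a w ^ w.mult :=
  Finset.prod_pos fun w _ => pow_pos (ha w) _

theorem integral_sc {a : InfinitePlace E → ℝ} (ha : ∀ w, 0 < a w) {f : mixedSpace E → ℝ} (hf : Continuous f) :
    ∫ x, f (sc E a x) = (∏ w, a w ^ w.mult)⁻¹ * ∫ x, f x := by
  have hd : LinearMap.det (sc E a) ≠ 0 := by rw [det_sc]; exact (det_pos ha).ne'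
  have hm := Measure.map_linearMap_addHaar_eq_smul_addHaar (volume : Measure (mixedSpace E)) hd
  have hc : Continuous (sc E a) := LinearMap.continuous_of_finiteDimensional _
  rw [← integral_map hc.measurable.aemeasurable hf.aestronglyMeasurable, hm, integral_smul_measure,
    det_sc, abs_of_pos (inv_pos.2 (det_pos ha)), ENNReal.toReal_ofReal (inv_pos.2 (det_pos ha)).le, smul_eq_mul]

theorem vol_sc {a : InfinitePlace E → ℝ} (ha : ∀ w, 0 < a w) {r : ℝ} (hr : 0 ≤ r) :
    volume {x : mixedSpace E | ‖sc E a x‖ ≤ r} ≠ ⊤ ∧ volume.real {x : mixedSpace E | ‖sc E a x‖ ≤ r} =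
      (∏ w, a w ^ w.mult)⁻¹ * (r ^ Module.finrank ℚ E * volume.real (Metric.ball (0 : mixedSpace E) 1)) := by
  have hd : LinearMap.det (sc E a) ≠ 0 := by rw [det_sc]; exact (det_pos ha).ne'
  have h1 : {x : mixedSpace E | ‖sc E a x‖ ≤ r} = sc E a ⁻¹' Metric.closedBall 0 r := by
    ext x; simp
  have h2 : volume {x : mixedSpace E | ‖sc E a x‖ ≤ r} = ENNReal.ofReal (∏ w, a w ^ w.mult)⁻¹ *
      (ENNReal.ofReal (r ^ Module.finrank ℚ E) * volume (Metric.ball (0 : mixedSpace E) 1)) := by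
    rw [h1, Measure.addHaar_preimage_linearMap _ hd, det_sc, abs_of_pos (inv_pos.2 (det_pos ha)),
      Measure.addHaar_closedBall _ _ hr, mixedEmbedding.finrank]
  constructor
  · rw [h2]
    exact ENNReal.mul_ne_top ENNReal.ofReal_ne_top (ENNReal.mul_ne_top ENNReal.ofReal_ne_top measure_ball_lt_top.ne)
  · rw [Measure.real, h2, ENNReal.toReal_mul, ENNReal.toReal_mul, ENNReal.toReal_ofReal (inv_pos.2 (det_pos ha)).le,
      ENNReal.toReal_ofReal (by positivity)]
    rfl

/-- bump function -/
noncomputable def bp (r : ℝ) : ℝ := max 0 (1 - |r - 2|)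

theorem bp_nonneg (r : ℝ) : 0 ≤ bp r := le_max_left _ _
theorem bp_le (r : ℝ) : bp r ≤ 1 := max_le (by norm_num) (by linarith [abs_nonneg (r - 2)])
theorem bp_supp {r : ℝ} (h : bp r ≠ 0) : 1 < r ∧ r < 3 := by
  by_contra hh
  apply h
  apply max_eq_left
  by_contra h3
  push Not at h3
  have : |r - 2| < 1 := by linarith
  rw [abs_lt] at this
  exact hh ⟨by linarith, by linarith⟩
theorem bp_cont : Continuous bp := by unfold bp; fun_prop
theorem bp_lip (r r' : ℝ) : |bp r - bp r'| ≤ |r - r'| := by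
  unfold bp
  refine (abs_max_sub_max_le_max _ _ _ _).trans ?_
  rw [sub_self, abs_zero]
  refine max_le (abs_nonneg _) ?_
  calc |1 - |r - 2| - (1 - |r' - 2|)| = |(|r' - 2| - |r - 2|)| := by congr 1; ring
    _ ≤ |(r' - 2) - (r - 2)| := abs_abs_sub_abs_le_abs_sub _ _
    _ = |r - r'| := by rw [abs_sub_comm]; congr 1; ring

theorem prod_lip {ι : Type*} (s : Finset ι) (u v : ι → ℝ) (hu : ∀ i, |u i| ≤ 1) (hv : ∀ i, |v i| ≤ 1) :
    |∏ i ∈ s, u i - ∏ i ∈ s, v i| ≤ ∑ i ∈ s, |u i - v i| := by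
  classical
  induction s using Finset.induction_on with
  | empty => simp
  | insert a s ha ih =>
    rw [prod_insert ha, prod_insert ha, sum_insert ha]
    have e : u a * ∏ i ∈ s, u i - v a * ∏ i ∈ s, v i =
      (u a - v a) * ∏ i ∈ s, u i + v a * (∏ i ∈ s, u i - ∏ i ∈ s, v i) := by ring
    rw [e]
    refine (abs_add_le _ _).trans ?_
    rw [abs_mul, abs_mul]
    have h1 : |∏ i ∈ s, u i| ≤ 1 := by
      rw [Finset.abs_prod]; exact Finset.prod_le_one (fun _ _ => abs_nonneg _) fun i _ => hu i
    have := hv a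
    have h3 := abs_nonneg (u a - v a)
    have h4 := abs_nonneg (∏ i ∈ s, u i - ∏ i ∈ s, v i)
    nlinarith

variable (E) in
/-- test function on the mixed space -/
noncomputable def Ph (x : mixedSpace E) : ℝ := ∏ w, bp (normAtPlace w x)

theorem Ph_nonneg (x : mixedSpace E) : 0 ≤ Ph E x := Finset.prod_nonneg fun _ _ => bp_nonneg _

theorem Ph_cont : Continuous (Ph E) :=
  continuous_finsetProd _ fun w _ => bp_cont.comp (continuous_normAtPlace w)

theorem np_le_norm (w : InfinitePlace E) (x : mixedSpace E) : normAtPlace w x ≤ ‖x‖ := by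
  rw [mixedEmbedding.norm_eq_sup'_normAtPlace]
  exact Finset.le_sup' (fun w => normAtPlace w x) (mem_univ w)

theorem norm_le_of_np {x : mixedSpace E} {r : ℝ} (h : ∀ w, normAtPlace w x ≤ r) : ‖x‖ ≤ r := by
  rw [mixedEmbedding.norm_eq_sup'_normAtPlace]
  exact Finset.sup'_le _ _ fun w _ => h w

theorem Ph_supp {x : mixedSpace E} (h : Ph E x ≠ 0) : ∀ w, 1 < normAtPlace w x ∧ normAtPlace w x < 3 :=
  fun w => bp_supp (Finset.prod_ne_zero_iff.1 h w (mem_univ w))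

theorem Ph_zero {x : mixedSpace E} (h : 3 < ‖x‖) : Ph E x = 0 := by
  by_contra h1
  have := norm_le_of_np fun w => (Ph_supp h1 w).2.le
  linarith

theorem card_places : Fintype.card (InfinitePlace E) ≤ Module.finrank ℚ E := by
  rw [← InfinitePlace.sum_mult_eq, Fintype.card_eq_sum_ones]
  exact sum_le_sum fun w _ => InfinitePlace.mult_pos

theorem Ph_lip (x y : mixedSpace E) : |Ph E x - Ph E y| ≤ Module.finrank ℚ E * ‖x - y‖ := by
  refine (prod_lip _ _ _ (fun w => ?_) (fun w => ?_)).trans ?_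
  · rw [abs_of_nonneg (bp_nonneg _)]; exact bp_le _
  · rw [abs_of_nonneg (bp_nonneg _)]; exact bp_le _
  have h1 : ∀ w ∈ (univ : Finset (InfinitePlace E)), |bp (normAtPlace w x) - bp (normAtPlace w y)| ≤ ‖x - y‖ := by
    intro w _
    refine (bp_lip _ _).trans (le_trans ?_ (np_le_norm w (x - y)))
    rw [abs_sub_le_iff]
    have t1 := normAtPlace_add_le w (x - y) y
    have t2 := normAtPlace_add_le w (y - x) x
    have t3 := normAtPlace_neg w (x - y)
    rw [neg_sub] at t3
    simp only [sub_add_cancel] at t1 t2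
    constructor <;> linarith
  refine (sum_le_sum h1).trans ?_
  rw [sum_const, nsmul_eq_mul, card_univ]
  have : (Fintype.card (InfinitePlace E) : ℝ) ≤ Module.finrank ℚ E := by exact_mod_cast card_places
  exact mul_le_mul_of_nonneg_right this (norm_nonneg _)

theorem Ph_int : Integrable (Ph E) := by
  refine Ph_cont.integrable_of_hasCompactSupport ?_
  refine HasCompactSupport.of_support_subset_isCompact (isCompact_closedBall (0:mixedSpace E) 3) ?_
  intro x hx
  by_contra h
  exact hx (Ph_zero (by simpa using h))

variable (E) in
/-- volume of the unit ball -/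
noncomputable def v1 : ℝ := volume.real (Metric.ball (0 : mixedSpace E) 1)

theorem v1_pos : 0 < v1 E := ENNReal.toReal_pos (Metric.measure_ball_pos _ _ one_pos).ne' measure_ball_lt_top.ne

theorem Ph_lower : (1/4 : ℝ) ^ Module.finrank ℚ E * v1 E ≤ ∫ x, Ph E x := by
  set d := Module.finrank ℚ E
  set z : mixedSpace E := mixedSpaceOfRealSpace (fun _ => 2) with hz
  have hzw : ∀ w, normAtPlace w z = 2 := fun w => by
    rw [hz, normAtPlace_mixedSpaceOfRealSpace (by norm_num)]
  have hv : volume.real (Metric.ball z (1/2)) = (1/2) ^ d * v1 E := by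
    rw [Measure.real, Measure.addHaar_ball _ _ (by norm_num), mixedEmbedding.finrank, ENNReal.toReal_mul,
      ENNReal.toReal_ofReal (by positivity)]
    rfl
  have hb : ∀ x ∈ Metric.ball z (1/2), (1/2 : ℝ) ^ d ≤ Ph E x := by
    intro x hx
    have h1 : ∀ w, 1/2 ≤ bp (normAtPlace w x) := by
      intro w
      have h2 : ‖x - z‖ < 1/2 := by simpa [dist_eq_norm] using hx
      have h3 := np_le_norm w (x - z)
      have t1 := normAtPlace_add_le w (x - z) z
      have t2 := normAtPlace_add_le w (z - x) x
      have t3 := normAtPlace_neg w (x - z)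
      rw [neg_sub] at t3
      simp only [sub_add_cancel, hzw] at t1 t2
      refine le_max_of_le_right ?_
      have : |normAtPlace w x - 2| ≤ 1/2 := by rw [abs_le]; constructor <;> linarith
      linarith
    calc (1/2 : ℝ) ^ d ≤ (1/2) ^ Fintype.card (InfinitePlace E) :=
          pow_le_pow_of_le_one (by norm_num) (by norm_num) card_places
      _ = ∏ w : InfinitePlace E, (1/2 : ℝ) := by simp
      _ ≤ _ := Finset.prod_le_prod (fun _ _ => by norm_num) fun w _ => h1 w
  calc (1/4 : ℝ) ^ d * v1 E = volume.real (Metric.ball z (1/2)) * (1/2) ^ d := by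
        rw [hv]
        have : (1/4 : ℝ) = 1/2 * (1/2) := by norm_num
        rw [this, mul_pow]; ring
    _ = ∫ x in Metric.ball z (1/2), (1/2 : ℝ) ^ d := by rw [setIntegral_const, smul_eq_mul]
    _ ≤ ∫ x in Metric.ball z (1/2), Ph E x :=
        setIntegral_mono_on (integrableOn_const measure_ball_lt_top.ne) Ph_int.integrableOn measurableSet_ball hb
    _ ≤ ∫ x, Ph E x := setIntegral_le_integral Ph_int (Eventually.of_forall Ph_nonneg)

end geom
end Mert

open NumberField Finset Filter Topology MeasureTheory
namespace Mert
open NumberField.mixedEmbedding NumberField.InfinitePlace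

theorem lattice_index {V : Type*} [NormedAddCommGroup V] [NormedSpace ℝ V] [MeasurableSpace V] [BorelSpace V]
    {ι : Type*} [Fintype ι] (μ : Measure V) [μ.IsAddHaarMeasure] (b b₀ : Module.Basis ι ℝ V)
    {G : Type*} [AddCommGroup G] (e : G →+ V) (he : Function.Injective e) (Λ : AddSubgroup G)
    (hb : Λ.map e = (Submodule.span ℤ (Set.range b)).toAddSubgroup)
    (hb₀ : (⊤ : AddSubgroup G).map e = (Submodule.span ℤ (Set.range b₀)).toAddSubgroup) :
    Λ.index ≠ 0 ∧ μ.real (ZSpan.fundamentalDomain b) / Λ.index = μ.real (ZSpan.fundamentalDomain b₀) := by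
  classical
  have hle : (Submodule.span ℤ (Set.range b)).toAddSubgroup ≤ (Submodule.span ℤ (Set.range b₀)).toAddSubgroup := by
    rw [← hb, ← hb₀]; exact AddSubgroup.map_mono le_top
  have h1 : Λ.index = (Submodule.span ℤ (Set.range b)).toAddSubgroup.relIndex
      (Submodule.span ℤ (Set.range b₀)).toAddSubgroup := by
    rw [← hb, ← hb₀, AddSubgroup.relIndex_map_map_of_injective _ _ he, AddSubgroup.relIndex_top_right]
  have h2 : (Submodule.span ℤ (Set.range b)).toAddSubgroup.relIndex (Submodule.span ℤ (Set.range b₀)).toAddSubgroup =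
      ((b₀.restrictScalars ℤ).det fun j =>
        (⟨b j, hle (Submodule.subset_span ⟨j, rfl⟩)⟩ : Submodule.span ℤ (Set.range b₀))).natAbs := by
    have h := AddSubgroup.relIndex_eq_natAbs_det _ _ hle (b.restrictScalars ℤ) (b₀.restrictScalars ℤ)
    rw [h]
    change ((b₀.restrictScalars ℤ).det _).natAbs = _
    congr 2
    funext j
    exact Subtype.ext (Module.Basis.restrictScalars_apply ℤ b j)
  have h3 : ((Λ.index : ℕ) : ℝ) = |b₀.det b| := by
    rw [h1, h2, Nat.cast_natAbs, Int.cast_abs, Module.Basis.det_apply, Module.Basis.det_apply, Int.cast_det]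
    congr 2
    ext i j
    have := Module.Basis.restrictScalars_repr_apply ℤ b₀ ⟨b j, hle (Submodule.subset_span ⟨j, rfl⟩)⟩ i
    simp only [Module.Basis.toMatrix_apply, Matrix.map_apply]
    rw [← this]
    simp only [algebraMap_int_eq, eq_intCast]
  have h4 : |b₀.det b| ≠ 0 := abs_ne_zero.2 (Module.Basis.isUnit_det b₀ b).ne_zero
  have h5 : (Λ.index : ℝ) ≠ 0 := by rw [h3]; exact h4
  refine ⟨by exact_mod_cast h5, ?_⟩
  rw [ZSpan.measureReal_fundamentalDomain b μ b₀, h3]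
  field_simp

section geom
open scoped Classical
variable {E : Type*} [Field E] [NumberField E]

theorem pow_span (θ : 𝓞 E) (hθ : IntermediateField.adjoin ℚ {(θ : E)} = ⊤) :
    Submodule.span ℚ (Set.range fun i : Fin (Module.finrank ℚ E) => (θ : E) ^ (i : ℕ)) = ⊤ := by
  have hi : IsIntegral ℚ (θ : E) := Algebra.IsIntegral.isIntegral _
  have h1 := Submodule.span_range_natDegree_eq_adjoin (minpoly.monic hi) (minpoly.aeval ℚ (θ:E))
  have h2 : (minpoly ℚ (θ:E)).natDegree = Module.finrank ℚ E := by
    rw [← IntermediateField.adjoin.finrank hi, hθ, IntermediateField.finrank_top']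
  have h3 : Algebra.adjoin ℚ {(θ:E)} = ⊤ := by
    rw [← IntermediateField.adjoin_simple_toSubalgebra_of_isAlgebraic hi.isAlgebraic, hθ]; rfl
  rw [h3, Algebra.top_toSubmodule] at h1
  rw [eq_top_iff, ← h1]
  apply Submodule.span_mono
  intro x hx
  simp only [Finset.coe_image, Set.mem_image, Finset.mem_coe, Finset.mem_range] at hx
  obtain ⟨i, hi, rfl⟩ := hx
  exact ⟨⟨i, h2 ▸ hi⟩, rfl⟩

theorem exists_basis (θ : 𝓞 E) (hθ : IntermediateField.adjoin ℚ {(θ : E)} = ⊤) (a : E) (ha : a ≠ 0) :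
    ∃ b : Module.Basis (Fin (Module.finrank ℚ E)) ℝ (mixedSpace E),
      ∀ i, b i = mixedEmbedding E (a * (θ:E) ^ (i:ℕ)) := by
  let v : Fin (Module.finrank ℚ E) → mixedSpace E := fun i => mixedEmbedding E (a * (θ:E) ^ (i:ℕ))
  let φ : E →ₗ[ℚ] mixedSpace E := (mixedEmbedding E).toAddMonoidHom.toRatLinearMap
  have h1 : ∀ x : E, mixedEmbedding E x ∈ Submodule.span ℝ (Set.range v) := by
    let W : Submodule ℚ E := (((Submodule.span ℝ (Set.range v)).restrictScalars ℚ).comap φ).comap (LinearMap.mulLeft ℚ a)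
    have hW : W = ⊤ := by
      rw [eq_top_iff, ← pow_span θ hθ, Submodule.span_le]
      rintro _ ⟨i, rfl⟩
      exact Submodule.subset_span ⟨i, rfl⟩
    intro x
    have : a⁻¹ * x ∈ W := by rw [hW]; trivial
    have h2 : mixedEmbedding E (a * (a⁻¹ * x)) ∈ Submodule.span ℝ (Set.range v) := this
    rwa [mul_inv_cancel_left₀ ha] at h2
  have h2 : ⊤ ≤ Submodule.span ℝ (Set.range v) := by
    rw [← (latticeBasis E).span_eq, Submodule.span_le]
    rintro _ ⟨i, rfl⟩
    rw [latticeBasis_apply]; exact h1 _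
  exact ⟨basisOfTopLeSpanOfCardEqFinrank v h2 (by rw [Fintype.card_fin, mixedEmbedding.finrank]),
    fun i => by simp [v]⟩

end geom
end Mert

open NumberField Finset Filter Topology MeasureTheory
namespace Mert
open NumberField.mixedEmbedding NumberField.InfinitePlace
open scoped nonZeroDivisors

section geom
open scoped Classical
variable {E : Type*} [Field E] [NumberField E]

/-- embedding of an ideal into the mixed space -/
noncomputable def eJ (J : Ideal (𝓞 E)) : J →+ mixedSpace E :=
  ((mixedEmbedding E).comp (algebraMap (𝓞 E) E)).toAddMonoidHom.comp J.toAddSubgroup.subtype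

theorem eJ_apply (J : Ideal (𝓞 E)) (x : J) : eJ J x = mixedEmbedding E ((x : 𝓞 E) : E) := rfl

theorem eJ_inj (J : Ideal (𝓞 E)) : Function.Injective (eJ J) := by
  intro x y h
  rw [eJ_apply, eJ_apply] at h
  exact Subtype.ext (RingOfIntegers.ext (mixedEmbedding_injective E h))

/-- covolume of an ideal -/
noncomputable def cv (J : Ideal (𝓞 E)) : ℝ :=
  Ideal.absNorm J * volume.real (ZSpan.fundamentalDomain (latticeBasis E))

noncomputable def cv0 (E : Type*) [Field E] [NumberField E] : ℝ :=
  volume.real (ZSpan.fundamentalDomain (latticeBasis E))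

theorem cv_eq (J : Ideal (𝓞 E)) : cv J = Ideal.absNorm J * cv0 E := rfl

theorem cv_frac (J : Ideal (𝓞 E)) (hJ : J ≠ ⊥) :
    volume.real (ZSpan.fundamentalDomain (fractionalIdealLatticeBasis E
      (FractionalIdeal.mk0 E ⟨J, mem_nonZeroDivisors_iff_ne_zero.2 hJ⟩))) = cv J := by
  rw [Measure.real, volume_fundamentalDomain_fractionalIdealLatticeBasis, ENNReal.toReal_mul, cv, Measure.real,
    ENNReal.toReal_ofReal (by exact_mod_cast FractionalIdeal.absNorm_nonneg _)]
  simp [FractionalIdeal.coeIdeal_absNorm]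

theorem cv0_eq : cv0 E = 2⁻¹ ^ nrComplexPlaces E * Real.sqrt |(discr E : ℝ)| := by
  rw [cv0, Measure.real, volume_fundamentalDomain_latticeBasis, ENNReal.toReal_mul]
  simp [Real.coe_sqrt, Int.norm_eq_abs]

theorem cv0_pos : 0 < cv0 E := by
  rw [cv0_eq]
  have : (discr E : ℝ) ≠ 0 := by exact_mod_cast discr_ne_zero E
  positivity

theorem cv0_le {X : ℝ} (hX : |(discr E : ℝ)| ≤ X) (hX1 : 1 ≤ X) : cv0 E ≤ X := by
  rw [cv0_eq]
  have h1 : (2⁻¹ : ℝ) ^ nrComplexPlaces E ≤ 1 := pow_le_one₀ (by norm_num) (by norm_num)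
  have h2 : Real.sqrt |(discr E : ℝ)| ≤ X := by
    rw [Real.sqrt_le_left (by linarith)]; nlinarith
  calc _ ≤ 1 * X := by gcongr
    _ = X := one_mul _

theorem map_top (J : Ideal (𝓞 E)) (hJ : J ≠ ⊥) :
    (⊤ : AddSubgroup J).map (eJ J) = (Submodule.span ℤ (Set.range (fractionalIdealLatticeBasis E
      (FractionalIdeal.mk0 E ⟨J, mem_nonZeroDivisors_iff_ne_zero.2 hJ⟩)))).toAddSubgroup := by
  ext x
  rw [Submodule.mem_toAddSubgroup, mem_span_fractionalIdealLatticeBasis]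
  simp only [AddSubgroup.mem_map, AddSubgroup.mem_top, true_and, Set.mem_image, SetLike.mem_coe]
  constructor
  · rintro ⟨y, rfl⟩
    exact ⟨_, FractionalIdeal.mem_coeIdeal_of_mem _ y.2, rfl⟩
  · rintro ⟨y, hy, rfl⟩
    rw [FractionalIdeal.coe_mk0, FractionalIdeal.mem_coeIdeal] at hy
    obtain ⟨z, hz, rfl⟩ := hy
    exact ⟨⟨z, hz⟩, rfl⟩

/-- multiples of `q` in the additive group `J` -/
noncomputable def mulQ (J : Ideal (𝓞 E)) (q : ℕ) : AddSubgroup J := (nsmulAddMonoidHom (α := J) q).range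

theorem lat1 (J : Ideal (𝓞 E)) (hJ : J ≠ ⊥) (q : ℕ) (hq : 0 < q) (f : J → ℂ)
    (hf : ∀ x, ∀ n ∈ mulQ J q, f (x + n) = f x) (hf1 : ∀ x, ‖f x‖ ≤ 1)
    (s : InfinitePlace E → ℝ) (hs : ∀ w, 0 < s w) (a : 𝓞 E) (haJ : a ∈ J) (ha0 : a ≠ 0) {κ : ℝ} 
    (haκ : ∀ w : InfinitePlace E, w (a : E) ≤ κ * s w) (θ : 𝓞 E)
    (hθ : IntermediateField.adjoin ℚ {(θ : E)} = ⊤) {B : ℝ} (hB : 1 ≤ B) (hθB : ∀ w : InfinitePlace E, w (θ : E) ≤ B)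
    {η : ℝ} (hη : η = Module.finrank ℚ E * (q * κ * B ^ Module.finrank ℚ E)) :
    (Function.support fun x : J => Ph E (sc E s⁻¹ (eJ J x))).Finite ∧
    ‖(cv J : ℂ) * ∑' x : J, f x * Ph E (sc E s⁻¹ (eJ J x))
      - avg (mulQ J q) f * (((∏ w, s w ^ w.mult) * ∫ x, Ph E x : ℝ))‖ ≤
      Module.finrank ℚ E * η * ((∏ w, s w ^ w.mult) * ((3 + η) ^ Module.finrank ℚ E * v1 E)) := by
  set d := Module.finrank ℚ E with hd
  have hs' : ∀ w, 0 < (s⁻¹ : InfinitePlace E → ℝ) w := fun w => inv_pos.2 (hs w)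
  have hκ : 0 ≤ κ := by
    obtain ⟨w⟩ : Nonempty (InfinitePlace E) := inferInstance
    have := (apply_nonneg w (a:E)).trans (haκ w)
    exact nonneg_of_mul_nonneg_left this (hs w)
  have hη0 : 0 ≤ η := by rw [hη]; positivity
  obtain ⟨b, hb⟩ := exists_basis θ hθ ((q:E) * a) (by
    have : (a:E) ≠ 0 := RingOfIntegers.coe_ne_zero_iff.2 ha0
    exact mul_ne_zero (by exact_mod_cast hq.ne') this)
  let g : Fin d → J := fun i => q • (⟨a * θ ^ (i:ℕ), J.mul_mem_right _ haJ⟩ : J)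
  have hg : ∀ i, eJ J (g i) = b i := by
    intro i
    rw [hb, eJ_apply]
    congr 1
    simp [g, mul_assoc]
  let Λ : AddSubgroup J := AddSubgroup.closure (Set.range g)
  have hmap : Λ.map (eJ J) = (Submodule.span ℤ (Set.range b)).toAddSubgroup := by
    rw [Submodule.span_int_eq_addSubgroupClosure, AddMonoidHom.map_closure, ← Set.range_comp]
    congr 2
    funext i; exact hg i
  have hΛN : Λ ≤ mulQ J q := by
    rw [AddSubgroup.closure_le]
    rintro _ ⟨i, rfl⟩
    exact ⟨_, rfl⟩
  obtain ⟨e, -⟩ : ∃ e : Fin d ≃ Module.Free.ChooseBasisIndex ℤ (FractionalIdeal.mk0 E ⟨J, mem_nonZeroDivisors_iff_ne_zero.2 hJ⟩ : FractionalIdeal (𝓞 E)⁰ E), True :=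
    ⟨Fintype.equivOfCardEq (by
      rw [Fintype.card_fin, ← Module.finrank_eq_card_chooseBasisIndex, fractionalIdeal_rank, RingOfIntegers.rank]), trivial⟩
  set b₀ := (fractionalIdealLatticeBasis E (FractionalIdeal.mk0 E ⟨J, mem_nonZeroDivisors_iff_ne_zero.2 hJ⟩)).reindex e.symm with hb₀
  have hcv : volume.real (ZSpan.fundamentalDomain b₀) = cv J := by
    rw [hb₀, ZSpan.fundamentalDomain_reindex, cv_frac J hJ]
  have htop : (⊤ : AddSubgroup J).map (eJ J) = (Submodule.span ℤ (Set.range b₀)).toAddSubgroup := by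
    rw [map_top J hJ, hb₀, Module.Basis.range_reindex]
  obtain ⟨h1, h2⟩ := lattice_index volume b b₀ (eJ J) (eJ_inj J) Λ hmap htop
  have hP : ∀ p ∈ ZSpan.fundamentalDomain b, ‖sc E s⁻¹ p‖ ≤ η := by
    intro p hp
    apply norm_le_of_np
    intro w
    rw [np_sc hs', Pi.inv_apply]
    have h3 : normAtPlace w p ≤ ∑ i : Fin d, (q * κ * B ^ d) * s w := by
      have hsum : ∀ (S : Finset (Fin d)), normAtPlace w (∑ i ∈ S, b.repr p i • b i) ≤ ∑ i ∈ S, normAtPlace w (b.repr p i • b i) := by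
        intro S
        refine Finset.le_sum_of_subadditive (normAtPlace w) (map_zero _).le (normAtPlace_add_le w) _ _
      calc normAtPlace w p = normAtPlace w (∑ i, b.repr p i • b i) := by rw [b.sum_repr]
        _ ≤ _ := hsum _
        _ ≤ _ := by
          apply Finset.sum_le_sum
          intro i _
          rw [normAtPlace_smul, hb, normAtPlace_apply]
          have h4 := hp i
          rw [abs_of_nonneg h4.1]
          have h5 : w ((q:E) * a * (θ:E)^(i:ℕ)) ≤ q * κ * B^d * s w := by
            have hwq : w (q:E) = q := by
              rw [← norm_embedding_eq, map_natCast, Complex.norm_natCast]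
            rw [map_mul, map_mul, map_pow, hwq]
            have h6 : w (θ:E) ^ (i:ℕ) ≤ B ^ d :=
              (pow_le_pow_left₀ (apply_nonneg w _) (hθB w) _).trans (pow_le_pow_right₀ hB i.2.le)
            have h7 := haκ w
            have h8 := apply_nonneg w (a:E)
            have h9 := hs w
            calc (q:ℝ) * w (a:E) * w (θ:E) ^ (i:ℕ) ≤ (q:ℝ) * (κ * s w) * B ^ d := by
                  apply mul_le_mul (mul_le_mul_of_nonneg_left h7 (by positivity)) h6 (by positivity) (by positivity)
              _ = _ := by ring
          calc _ ≤ 1 * w ((q:E) * a * (θ:E)^(i:ℕ)) := by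
                exact mul_le_mul_of_nonneg_right h4.2.le (apply_nonneg w _)
            _ ≤ _ := by rw [one_mul]; exact h5
    rw [Finset.sum_const, Finset.card_univ, Fintype.card_fin, nsmul_eq_mul] at h3
    rw [inv_mul_le_iff₀ (hs w), hη]
    linarith
  have hcont : Continuous (sc E s⁻¹) := LinearMap.continuous_of_finiteDimensional _
  obtain ⟨hS1, hS2⟩ := vol_sc (E := E) hs' (r := 3 + η) (by linarith)
  obtain ⟨C, hC⟩ : ∃ C : ℝ, ∀ w, s w ≤ C := by
    obtain ⟨C, hC⟩ := (Set.finite_range s).bddAbove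
    exact ⟨C, fun w => hC ⟨w, rfl⟩⟩
  have key := avg_tile volume b (fun x => Ph E (sc E s⁻¹ x)) (Ph_cont.comp hcont) (R := C * 3) (by
      intro x hx
      apply Ph_zero
      by_contra hcon
      push Not at hcon
      apply absurd hx; push Not
      apply norm_le_of_np
      intro w
      have h3 := (np_le_norm w (sc E s⁻¹ x)).trans hcon
      rw [np_sc hs', Pi.inv_apply, inv_mul_le_iff₀ (hs w)] at h3
      exact h3.trans (by have := hC w; gcongr))
    (S := {x : mixedSpace E | ‖sc E s⁻¹ x‖ ≤ 3 + η}) (measurableSet_le hcont.norm.measurable measurable_const) hS1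
    (ε := d * η) (by
      intro x p hp
      have hp' := hP p hp
      by_cases hx : x + p ∈ {x : mixedSpace E | ‖sc E s⁻¹ x‖ ≤ 3 + η}
      · rw [Set.indicator_of_mem hx, Pi.one_apply, mul_one]
        refine (Ph_lip _ _).trans ?_
        rw [map_add, add_sub_cancel_left]
        gcongr
      · rw [Set.indicator_of_notMem hx]
        have h3 : 3 + η < ‖sc E s⁻¹ (x + p)‖ := not_le.1 hx
        have h4 : 3 < ‖sc E s⁻¹ x‖ := by
          rw [map_add] at h3
          linarith [norm_add_le (sc E s⁻¹ x) (sc E s⁻¹ p)]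
        rw [Ph_zero (by linarith), Ph_zero h4]; simp)
    (eJ J) (eJ_inj J) Λ (mulQ J q) hΛN h1 hmap f hf hf1
  refine ⟨key.1, ?_⟩
  have h9 := key.2
  rw [h2, hcv, hS2, integral_sc hs' Ph_cont] at h9
  have h10 : (∏ w, (s⁻¹ : InfinitePlace E → ℝ) w ^ w.mult)⁻¹ = ∏ w, s w ^ w.mult := by
    rw [← Finset.prod_inv_distrib]; simp
  rw [h10] at h9
  exact h9

end geom
end Mert

open NumberField Finset Filter Topology MeasureTheory
namespace Mert
open NumberField.mixedEmbedding NumberField.InfinitePlace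
open scoped nonZeroDivisors

section geom
open scoped Classical
variable {E : Type*} [Field E] [NumberField E]

theorem mink_eq (I : (FractionalIdeal (𝓞 E)⁰ E)ˣ) :
    minkowskiBound E I = ENNReal.ofReal (volume.real (ZSpan.fundamentalDomain (fractionalIdealLatticeBasis E I)) *
      2 ^ Module.finrank ℚ E) := by
  have hfin : volume (ZSpan.fundamentalDomain (fractionalIdealLatticeBasis E I)) ≠ ⊤ := by
    have := minkowskiBound_lt_top E I
    rw [minkowskiBound] at this
    intro h
    rw [h, ENNReal.top_mul (by simp)] at this
    exact absurd this (by simp)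
  rw [minkowskiBound, mixedEmbedding.finrank, ENNReal.ofReal_mul measureReal_nonneg, ofReal_measureReal hfin]
  simp [ENNReal.ofReal_pow]

theorem exists_theta {X : ℝ} (hX : 2 ≤ X) (hD : |(discr E : ℝ)| ≤ X) :
    ∃ θ : 𝓞 E, IntermediateField.adjoin ℚ {(θ : E)} = ⊤ ∧ ∀ w : InfinitePlace E, w (θ : E) ≤ X ^ (Module.finrank ℚ E + 3) := by
  set d := Module.finrank ℚ E
  have h1 : volume.real (ZSpan.fundamentalDomain (fractionalIdealLatticeBasis E (1 : (FractionalIdeal (𝓞 E)⁰ E)ˣ))) ≤ X := by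
    rw [Measure.real, volume_fundamentalDomain_fractionalIdealLatticeBasis]
    simp only [Units.val_one, map_one, Rat.cast_one, ENNReal.ofReal_one, one_mul]
    exact cv0_le hD (by linarith)
  let B : NNReal := ⟨X * 2 ^ d + 1, by positivity⟩
  have hBX : (B : ℝ) + 1 ≤ X ^ (d + 3) := by
    change X * 2 ^ d + 1 + 1 ≤ _
    have h2 : (2:ℝ) ^ d ≤ X ^ d := pow_le_pow_left₀ (by norm_num) hX d
    have h3 : (1:ℝ) ≤ X ^ d := one_le_pow₀ (by linarith)
    calc X * 2 ^ d + 1 + 1 ≤ X * X ^ d + X * X ^ d := by nlinarith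
      _ ≤ X ^ 3 * X ^ d := by nlinarith [pow_pos (show 0 < X by linarith) d, mul_pos (show 0 < X by linarith) (pow_pos (show 0 < X by linarith) d), mul_self_nonneg X, mul_nonneg (show (0:ℝ) ≤ X^2 - 2 by nlinarith) (mul_pos (show 0 < X by linarith) (pow_pos (show 0 < X by linarith) d)).le]
      _ = _ := by rw [pow_add, mul_comm]
  have hlt : minkowskiBound E ↑(1 : (FractionalIdeal (𝓞 E)⁰ E)ˣ) < (B : ENNReal) := by
    rw [mink_eq, ← ENNReal.ofReal_coe_nnreal]
    apply (ENNReal.ofReal_lt_ofReal_iff (by change 0 < X * 2 ^ d + 1; positivity)).2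
    change _ < X * 2 ^ d + 1
    have : volume.real (ZSpan.fundamentalDomain (fractionalIdealLatticeBasis E (1 : (FractionalIdeal (𝓞 E)⁰ E)ˣ))) * 2 ^ d ≤ X * 2 ^ d := by gcongr
    linarith
  obtain ⟨w₀⟩ : Nonempty (InfinitePlace E) := inferInstance
  rcases isReal_or_isComplex w₀ with hw | hw
  · obtain ⟨θ, h2, h3⟩ := exists_primitive_element_lt_of_isReal E hw (B := B) (hlt.trans_le (by
      calc (B:ENNReal) = 1 * B := (one_mul _).symm
        _ ≤ _ := by gcongr; exact_mod_cast one_le_convexBodyLTFactor E))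
    refine ⟨θ, h2, fun w => (h3 w).le.trans (le_trans ?_ hBX)⟩
    push_cast
    have := B.2
    exact max_le (by linarith) (by linarith)
  · obtain ⟨θ, h2, h3⟩ := exists_primitive_element_lt_of_isComplex E hw (B := B) (hlt.trans_le (by
      calc (B:ENNReal) = 1 * B := (one_mul _).symm
        _ ≤ _ := by gcongr; exact_mod_cast one_le_convexBodyLT'Factor E))
    refine ⟨θ, h2, fun w => (h3 w).le.trans (le_trans ?_ hBX)⟩
    have := B.2
    rw [Real.sqrt_le_left (by linarith)]
    nlinarith

theorem exists_alpha {X : ℝ} (hX : 2 ≤ X) (hD : |(discr E : ℝ)| ≤ X) (J : Ideal (𝓞 E)) (hJ : J ≠ ⊥)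
    (hJX : (Ideal.absNorm J : ℝ) ≤ X) (s : InfinitePlace E → ℝ) (hs : ∀ w, 0 < s w) {Y : ℝ}
    (hY : ∏ w, s w ^ w.mult = Real.exp Y) :
    ∃ a ∈ J, a ≠ 0 ∧ ∀ w : InfinitePlace E, w (a : E) ≤ (X ^ 4 * Real.exp (-Y / Module.finrank ℚ E)) * s w := by
  set d := Module.finrank ℚ E with hd
  have hd0 : 0 < d := Module.finrank_pos
  let f : InfinitePlace E → NNReal := fun w => ⟨(X ^ 4 * Real.exp (-Y / d)) * s w, by have := hs w; positivity⟩
  obtain ⟨P, hP⟩ : ∃ P : NNReal, (P:ℝ) = X ^ (4 * d) := ⟨⟨X ^ (4 * d), by positivity⟩, rfl⟩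
  have hprod : ∏ w, f w ^ w.mult = P := by
    apply NNReal.eq
    rw [hP]
    push_cast
    change ∏ w, ((X ^ 4 * Real.exp (-Y / d)) * s w) ^ w.mult = X ^ (4 * d)
    simp_rw [mul_pow]
    rw [Finset.prod_mul_distrib, Finset.prod_mul_distrib, hY, Finset.prod_pow_eq_pow_sum, Finset.prod_pow_eq_pow_sum,
      sum_mult_eq, ← hd, ← Real.exp_nat_mul, mul_assoc, ← Real.exp_add, ← pow_mul]
    have : (d:ℝ) * (-Y / d) + Y = 0 := by field_simp; ring
    rw [this, Real.exp_zero, mul_one]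
  have hlt : minkowskiBound E (FractionalIdeal.mk0 E ⟨J, mem_nonZeroDivisors_iff_ne_zero.2 hJ⟩) < volume (convexBodyLT E f) := by
    have h1 : minkowskiBound E (FractionalIdeal.mk0 E ⟨J, mem_nonZeroDivisors_iff_ne_zero.2 hJ⟩) < (P : ENNReal) := by
      rw [mink_eq, ← ENNReal.ofReal_coe_nnreal]
      apply (ENNReal.ofReal_lt_ofReal_iff (by rw [hP]; positivity)).2
      rw [hP]
      rw [cv_frac J hJ, cv_eq, ← hd]
      have h2 := cv0_le hD (by linarith)
      have h3 : (2:ℝ) ^ d ≤ X ^ d := pow_le_pow_left₀ (by norm_num) hX d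
      have h4 := cv0_pos (E := E)
      calc (Ideal.absNorm J : ℝ) * cv0 E * 2 ^ d ≤ X * X * X ^ d := by gcongr
        _ = X ^ (d + 2) := by ring
        _ < X ^ (4 * d) := pow_lt_pow_right₀ (by linarith) (by omega)
    refine h1.trans_le ?_
    rw [convexBodyLT_volume]
    rw [hprod]
    calc _ = 1 * (P : ENNReal) := (one_mul _).symm
      _ ≤ _ := by gcongr; exact_mod_cast one_le_convexBodyLTFactor E
  obtain ⟨a, ha, ha0, haw⟩ := exists_ne_zero_mem_ideal_lt E _ hlt
  rw [FractionalIdeal.coe_mk0, FractionalIdeal.mem_coeIdeal] at ha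
  obtain ⟨z, hz, rfl⟩ := ha
  exact ⟨z, hz, by rintro rfl; simp at ha0, fun w => (haw w).le⟩

theorem lat2 (d : ℕ) : ∃ A : ℕ, ∀ {E : Type*} [Field E] [NumberField E] (_ : Module.finrank ℚ E = d) {X : ℝ} (_ : 2 ≤ X)
    (_ : |(discr E : ℝ)| ≤ X) (J : Ideal (𝓞 E)) (_ : J ≠ ⊥) (_ : (Ideal.absNorm J : ℝ) ≤ X)
    (q : ℕ) (_ : 0 < q) (_ : (q:ℝ) ≤ X ^ 2) (f : J → ℂ)
    (_ : ∀ x, ∀ n ∈ mulQ J q, f (x + n) = f x) (_ : ∀ x, ‖f x‖ ≤ 1)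
    (s : InfinitePlace E → ℝ) (_ : ∀ w, 0 < s w) (Y : ℝ) (_ : ∏ w, s w ^ w.mult = Real.exp Y) (_ : -(d * Real.log 3) ≤ Y),
    (Function.support fun x : J => Ph E (sc E s⁻¹ (eJ J x))).Finite ∧
    ‖(cv J : ℂ) * ∑' x : J, f x * Ph E (sc E s⁻¹ (eJ J x))
      - avg (mulQ J q) f * ((Real.exp Y * ∫ x, Ph E x : ℝ))‖ ≤
      X ^ A * Real.exp ((1 - 1 / d) * Y) * ∫ x, Ph E x := by
  set A1 : ℕ := d + 2 + 4 + (d + 3) * d with hA1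
  refine ⟨d + A1 + (A1 + 3) * d + 2 * d, ?_⟩
  intro E _ _ hdE X hX hD J hJ hJX q hq hqX f hf hf1 s hs Y hY hY3
  obtain ⟨θ, hθ, hθB⟩ := exists_theta (E := E) hX hD
  obtain ⟨a, haJ, ha0, haκ⟩ := exists_alpha hX hD J hJ hJX s hs hY
  have hd0 : 0 < d := hdE ▸ Module.finrank_pos
  have hX0 : 0 < X := by linarith
  have hX1 : 1 ≤ X := by linarith
  obtain ⟨h1, h2⟩ := lat1 J hJ q hq f hf hf1 s hs a haJ ha0 haκ θ hθ (one_le_pow₀ hX1) hθB rfl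
  rw [hdE] at h2 hθB haκ
  refine ⟨h1, ?_⟩
  rw [hY] at h2
  refine h2.trans ?_
  set τ := Real.exp (-Y / d) with hτ
  have hτ0 : 0 < τ := Real.exp_pos _
  have hτ3 : τ ≤ 3 := by
    rw [hτ, ← Real.le_log_iff_exp_le (by norm_num), div_le_iff₀ (by positivity)]
    linarith
  set η := (d:ℝ) * (q * (X ^ 4 * τ) * (X ^ (d + 3)) ^ d) with hη
  have hdX : (d:ℝ) ≤ X ^ d := by
    have : (d:ℝ) ≤ 2 ^ d := by exact_mod_cast Nat.lt_two_pow_self.le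
    exact this.trans (pow_le_pow_left₀ (by norm_num) hX d)
  have hη0 : 0 ≤ η := by positivity
  have hη1 : η ≤ X ^ A1 * τ := by
    calc η ≤ X ^ d * (X ^ 2 * (X ^ 4 * τ) * (X ^ (d + 3)) ^ d) := by rw [hη]; gcongr
      _ = _ := by rw [hA1, ← pow_mul]; ring
  have hη2 : 3 + η ≤ X ^ (A1 + 3) := by
    have h3 : X ^ A1 * τ ≤ X ^ A1 * 3 := by gcongr
    have h4 : (1:ℝ) ≤ X ^ A1 := one_le_pow₀ hX1
    have h5 : (8:ℝ) ≤ X ^ 3 := by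
      calc (8:ℝ) = 2 ^ 3 := by norm_num
        _ ≤ X ^ 3 := by gcongr
    rw [pow_add]
    nlinarith
  have hv : v1 E ≤ X ^ (2 * d) * ∫ x, Ph E x := by
    have h3 := Ph_lower (E := E)
    rw [hdE] at h3
    have h4 : v1 E ≤ 4 ^ d * ∫ x, Ph E x := by
      calc v1 E = 4 ^ d * ((1/4) ^ d * v1 E) := by rw [← mul_assoc, ← mul_pow]; norm_num
        _ ≤ _ := by gcongr
    refine h4.trans ?_
    gcongr
    · exact integral_nonneg Ph_nonneg
    · calc (4:ℝ) ^ d = 2 ^ (2 * d) := by rw [pow_mul]; norm_num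
        _ ≤ _ := by gcongr
  have hv0 := (v1_pos (E := E)).le
  have hexp : Real.exp ((1 - 1 / d) * Y) = τ * Real.exp Y := by
    rw [hτ, ← Real.exp_add]; congr 1; field_simp; ring
  calc (d:ℝ) * η * (Real.exp Y * ((3 + η) ^ d * v1 E))
      ≤ X ^ d * (X ^ A1 * τ) * (Real.exp Y * ((X ^ (A1 + 3)) ^ d * (X ^ (2 * d) * ∫ x, Ph E x))) := by gcongr
    _ = _ := by rw [hexp, ← pow_mul]; ring

end geom
end Mert

open NumberField Finset Filter Topology MeasureTheory
namespace Mert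
open NumberField.mixedEmbedding NumberField.InfinitePlace NumberField.Units NumberField.Units.dirichletUnitTheorem
open scoped nonZeroDivisors

section geom
open scoped Classical
variable (E : Type*) [Field E] [NumberField E]

/-- logarithmic coordinates -/
noncomputable def lY (Y : ℝ) (t : logSpace E) (w : InfinitePlace E) : ℝ :=
  Y / Module.finrank ℚ E + (if h : w = w₀ then -(∑ v, t v) else t ⟨w, h⟩) / w.mult

noncomputable def sY (Y : ℝ) (t : logSpace E) (w : InfinitePlace E) : ℝ := Real.exp (lY E Y t w)

noncomputable def Psi (z : ℝ) (t : logSpace E) : ℝ := ∏ w, bp (sY E z t w)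

noncomputable def h0 (z : ℝ) : ℝ := ∫ t, Psi E z t

variable {E}

theorem sY_pos (Y : ℝ) (t : logSpace E) (w : InfinitePlace E) : 0 < sY E Y t w := Real.exp_pos _

theorem lY_sub (Y Y' : ℝ) (t t' : logSpace E) (w : InfinitePlace E) :
    lY E (Y - Y') (t - t') w = lY E Y t w - lY E Y' t' w := by
  unfold lY
  split_ifs with h
  · simp only [Pi.sub_apply, Finset.sum_sub_distrib]; ring
  · simp only [Pi.sub_apply]; ring

theorem sum_split (g : InfinitePlace E → ℝ) : ∑ w, g w = g w₀ + ∑ v : {w : InfinitePlace E // w ≠ w₀}, g v := by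
  rw [← Finset.add_sum_erase _ _ (Finset.mem_univ w₀)]
  congr 1
  exact Finset.sum_subtype _ (by simp) _

theorem sum_lY (Y : ℝ) (t : logSpace E) : ∑ w : InfinitePlace E, w.mult * lY E Y t w = Y := by
  have hd : (0:ℝ) < Module.finrank ℚ E := by exact_mod_cast Module.finrank_pos
  have h1 : ∀ w : InfinitePlace E, w.mult * lY E Y t w = w.mult * (Y / Module.finrank ℚ E) +
      (if h : w = w₀ then -(∑ v, t v) else t ⟨w, h⟩) := by
    intro w
    have : (w.mult : ℝ) ≠ 0 := by exact_mod_cast w.mult_ne_zero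
    rw [lY, mul_add, mul_div_cancel₀ _ this]
  simp_rw [h1]
  rw [Finset.sum_add_distrib, ← Finset.sum_mul, sum_split (fun w => if h : w = w₀ then -(∑ v, t v) else t ⟨w, h⟩)]
  have h2 : ∑ v : {w : InfinitePlace E // w ≠ w₀}, (if h : (v:InfinitePlace E) = w₀ then -(∑ v, t v) else t ⟨v, h⟩) = ∑ v, t v :=
    Finset.sum_congr rfl fun v _ => by rw [dif_neg v.2]
  rw [h2, dif_pos rfl, ← Nat.cast_sum, sum_mult_eq]
  field_simp
  ring

theorem prod_sY (Y : ℝ) (t : logSpace E) : ∏ w : InfinitePlace E, sY E Y t w ^ w.mult = Real.exp Y := by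
  unfold sY
  simp_rw [← Real.exp_nat_mul]
  rw [← Real.exp_sum, sum_lY]

theorem np_eq (x : mixedSpace E) (hx : mixedEmbedding.norm x ≠ 0) (w : InfinitePlace E) :
    normAtPlace w x = sY E (Real.log (mixedEmbedding.norm x)) (logMap x) w := by
  have hd : (0:ℝ) < Module.finrank ℚ E := by exact_mod_cast Module.finrank_pos
  have hnp : ∀ w, 0 < normAtPlace w x := fun w =>
    lt_of_le_of_ne (normAtPlace_nonneg w x) (mixedEmbedding.norm_ne_zero_iff.mp hx w).symm
  rw [sY, ← Real.exp_log (hnp w)]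
  congr 1
  have key : ∀ v : {w : InfinitePlace E // w ≠ w₀}, Real.log (normAtPlace v.1 x) = lY E (Real.log (mixedEmbedding.norm x)) (logMap x) v := by
    intro v
    have : (v.1.mult : ℝ) ≠ 0 := by exact_mod_cast v.1.mult_ne_zero
    rw [lY, dif_neg v.2, logMap_apply]
    field_simp; ring
  by_cases h : w = w₀
  · subst h
    have h1 := sum_lY (Real.log (mixedEmbedding.norm x)) (logMap x)
    have h2 : ∑ w : InfinitePlace E, w.mult * Real.log (normAtPlace w x) = Real.log (mixedEmbedding.norm x) := by
      rw [mixedEmbedding.norm_apply, Real.log_prod (fun w _ => pow_ne_zero _ (hnp w).ne')]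
      simp
    rw [sum_split] at h1 h2
    have h3 : ∑ v : {w : InfinitePlace E // w ≠ w₀}, (v.1.mult : ℝ) * Real.log (normAtPlace v.1 x) = ∑ v : {w : InfinitePlace E // w ≠ w₀}, (v.1.mult : ℝ) * lY E (Real.log (mixedEmbedding.norm x)) (logMap x) v :=
      Finset.sum_congr rfl fun v _ => by rw [key v]
    have h4 : ((w₀ : InfinitePlace E).mult : ℝ) ≠ 0 := by exact_mod_cast mult_ne_zero
    rw [h3] at h2
    exact mul_left_cancel₀ h4 (by linarith)
  · exact key ⟨w, h⟩

theorem Ph_eq (x : mixedSpace E) (hx : mixedEmbedding.norm x ≠ 0) (Y : ℝ) (t : logSpace E) :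
    Ph E (sc E (sY E Y t)⁻¹ x) = Psi E (Real.log (mixedEmbedding.norm x) - Y) (logMap x - t) := by
  unfold Ph Psi
  refine Finset.prod_congr rfl fun w _ => ?_
  rw [np_sc (a := (sY E Y t)⁻¹) (fun w => inv_pos.2 (sY_pos Y t w)), np_eq x hx, Pi.inv_apply]
  unfold sY
  rw [lY_sub, Real.exp_sub, div_eq_inv_mul]

theorem Psi_nonneg (z : ℝ) (t : logSpace E) : 0 ≤ Psi E z t := Finset.prod_nonneg fun _ _ => bp_nonneg _

theorem Psi_le (z : ℝ) (t : logSpace E) : Psi E z t ≤ 1 :=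
  Finset.prod_le_one (fun _ _ => bp_nonneg _) fun _ _ => bp_le _

theorem lY_cont (w : InfinitePlace E) : Continuous fun p : ℝ × logSpace E => lY E p.1 p.2 w := by
  unfold lY
  split_ifs with h <;> fun_prop

theorem Psi_cont : Continuous fun p : ℝ × logSpace E => Psi E p.1 p.2 := by
  unfold Psi sY
  exact continuous_finset_prod _ fun w _ => bp_cont.comp (Real.continuous_exp.comp (lY_cont w))

theorem Psi_supp {z : ℝ} {t : logSpace E} (h : Psi E z t ≠ 0) :
    (0 ≤ z ∧ z ≤ Module.finrank ℚ E * Real.log 3) ∧ ‖t‖ ≤ 4 * Real.log 3 := by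
  have hd : (0:ℝ) < Module.finrank ℚ E := by exact_mod_cast Module.finrank_pos
  have h1 : ∀ w, 0 < lY E z t w ∧ lY E z t w < Real.log 3 := by
    intro w
    have h2 := bp_supp (Finset.prod_ne_zero_iff.1 h w (Finset.mem_univ w))
    unfold sY at h2
    refine ⟨by simpa using Real.one_lt_exp_iff.1 h2.1, ?_⟩
    rw [Real.lt_log_iff_exp_lt (by norm_num)]; exact h2.2
  have hz : 0 ≤ z ∧ z ≤ Module.finrank ℚ E * Real.log 3 := by
    rw [← sum_lY z t]
    constructor
    · exact Finset.sum_nonneg fun w _ => mul_nonneg (by positivity) (h1 w).1.le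
    · calc _ ≤ ∑ w : InfinitePlace E, (w.mult : ℝ) * Real.log 3 :=
            Finset.sum_le_sum fun w _ => mul_le_mul_of_nonneg_left (h1 w).2.le (by positivity)
        _ = _ := by rw [← Finset.sum_mul, ← Nat.cast_sum, sum_mult_eq]
  refine ⟨hz, ?_⟩
  have hl3 : 0 < Real.log 3 := Real.log_pos (by norm_num)
  rw [pi_norm_le_iff_of_nonneg (by positivity)]
  intro v
  have h2 := h1 v
  rw [lY, dif_neg v.2] at h2
  have h3 : z / Module.finrank ℚ E ≤ Real.log 3 := by rw [div_le_iff₀ hd]; linarith [hz.2]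
  have h4 : 0 ≤ z / Module.finrank ℚ E := div_nonneg hz.1 hd.le
  have hm : (0:ℝ) < v.1.mult := by exact_mod_cast v.1.mult_pos
  have hm2 : (v.1.mult : ℝ) ≤ 2 := by
    have : v.1.mult ≤ 2 := by rw [mult]; split_ifs <;> norm_num
    exact_mod_cast this
  have h5 : |t v / v.1.mult| ≤ 2 * Real.log 3 := by
    rw [abs_le]; constructor <;> linarith
  rw [abs_div, abs_of_pos hm, div_le_iff₀ hm] at h5
  rw [Real.norm_eq_abs]
  nlinarith

theorem h0_eq (z : ℝ) : h0 E z = ∫ t in Metric.closedBall (0 : logSpace E) (4 * Real.log 3), Psi E z t := by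
  rw [h0, ← setIntegral_eq_integral_of_forall_compl_eq_zero]
  intro t ht
  by_contra h
  exact ht (by simpa using (Psi_supp h).2)

theorem h0_cont : Continuous (h0 E) := by
  have : h0 E = fun z => ∫ t in Metric.closedBall (0 : logSpace E) (4 * Real.log 3), Psi E z t := funext h0_eq
  rw [this]
  exact continuous_parametric_integral_of_continuous Psi_cont (isCompact_closedBall _ _)

theorem Psi_cs (z : ℝ) : HasCompactSupport (Psi E z) :=
  HasCompactSupport.intro (isCompact_closedBall (0 : logSpace E) (4 * Real.log 3)) fun t ht => by
    by_contra h
    exact ht (by simpa using (Psi_supp h).2)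

theorem Psi_cont' (z : ℝ) : Continuous (Psi E z) := by
  have h : Continuous fun t : logSpace E => (z, t) := Continuous.prodMk continuous_const continuous_id
  have h2 := Psi_cont.comp h
  simp only [Function.comp_def] at h2
  exact h2

theorem Psi_int (z : ℝ) : Integrable (Psi E z) := (Psi_cont' z).integrable_of_hasCompactSupport (Psi_cs z)

theorem h0_nonneg (z : ℝ) : 0 ≤ h0 E z := integral_nonneg fun _ => Psi_nonneg _ _

theorem h0_supp {z : ℝ} (h : h0 E z ≠ 0) : 0 ≤ z ∧ z ≤ Module.finrank ℚ E * Real.log 3 := by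
  by_contra hcon
  apply h
  rw [h0]
  apply integral_eq_zero_of_ae
  filter_upwards with t
  by_contra ht
  exact hcon (Psi_supp ht).1

theorem h0_pos : 0 < h0 E (Module.finrank ℚ E * Real.log 2) := by
  have hd : (0:ℝ) < Module.finrank ℚ E := by exact_mod_cast Module.finrank_pos
  refine (Psi_cont' _).integral_pos_of_hasCompactSupport_nonneg_nonzero (Psi_cs _) (fun t => Psi_nonneg _ t) (x := 0) ?_
  unfold Psi
  rw [Finset.prod_ne_zero_iff]
  intro w _
  have : sY E (Module.finrank ℚ E * Real.log 2) 0 w = 2 := by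
    unfold sY lY
    rw [show (if h : w = w₀ then -(∑ v, (0 : logSpace E) v) else (0 : logSpace E) ⟨w, h⟩) = 0 by split_ifs <;> simp]
    rw [zero_div, add_zero, mul_div_cancel_left₀ _ hd.ne', Real.exp_log (by norm_num)]
  rw [this, bp]; norm_num

noncomputable def c0 (E : Type*) [Field E] [NumberField E] : ℝ := ∫ z, h0 E z * Real.exp z

theorem c0_pos : 0 < c0 E := by
  refine (h0_cont.mul Real.continuous_exp).integral_pos_of_hasCompactSupport_nonneg_nonzero ?_
    (fun z => mul_nonneg (h0_nonneg z) (Real.exp_pos z).le) (x := Module.finrank ℚ E * Real.log 2)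
    (mul_pos h0_pos (Real.exp_pos _)).ne'
  refine HasCompactSupport.intro (isCompact_Icc (a := (0:ℝ)) (b := Module.finrank ℚ E * Real.log 3)) fun z hz => ?_
  by_contra h
  exact hz (h0_supp (left_ne_zero_of_mul h))

theorem h0_wt : Wt (fun z => h0 E z / c0 E) (Module.finrank ℚ E * Real.log 3) where
  cont := h0_cont.div_const _
  nonneg z := div_nonneg (h0_nonneg z) c0_pos.le
  supp z hz := h0_supp (by intro h; rw [h, zero_div] at hz; exact hz rfl)
  bpos := mul_nonneg (by positivity) (Real.log_nonneg (by norm_num))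
  norm := by
    simp_rw [div_mul_eq_mul_div]
    rw [integral_div]
    exact div_self c0_pos.ne'

end geom
end Mert

open NumberField Finset Filter Topology MeasureTheory
namespace Mert
open NumberField.mixedEmbedding NumberField.InfinitePlace NumberField.Units NumberField.Units.dirichletUnitTheorem
open scoped nonZeroDivisors

theorem tsum_hom {A B : Type*} [AddCommGroup A] [AddCommGroup B] (φ : A →+ B) [Finite φ.ker] (F : B → ℝ)
    (hF : Summable fun b : φ.range => F b) :
    (∑' a, F (φ a) = Nat.card φ.ker * ∑' b : φ.range, F b) := by
  have : Fintype φ.ker := Fintype.ofFinite _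
  rw [← (cosetEq φ.ker).tsum_eq]
  obtain ⟨e, he⟩ : ∃ e : (A ⧸ φ.ker) ≃ φ.range, ∀ r, e r = QuotientAddGroup.quotientKerEquivRange φ r :=
    ⟨(QuotientAddGroup.quotientKerEquivRange φ).toEquiv, fun _ => rfl⟩
  have h1 : ∀ p : (A ⧸ φ.ker) × φ.ker, F (φ (cosetEq φ.ker p)) =
      F (e p.1) * 1 := by
    rintro ⟨r, l⟩
    rw [mul_one, he]
    congr 1
    change φ (Quotient.out r + l) = _
    rw [map_add, show φ l = 0 from l.2, add_zero]
    conv_rhs => rw [← QuotientAddGroup.out_eq' r]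
    rfl
  simp_rw [h1]
  have hF' : Summable fun r : A ⧸ φ.ker => F (e r) := (e.summable_iff (f := fun b : φ.range => F b)).2 hF
  have h2 := tsum_mul_tsum_of_summable_norm (f := fun r : A ⧸ φ.ker => F (e r))
    (g := fun _ : φ.ker => (1:ℝ)) hF'.norm (Summable.of_finite)
  rw [← h2, tsum_fintype (f := fun _ : φ.ker => (1:ℝ)), Finset.sum_const, Finset.card_univ, ← Nat.card_eq_fintype_card, nsmul_eq_mul, mul_one, mul_comm]
  congr 1
  exact e.tsum_eq (fun b : φ.range => F b)

section geom
open scoped Classical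
variable (E : Type*) [Field E] [NumberField E]

/-- fundamental domain of the unit lattice -/
noncomputable def DU : Set (logSpace E) := ZSpan.fundamentalDomain ((basisUnitLattice E).ofZLatticeBasis ℝ _)

/-- number of roots of unity -/
noncomputable def wE : ℕ := Nat.card (logEmbedding E).ker

instance : Finite (logEmbedding E).ker := by
  have : ((logEmbedding E).ker : Set (Additive (𝓞 E)ˣ)) = Additive.toMul ⁻¹' (torsion E : Set (𝓞 E)ˣ) := by
    ext x
    exact logEmbedding_eq_zero_iff
  have h2 : ((torsion E : Set (𝓞 E)ˣ)).Finite := by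
    have : Finite (torsion E) := inferInstance
    exact Set.toFinite _
  have h3 : ((logEmbedding E).ker : Set (Additive (𝓞 E)ˣ)).Finite := by
    rw [this]; exact h2.preimage Additive.toMul.injective.injOn
  exact h3.to_subtype

theorem wE_pos : 0 < wE E := Nat.card_pos

variable {E}

theorem DU_bdd : ∃ R, ∀ t ∈ DU E, ‖t‖ ≤ R := by
  obtain ⟨R, hR⟩ := (ZSpan.fundamentalDomain_isBounded ((basisUnitLattice E).ofZLatticeBasis ℝ (unitLattice E))).subset_closedBall 0
  exact ⟨R, fun t ht => by simpa using hR ht⟩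

theorem DU_meas : MeasurableSet (DU E) := ZSpan.fundamentalDomain_measurableSet _

theorem DU_fin : volume (DU E) ≠ ⊤ :=
  (ZSpan.fundamentalDomain_isBounded ((basisUnitLattice E).ofZLatticeBasis ℝ (unitLattice E))).measure_lt_top.ne

theorem DU_pos : 0 < volume.real (DU E) := by
  refine ENNReal.toReal_pos ?_ DU_fin
  exact ZSpan.measure_fundamentalDomain_ne_zero _

theorem unit_sum (z : ℝ) (c : logSpace E) :
    ∑' u : Additive (𝓞 E)ˣ, ∫ t in DU E, Psi E z (logEmbedding E u + c - t) = wE E * h0 E z := by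
  obtain ⟨R, hR⟩ := DU_bdd (E := E)
  have hfs : {b : logSpace E | b ∈ unitLattice E ∧ ∫ t in DU E, Psi E z (b + c - t) ≠ 0}.Finite := by
    refine (unitLattice_inter_ball_finite E (4 * Real.log 3 + ‖c‖ + R)).subset ?_
    rintro b ⟨hb, h⟩
    refine ⟨hb, ?_⟩
    by_contra hcon
    apply h
    rw [setIntegral_eq_zero_of_forall_eq_zero]
    intro t ht
    by_contra h2
    apply hcon
    have h3 := (Psi_supp h2).2
    have h4 := hR t ht
    rw [mem_closedBall_zero_iff]
    calc ‖b‖ = ‖(b + c - t) - c + t‖ := by congr 1; abel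
      _ ≤ ‖b + c - t‖ + ‖c‖ + ‖t‖ := (norm_add_le _ _).trans (by gcongr; exact norm_sub_le _ _)
      _ ≤ _ := by gcongr
  have hsum : Summable fun b : (logEmbedding E).range => ∫ t in DU E, Psi E z (b + c - t) := by
    apply summable_of_hasFiniteSupport
    refine Set.Finite.of_finite_image (f := fun l => (l : logSpace E)) (hfs.subset ?_) Subtype.val_injective.injOn
    rintro _ ⟨b, hb, rfl⟩
    obtain ⟨x, hx⟩ := b.2
    exact ⟨⟨x, trivial, hx⟩, hb⟩
  rw [tsum_hom (logEmbedding E) (fun b => ∫ t in DU E, Psi E z (b + c - t)) hsum]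
  congr 1
  have hD : IsAddFundamentalDomain (unitLattice E) (DU E) (volume : Measure (logSpace E)) :=
    ZLattice.isAddFundamentalDomain (basisUnitLattice E) volume
  have : VAddInvariantMeasure (unitLattice E) (logSpace E) (volume : Measure (logSpace E)) :=
    inferInstanceAs (VAddInvariantMeasure (unitLattice E).toAddSubgroup (logSpace E) volume)
  have h1 : ∫ t, Psi E z (c - t) = h0 E z := integral_sub_left_eq_self (Psi E z) volume c
  have h2 := hD.integral_eq_tsum' (fun t => Psi E z (c - t)) ((Psi_int z).comp_sub_left c)
  rw [← h1, h2]
  obtain ⟨e, he⟩ : ∃ e : (logEmbedding E).range ≃ unitLattice E, ∀ b, ((e b : logSpace E)) = b :=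
    ⟨Equiv.subtypeEquivRight fun x => by
      constructor
      · rintro ⟨y, hy⟩; exact ⟨y, trivial, hy⟩
      · rintro ⟨y, -, hy⟩; exact ⟨y, hy⟩, fun b => rfl⟩
  rw [← e.tsum_eq]
  refine tsum_congr fun b => ?_
  congr 1
  funext t
  congr 1
  have : (-(e b) +ᵥ t : logSpace E) = -(b : logSpace E) + t := by
    rw [← he]; rfl
  rw [this]; abel

end geom
end Mert

open NumberField Finset Filter Topology MeasureTheory
namespace Mert
open NumberField.mixedEmbedding NumberField.InfinitePlace NumberField.Units NumberField.Units.dirichletUnitTheorem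
open scoped nonZeroDivisors

section geom
open scoped Classical
variable {E : Type*} [Field E] [NumberField E]

theorem sY_bdd (Y : ℝ) : ∃ B : ℝ, ∀ t ∈ DU E, ∀ w, sY E Y t w ≤ B := by
  obtain ⟨R, hR⟩ := DU_bdd (E := E)
  have : ∀ w : InfinitePlace E, ∃ B : ℝ, ∀ t ∈ DU E, sY E Y t w ≤ B := by
    intro w
    have hc : Continuous fun t : logSpace E => sY E Y t w := by
      have h : Continuous fun t : logSpace E => (Y, t) := Continuous.prodMk continuous_const continuous_id
      exact Real.continuous_exp.comp ((lY_cont w).comp h)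
    obtain ⟨B, hB⟩ := (isCompact_closedBall (0 : logSpace E) R).bddAbove_image hc.continuousOn
    exact ⟨B, fun t ht => hB ⟨t, by simpa using hR t ht, rfl⟩⟩
  choose B hB using this
  exact ⟨∑ w, |B w|, fun t ht w => (hB w t ht).trans ((le_abs_self _).trans
    (Finset.single_le_sum (f := fun w => |B w|) (fun _ _ => abs_nonneg _) (mem_univ w)))⟩

theorem fin_supp (J : Ideal (𝓞 E)) (Y : ℝ) :
    ∃ S : Finset J, ∀ x ∉ S, ∀ t ∈ DU E, Ph E (sc E (sY E Y t)⁻¹ (eJ J x)) = 0 := by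
  obtain ⟨B, hB⟩ := sY_bdd (E := E) Y
  have hfin := Embeddings.finite_of_norm_le E ℂ (3 * B)
  have hfin2 : {x : J | ∀ φ : E →+* ℂ, ‖φ ((x : 𝓞 E) : E)‖ ≤ 3 * B}.Finite := by
    refine Set.Finite.of_finite_image (f := fun x : J => ((x : 𝓞 E) : E)) (hfin.subset ?_) ?_
    · rintro _ ⟨x, hx, rfl⟩
      exact ⟨RingOfIntegers.isIntegral_coe _, hx⟩
    · intro x _ y _ h
      exact Subtype.ext (RingOfIntegers.ext h)
  refine ⟨hfin2.toFinset, fun x hx t ht => ?_⟩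
  by_contra h
  apply hx
  rw [Set.Finite.mem_toFinset]
  intro φ
  have h1 := (Ph_supp h (InfinitePlace.mk φ)).2
  rw [np_sc (a := (sY E Y t)⁻¹) (fun w => inv_pos.2 (sY_pos Y t w)), Pi.inv_apply, eJ_apply, normAtPlace_apply,
    InfinitePlace.apply, inv_mul_lt_iff₀ (sY_pos _ _ _)] at h1
  have h2 := hB t ht (InfinitePlace.mk φ)
  linarith

/-- the contribution of one integer -/
noncomputable def PI (E : Type*) [Field E] [NumberField E] (Y : ℝ) (y : 𝓞 E) : ℝ :=
  ∫ t in DU E, Ph E (sc E (sY E Y t)⁻¹ (mixedEmbedding E (y : E)))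

theorem PI_eq (Y : ℝ) {y : 𝓞 E} (hy : y ≠ 0) :
    PI E Y y = ∫ t in DU E, Psi E (Real.log (Ideal.absNorm (Ideal.span {y})) - Y) (logMap (mixedEmbedding E (y:E)) - t) := by
  unfold PI
  have hn : mixedEmbedding.norm (mixedEmbedding E (y:E)) = Ideal.absNorm (Ideal.span {y}) := by
    rw [mixedEmbedding.norm_eq_norm, Ideal.absNorm_span_singleton]
    rw [← Algebra.coe_norm_int]
    simp [Nat.cast_natAbs]
  have hn0 : mixedEmbedding.norm (mixedEmbedding E (y:E)) ≠ 0 := by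
    rw [mixedEmbedding.norm_eq_norm]
    simpa using hy
  simp_rw [Ph_eq _ hn0, hn]

theorem PI_zero (Y : ℝ) : PI E Y 0 = 0 := by
  unfold PI
  apply setIntegral_eq_zero_of_forall_eq_zero
  intro t _
  by_contra h
  have := (Ph_supp h (Classical.arbitrary _)).1
  simp at this
  linarith

theorem PI_units (Y : ℝ) {y : 𝓞 E} (hy : y ≠ 0) :
    ∑' u : (𝓞 E)ˣ, PI E Y (y * u) = wE E * h0 E (Real.log (Ideal.absNorm (Ideal.span {y})) - Y) := by
  rw [← unit_sum _ (logMap (mixedEmbedding E (y:E))), ← Additive.ofMul.symm.tsum_eq]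
  refine tsum_congr fun u => ?_
  rw [PI_eq _ (mul_ne_zero hy (Units.ne_zero _))]
  have h1 : Ideal.span {y * ((Additive.ofMul.symm u : (𝓞 E)ˣ) : 𝓞 E)} = Ideal.span {y} := by
    rw [Ideal.span_singleton_mul_right_unit (Units.isUnit _)]
  rw [h1]
  have h2 : logMap (mixedEmbedding E ((y * ((Additive.ofMul.symm u : (𝓞 E)ˣ) : 𝓞 E) : 𝓞 E) : E)) =
      logEmbedding E u + logMap (mixedEmbedding E (y:E)) := by
    have h3 := logMap_unit_smul (x := mixedEmbedding E (y:E)) (Additive.ofMul.symm u) (by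
      rw [mixedEmbedding.norm_eq_norm]
      simpa using hy)
    rw [unitSMul_smul] at h3
    rw [show Additive.ofMul (Additive.ofMul.symm u) = u from rfl] at h3
    rw [← h3, ← map_mul, mul_comm]
    rfl
  rw [h2]

theorem swap (J : Ideal (𝓞 E)) (Y : ℝ) (f : J → ℂ) :
    (Function.support fun x : J => PI E Y x).Finite ∧
    IntegrableOn (fun t => ∑' x : J, f x * (Ph E (sc E (sY E Y t)⁻¹ (eJ J x)) : ℂ)) (DU E) ∧
    ∫ t in DU E, ∑' x : J, f x * (Ph E (sc E (sY E Y t)⁻¹ (eJ J x)) : ℂ) = ∑' x : J, f x * (PI E Y x : ℂ) := by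
  obtain ⟨S, hS⟩ := fin_supp J Y
  have h0 : ∀ x ∉ S, PI E Y x = 0 := fun x hx => setIntegral_eq_zero_of_forall_eq_zero fun t ht => hS x hx t ht
  have hintg : ∀ x ∈ S, IntegrableOn (fun t => f x * (Ph E (sc E (sY E Y t)⁻¹ (eJ J x)) : ℂ)) (DU E) := by
    intro x _
    have key : IntegrableOn (fun t => Ph E (sc E (sY E Y t)⁻¹ (eJ J x))) (DU E) := ?_
    · have h2 : Integrable (fun t => ((Ph E (sc E (sY E Y t)⁻¹ (eJ J x)) : ℝ) : ℂ)) (volume.restrict (DU E)) := key.ofReal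
      exact h2.const_mul _
    by_cases hx : (x : 𝓞 E) = 0
    · have : ∀ t, Ph E (sc E (sY E Y t)⁻¹ (eJ J x)) = 0 := by
        intro t
        by_contra h
        have := (Ph_supp h (Classical.arbitrary _)).1
        rw [eJ_apply, hx] at this
        simp at this
        linarith
      simp_rw [this]
      exact integrableOn_zero
    · have hn0 : mixedEmbedding.norm (eJ J x) ≠ 0 := by
        rw [eJ_apply, mixedEmbedding.norm_eq_norm]
        simpa using hx
      simp_rw [Ph_eq _ hn0]
      exact ((Psi_int _).comp_sub_left _).integrableOn
  have hcg : ∀ t ∈ DU E, ∑' x : J, f x * (Ph E (sc E (sY E Y t)⁻¹ (eJ J x)) : ℂ) =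
      ∑ x ∈ S, f x * (Ph E (sc E (sY E Y t)⁻¹ (eJ J x)) : ℂ) :=
    fun t ht => tsum_eq_sum (s := S) (fun x hx => by rw [hS x hx t ht]; simp)
  refine ⟨S.finite_toSet.subset fun x hx => by
    by_contra h
    exact hx (h0 x h), ?_, ?_⟩
  · have h3 := MeasureTheory.integrable_finset_sum (μ := volume.restrict (DU E)) S hintg
    refine IntegrableOn.congr_fun (f := fun t => ∑ x ∈ S, f x * (Ph E (sc E (sY E Y t)⁻¹ (eJ J x)) : ℂ)) h3
      (fun t ht => (hcg t ht).symm) DU_meas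
  rw [tsum_eq_sum (s := S) (fun x hx => by rw [h0 x hx]; simp), setIntegral_congr_fun DU_meas hcg,
    integral_finset_sum S hintg]
  refine Finset.sum_congr rfl fun x _ => ?_
  rw [integral_const_mul, integral_complex_ofReal]
  rfl

theorem unfold1 (J : Ideal (𝓞 E)) (Y : ℝ) (φ : ℕ → ℂ) :
    ∑' x : J, φ (Ideal.absNorm (Ideal.span {(x : 𝓞 E)})) * (PI E Y x : ℂ) =
     ∑' I : Ideal (𝓞 E), if I ≠ ⊥ ∧ I ≤ J ∧ I.IsPrincipal then
      φ (Ideal.absNorm I) * (wE E * h0 E (Real.log (Ideal.absNorm I) - Y) : ℝ) else 0 := by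
  have hfs := (swap J Y (fun _ => 0)).1
  have hs : Summable fun x : J => φ (Ideal.absNorm (Ideal.span {(x : 𝓞 E)})) * (PI E Y x : ℂ) := by
    apply summable_of_hasFiniteSupport
    refine hfs.subset fun x hx h => hx ?_
    simp only at h
    simp [h]
  rw [← (hs.hasSum.tsum_fiberwise fun x : J => Ideal.span {(x : 𝓞 E)}).tsum_eq]
  refine tsum_congr fun I => ?_
  have hcg : ∀ x : (fun x : J => Ideal.span {(x : 𝓞 E)}) ⁻¹' {I}, 
      φ (Ideal.absNorm (Ideal.span {((x : J) : 𝓞 E)})) * (PI E Y (x : J) : ℂ) = 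
      φ (Ideal.absNorm I) * (PI E Y (x : J) : ℂ) := fun x => by
    have := x.2
    simp only [Set.mem_preimage, Set.mem_singleton_iff] at this
    rw [this]
  rw [tsum_congr hcg, tsum_mul_left]
  split_ifs with h
  · obtain ⟨h1, h2, ⟨α, hα⟩⟩ := h
    have hα' : I = Ideal.span {α} := hα
    have hα0 : α ≠ 0 := by
      rintro rfl
      exact h1 (by rw [hα']; simp)
    congr 1
    subst hα'
    have hαJ : α ∈ J := h2 (Ideal.mem_span_singleton_self α)
    rw [← PI_units Y hα0, Complex.ofReal_tsum]
    obtain ⟨e, he⟩ : ∃ e : (𝓞 E)ˣ ≃ ((fun x : J => Ideal.span {(x : 𝓞 E)}) ⁻¹' {Ideal.span {α}}),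
        ∀ u, (((e u : J)) : 𝓞 E) = α * u := by
      refine ⟨Equiv.ofBijective (fun u => ⟨⟨α * u, J.mul_mem_right _ hαJ⟩, ?_⟩) ⟨?_, ?_⟩, fun u => rfl⟩
      · simp only [Set.mem_preimage, Set.mem_singleton_iff]
        rw [Ideal.span_singleton_mul_right_unit (Units.isUnit _)]
      · intro u v huv
        simp only [Subtype.mk.injEq] at huv
        exact Units.ext (mul_left_cancel₀ hα0 huv)
      · rintro ⟨⟨x, hx⟩, hx2⟩
        simp only [Set.mem_preimage, Set.mem_singleton_iff] at hx2
        obtain ⟨u, hu⟩ := (Ideal.span_singleton_eq_span_singleton.1 hx2).symm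
        exact ⟨u, Subtype.ext (Subtype.ext hu)⟩
    rw [← e.tsum_eq]
    exact tsum_congr fun u => by rw [he]
  · rw [mul_eq_zero]
    right
    convert tsum_zero with x
    have hx := x.2
    simp only [Set.mem_preimage, Set.mem_singleton_iff] at hx
    by_cases h0 : ((x : J) : 𝓞 E) = 0
    · rw [h0, PI_zero]; simp
    · exfalso
      apply h
      rw [← hx]
      refine ⟨by simpa using h0, ?_, ⟨_, rfl⟩⟩
      rw [Ideal.span_singleton_le_iff_mem]
      exact x.1.2

end geom
end Mert

open NumberField Finset Filter Topology MeasureTheory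
namespace Mert
open NumberField.mixedEmbedding NumberField.InfinitePlace NumberField.Units NumberField.Units.dirichletUnitTheorem
open scoped nonZeroDivisors

/-- even periodic functions -/
def Per (f : ℕ → ℂ) (m : ℕ) : Prop := ∀ a b : ℤ, a ≡ b [ZMOD m] → f a.natAbs = f b.natAbs

section geom
open scoped Classical
variable {E : Type*} [Field E] [NumberField E]

theorem norm_congr (x y : 𝓞 E) (k : ℕ) : Algebra.norm ℤ (x + k • y) ≡ Algebra.norm ℤ x [ZMOD k] := by
  rw [← ZMod.intCast_eq_intCast_iff]
  have b := Module.Free.chooseBasis ℤ (𝓞 E)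
  have h : ∀ z, ((Algebra.norm ℤ z : ℤ) : ZMod k) = ((Algebra.leftMulMatrix b z).map (Int.castRingHom (ZMod k))).det := by
    intro z
    rw [Algebra.norm_eq_matrix_det b]
    exact RingHom.map_det (Int.castRingHom (ZMod k)) _
  rw [h, h]
  congr 1
  ext i j
  rw [map_add, map_nsmul]
  simp [Matrix.add_apply, Matrix.smul_apply, -nsmul_eq_mul]

theorem F_per {m : ℕ} {f : ℕ → ℂ} (hf : Per f m) (J : Ideal (𝓞 E)) (hJ : J ≠ ⊥) (x : J) (n : J)
    (hn : n ∈ mulQ J (m * Ideal.absNorm J)) :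
    f (Ideal.absNorm (Ideal.span {((x + n : J) : 𝓞 E)}) / Ideal.absNorm J) =
    f (Ideal.absNorm (Ideal.span {(x : 𝓞 E)}) / Ideal.absNorm J) := by
  obtain ⟨y, rfl⟩ := hn
  have hJ0 : Ideal.absNorm J ≠ 0 := by rwa [Ne, Ideal.absNorm_eq_zero_iff]
  have h1 : ((x + (nsmulAddMonoidHom (m * Ideal.absNorm J)) y : J) : 𝓞 E) =
    (x : 𝓞 E) + (m * Ideal.absNorm J) • (y : 𝓞 E) := by simp
  have h2 := norm_congr (x : 𝓞 E) (y : 𝓞 E) (m * Ideal.absNorm J)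
  rw [← h1] at h2
  obtain ⟨a, ha⟩ := Ideal.absNorm_dvd_norm_of_mem x.2
  obtain ⟨b, hb⟩ := Ideal.absNorm_dvd_norm_of_mem (x + (nsmulAddMonoidHom (m * Ideal.absNorm J)) y).2
  rw [Ideal.absNorm_span_singleton, Ideal.absNorm_span_singleton, ha, hb, Int.natAbs_mul, Int.natAbs_mul,
    Int.natAbs_natCast, Nat.mul_div_cancel_left _ (Nat.pos_of_ne_zero hJ0), Nat.mul_div_cancel_left _ (Nat.pos_of_ne_zero hJ0)]
  apply hf
  rw [ha, hb] at h2
  push_cast at h2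
  rw [mul_comm (m : ℤ)] at h2
  exact Int.ModEq.mul_left_cancel' (by exact_mod_cast hJ0) h2

theorem mulQ_index (J : Ideal (𝓞 E)) {q : ℕ} (hq : q ≠ 0) : (mulQ J q).index ≠ 0 := by
  have h1 : Module.Free ℤ J := inferInstance
  have h2 : Module.Finite ℤ J := inferInstance
  have := AddSubgroup.index_range_nsmul J q
  rw [mulQ]
  erw [this]
  positivity

/-- volume factor -/
noncomputable def WE (E : Type*) [Field E] [NumberField E] : ℝ := volume.real (DU E) * (∫ x, Ph E x) / cv0 E

theorem Phint_pos : 0 < ∫ x, Ph E x := lt_of_lt_of_le (by have := v1_pos (E := E); positivity) Ph_lower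

theorem WE_pos : 0 < WE E := div_pos (mul_pos DU_pos Phint_pos) cv0_pos

theorem one_ideal (d : ℕ) : ∃ A : ℕ, ∀ {E : Type*} [Field E] [NumberField E] (_ : Module.finrank ℚ E = d) {X : ℝ} (_ : 2 ≤ X)
    (_ : |(discr E : ℝ)| ≤ X) (J : Ideal (𝓞 E)) (_ : J ≠ ⊥) (_ : (Ideal.absNorm J : ℝ) ≤ X)
    (m : ℕ) (_ : 0 < m) (_ : (m : ℝ) ≤ X) (f : ℕ → ℂ) (_ : Per f m) (_ : ∀ k, ‖f k‖ ≤ 1),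
    ∃ M : ℂ, ‖M‖ ≤ 1 ∧ ((∀ k, f k = 1) → M = 1) ∧ ∀ Y : ℝ, -(d * Real.log 3) ≤ Y →
    ‖∑' x : J, f (Ideal.absNorm (Ideal.span {(x : 𝓞 E)}) / Ideal.absNorm J) *
        (PI E (Y + Real.log (Ideal.absNorm J)) x : ℂ) - M * WE E * Real.exp Y‖ ≤
      X ^ A * Real.exp ((1 - 1 / d) * Y) * WE E := by
  obtain ⟨A, hA⟩ := lat2 d
  refine ⟨A, ?_⟩
  intro E _ _ hdE X hX hD J hJ hJX m hm hmX f hf hf1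
  have hd0 : 0 < d := hdE ▸ Module.finrank_pos
  have hJ0 : Ideal.absNorm J ≠ 0 := by rwa [Ne, Ideal.absNorm_eq_zero_iff]
  have hq : 0 < m * Ideal.absNorm J := Nat.mul_pos hm (Nat.pos_of_ne_zero hJ0)
  set N : ℝ := (Ideal.absNorm J : ℝ) with hN
  have hN1 : 1 ≤ N := by rw [hN]; exact_mod_cast Nat.one_le_iff_ne_zero.2 hJ0
  have hN0 : 0 < N := by linarith
  have hlog : 0 ≤ Real.log N := Real.log_nonneg hN1
  set Fx : J → ℂ := fun x => f (Ideal.absNorm (Ideal.span {(x : 𝓞 E)}) / Ideal.absNorm J) with hFx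
  set M := avg (mulQ J (m * Ideal.absNorm J)) Fx with hM
  refine ⟨M, avg_norm _ (mulQ_index J hq.ne') _ (fun x => hf1 _), fun h => avg_one _ (mulQ_index J hq.ne') _ (fun x => h _), ?_⟩
  intro Y hY
  have hqX : ((m * Ideal.absNorm J : ℕ) : ℝ) ≤ X ^ 2 := by
    push_cast; rw [pow_two]; gcongr
  obtain ⟨-, hintg, hsw⟩ := swap J (Y + Real.log N) Fx
  rw [← hsw]
  set V := volume.real (DU E) with hV
  set Φ := ∫ x, Ph E x with hΦ
  have hΦ0 : 0 < Φ := Phint_pos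
  have hV0 : 0 < V := DU_pos
  have hc0 : 0 < cv0 E := cv0_pos
  set T : logSpace E → ℂ := fun t => ∑' x : J, Fx x * (Ph E (sc E (sY E (Y + Real.log N) t)⁻¹ (eJ J x)) : ℂ) with hT
  set Y' := Y + Real.log N
  have hb : ∀ t ∈ DU E, ‖(cv J : ℂ) * T t - M * ((Real.exp Y' * Φ : ℝ))‖ ≤ X ^ A * Real.exp ((1 - 1 / d) * Y') * Φ := by
    intro t _
    exact (hA hdE hX hD J hJ hJX _ hq hqX Fx (F_per hf J hJ) (fun x => hf1 _) (sY E Y' t) (sY_pos Y' t) Y' (prod_sY Y' t)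
      (by simp only [Y']; linarith)).2
  have h1 := norm_setIntegral_le_of_norm_le_const (μ := volume) (lt_of_le_of_ne le_top DU_fin) hb
  have hconst : IntegrableOn (fun _ : logSpace E => M * ((Real.exp Y' * Φ : ℝ) : ℂ)) (DU E) :=
    integrableOn_const DU_fin
  have hcm : IntegrableOn (fun t => (cv J : ℂ) * T t) (DU E) := Integrable.const_mul hintg _
  rw [integral_sub hcm hconst, integral_const_mul, setIntegral_const] at h1
  have hexp : Real.exp Y' = Real.exp Y * N := by rw [Real.exp_add, Real.exp_log hN0]
  have hcv : cv J = N * cv0 E := cv_eq J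
  have hexp2 : Real.exp ((1 - 1 / d) * Y') ≤ Real.exp ((1 - 1 / d) * Y) * N := by
    have hh : Real.exp ((1 - 1 / d) * Y) * N = Real.exp ((1 - 1 / d) * Y + Real.log N) := by
      rw [Real.exp_add, Real.exp_log hN0]
    rw [hh]
    apply Real.exp_le_exp.2
    have : 0 ≤ (1 : ℝ) / d * Real.log N := by positivity
    simp only [Y']
    nlinarith
  have hNc : 0 < N * cv0 E := mul_pos hN0 hc0
  have heq : (cv J : ℂ) * (∫ t in DU E, T t) - V • (M * ((Real.exp Y' * Φ : ℝ) : ℂ)) =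
      ((N * cv0 E : ℝ) : ℂ) * ((∫ t in DU E, T t) - M * WE E * Real.exp Y) := by
    rw [WE, hcv, hexp, Complex.real_smul]
    have : ((cv0 E : ℝ) : ℂ) ≠ 0 := by exact_mod_cast hc0.ne'
    push_cast
    field_simp
    try ring
  rw [heq, norm_mul, Complex.norm_real, Real.norm_of_nonneg hNc.le] at h1
  have h2 : N * cv0 E * ‖(∫ t in DU E, T t) - M * WE E * Real.exp Y‖ ≤
      N * cv0 E * (X ^ A * Real.exp ((1 - 1 / d) * Y) * WE E) := by
    refine h1.trans ?_
    calc X ^ A * Real.exp ((1 - 1 / d) * Y') * Φ * V ≤ X ^ A * (Real.exp ((1 - 1 / d) * Y) * N) * Φ * V := by gcongr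
      _ = _ := by
        have hW : cv0 E * WE E = V * Φ := mul_div_cancel₀ (V * Φ) hc0.ne'
        linear_combination (-(X ^ A * Real.exp ((1 - 1 / d) * Y) * N)) * hW
  exact le_of_mul_le_mul_left h2 hNc

end geom
end Mert

open NumberField Finset Filter Topology MeasureTheory
namespace Mert
open NumberField.mixedEmbedding NumberField.InfinitePlace NumberField.Units NumberField.Units.dirichletUnitTheorem
open scoped nonZeroDivisors

section geom
open scoped Classical
variable {E : Type*} [Field E] [NumberField E]

theorem reindex (J : Ideal (𝓞 E)) (hJ : J ≠ ⊥) (Y : ℝ) (f : ℕ → ℂ) :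
    ∑' x : J, f (Ideal.absNorm (Ideal.span {(x : 𝓞 E)}) / Ideal.absNorm J) *
        (PI E (Y + Real.log (Ideal.absNorm J)) x : ℂ) =
    ∑' I : Ideal (𝓞 E), if I ≠ ⊥ ∧ (J * I).IsPrincipal then
      f (Ideal.absNorm I) * (wE E * h0 E (Real.log (Ideal.absNorm I) - Y) : ℝ) else 0 := by
  have hJ0 : Ideal.absNorm J ≠ 0 := by rwa [Ne, Ideal.absNorm_eq_zero_iff]
  rw [unfold1 J _ (fun n => f (n / Ideal.absNorm J))]
  rw [← (mul_right_injective₀ (show J ≠ 0 from hJ)).tsum_eq]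
  · refine tsum_congr fun I => ?_
    have hiff : (J * I ≠ ⊥ ∧ J * I ≤ J ∧ (J * I).IsPrincipal) ↔ (I ≠ ⊥ ∧ (J * I).IsPrincipal) := by
      have h1 : J * I ≤ J := Ideal.mul_le_left
      have h2 : J * I ≠ ⊥ ↔ I ≠ ⊥ := by
        rw [← Ideal.zero_eq_bot, mul_ne_zero_iff]
        exact ⟨fun h => h.2, fun h => ⟨hJ, h⟩⟩
      tauto
    simp only [hiff]
    split_ifs with h
    · have hI0 : Ideal.absNorm I ≠ 0 := by rw [Ne, Ideal.absNorm_eq_zero_iff]; exact h.1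
      rw [map_mul, Nat.mul_div_cancel_left _ (Nat.pos_of_ne_zero hJ0), Nat.cast_mul,
        Real.log_mul (by exact_mod_cast hJ0) (by exact_mod_cast hI0)]
      congr 4
      ring_nf
    · rfl
  · intro I hI
    have : I ≤ J := by
      by_contra h
      apply hI
      simp [h]
    obtain ⟨K, hK⟩ := Ideal.dvd_iff_le.2 this
    exact ⟨K, hK.symm⟩

theorem h0_fin (Y : ℝ) : {I : Ideal (𝓞 E) | I ≠ ⊥ ∧ h0 E (Real.log (Ideal.absNorm I) - Y) ≠ 0}.Finite := by
  refine (Ideal.finite_setOfPred_absNorm_le (S := 𝓞 E) ⌈Real.exp (Module.finrank ℚ E * Real.log 3 + Y)⌉₊).subset ?_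
  rintro I ⟨h1, h2⟩
  have h3 := (h0_supp h2).2
  have hI0 : 0 < Ideal.absNorm I := by
    rw [Nat.pos_iff_ne_zero, Ne, Ideal.absNorm_eq_zero_iff]; exact h1
  have h4 : ((Ideal.absNorm I : ℕ) : ℝ) ≤ Real.exp (Module.finrank ℚ E * Real.log 3 + Y) := by
    rw [← Real.log_le_iff_le_exp (by exact_mod_cast hI0)]
    linarith
  exact_mod_cast h4.trans (Nat.le_ceil _)

theorem class_sum (J : ClassGroup (𝓞 E) → (Ideal (𝓞 E))⁰) (hJ : ∀ c, ClassGroup.mk0 (J c) = c) (Y : ℝ) (f : ℕ → ℂ) :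
    ∑ c, ∑' I : Ideal (𝓞 E), (if I ≠ ⊥ ∧ ((J c : Ideal (𝓞 E)) * I).IsPrincipal then
      f (Ideal.absNorm I) * (wE E * h0 E (Real.log (Ideal.absNorm I) - Y) : ℝ) else 0) =
    wE E * Ssum (aT E f) (h0 E) Y := by
  rw [← Summable.tsum_finsetSum]
  · have h1 : ∀ I : Ideal (𝓞 E), ∑ c, (if I ≠ ⊥ ∧ ((J c : Ideal (𝓞 E)) * I).IsPrincipal then
      f (Ideal.absNorm I) * (wE E * h0 E (Real.log (Ideal.absNorm I) - Y) : ℝ) else 0) =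
      wE E * (if I ≠ ⊥ then f (Ideal.absNorm I) * (h0 E (Real.log (Ideal.absNorm I) - Y) : ℝ) else 0) := by
      intro I
      by_cases hI : I = ⊥
      · simp [hI]
      · have h2 : ∀ c, ((J c : Ideal (𝓞 E)) * I).IsPrincipal ↔ c = (ClassGroup.mk0 ⟨I, mem_nonZeroDivisors_iff_ne_zero.2 hI⟩)⁻¹ := by
          intro c
          rw [eq_inv_iff_mul_eq_one, ← hJ c, ← map_mul, hJ c]
          exact (ClassGroup.mk0_eq_one_iff _).symm
        simp only [h2, hI, ne_eq, not_false_eq_true, true_and, Finset.sum_ite_eq', Finset.mem_univ, if_true]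
        push_cast
        ring
    simp_rw [h1]
    rw [tsum_mul_left]
    congr 1
    have hs : Summable fun I : Ideal (𝓞 E) => if I ≠ ⊥ then f (Ideal.absNorm I) * ((h0 E (Real.log (Ideal.absNorm I) - Y) : ℝ) : ℂ) else 0 := by
      apply summable_of_hasFiniteSupport
      refine (h0_fin (E := E) Y).subset fun I hI => ?_
      have h3 : I ≠ ⊥ := by
        rintro rfl; apply hI; simp
      refine ⟨h3, fun h4 => hI ?_⟩
      simp [h4]
    rw [← (hs.hasSum.tsum_fiberwise fun I : Ideal (𝓞 E) => Ideal.absNorm I).tsum_eq, Ssum]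
    refine tsum_congr fun k => ?_
    have hcg : ∀ I : (fun I : Ideal (𝓞 E) => Ideal.absNorm I) ⁻¹' {k}, 
        (if (I : Ideal (𝓞 E)) ≠ ⊥ then f (Ideal.absNorm (I : Ideal (𝓞 E))) * 
          ((h0 E (Real.log (Ideal.absNorm (I : Ideal (𝓞 E))) - Y) : ℝ) : ℂ) else 0) =
        if k = 0 then 0 else f k * ((h0 E (Real.log k - Y) : ℝ) : ℂ) := by
      intro I
      have h4 : Ideal.absNorm (I : Ideal (𝓞 E)) = k := I.2
      have h5 : (I : Ideal (𝓞 E)) ≠ ⊥ ↔ k ≠ 0 := by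
        have := Ideal.absNorm_eq_zero_iff (I := (I : Ideal (𝓞 E)))
        rw [h4] at this
        exact (not_congr this).symm
      simp only [h4, h5]
      split_ifs <;> simp_all
    rw [tsum_congr hcg, tsum_const, show Nat.card ((fun I : Ideal (𝓞 E) => Ideal.absNorm I) ⁻¹' {k}) = aE E k from (aE_eq_card k).symm]
    split_ifs
    · simp
    · rw [nsmul_eq_mul, aT]; ring
  · intro c _
    apply summable_of_hasFiniteSupport
    refine (h0_fin (E := E) Y).subset fun I hI => ?_
    have h3 : I ≠ ⊥ := by
      rintro rfl; apply hI; simp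
    refine ⟨h3, fun h4 => hI ?_⟩
    simp [h4]

theorem Ssum_div (a : ℕ → ℂ) (h : ℝ → ℝ) (c Y : ℝ) : Ssum a (fun z => h z / c) Y = Ssum a h Y / c := by
  unfold Ssum
  rw [← tsum_div_const]
  refine tsum_congr fun k => ?_
  split_ifs
  · simp
  · push_cast; ring

/-- the residue -/
noncomputable def rhoE (E : Type*) [Field E] [NumberField E] : ℝ := classNumber E * WE E / (wE E * c0 E)

theorem rhoE_pos : 0 < rhoE E := by
  have h1 : (0:ℝ) < classNumber E := by exact_mod_cast classNumber_pos E
  have h2 : (0:ℝ) < wE E := by exact_mod_cast wE_pos E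
  exact div_pos (mul_pos h1 WE_pos) (mul_pos h2 c0_pos)

theorem mink_le {X : ℝ} (hX : 2 ≤ X) (hD : |(discr E : ℝ)| ≤ X) :
    (4 / Real.pi) ^ nrComplexPlaces E * ((Module.finrank ℚ E).factorial / (Module.finrank ℚ E : ℝ) ^ (Module.finrank ℚ E) * √|(discr E : ℝ)|)
      ≤ X ^ (Module.finrank ℚ E + 1) := by
  have hd : (0:ℝ) < Module.finrank ℚ E := by exact_mod_cast Module.finrank_pos
  have h1 : (4 / Real.pi) ^ nrComplexPlaces E ≤ X ^ (Module.finrank ℚ E) := by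
    have h4 : 4 / Real.pi ≤ X := by
      rw [div_le_iff₀ Real.pi_pos]
      nlinarith [Real.pi_gt_three]
    have h5 : nrComplexPlaces E ≤ Module.finrank ℚ E := by
      rw [← card_add_two_mul_card_eq_rank]; omega
    calc (4 / Real.pi) ^ nrComplexPlaces E ≤ X ^ nrComplexPlaces E := by gcongr
      _ ≤ _ := pow_le_pow_right₀ (by linarith) h5
  have h2 : ((Module.finrank ℚ E).factorial / (Module.finrank ℚ E : ℝ) ^ (Module.finrank ℚ E)) ≤ 1 := by
    rw [div_le_one (by positivity)]
    exact_mod_cast Nat.factorial_le_pow _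
  have h3 : √|(discr E : ℝ)| ≤ X := by
    rw [Real.sqrt_le_left (by linarith)]
    nlinarith
  calc _ ≤ X ^ (Module.finrank ℚ E) * (1 * X) := by gcongr
    _ = _ := by ring

theorem cnt (d : ℕ) : ∃ A : ℕ, ∀ {E : Type*} [Field E] [NumberField E] (_ : Module.finrank ℚ E = d) {X : ℝ} (_ : 2 ≤ X)
    (_ : |(discr E : ℝ)| ≤ X)
    (m : ℕ) (_ : 0 < m) (_ : (m : ℝ) ≤ X) (f : ℕ → ℂ) (_ : Per f m) (_ : ∀ k, ‖f k‖ ≤ 1),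
    ∃ M : ℂ, ‖M‖ ≤ 1 ∧ ((∀ k, f k = 1) → M = 1) ∧
      Cnt (aT E f) (fun z => h0 E z / c0 E) (d * Real.log 3) (rhoE E) (X ^ A) (1 / d) M := by
  obtain ⟨A, hA⟩ := one_ideal d
  refine ⟨(d + 1) * A, ?_⟩
  intro E _ _ hdE X hX hD m hm hmX f hf hf1
  have hX1 : (1:ℝ) ≤ X := by linarith
  have hXX : X ≤ X ^ (d + 1) := le_self_pow₀ hX1 (by omega)
  choose J hJ hJX using exists_ideal_in_class_of_norm_le (K := E)
  have hJX' : ∀ c, ((Ideal.absNorm (J c : Ideal (𝓞 E)) : ℕ) : ℝ) ≤ X ^ (d + 1) := fun c => by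
    refine (hJX c).trans ?_
    rw [← hdE]
    exact mink_le hX hD
  have hJ0 : ∀ c, (J c : Ideal (𝓞 E)) ≠ ⊥ := fun c => nonZeroDivisors.ne_zero (J c).2
  choose M hM1 hM2 hM3 using fun c => hA hdE (hX.trans hXX) (hD.trans hXX) (J c : Ideal (𝓞 E)) (hJ0 c)
    (hJX' c) m hm (hmX.trans hXX) f hf hf1
  have hh : (0:ℝ) < classNumber E := by exact_mod_cast classNumber_pos E
  have hw : (0:ℝ) < wE E := by exact_mod_cast wE_pos E
  have hc0 := c0_pos (E := E)
  have hcard : ((Finset.univ : Finset (ClassGroup (𝓞 E))).card : ℝ) = classNumber E := rfl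
  refine ⟨(∑ c, M c) / classNumber E, ?_, ?_, ?_⟩
  · rw [norm_div, Complex.norm_natCast, div_le_one hh]
    refine (norm_sum_le _ _).trans ((Finset.sum_le_sum fun c _ => hM1 c).trans ?_)
    rw [Finset.sum_const, nsmul_eq_mul, mul_one, hcard]
  · intro h
    simp_rw [fun c => hM2 c h]
    rw [Finset.sum_const, nsmul_eq_mul, mul_one]
    exact div_self (by exact_mod_cast (classNumber_ne_zero E))
  · intro Y hY
    have h1 : ‖wE E * Ssum (aT E f) (h0 E) Y - (∑ c, M c) * WE E * Real.exp Y‖ ≤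
        classNumber E * ((X ^ (d + 1)) ^ A * Real.exp ((1 - 1 / d) * Y) * WE E) := by
      rw [← class_sum J hJ Y f, Finset.sum_mul, Finset.sum_mul, ← Finset.sum_sub_distrib]
      refine (norm_sum_le _ _).trans ?_
      have : ∀ c ∈ (Finset.univ : Finset (ClassGroup (𝓞 E))), _ ≤ _ := fun c _ => by
        have := hM3 c Y hY
        rw [reindex _ (hJ0 c)] at this
        exact this
      refine (Finset.sum_le_sum this).trans ?_
      rw [Finset.sum_const, nsmul_eq_mul, hcard]
    have hwc : 0 < wE E * c0 E := mul_pos hw hc0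
    have hwC : ((wE E : ℝ) : ℂ) ≠ 0 := by exact_mod_cast hw.ne'
    have hwC' : ((wE E : ℕ) : ℂ) ≠ 0 := by exact_mod_cast hw.ne'
    have hcC : ((c0 E : ℝ) : ℂ) ≠ 0 := by exact_mod_cast hc0.ne'
    have hhC : ((classNumber E : ℕ) : ℂ) ≠ 0 := by exact_mod_cast hh.ne'
    have h2 : wE E * Ssum (aT E f) (h0 E) Y - (∑ c, M c) * WE E * Real.exp Y =
       ((wE E * c0 E : ℝ) : ℂ) * (Ssum (aT E f) (fun z => h0 E z / c0 E) Y - (∑ c, M c) / classNumber E * rhoE E * Real.exp Y) := by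
      rw [Ssum_div, rhoE]
      push_cast
      field_simp
    rw [h2, norm_mul, Complex.norm_real, Real.norm_of_nonneg hwc.le] at h1
    refine le_of_mul_le_mul_left (h1.trans (le_of_eq ?_)) hwc
    have h3 : wE E * c0 E * rhoE E = classNumber E * WE E := mul_div_cancel₀ _ hwc.ne'
    rw [← pow_mul]
    linear_combination (-(X ^ ((d + 1) * A) * Real.exp ((1 - 1 / d) * Y))) * h3

end geom

end Mert

open NumberField Finset Filter Topology MeasureTheory
namespace Mert

theorem pow_bound (K : ℝ) : ∃ n : ℕ, ∀ X : ℝ, 2 ≤ X → K ≤ X ^ n := by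
  obtain ⟨n, hn⟩ := pow_unbounded_of_one_lt K (one_lt_two)
  exact ⟨n, fun X hX => hn.le.trans (by gcongr)⟩

/-- the analytic theorem on twisted Dedekind zeta functions, polynomially uniform -/
theorem reg (d : ℕ) : ∃ A : ℕ, ∀ {E : Type*} [Field E] [NumberField E] (_ : Module.finrank ℚ E = d) {X : ℝ} (_ : 2 ≤ X)
    (_ : |(discr E : ℝ)| ≤ X)
    (m : ℕ) (_ : 0 < m) (_ : (m : ℝ) ≤ X) (f : ℕ → ℂ) (_ : Per f m) (_ : CM f),
    ∃ M : ℂ, ((∀ k, f k = 1) → M = 1) ∧ Reg E f (rhoE E) (X ^ A) M := by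
  rcases Nat.eq_zero_or_pos d with rfl | hd
  · refine ⟨0, ?_⟩
    intro E _ _ h0
    exact absurd h0 Module.finrank_pos.ne'
  obtain ⟨A, hA⟩ := cnt d
  have hd1 : (1:ℝ) ≤ d := by exact_mod_cast hd
  obtain ⟨K, hK1, hK⟩ := L_facts (d * Real.log 3) (1 / d) (mul_nonneg (by positivity) (Real.log_nonneg (by norm_num)))
    (by positivity) (by rw [div_le_one (by positivity)]; exact hd1)
  obtain ⟨n, hn⟩ := pow_bound K
  refine ⟨A + n, ?_⟩
  intro E _ _ hdE X hX hD m hm hmX f hf hcm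
  obtain ⟨M, hM1, hM2, hM3⟩ := hA hdE hX hD m hm hmX f hf hcm.bd
  have hX1 : (1:ℝ) ≤ X := by linarith
  have hρ := rhoE_pos (E := E)
  have hwt := h0_wt (E := E)
  rw [hdE] at hwt
  obtain ⟨h1, h2, h3⟩ := hK _ _ _ _ _ hwt hM3 hρ (one_le_pow₀ hX1) hM1
    (fun s hs => aT_summable hcm (by simpa using hs))
  have hC : rhoE E * X ^ A * K ≤ rhoE E * X ^ (A + n) := by
    rw [pow_add, ← mul_assoc]
    have := hn X hX
    gcongr
  refine ⟨M, hM2, ⟨hcm, hρ, one_le_pow₀ hX1, ?_, ?_, ?_⟩⟩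
  · intro s hs hs2
    refine (h1 s hs hs2).trans (mul_le_mul_of_nonneg_right hC (by linarith))
  · intro s s' a1 a2 a3 a4
    exact (h2 s s' a1 a2 a3 a4).trans (mul_le_mul_of_nonneg_right hC (abs_nonneg _))
  · intro hM s s' a1 a2 a3 a4
    obtain ⟨b1, b2⟩ := h3 hM s s' a1 a2 a3 a4
    exact ⟨b1.trans hC, b2.trans (mul_le_mul_of_nonneg_right hC (abs_nonneg _))⟩

end Mert


namespace Mert

open NumberField Finset Filter Topology MeasureTheory

section GF
variable {F L : Type*} [Field F] [NumberField F] [Field L] [NumberField L] [Algebra F L]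

theorem unram {p : ℕ} (hp : p.Prime) (hd : ¬ (p:ℤ) ∣ discr L) (P : Ideal (𝓞 L)) [P.IsPrime]
    (hP : (p : 𝓞 L) ∈ P) : Algebra.IsUnramifiedAt (𝓞 F) P := by
  have h := (not_dvd_discr_iff_forall_mem L (𝓞 L) (Nat.prime_iff_prime_int.mp hp)).1 hd P ‹_›
    (by simpa using hP)
  exact Algebra.FormallyUnramified.of_restrictScalars ℤ (𝓞 F) (Localization.AtPrime P)

theorem galgrp [IsGalois F L] : IsGaloisGroup Gal(L/F) (𝓞 F) (𝓞 L) :=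
  IsGaloisGroup.of_isFractionRing Gal(L/F) (𝓞 F) (𝓞 L) F L

theorem smul_eq (σ : Gal(L/F)) (x : 𝓞 L) : σ • x = galRestrict (𝓞 F) F L (𝓞 L) σ x := by
  apply RingOfIntegers.ext
  exact (algebraMap_galRestrict_apply (𝓞 F) σ x).symm

theorem scc : SMulCommClass Gal(L/F) (𝓞 F) (𝓞 L) := by
  refine ⟨fun σ a x => ?_⟩
  rw [smul_eq, smul_eq, map_smul]

/-- Frobenius predicate -/
def Fr (σ : Gal(L/F)) (Q : Ideal (𝓞 L)) (q : ℕ) : Prop := ∀ x : 𝓞 L, σ • x - x ^ q ∈ Q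

theorem card_quot (P : Ideal (𝓞 L)) : Nat.card (𝓞 L ⧸ P) = Ideal.absNorm P := by
  rw [Ideal.absNorm_apply, Submodule.cardQuot_apply]

attribute [local instance] scc in
theorem Fr.isArith {σ : Gal(L/F)} {Q : Ideal (𝓞 L)} (h : Fr σ Q (Ideal.absNorm (Q.under (𝓞 F)))) :
    IsArithFrobAt (𝓞 F) σ Q := by
  intro x
  have := h x
  rw [← card_quot] at this
  exact this

attribute [local instance] scc in
theorem Fr.unique {σ τ : Gal(L/F)} {Q : Ideal (𝓞 L)} [Q.IsPrime]
    (h : Fr σ Q (Ideal.absNorm (Q.under (𝓞 F)))) (h' : Fr τ Q (Ideal.absNorm (Q.under (𝓞 F))))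
    {p : ℕ} (hp : p.Prime) (hd : ¬ (p:ℤ) ∣ discr L) (hP : (p : 𝓞 L) ∈ Q) : σ = τ := by
  have := unram (F := F) hp hd Q hP
  have h1 := AlgHom.IsArithFrobAt.eq_of_isUnramifiedAt h.isArith h'.isArith
    (Ideal.primeCompl_le_nonZeroDivisors Q)
  ext x
  obtain ⟨a, b, hb, rfl⟩ := IsFractionRing.div_surjective (A := 𝓞 L) x
  have e : ∀ a : 𝓞 L, σ (algebraMap (𝓞 L) L a) = τ (algebraMap (𝓞 L) L a) := by
    intro a
    have := congrArg (algebraMap (𝓞 L) L) (DFunLike.congr_fun h1 a)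
    exact this
  rw [map_div₀, map_div₀, e, e]

theorem exists_Fr [IsGalois F L] (Q : Ideal (𝓞 L)) [Q.IsPrime] (hQ : Q ≠ ⊥) :
    ∃ σ : Gal(L/F), Fr σ Q (Ideal.absNorm (Q.under (𝓞 F))) := by
  have := galgrp (F := F) (L := L)
  have : Finite (𝓞 L ⧸ Q) := Ideal.finiteQuotientOfFreeOfNeBot Q hQ
  obtain ⟨σ, h⟩ := IsArithFrobAt.exists_of_isInvariant (𝓞 F) Gal(L/F) Q
  refine ⟨σ, fun x => ?_⟩
  have := h x
  rw [card_quot] at this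
  exact this


/-- primes over 𝔭 and norms -/
theorem norm_eq (Q : Ideal (𝓞 L)) [Q.IsPrime] (hQ : Q ≠ ⊥) :
    Ideal.absNorm Q = Ideal.absNorm (Q.under (𝓞 F)) ^ Q.inertiaDeg (𝓞 F) := by
  have : Q.IsMaximal := Ideal.IsPrime.isMaximal ‹_› hQ
  have : (Q.under (𝓞 F)).IsMaximal := inferInstance
  rw [← Ideal.absNorm_relNorm (𝓞 F), Ideal.relNorm_eq_pow_of_isMaximal Q (Q.under (𝓞 F)), map_pow]

theorem under_ne {Q : Ideal (𝓞 L)} (hQ : Q ≠ ⊥) : Q.under (𝓞 F) ≠ ⊥ :=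
  fun h => hQ (Ideal.eq_bot_of_comap_eq_bot h)

theorem norm_of_id (Q : Ideal (𝓞 L)) [Q.IsPrime] (hQ : Q ≠ ⊥) {q : ℕ}
    (hq : Ideal.absNorm (Q.under (𝓞 F)) = q) (h : ∀ x : 𝓞 L, x - x ^ q ∈ Q) :
    Ideal.absNorm Q = q := by
  have hmax : Q.IsMaximal := Ideal.IsPrime.isMaximal ‹_› hQ
  have hq2 : 2 ≤ q := by rw [← hq]; exact two_le_norm inferInstance (under_ne hQ)
  have : Finite (𝓞 L ⧸ Q) := Ideal.finiteQuotientOfFreeOfNeBot Q hQ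
  have hle : Ideal.absNorm Q ≤ q := by
    rw [← card_quot]
    letI := Ideal.Quotient.field Q
    letI := Fintype.ofFinite (𝓞 L ⧸ Q)
    have hne : (Polynomial.X ^ q - Polynomial.X : Polynomial (𝓞 L ⧸ Q)) ≠ 0 :=
      FiniteField.X_pow_card_sub_X_ne_zero _ (by omega)
    have hsub : (Finset.univ : Finset (𝓞 L ⧸ Q)).val ≤ (Polynomial.X ^ q - Polynomial.X : Polynomial (𝓞 L ⧸ Q)).roots := by
      rw [Multiset.le_iff_subset Finset.univ.nodup]
      intro y _
      rw [Polynomial.mem_roots hne]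
      obtain ⟨x, rfl⟩ := Ideal.Quotient.mk_surjective y
      have := Ideal.Quotient.eq_zero_iff_mem.2 (h x)
      simp only [Polynomial.IsRoot, Polynomial.eval_sub, Polynomial.eval_pow, Polynomial.eval_X]
      rw [← map_pow, ← map_sub, ← neg_sub, map_neg, this, neg_zero]
    have h1 := Multiset.card_le_card hsub
    have h2 := Polynomial.card_roots' (Polynomial.X ^ q - Polynomial.X : Polynomial (𝓞 L ⧸ Q))
    rw [FiniteField.X_pow_card_sub_X_natDegree_eq _ (by omega)] at h2
    rw [Nat.card_eq_fintype_card]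
    exact h1.trans h2
  have h3 := norm_eq (F := F) Q hQ
  rw [hq] at h3
  have h4 : Q.inertiaDeg (𝓞 F) ≠ 0 := by
    intro h
    rw [h, pow_zero, Ideal.absNorm_eq_one_iff] at h3
    exact hmax.ne_top h3
  have h5 : q ≤ q ^ Q.inertiaDeg (𝓞 F) := Nat.le_self_pow h4 q
  omega

theorem id_of_norm (Q : Ideal (𝓞 L)) [Q.IsPrime] (hQ : Q ≠ ⊥) {q : ℕ}
    (hq : Ideal.absNorm Q = q) (x : 𝓞 L) : x - x ^ q ∈ Q := by
  have hmax : Q.IsMaximal := Ideal.IsPrime.isMaximal ‹_› hQ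
  have : Finite (𝓞 L ⧸ Q) := Ideal.finiteQuotientOfFreeOfNeBot Q hQ
  letI := Ideal.Quotient.field Q
  letI := Fintype.ofFinite (𝓞 L ⧸ Q)
  rw [← Ideal.Quotient.eq_zero_iff_mem, map_sub, map_pow, sub_eq_zero]
  have := FiniteField.pow_card (Ideal.Quotient.mk Q x)
  rw [← Nat.card_eq_fintype_card, card_quot, hq] at this
  exact this.symm

theorem mem_norm {Q : Ideal (𝓞 L)} {p : ℕ} (h : Ideal.absNorm Q = p) : (p : 𝓞 L) ∈ Q := by
  rw [← h]; exact Ideal.absNorm_mem Q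

theorem norm_under (Q : Ideal (𝓞 L)) [Q.IsPrime] (hQ : Q ≠ ⊥) {p : ℕ} (hp : p.Prime)
    (h : Ideal.absNorm Q = p) : Ideal.absNorm (Q.under (𝓞 F)) = p := by
  have h3 := norm_eq (F := F) Q hQ
  rw [h] at h3
  have h6 := two_le_norm (P := Q.under (𝓞 F)) inferInstance (under_ne hQ)
  rw [h3] at hp
  have := Nat.Prime.eq_one_of_pow hp
  rw [this, pow_one] at h3
  exact h3.symm

end GF
end Mert


namespace Mert

open NumberField Finset Filter Topology MeasureTheory
open scoped Pointwise

section GF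
variable {F L : Type*} [Field F] [NumberField F] [Field L] [NumberField L] [Algebra F L]

open Classical in
theorem cE_split [IsGalois F L] {p : ℕ} (hp : p.Prime) (hd : ¬ (p:ℤ) ∣ discr L) :
    cE L p = Module.finrank F L * ((prm F p).filter (fun 𝔭 => Ideal.absNorm 𝔭 = p ∧
      ∃ P : Ideal (𝓞 L), P.IsPrime ∧ P.under (𝓞 F) = 𝔭 ∧ ∀ x, x - x ^ p ∈ P)).card := by
  have hGG := galgrp (F := F) (L := L)
  rw [cE, Finset.card_eq_sum_card_fiberwise (f := fun P => P.under (𝓞 F)) (t := (prm F p).filter (fun 𝔭 => Ideal.absNorm 𝔭 = p ∧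
      ∃ P : Ideal (𝓞 L), P.IsPrime ∧ P.under (𝓞 F) = 𝔭 ∧ ∀ x, x - x ^ p ∈ P)),
    Finset.sum_const_nat (m := Module.finrank F L), mul_comm]
  · intro 𝔭 h
    simp only [Finset.mem_filter, mem_prm] at h
    obtain ⟨⟨hpr, hne, -⟩, hN, P₀, hP0, hunder, hid⟩ := h
    have hmx : 𝔭.IsMaximal := Ideal.IsPrime.isMaximal hpr hne
    have hP0ne : P₀ ≠ ⊥ := by
      rintro rfl
      apply hne
      rw [← hunder]
      exact Ideal.under_bot (𝓞 F) (𝓞 L)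
    have hover : P₀.LiesOver 𝔭 := ⟨hunder.symm⟩
    have hN0 : Ideal.absNorm P₀ = p := norm_of_id (F := F) P₀ hP0ne (by rw [hunder, hN]) hid
    -- e = 1, f = 1
    have key := Ideal.ncard_primesOver_mul_ramificationIdxIn_mul_inertiaDegIn 𝔭 (𝓞 L) Gal(L/F)
    have hf : Ideal.inertiaDegIn 𝔭 (𝓞 L) = 1 := by
      rw [Ideal.inertiaDegIn_eq_inertiaDeg 𝔭 P₀ Gal(L/F)]
      have h3 := norm_eq (F := F) P₀ hP0ne
      rw [hunder, hN, hN0] at h3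
      exact (Nat.pow_right_injective hp.two_le (by simpa using h3)).symm
    have he : Ideal.ramificationIdxIn 𝔭 (𝓞 L) = 1 := by
      rw [Ideal.ramificationIdxIn_eq_ramificationIdx 𝔭 P₀ Gal(L/F)]
      have := unram (F := F) hp hd P₀ (mem_norm hN0)
      exact Ideal.ramificationIdx_eq_one_of_isUnramifiedAt
    rw [he, hf, mul_one, mul_one, IsGalois.card_aut_eq_finrank] at key
    rw [← key, ← Set.ncard_coe_finset]
    congr 1
    ext P
    simp only [Finset.coe_filter, Finset.mem_filter, mem_prm, Set.mem_setOf_eq, Ideal.primesOver]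
    constructor
    · rintro ⟨⟨⟨h1, h2, -⟩, h3⟩, h4⟩
      exact ⟨h1, ⟨h4.symm⟩⟩
    · rintro ⟨h1, h2⟩
      have hu : P.under (𝓞 F) = 𝔭 := h2.over.symm
      have hPne : P ≠ ⊥ := by
        rintro rfl
        apply hne
        rw [← hu]
        exact Ideal.under_bot (𝓞 F) (𝓞 L)
      have h5 : Ideal.absNorm P = p := by
        have h3 := norm_eq (F := F) P hPne
        rw [hu, hN, ← Ideal.inertiaDegIn_eq_inertiaDeg 𝔭 P Gal(L/F), hf, pow_one] at h3
        exact h3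
      exact ⟨⟨⟨h1, hPne, h5.le⟩, h5⟩, hu⟩
  · intro P hP
    simp only [Finset.coe_filter, mem_prm, Set.mem_setOf_eq] at hP ⊢
    obtain ⟨⟨h1, h2, -⟩, h3⟩ := hP
    have h4 := norm_under (F := F) P h2 hp h3
    exact ⟨⟨inferInstance, under_ne h2, h4.le⟩, h4, P, h1, rfl, id_of_norm P h2 h3⟩

end GF

section Tower
variable {F K Ω : Type*} [Field F] [NumberField F] [Field K] [NumberField K] [Algebra F K]
  [Field Ω] [NumberField Ω] [Algebra F Ω] [Algebra K Ω] [IsScalarTower F K Ω]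

/-- restriction of Frobenius -/
theorem Fr.restr [IsGalois F K] {σ : Gal(Ω/F)} {Q : Ideal (𝓞 Ω)} {q : ℕ} (h : Fr σ Q q) :
    Fr (AlgEquiv.restrictNormalHom K σ) (Q.under (𝓞 K)) q := by
  intro x
  rw [Ideal.under, Ideal.mem_comap]
  have := h (algebraMap (𝓞 K) (𝓞 Ω) x)
  have e : σ • (algebraMap (𝓞 K) (𝓞 Ω) x) =
      algebraMap (𝓞 K) (𝓞 Ω) ((AlgEquiv.restrictNormalHom K σ) • x) := by
    apply RingOfIntegers.ext
    change σ (algebraMap K Ω (x : K)) = algebraMap K Ω ((AlgEquiv.restrictNormalHom K σ) (x : K))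
    exact (AlgEquiv.restrictNormal_commutes σ K (x : K)).symm
  rw [map_sub, ← e, map_pow]
  exact this

/-- Frobenius element in abelian extension independent of the prime -/
theorem Fr.unique' [IsGalois F K] (hab : ∀ σ τ : Gal(K/F), σ * τ = τ * σ)
    {σ τ : Gal(K/F)} {Q Q' : Ideal (𝓞 K)} [Q.IsPrime] [Q'.IsPrime] {q : ℕ}
    {𝔭 : Ideal (𝓞 F)} [𝔭.IsPrime] (hQ : Q.under (𝓞 F) = 𝔭) (hQ' : Q'.under (𝓞 F) = 𝔭) (hq : Ideal.absNorm 𝔭 = q)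
    (h : Fr σ Q q) (h' : Fr τ Q' q)
    {p : ℕ} (hp : p.Prime) (hd : ¬ (p:ℤ) ∣ discr K) (hP : (p : 𝓞 F) ∈ 𝔭) : σ = τ := by
  have hGG := galgrp (F := F) (L := K)
  have : Q.LiesOver 𝔭 := ⟨hQ.symm⟩
  have : Q'.LiesOver 𝔭 := ⟨hQ'.symm⟩
  obtain ⟨g, hg⟩ := Ideal.exists_smul_eq_of_isGaloisGroup 𝔭 Q' Q Gal(K/F)
  have h2 : Fr τ Q q := by
    intro x
    have h3 := h' (g⁻¹ • x)
    have h4 : g • (τ • g⁻¹ • x - (g⁻¹ • x)^q) ∈ g • Q' := Ideal.smul_mem_pointwise_smul _ _ _ h3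
    rw [hg, smul_sub, smul_pow', smul_inv_smul, smul_smul, smul_smul] at h4
    rw [hab g, mul_assoc, mul_inv_cancel, mul_one] at h4
    exact h4
  subst hq
  rw [← hQ] at h h2
  refine Fr.unique h h2 hp hd ?_
  rw [← hQ] at hP
  have := (Ideal.mem_comap.1 hP)
  simpa using this

end Tower
end Mert


namespace Mert

open NumberField Finset Filter Topology MeasureTheory
open scoped Pointwise IntermediateField

section Cyc
variable {F K Ω : Type*} [Field F] [NumberField F] [Field K] [NumberField K] [Algebra F K]
  [Field Ω] [NumberField Ω] [Algebra F Ω] [Algebra K Ω] [IsScalarTower F K Ω]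
  {m : ℕ} [NeZero m] [IsCyclotomicExtension {m} K Ω] {ζ : Ω} (hζ : IsPrimitiveRoot ζ m)

include hζ in
omit [NumberField F] [NumberField K] [NumberField Ω] [Algebra F K] [IsScalarTower F K Ω] in
theorem cyc_top (T : IntermediateField F Ω) (h1 : ζ ∈ T) (h2 : ∀ a : K, algebraMap K Ω a ∈ T) :
    T = ⊤ := by
  rw [eq_top_iff]
  intro x _
  have hx : x ∈ Algebra.adjoin K {ζ} := by
    rw [IsCyclotomicExtension.adjoin_primitive_root_eq_top hζ]
    trivial
  induction hx using Algebra.adjoin_induction with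
  | mem y hy => rw [Set.mem_singleton_iff.1 hy]; exact h1
  | algebraMap r => exact h2 r
  | add x y _ _ hx hy => exact add_mem (hx trivial) (hy trivial)
  | mul x y _ _ hx hy => exact mul_mem (hx trivial) (hy trivial)

include hζ in
theorem cyc_deg (hm : Nat.Coprime m (discr K).natAbs) :
    Module.finrank ℚ Ω = m.totient * Module.finrank ℚ K ∧
    (discr Ω).natAbs ∣ (m ^ m.totient) ^ Module.finrank ℚ K * (discr K).natAbs ^ m.totient := by
  have hc1 : IsCyclotomicExtension {m} ℚ ℚ⟮ζ⟯ :=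
    hζ.intermediateField_adjoin_isCyclotomicExtension ℚ
  have hG : IsGalois ℚ ℚ⟮ζ⟯ := IsCyclotomicExtension.isGalois {m} ℚ ℚ⟮ζ⟯
  set K₂ : IntermediateField ℚ Ω := (IsScalarTower.toAlgHom ℚ K Ω).fieldRange with hK2
  have e : K ≃ₐ[ℚ] K₂ := AlgEquiv.ofInjectiveField (IsScalarTower.toAlgHom ℚ K Ω)
  have hd2 : discr K = discr K₂ := discr_eq_discr_of_algEquiv K e
  have hr2 : Module.finrank ℚ K = Module.finrank ℚ K₂ := e.toLinearEquiv.finrank_eq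
  have hd1 := IsCyclotomicExtension.Rat.natAbs_discr m ℚ⟮ζ⟯
  have hd1' : (discr ℚ⟮ζ⟯).natAbs ∣ m ^ m.totient := by
    rw [hd1]
    exact Nat.div_dvd_of_dvd (Nat.prod_primeFactors_pow_totient_ediv_dvd (NeZero.pos _))
  have hr1 : Module.finrank ℚ ℚ⟮ζ⟯ = m.totient :=
    IsCyclotomicExtension.finrank ℚ⟮ζ⟯ (Polynomial.cyclotomic.irreducible_rat (NeZero.pos m))
  have hcop : IsCoprime (discr ℚ⟮ζ⟯) (discr K₂) := by
    rw [Int.isCoprime_iff_nat_coprime, ← hd2]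
    exact Nat.Coprime.coprime_dvd_left hd1' (Nat.Coprime.pow_left _ hm)
  have hdisj : (ℚ⟮ζ⟯ : IntermediateField ℚ Ω).LinearDisjoint K₂ :=
    linearDisjoint_of_isGalois_isCoprime_discr _ _ _ hcop
  have htop : ℚ⟮ζ⟯ ⊔ K₂ = ⊤ := by
    refine cyc_top (K := K) hζ _ ?_ ?_
    · exact (le_sup_left : ℚ⟮ζ⟯ ≤ ℚ⟮ζ⟯ ⊔ K₂) (IntermediateField.mem_adjoin_simple_self ℚ ζ)
    · intro a
      exact (le_sup_right : K₂ ≤ ℚ⟮ζ⟯ ⊔ K₂) ⟨a, rfl⟩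
  constructor
  · have := hdisj.finrank_sup
    rw [htop, IntermediateField.finrank_top'] at this
    rw [this, hr1, hr2]
  · rw [natAbs_discr_eq_natAbs_discr_pow_mul_natAbs_discr_pow _ _ _ hdisj htop
      (isCoprime_differentIdeal_of_isCoprime_discr _ hcop), hr1, ← hr2, ← hd2]
    exact mul_dvd_mul (pow_dvd_pow_of_dvd hd1' _) dvd_rfl

include hζ in
omit [NumberField K] in
theorem cyc_gal [IsGalois F K] : IsGalois F Ω := by
  have hc1 : IsCyclotomicExtension {m} F F⟮ζ⟯ :=
    hζ.intermediateField_adjoin_isCyclotomicExtension F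
  have hG : IsGalois F F⟮ζ⟯ := IsCyclotomicExtension.isGalois {m} F F⟮ζ⟯
  set K₂ : IntermediateField F Ω := (IsScalarTower.toAlgHom F K Ω).fieldRange with hK2
  have e : K ≃ₐ[F] K₂ := AlgEquiv.ofInjectiveField (IsScalarTower.toAlgHom F K Ω)
  have hG2 : IsGalois F K₂ := IsGalois.of_algEquiv e
  have htop : F⟮ζ⟯ ⊔ K₂ = ⊤ := by
    refine cyc_top (K := K) hζ _ ?_ ?_
    · exact (le_sup_left : F⟮ζ⟯ ≤ F⟮ζ⟯ ⊔ K₂) (IntermediateField.mem_adjoin_simple_self F ζ)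
    · intro a
      exact (le_sup_right : K₂ ≤ F⟮ζ⟯ ⊔ K₂) ⟨a, rfl⟩
  have : IsGalois F ↥(F⟮ζ⟯ ⊔ K₂) := inferInstance
  rw [htop] at this
  exact IsGalois.of_algEquiv (IntermediateField.topEquiv (F := F) (E := Ω))

/-- the Galois group map -/
noncomputable def gmap (F K : Type*) {Ω : Type*} [Field F] [Field K] [Algebra F K] [Field Ω]
    [Algebra F Ω] [Algebra K Ω] [IsScalarTower F K Ω] [IsGalois F K] {m : ℕ} [NeZero m] {ζ : Ω}
    (hζ : IsPrimitiveRoot ζ m) :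
    Gal(Ω/F) →* Gal(K/F) × (ZMod m)ˣ :=
  (AlgEquiv.restrictNormalHom K).prod (hζ.autToPow F)

omit [NumberField F] [NumberField K] [NumberField Ω] in
theorem gmap_inj [IsGalois F K] : Function.Injective (gmap F K hζ) := by
  rw [injective_iff_map_eq_one]
  intro σ h
  have h1 : AlgEquiv.restrictNormalHom K σ = 1 := congrArg Prod.fst h
  have h2 : hζ.autToPow F σ = 1 := congrArg Prod.snd h
  have h3 := hζ.autToPow_spec F σ
  have key : ∀ x : Ω, σ x = x → x ∈ IntermediateField.fixedField (Subgroup.zpowers σ) := by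
    intro x hx
    rw [IntermediateField.mem_fixedField_iff]
    have : Subgroup.zpowers σ ≤ MulAction.stabilizer Gal(Ω/F) x :=
      Subgroup.zpowers_le.2 hx
    exact fun f hf => this hf
  have hζ1 : σ ζ = ζ := by
    rw [← h3, h2, Units.val_one]
    rcases eq_or_ne m 1 with rfl | h1
    · have : ζ = 1 := by simpa using hζ
      simp [this]
    · have : Fact (1 < m) := ⟨by have := NeZero.ne m; omega⟩
      rw [ZMod.val_one, pow_one]
  have hfix : IntermediateField.fixedField (Subgroup.zpowers σ) = ⊤ := by
    refine cyc_top (K := K) hζ _ (key _ hζ1) fun a => key _ ?_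
    have := AlgEquiv.restrictNormal_commutes σ K a
    rw [show AlgEquiv.restrictNormal σ K = 1 from h1] at this
    exact this.symm
  ext x
  have hx : x ∈ IntermediateField.fixedField (Subgroup.zpowers σ) := by rw [hfix]; trivial
  rw [IntermediateField.mem_fixedField_iff] at hx
  exact hx σ (Subgroup.mem_zpowers σ)

include hζ in
theorem gmap_card [IsGalois F K] (hm : Nat.Coprime m (discr K).natAbs) :
    Nat.card Gal(Ω/F) = m.totient * Nat.card Gal(K/F) := by
  have := cyc_gal (F := F) (K := K) hζ
  rw [IsGalois.card_aut_eq_finrank, IsGalois.card_aut_eq_finrank]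
  have h1 := (cyc_deg hζ hm).1
  rw [← Module.finrank_mul_finrank ℚ F Ω, ← Module.finrank_mul_finrank ℚ F K] at h1
  have h2 : 0 < Module.finrank ℚ F := Module.finrank_pos
  refine Nat.eq_of_mul_eq_mul_left h2 ?_
  rw [h1]; ring

theorem gmap_bij [IsGalois F K] (hm : Nat.Coprime m (discr K).natAbs) :
    Function.Bijective (gmap F K hζ) := by
  have := cyc_gal (F := F) (K := K) hζ
  refine (Nat.bijective_iff_injective_and_card _).2 ⟨gmap_inj hζ, ?_⟩
  rw [gmap_card (F := F) hζ hm, Nat.card_prod, Nat.card_eq_fintype_card (α := (ZMod m)ˣ),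
    ZMod.card_units_eq_totient, mul_comm]

end Cyc
end Mert


namespace Mert

open NumberField Finset Filter Topology MeasureTheory
open scoped Pointwise IntermediateField

universe u v

open Classical in
/-- for p prime: number of degree one primes over p whose Artin symbol lies in Q -/
noncomputable def cnt' {F : Type*} [Field F] [NumberField F] {G : Type*} [Group G] {m : ℕ}
    (fr : Ideal (𝓞 F) → G) (Q : Subgroup (G × (ZMod m)ˣ)) (p : ℕ) (u : (ZMod m)ˣ) : ℕ :=
  ((prm F p).filter (fun 𝔭 => Ideal.absNorm 𝔭 = p ∧ (fr 𝔭, u) ∈ Q)).card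

attribute [local instance] scc in
theorem cyc_frob {F Ω : Type*} [Field F] [NumberField F] [Field Ω] [NumberField Ω] [Algebra F Ω]
    {m : ℕ} [NeZero m] {ζ : Ω} (hζ : IsPrimitiveRoot ζ m) {Q : Ideal (𝓞 Ω)} (hQ : Q.IsPrime)
    {p : ℕ} (hp : p.Prime) (hpm : ¬ p ∣ m) (hpQ : (p : 𝓞 Ω) ∈ Q)
    (hN : Ideal.absNorm (Q.under (𝓞 F)) = p) {σ : Gal(Ω/F)} (hσ : Fr σ Q p)
    (u : (ZMod m)ˣ) (hu : (u : ZMod m) = p) : hζ.autToPow F σ = u := by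
  have hmQ : (m : 𝓞 Ω) ∉ Q := by
    intro h
    have hc : IsCoprime (p : ℤ) (m : ℤ) := Nat.isCoprime_iff_coprime.2 ((Nat.Prime.coprime_iff_not_dvd hp).2 hpm)
    obtain ⟨a, b, hab⟩ := hc
    apply hQ.ne_top
    rw [Ideal.eq_top_iff_one]
    have h1 : (1 : 𝓞 Ω) = a * p + b * m := by
      have := congrArg (fun z : ℤ => (z : 𝓞 Ω)) hab
      push_cast at this
      exact this.symm
    rw [h1]
    exact add_mem (Q.mul_mem_left _ hpQ) (Q.mul_mem_left _ h)
  have hF : Fr σ Q (Ideal.absNorm (Q.under (𝓞 F))) := by rw [hN]; exact hσ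
  have h1 := AlgHom.IsArithFrobAt.apply_of_pow_eq_one (ζ := hζ.toInteger) (m := m) hF.isArith
    hζ.toInteger_isPrimitiveRoot.pow_eq_one hmQ
  rw [card_quot, hN] at h1
  have h2 : σ ζ = ζ ^ p := by
    have := congrArg (algebraMap (𝓞 Ω) Ω) h1
    rw [map_pow] at this
    exact this
  have h3 := hζ.autToPow_spec F σ
  rw [h2, ← pow_mod_orderOf ζ p, ← hζ.eq_orderOf] at h3
  have h4 := hζ.pow_inj (ZMod.val_lt _) (Nat.mod_lt _ (NeZero.pos m)) h3
  apply Units.ext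
  rw [hu]
  have := congrArg (fun k : ℕ => (k : ZMod m)) h4
  simpa using this

theorem field_data {F : Type u} {K : Type v} [Field F] [NumberField F] [Field K] [NumberField K]
    [Algebra F K] [IsGalois F K] (hab : ∀ σ τ : Gal(K/F), σ * τ = τ * σ)
    (fr : Ideal (𝓞 F) → Gal(K/F))
    (hfr : ∀ 𝔭 : Ideal (𝓞 F), 𝔭.IsPrime → 𝔭 ≠ ⊥ → ∃ 𝔔 : Ideal (𝓞 K), 𝔔.IsPrime ∧
      𝔔.under (𝓞 F) = 𝔭 ∧ Fr (fr 𝔭) 𝔔 (Ideal.absNorm 𝔭))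
    {m : ℕ} [NeZero m] (hm : Nat.Coprime m (discr K).natAbs)
    (Q : Subgroup (Gal(K/F) × (ZMod m)ˣ)) :
    ∃ (E : Type v) (_ : Field E) (_ : NumberField E),
      Module.finrank ℚ E = Module.finrank ℚ F * Q.index ∧
      (discr E).natAbs ≤ (m ^ Module.finrank ℚ K * (discr K).natAbs) ^ Q.index ∧
      ∀ p : ℕ, p.Prime → ¬ p ∣ m → ¬ (p:ℤ) ∣ discr K → ∀ u : (ZMod m)ˣ, (u : ZMod m) = p →
        cE E p = Q.index * cnt' fr Q p u := by
  classical
  set Ω := CyclotomicField m K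
  have hζ : IsPrimitiveRoot (IsCyclotomicExtension.zeta m K Ω) m :=
    IsCyclotomicExtension.zeta_spec m K Ω
  have hG := cyc_gal (F := F) (K := K) hζ
  have hbij := gmap_bij (F := F) hζ hm
  set Φ := gmap F K hζ with hΦ
  set H : Subgroup Gal(Ω/F) := Q.comap Φ with hH
  have hindex : H.index = Q.index := Subgroup.index_comap_of_surjective Q hbij.2
  have hcomm : ∀ σ τ : Gal(Ω/F), σ * τ = τ * σ := by
    intro σ τ
    apply hbij.1
    rw [map_mul, map_mul]
    exact Prod.ext (hab _ _) (mul_comm _ _)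
  have hHn : H.Normal := ⟨fun a ha g => by rw [hcomm g, mul_assoc, mul_inv_cancel, mul_one]; exact ha⟩
  set E : IntermediateField F Ω := IntermediateField.fixedField H with hE
  have hGE : IsGalois F E := IsGalois.of_fixedField_normal_subgroup H
  have hNE : NumberField E := inferInstance
  have hfinH : Module.finrank F E = Q.index := by
    rw [IntermediateField.finrank_eq_fixingSubgroup_index, hE, IntermediateField.fixingSubgroup_fixedField, hindex]
  obtain ⟨hdeg, hdisc⟩ := cyc_deg hζ hm
  have hQ0 : Q.index ≠ 0 := by rw [← hfinH]; exact Module.finrank_pos.ne'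
  refine ⟨E, inferInstance, hNE, ?_, ?_, ?_⟩
  · rw [← Module.finrank_mul_finrank ℚ F E, hfinH]
  · have h1 := natAbs_discr_eq_absNorm_differentIdeal_mul_natAbs_discr_pow E (𝓞 E) Ω (𝓞 Ω)
    have hm0 : 0 < m := NeZero.pos m
    have hdK : 0 < (discr K).natAbs := Int.natAbs_pos.2 (discr_ne_zero K)
    have hdΩ : 0 < (discr Ω).natAbs := Int.natAbs_pos.2 (discr_ne_zero Ω)
    have h2 : (discr E).natAbs ^ Module.finrank E Ω ≤ (discr Ω).natAbs :=
      Nat.le_of_dvd hdΩ (by rw [h1]; exact Dvd.intro_left _ rfl)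
    have h3 := Nat.le_of_dvd (by positivity) hdisc
    set B := m ^ Module.finrank ℚ K * (discr K).natAbs with hB
    have hB0 : 0 < B := by positivity
    have h4 : (m ^ m.totient) ^ Module.finrank ℚ K * (discr K).natAbs ^ m.totient = B ^ m.totient := by
      rw [hB, mul_pow, ← pow_mul, ← pow_mul, mul_comm m.totient]
    have hc := gmap_card (F := F) hζ hm
    have hc2 : Nat.card Gal(Ω/F) = Q.index * Module.finrank E Ω := by
      rw [IsGalois.card_aut_eq_finrank, ← Module.finrank_mul_finrank F E Ω, hfinH]
    have h5 : B ^ m.totient ≤ (B ^ Q.index) ^ Module.finrank E Ω := by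
      rw [← pow_mul, ← hc2, hc]
      exact Nat.pow_le_pow_right hB0 (Nat.le_mul_of_pos_right _ Nat.card_pos)
    have h6 : Module.finrank E Ω ≠ 0 := Module.finrank_pos.ne'
    exact (Nat.pow_le_pow_iff_left h6).1 (h2.trans (h3.trans (h4.le.trans h5)))
  · intro p hp hpm hpd u hu
    have hpΩ : ¬ (p:ℤ) ∣ discr Ω := by
      intro h
      have h1 : p ∣ (discr Ω).natAbs := Int.natCast_dvd.1 h
      rcases (Nat.Prime.dvd_mul hp).1 (h1.trans hdisc) with h | h
      · exact hpm (hp.dvd_of_dvd_pow (hp.dvd_of_dvd_pow h))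
      · exact hpd (Int.natCast_dvd.2 (hp.dvd_of_dvd_pow h))
    have hpE : ¬ (p:ℤ) ∣ discr E := fun h => hpΩ (h.trans (discr_dvd_discr E Ω))
    rw [cE_split (F := F) hp hpE, hfinH, cnt']
    congr 2
    apply Finset.filter_congr
    intro 𝔭 h𝔭
    rw [mem_prm] at h𝔭
    obtain ⟨hpr, hne, -⟩ := h𝔭
    refine and_congr_right fun hN => ?_
    have hne' : ∀ {L : Type v} [Field L] [NumberField L] [Algebra F L] (P : Ideal (𝓞 L)),
        P.under (𝓞 F) = 𝔭 → P ≠ ⊥ := by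
      rintro L _ _ _ P h rfl
      apply hne
      rw [← h]
      exact Ideal.under_bot (𝓞 F) (𝓞 L)
    -- key: for P over 𝔭 in E
    have key : ∀ P : Ideal (𝓞 E), P.IsPrime → P.under (𝓞 F) = 𝔭 →
        ((∀ x, x - x ^ p ∈ P) ↔ (fr 𝔭, u) ∈ Q) := by
      intro P hP hPu
      obtain ⟨⟨Q', hQ'1, hQ'2⟩⟩ : Nonempty (Ideal.primesOver P (𝓞 Ω)) := inferInstance
      have hQP : Q'.under (𝓞 E) = P := hQ'2.over.symm
      have hQF : Q'.under (𝓞 F) = 𝔭 := by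
        rw [← hPu, ← hQP, Ideal.under_under]
      obtain ⟨σ, hσ⟩ := exists_Fr (F := F) Q' (hne' Q' hQF)
      rw [hQF, hN] at hσ
      have hpQ : (p : 𝓞 F) ∈ 𝔭 := mem_norm hN
      have hσK : AlgEquiv.restrictNormalHom K σ = fr 𝔭 := by
        have h1 := Fr.restr (K := K) hσ
        obtain ⟨𝔔, h2, h3, h4⟩ := hfr 𝔭 hpr hne
        rw [hN] at h4
        have : (Q'.under (𝓞 K)).under (𝓞 F) = 𝔭 := by rw [Ideal.under_under, hQF]
        exact Fr.unique' hab this h3 hN h1 h4 hp hpd hpQ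
      have hpQ' : (p : 𝓞 Ω) ∈ Q' := by
        have hpQ2 := hpQ
        rw [← hQF] at hpQ2
        simpa using (Ideal.mem_comap.1 hpQ2)
      have hσm : hζ.autToPow F σ = u := cyc_frob hζ hQ'1 hp hpm hpQ' (hQF ▸ hN) hσ u hu
      have hmem : (fr 𝔭, u) ∈ Q ↔ σ ∈ H := by
        rw [← hσK, ← hσm]; rfl
      have hσE := Fr.restr (K := E) hσ
      rw [hQP] at hσE
      rw [hmem]
      have hker : σ ∈ H ↔ AlgEquiv.restrictNormalHom E σ = 1 := by
        rw [← MonoidHom.mem_ker, IntermediateField.restrictNormalHom_ker, hE, IntermediateField.fixingSubgroup_fixedField]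
      rw [hker]
      constructor
      · intro h
        have h1 : Fr (1 : Gal(E/F)) P p := by
          intro x; rw [one_smul]; exact h x
        have hN' : Ideal.absNorm (P.under (𝓞 F)) = p := by rw [hPu, hN]
        rw [← hN'] at hσE h1
        refine Fr.unique hσE h1 hp hpE ?_
        rw [← hPu] at hpQ
        simpa using (Ideal.mem_comap.1 hpQ)
      · intro h x
        have := hσE x
        rw [h, one_smul] at this
        exact this
    constructor
    · rintro ⟨P, h1, h2, h3⟩
      exact (key P h1 h2).1 h3
    · intro h
      obtain ⟨⟨P, hP1, hP2⟩⟩ : Nonempty (Ideal.primesOver 𝔭 (𝓞 E)) := inferInstance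
      exact ⟨P, hP1, hP2.over.symm, (key P hP1 hP2.over.symm).2 h⟩

end Mert


namespace Mert

open NumberField Finset Filter Topology MeasureTheory

/-- primes with prescribed order of a given base -/
theorem prime_order {b k : ℕ} (hk : 1 < k) (hb : 2 ≤ b) (hkb : k ∣ b) :
    ∃ p : ℕ, p.Prime ∧ ¬ p ∣ b ∧ orderOf (b : ZMod p) = k ∧ p ≤ b ^ k ∧ p ≡ 1 [MOD k] := by
  have hgt : 1 < (Polynomial.eval (↑b) (Polynomial.cyclotomic k ℤ)).natAbs := by
    calc
      1 ≤ b - 1 := le_tsub_of_add_le_left hb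
      _ < _ := Polynomial.sub_one_lt_natAbs_cyclotomic_eval hk (by omega)
  obtain ⟨p, hpp, hpd⟩ := Nat.exists_prime_and_dvd (ne_of_lt hgt).symm
  have hprime : Fact p.Prime := ⟨hpp⟩
  have hroot : Polynomial.IsRoot (Polynomial.cyclotomic k (ZMod p)) (Nat.castRingHom (ZMod p) b) := by
    have : ((b : ℤ) : ZMod p) = ↑(Int.castRingHom (ZMod p) b) := by simp
    rw [Polynomial.IsRoot.def, ← Polynomial.map_cyclotomic_int k (ZMod p), Polynomial.eval_map,
      Nat.coe_castRingHom,
      ← Int.cast_natCast, this, Polynomial.eval₂_hom, Int.coe_castRingHom, ZMod.intCast_zmod_eq_zero_iff_dvd]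
    apply Int.dvd_natAbs.1
    exact mod_cast hpd
  have hpb : ¬p ∣ b :=
    hprime.1.coprime_iff_not_dvd.1 (Polynomial.coprime_of_root_cyclotomic (by omega) hroot).symm
  have hdiv : orderOf (b : ZMod p) ∣ p - 1 :=
    ZMod.orderOf_dvd_card_sub_one (mt (CharP.cast_eq_zero_iff _ _ _).1 hpb)
  have : NeZero (k : ZMod p) :=
    NeZero.of_not_dvd (ZMod p) fun hpk => hpb (hpk.trans hkb)
  have ho : k = orderOf (b : ZMod p) := (Polynomial.isRoot_cyclotomic_iff.mp hroot).eq_orderOf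
  refine ⟨p, hpp, hpb, ho.symm, ?_, ?_⟩
  · have h1 : (b : ZMod p) ^ k = 1 := by rw [ho]; exact pow_orderOf_eq_one _
    have h2 : ((b ^ k - 1 : ℕ) : ZMod p) = 0 := by
      rw [Nat.cast_sub (Nat.one_le_pow _ _ (by omega))]
      push_cast
      rw [h1, sub_self]
    rw [CharP.cast_eq_zero_iff (ZMod p) p] at h2
    have h3 : 1 < b ^ k := Nat.one_lt_pow (by omega) (by omega)
    have := Nat.le_of_dvd (by omega) h2
    omega
  · rw [← ho] at hdiv
    exact ((Nat.modEq_iff_dvd' hprime.1.pos).2 hdiv).symm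

theorem supply (n : ℕ) (hn : 0 < n) (D : ℕ) (hD : 0 < D) : ∃ c : ℕ, ∀ k : ℕ, ∃ r : Fin k → ℕ,
    (∀ i, (r i).Prime) ∧ (∀ i, r i ≡ 1 [MOD 2 * n]) ∧ (∀ i, Nat.Coprime (r i) D) ∧
    Function.Injective r ∧ ∏ i, r i ≤ 2 ^ (c * (k + 1) ^ 4) := by
  obtain ⟨e, he⟩ : ∃ e : ℕ, 2 * n * D ≤ 2 ^ e := ⟨_, Nat.lt_two_pow_self.le⟩
  refine ⟨(e + 1) * (2 * n), fun k => ?_⟩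
  set b := 2 * n * D * k.factorial with hb
  have hkf : 0 < k.factorial := Nat.factorial_pos k
  have hb2 : 2 ≤ b := by
    rw [hb]
    have : 0 < n * D * k.factorial := by positivity
    nlinarith
  have hbl : b ≤ 2 ^ ((e + 1) * (k + 1) ^ 2) := by
    calc b ≤ 2 ^ e * (k+1) ^ (k+1) := by
          apply Nat.mul_le_mul he
          exact (Nat.factorial_le_pow k).trans ((Nat.pow_le_pow_left (by omega) _).trans
            (Nat.pow_le_pow_right (by omega) (by omega)))
      _ ≤ 2 ^ e * (2 ^ (k+1)) ^ (k+1) := by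
          gcongr
          exact Nat.lt_two_pow_self.le
      _ = 2 ^ (e + (k+1)^2) := by rw [← pow_mul, ← pow_add]; ring_nf
      _ ≤ _ := by
          apply Nat.pow_le_pow_right (by omega)
          have : 1 ≤ (k+1)^2 := Nat.one_le_pow _ _ (by omega)
          nlinarith
  have h : ∀ i : Fin k, ∃ p : ℕ, p.Prime ∧ ¬ p ∣ b ∧ orderOf (b : ZMod p) = 2 * n * (i + 1) ∧
      p ≤ b ^ (2 * n * (i + 1)) ∧ p ≡ 1 [MOD 2 * n * (i + 1)] := by
    intro i
    apply prime_order
    · nlinarith [Nat.zero_le i.1]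
    · exact hb2
    · rw [hb, mul_assoc (2 * n)]
      apply Nat.mul_dvd_mul_left
      apply Dvd.dvd.mul_left
      exact Nat.dvd_factorial (by omega) (by omega)
  choose r h1 h2 h3 h4 h5 using h
  refine ⟨r, h1, fun i => (h5 i).of_mul_right _, ?_, ?_, ?_⟩
  · intro i
    rw [Nat.Prime.coprime_iff_not_dvd (h1 i)]
    intro hd
    apply h2 i
    rw [hb]
    exact (hd.mul_left _).mul_right _
  · intro i j hij
    have e1 := h3 i
    rw [hij, h3 j] at e1
    have := Nat.eq_of_mul_eq_mul_left (by omega) e1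
    exact Fin.ext (by omega)
  · calc ∏ i, r i ≤ ∏ i : Fin k, 2 ^ ((e + 1) * (k + 1) ^ 2 * (2 * n * (k + 1))) := by
          apply Finset.prod_le_prod' 
          intro i _
          rw [pow_mul]
          refine (h4 i).trans ((Nat.pow_le_pow_left hbl _).trans (Nat.pow_le_pow_right (by positivity) ?_))
          apply Nat.mul_le_mul_left
          omega
      _ = 2 ^ ((e + 1) * (k + 1) ^ 2 * (2 * n * (k + 1)) * k) := by
          rw [Finset.prod_const, ← pow_mul]; simp
      _ ≤ _ := by
          apply Nat.pow_le_pow_right (by omega)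
          calc (e + 1) * (k + 1) ^ 2 * (2 * n * (k + 1)) * k ≤ (e + 1) * (k + 1) ^ 2 * (2 * n * (k + 1)) * (k+1) := by gcongr; omega
            _ = _ := by ring

end Mert


namespace Mert

open NumberField Finset Filter Topology MeasureTheory

theorem chars (n : ℕ) (hn : 0 < n) {k : ℕ} (r : Fin k → ℕ) (hp : ∀ i, (r i).Prime)
    (h1 : ∀ i, r i ≡ 1 [MOD 2 * n]) (hinj : Function.Injective r) {m : ℕ} (hm : m = ∏ i, r i) :
    ∃ β : Fin k → ((ZMod m)ˣ →* ℂˣ), (∀ i u, β i u ^ n = 1) ∧ (∀ i, β i (-1) = 1) ∧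
      ∀ a : Fin k → ℕ, (∀ i, a i < n) → (∀ u, ∏ i, β i u ^ a i = 1) → ∀ i, a i = 0 := by
  subst hm
  have hF : ∀ i, Fact (r i).Prime := fun i => ⟨hp i⟩
  have hc : ∀ i, ∃ χ : MulChar (ZMod (r i)) ℂ, orderOf χ = 2 * n := by
    intro i
    refine MulChar.exists_mulChar_orderOf (ZMod (r i)) (n := 2 * n) ?_ (Complex.isPrimitiveRoot_exp _ (by omega))
    rw [ZMod.card]
    exact (Nat.modEq_iff_dvd' (hp i).pos).1 (h1 i).symm
  choose χ hχ using hc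
  have hd : ∀ i, r i ∣ ∏ i, r i := fun i => Finset.dvd_prod_of_mem r (mem_univ i)
  refine ⟨fun i => ((χ i).toUnitHom ^ 2).comp (ZMod.unitsMap (hd i)), ?_, ?_, ?_⟩
  · intro i u
    have h2 : χ i ^ (2 * n) = 1 := by rw [← hχ i]; exact pow_orderOf_eq_one _
    simp only [MonoidHom.comp_apply, MonoidHom.pow_apply]
    rw [← pow_mul]
    ext
    rw [Units.val_pow_eq_pow_val, MulChar.coe_toUnitHom, ← MulChar.pow_apply_coe, h2]
    simp
  · intro i
    have : ZMod.unitsMap (hd i) (-1) = -1 := by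
      ext
      simp [ZMod.unitsMap]
    simp only [MonoidHom.comp_apply, MonoidHom.pow_apply, this]
    rw [← map_pow]
    simp
  · intro a ha h i
    have hcop : Pairwise fun i j => Nat.Coprime (r i) (r j) := by
      intro i j hij
      exact (Nat.coprime_primes (hp i) (hp j)).2 (fun h => hij (hinj h))
    have key : ∀ x : (ZMod (r i))ˣ, ((χ i).toUnitHom x ^ 2) ^ a i = 1 := by
      intro x
      obtain ⟨u, hu⟩ : ∃ u : (ZMod (∏ i, r i))ˣ, ∀ j, ZMod.unitsMap (hd j) u = (Pi.mulSingle i x : ∀ j, (ZMod (r j))ˣ) j := by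
        refine ⟨(Units.mapEquiv (ZMod.prodEquivPi r hcop).toMulEquiv).symm
          (MulEquiv.piUnits.symm (Pi.mulSingle i x)), fun j => ?_⟩
        ext
        simp only [ZMod.unitsMap, Units.coe_map]
        refine (ZMod.prodEquivPi_apply r hcop _ j).symm.trans ?_
        exact congrFun ((ZMod.prodEquivPi r hcop).apply_symm_apply
          (fun j => ((Pi.mulSingle i x : ∀ j, (ZMod (r j))ˣ) j : ZMod (r j)))) j
      have h3 := h u
      rw [Finset.prod_eq_single i] at h3
      · simpa [hu] using h3
      · intro j _ hj
        simp [hu, Pi.mulSingle_eq_of_ne hj]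
      · simp
    have h4 : χ i ^ (2 * a i) = 1 := by
      ext x
      rw [MulChar.pow_apply_coe, ← MulChar.coe_toUnitHom, ← Units.val_pow_eq_pow_val, pow_mul, key]
      simp
    have h5 := orderOf_dvd_of_pow_eq_one h4
    rw [hχ] at h5
    have h6 := Nat.dvd_of_mul_dvd_mul_left (by omega) h5
    exact Nat.eq_zero_of_dvd_of_lt h6 (ha i)

end Mert


namespace Mert

open NumberField Finset Filter Topology MeasureTheory

universe u v

open Classical in
/-- extension by zero of a function on units -/
noncomputable def ext0 {m : ℕ} (H : (ZMod m)ˣ → ℂ) (k : ℕ) : ℂ :=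
  if h : IsUnit (k : ZMod m) then H h.unit else 0

theorem ext0_eq {m : ℕ} (H : (ZMod m)ˣ → ℂ) {k : ℕ} (u : (ZMod m)ˣ) (hu : (u : ZMod m) = k) :
    ext0 H k = H u := by
  have h : IsUnit (k : ZMod m) := hu ▸ u.isUnit
  rw [ext0, dif_pos h]
  congr 1
  ext
  simp [hu]

theorem ext0_zero {m : ℕ} (H : (ZMod m)ˣ → ℂ) {k : ℕ} (h : ¬ IsUnit (k : ZMod m)) :
    ext0 H k = 0 := by
  rw [ext0, dif_neg h]

/-- extension of a character -/
noncomputable def extC {m : ℕ} (χ : (ZMod m)ˣ →* ℂˣ) : ℕ → ℂ := ext0 (fun u => (χ u : ℂ))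

theorem chi_norm {m : ℕ} [NeZero m] (χ : (ZMod m)ˣ →* ℂˣ) (u : (ZMod m)ˣ) : ‖(χ u : ℂ)‖ = 1 := by
  apply Complex.norm_eq_one_of_pow_eq_one (n := Nat.card (ZMod m)ˣ) _ Nat.card_pos.ne'
  rw [← Units.val_pow_eq_pow_val, ← map_pow, pow_card_eq_one']
  simp

theorem extC_hz {m : ℕ} [NeZero m] (χ : (ZMod m)ˣ →* ℂˣ) (k : ℕ) : ‖extC χ k‖ = 1 ∨ extC χ k = 0 := by
  by_cases h : IsUnit (k : ZMod m)
  · left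
    rw [extC, ext0_eq _ h.unit (by simp)]
    exact chi_norm χ _
  · right
    exact ext0_zero _ h

theorem extC_CM {m : ℕ} [NeZero m] (χ : (ZMod m)ˣ →* ℂˣ) : CM (extC χ) where
  one := by
    rw [extC, ext0_eq _ 1 (by simp)]
    simp
  mul a b := by
    by_cases ha : IsUnit (a : ZMod m)
    · by_cases hb : IsUnit (b : ZMod m)
      · rw [extC, ext0_eq (k := a) _ ha.unit (by simp), ext0_eq (k := b) _ hb.unit (by simp),
          ext0_eq (k := a * b) _ (ha.unit * hb.unit) (by simp)]
        simp
      · rw [extC, ext0_zero _ hb, ext0_zero, mul_zero]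
        push_cast
        rw [IsUnit.mul_iff]
        tauto
    · rw [extC, ext0_zero _ ha, ext0_zero, zero_mul]
      push_cast
      rw [IsUnit.mul_iff]
      tauto
  bd a := by
    rcases extC_hz χ a with h | h
    · exact h.le
    · simp [h]

theorem extC_nat {m : ℕ} (χ : (ZMod m)ˣ →* ℂˣ) (h : χ (-1) = 1) (a : ℤ) (u : (ZMod m)ˣ)
    (hu : (u : ZMod m) = a) : extC χ a.natAbs = χ u := by
  rcases Int.natAbs_eq a with h1 | h1
  · rw [extC, ext0_eq _ u]
    rw [hu]
    conv_lhs => rw [h1]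
    simp
  · have h2 : χ (-u) = χ u := by rw [← neg_one_mul, map_mul, h, one_mul]
    rw [extC, ext0_eq _ (-u), h2]
    rw [Units.val_neg, hu]
    conv_lhs => rw [h1]
    simp

theorem extC_Per {m : ℕ} (χ : (ZMod m)ˣ →* ℂˣ) (h : χ (-1) = 1) : Per (extC χ) m := by
  intro a b hab
  have e : (a : ZMod m) = b := (ZMod.intCast_eq_intCast_iff _ _ _).2 hab
  by_cases ha : IsUnit (a : ZMod m)
  · rw [extC_nat χ h a ha.unit (by simp), extC_nat χ h b ha.unit (by simp [e])]
  · have key : ∀ c : ℤ, ¬ IsUnit (c : ZMod m) → extC χ c.natAbs = 0 := by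
      intro c hc
      apply ext0_zero
      intro h2
      apply hc
      rcases Int.natAbs_eq c with h1 | h1
      · rw [h1]; simpa using h2
      · rw [h1]; simpa using h2
    rw [key a ha, key b (e ▸ ha)]

theorem extC_pow {m : ℕ} (χ : (ZMod m)ˣ →* ℂˣ) {j : ℕ} (hj : 0 < j) :
    (fun k => extC χ k ^ j) = extC (χ ^ j) := by
  funext k
  by_cases h : IsUnit (k : ZMod m)
  · rw [extC, ext0_eq _ h.unit (by simp), extC, ext0_eq _ h.unit (by simp)]
    simp
  · rw [extC, ext0_zero _ h, extC, ext0_zero _ h, zero_pow hj.ne']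

theorem card_bad {N : ℕ} (hN : N ≠ 0) : 2 ^ N.primeFactors.card ≤ N := by
  calc 2 ^ N.primeFactors.card = ∏ p ∈ N.primeFactors, 2 := by simp
    _ ≤ ∏ p ∈ N.primeFactors, p := Finset.prod_le_prod' fun p hp => (Nat.prime_of_mem_primeFactors hp).two_le
    _ ≤ N := Nat.le_of_dvd (Nat.pos_of_ne_zero hN) (Nat.prod_primeFactors_dvd N)

section
variable {F : Type u} {K : Type v} [Field F] [NumberField F] [Field K] [NumberField K]
    [Algebra F K] [IsGalois F K]

/-- The field attached to a subgroup -/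
structure FD (fr : Ideal (𝓞 F) → Gal(K/F)) {m : ℕ} (Q : Subgroup (Gal(K/F) × (ZMod m)ˣ))
    (E : Type v) [Field E] [NumberField E] : Prop where
  deg : Module.finrank ℚ E = Module.finrank ℚ F * Q.index
  disc : (discr E).natAbs ≤ (m ^ Module.finrank ℚ K * (discr K).natAbs) ^ Q.index
  cnt : ∀ p : ℕ, p.Prime → ¬ p ∣ m → ¬ (p:ℤ) ∣ discr K → ∀ u : (ZMod m)ˣ, (u : ZMod m) = p →
        cE E p = Q.index * cnt' fr Q p u

/-- restriction of a character to a subgroup -/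
def phi {G : Type*} [Group G] {m : ℕ} (Q : Subgroup (G × (ZMod m)ˣ)) (χ : (ZMod m)ˣ →* ℂˣ) : Q →* ℂˣ :=
  χ.comp ((MonoidHom.snd _ _).comp Q.subtype)

/-- kernel subgroup -/
def kerQ {G : Type*} [Group G] {m : ℕ} (Q : Subgroup (G × (ZMod m)ˣ)) (χ : (ZMod m)ˣ →* ℂˣ) :
    Subgroup (G × (ZMod m)ˣ) := (phi Q χ).ker.map Q.subtype

theorem kerQ_index {G : Type*} [Group G] {m : ℕ} (Q : Subgroup (G × (ZMod m)ˣ)) (χ : (ZMod m)ˣ →* ℂˣ) :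
    (kerQ Q χ).index = (phi Q χ).ker.index * Q.index := Subgroup.index_map_subtype _

theorem mem_kerQ {G : Type*} [Group G] {m : ℕ} (Q : Subgroup (G × (ZMod m)ˣ)) (χ : (ZMod m)ˣ →* ℂˣ)
    (g : G) (x : (ZMod m)ˣ) : (g, x) ∈ kerQ Q χ ↔ (g, x) ∈ Q ∧ χ x = 1 := by
  simp [kerQ, phi, Subgroup.mem_map, MonoidHom.mem_ker, and_comm]

theorem phi_ne {G : Type*} [Group G] {m : ℕ} (Q : Subgroup (G × (ZMod m)ˣ)) (χ : (ZMod m)ˣ →* ℂˣ) :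
    phi Q χ ≠ 1 ↔ ∃ g x, (g, x) ∈ Q ∧ χ x ≠ 1 := by
  constructor
  · intro h
    by_contra h2
    push Not at h2
    apply h
    ext ⟨⟨g, x⟩, hx⟩
    simp [phi, h2 g x hx]
  · rintro ⟨g, x, hx, h1⟩ h
    apply h1
    exact DFunLike.congr_fun h ⟨(g, x), hx⟩

theorem phi_t {G : Type*} [Group G] [Finite G] {m : ℕ} [NeZero m] (Q : Subgroup (G × (ZMod m)ˣ))
    (χ : (ZMod m)ˣ →* ℂˣ) {n : ℕ} (hn : 0 < n) (hχ : χ ^ n = 1) (h : phi Q χ ≠ 1) :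
    2 ≤ (phi Q χ).ker.index ∧ (phi Q χ).ker.index ≤ n ∧
      ∀ j, 0 < j → j < (phi Q χ).ker.index → phi Q (χ ^ j) ≠ 1 := by
  have h0 : (phi Q χ).ker.index ≠ 0 := Subgroup.FiniteIndex.index_ne_zero
  have h1 : (phi Q χ).ker.index ≠ 1 := by
    intro h1
    rw [Subgroup.index_eq_one, MonoidHom.ker_eq_top_iff] at h1
    exact h h1
  have hr : ∀ y ∈ (phi Q χ).range, y ^ n = 1 := by
    rintro _ ⟨q, rfl⟩
    have := DFunLike.congr_fun hχ q.1.2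
    simpa [phi] using this
  refine ⟨by omega, ?_, ?_⟩
  · rw [Subgroup.index_ker]
    haveI : NeZero n := ⟨hn.ne'⟩
    have hle : (phi Q χ).range ≤ rootsOfUnity n ℂ := fun y hy => (mem_rootsOfUnity n y).2 (hr y hy)
    refine (Nat.card_le_card_of_injective _ (Subgroup.inclusion_injective hle)).trans ?_
    exact card_rootsOfUnity ℂ n
  · intro j hj hjt hc
    rw [Subgroup.index_ker] at hjt
    haveI : Finite (phi Q χ).range := Set.finite_range (phi Q χ)
    have h2 := IsCyclic.exponent_eq_card (α := (phi Q χ).range)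
    have h3 : Monoid.exponent (phi Q χ).range ∣ j := by
      apply Monoid.exponent_dvd_of_forall_pow_eq_one
      rintro ⟨_, q, rfl⟩
      have := DFunLike.congr_fun hc q
      apply Subtype.ext
      exact this
    rw [h2] at h3
    exact absurd (Nat.le_of_dvd hj h3) (by omega)

end

end Mert


namespace Mert

open NumberField Finset Filter Topology MeasureTheory

universe u v

section
variable {F : Type u} {K : Type v} [Field F] [NumberField F] [Field K] [NumberField K]
    [Algebra F K] [IsGalois F K]

/-- bad primes -/
noncomputable def bad (K : Type v) [Field K] [NumberField K] (m : ℕ) : Finset ℕ :=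
  (m * (discr K).natAbs).primeFactors

theorem not_bad {m : ℕ} [NeZero m] {p : ℕ} (hp : p.Prime) (h : p ∉ bad K m) :
    ¬ p ∣ m ∧ ¬ (p : ℤ) ∣ discr K := by
  have h0 : m * (discr K).natAbs ≠ 0 :=
    mul_ne_zero (NeZero.ne m) (Int.natAbs_ne_zero.2 (discr_ne_zero K))
  constructor
  · intro h2
    exact h (Nat.mem_primeFactors.2 ⟨hp, h2.mul_right _, h0⟩)
  · intro h2
    exact h (Nat.mem_primeFactors.2 ⟨hp, (Int.natCast_dvd.1 h2).mul_left _, h0⟩)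

theorem unit_of_not_dvd {m p : ℕ} (hp : p.Prime) (h : ¬ p ∣ m) : ∃ u : (ZMod m)ˣ, (u : ZMod m) = p :=
  ⟨ZMod.unitOfCoprime p ((Nat.Prime.coprime_iff_not_dvd hp).2 h), by simp⟩

theorem FD_rel {fr : Ideal (𝓞 F) → Gal(K/F)} {m : ℕ} [NeZero m] {Q : Subgroup (Gal(K/F) × (ZMod m)ˣ)}
    {χ : (ZMod m)ˣ →* ℂˣ} {E : Type v} [Field E] [NumberField E] (h : FD fr Q E)
    {E' : Type v} [Field E'] [NumberField E'] (h' : FD fr (kerQ Q χ) E') :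
    Rel E E' (extC χ) (phi Q χ).ker.index (bad K m) := by
  classical
  intro p hp hb
  obtain ⟨h1, h2⟩ := not_bad hp hb
  obtain ⟨u, hu⟩ := unit_of_not_dvd hp h1
  rw [h.cnt p hp h1 h2 u hu, h'.cnt p hp h1 h2 u hu, extC, ext0_eq _ u hu, kerQ_index]
  by_cases hχ : χ u = 1
  · have : cnt' fr (kerQ Q χ) p u = cnt' fr Q p u := by
      unfold cnt'
      congr 1
      ext 𝔭
      simp [mem_kerQ, hχ]
    rw [this, hχ]
    simp
    ring
  · have h3 : cnt' fr (kerQ Q χ) p u = 0 := by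
      unfold cnt'
      rw [Finset.card_eq_zero, Finset.filter_eq_empty_iff]
      intro 𝔭 _
      simp [mem_kerQ, hχ]
    rw [h3]
    by_cases h4 : cnt' fr Q p u = 0
    · simp [h4]
    · obtain ⟨𝔭, h5⟩ := Finset.card_ne_zero.1 h4
      rw [Finset.mem_filter] at h5
      have h6 := Subgroup.pow_index_mem (phi Q χ).ker ⟨_, h5.2.2⟩
      rw [MonoidHom.mem_ker, map_pow] at h6
      have h7 : (χ u : ℂ) ^ (phi Q χ).ker.index = 1 := by
        rw [← Units.val_pow_eq_pow_val]
        simpa [phi, Units.ext_iff] using h6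
      have h8 : (χ u : ℂ) ≠ 1 := fun h => hχ (Units.ext h)
      rw [geom_sum_eq h8, h7]
      simp

open Classical in
/-- coefficients of the prime sum attached to a subgroup -/
noncomputable def wT (fr : Ideal (𝓞 F) → Gal(K/F)) {m : ℕ} (Q : Subgroup (Gal(K/F) × (ZMod m)ˣ))
    (H : (ZMod m)ˣ → ℂ) (p : ℕ) : ℂ :=
  if h : p.Prime ∧ p ∉ bad K m ∧ IsUnit (p : ZMod m) then cnt' fr Q p h.2.2.unit * H h.2.2.unit else 0

/-- the prime sum attached to a subgroup -/
noncomputable def W (fr : Ideal (𝓞 F) → Gal(K/F)) {m : ℕ} (Q : Subgroup (Gal(K/F) × (ZMod m)ˣ))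
    (H : (ZMod m)ˣ → ℂ) (s : ℝ) : ℂ := ∑' p : ℕ, wT fr Q H p * (((p:ℝ) ^ (-s) : ℝ) : ℂ)

theorem wT_eq (fr : Ideal (𝓞 F) → Gal(K/F)) {m : ℕ} (Q : Subgroup (Gal(K/F) × (ZMod m)ˣ))
    (H : (ZMod m)ˣ → ℂ) {p : ℕ} (hp : p.Prime) (hb : p ∉ bad K m) (u : (ZMod m)ˣ) (hu : (u : ZMod m) = p) :
    wT fr Q H p = cnt' fr Q p u * H u := by
  have h : IsUnit (p : ZMod m) := hu ▸ u.isUnit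
  have e : h.unit = u := Units.ext (by simp [hu])
  rw [wT, dif_pos ⟨hp, hb, h⟩, e]

theorem wT_zero (fr : Ideal (𝓞 F) → Gal(K/F)) {m : ℕ} (Q : Subgroup (Gal(K/F) × (ZMod m)ˣ))
    (H : (ZMod m)ˣ → ℂ) {p : ℕ} (h : ¬ (p.Prime ∧ p ∉ bad K m)) :
    wT fr Q H p = 0 := by
  rw [wT, dif_neg (by tauto)]

theorem cnt'_le (fr : Ideal (𝓞 F) → Gal(K/F)) {m : ℕ} (Q : Subgroup (Gal(K/F) × (ZMod m)ˣ))
    {p : ℕ} (hp : p.Prime) (u : (ZMod m)ˣ) : cnt' fr Q p u ≤ Module.finrank ℚ F := by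
  classical
  refine le_trans ?_ (cE_le (E := F) hp)
  unfold cnt' cE
  apply Finset.card_le_card
  intro 𝔭 h
  rw [Finset.mem_filter] at h ⊢
  exact ⟨h.1, h.2.1⟩

theorem wT_le (fr : Ideal (𝓞 F) → Gal(K/F)) {m : ℕ} (Q : Subgroup (Gal(K/F) × (ZMod m)ˣ))
    (H : (ZMod m)ˣ → ℂ) {c : ℝ} (hc : 0 ≤ c) (hH : ∀ u, ‖H u‖ ≤ c) (p : ℕ) :
    ‖wT fr Q H p‖ ≤ Module.finrank ℚ F * c := by
  by_cases h : p.Prime ∧ p ∉ bad K m ∧ IsUnit (p : ZMod m)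
  · rw [wT, dif_pos h, norm_mul, Complex.norm_natCast]
    gcongr
    · exact cnt'_le fr Q h.1 _
    · exact hH _
  · rw [wT, dif_neg h, norm_zero]
    positivity

theorem W_summable (fr : Ideal (𝓞 F) → Gal(K/F)) {m : ℕ} [NeZero m] (Q : Subgroup (Gal(K/F) × (ZMod m)ˣ))
    (H : (ZMod m)ˣ → ℂ) {s : ℝ} (hs : 1 < s) :
    Summable fun p : ℕ => wT fr Q H p * (((p:ℝ) ^ (-s) : ℝ) : ℂ) := by
  have hc : ∀ u, ‖H u‖ ≤ ∑ u, ‖H u‖ := fun u =>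
    Finset.single_le_sum (f := fun u => ‖H u‖) (fun _ _ => norm_nonneg _) (mem_univ u)
  refine Summable.of_norm_bounded (g := fun k : ℕ => (Module.finrank ℚ F * (∑ u, ‖H u‖) : ℝ) * (k:ℝ) ^ (-s))
    ((Real.summable_nat_rpow.2 (by linarith)).mul_left _) fun k => ?_
  rw [norm_mul, Complex.norm_real, Real.norm_of_nonneg (by positivity)]
  gcongr
  exact wT_le fr Q H (Finset.sum_nonneg fun _ _ => norm_nonneg _) hc k

theorem W_compare {fr : Ideal (𝓞 F) → Gal(K/F)} {m : ℕ} [NeZero m] {Q : Subgroup (Gal(K/F) × (ZMod m)ˣ)}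
    {E : Type v} [Field E] [NumberField E] (h : FD fr Q E) {f : ℕ → ℂ} (hf : ∀ k, ‖f k‖ ≤ 1)
    {H : (ZMod m)ˣ → ℂ} (hH : ∀ (k : ℕ) (u : (ZMod m)ˣ), (u : ZMod m) = k → f k = H u)
    {s s' : ℝ} (hs : 1 < s) (hs' : 1 < s') :
    ‖(U E f s - U E f s') - Q.index * (W fr Q H s - W fr Q H s')‖ ≤
      (bad K m).card * Module.finrank ℚ E * |s - s'| := by
  have key : ∀ s : ℝ, 1 < s → U E f s - Q.index * W fr Q H s =
      ∑ p ∈ bad K m, uT E f p * (((p:ℝ) ^ (-s) : ℝ) : ℂ) := by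
    intro s hs
    rw [U, W, ← tsum_mul_left, ← (U_summable hf hs).tsum_sub ((W_summable fr Q H hs).mul_left _),
      tsum_eq_sum (s := bad K m)]
    · apply Finset.sum_congr rfl
      intro p hp
      rw [wT_zero fr Q H (p := p) (by tauto)]
      ring
    · intro p hp
      by_cases hpp : p.Prime
      · obtain ⟨h1, h2⟩ := not_bad hpp hp
        obtain ⟨u, hu⟩ := unit_of_not_dvd hpp h1
        rw [wT_eq fr Q H hpp hp u hu, uT, if_pos hpp, h.cnt p hpp h1 h2 u hu, hH p u hu]
        push_cast
        ring
      · rw [wT_zero fr Q H (p := p) (by tauto), uT, if_neg hpp]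
        ring
  have e : (U E f s - U E f s') - Q.index * (W fr Q H s - W fr Q H s') =
      ∑ p ∈ bad K m, uT E f p * (((p:ℝ) ^ (-s) - (p:ℝ) ^ (-s') : ℝ) : ℂ) := by
    rw [show (U E f s - U E f s') - Q.index * (W fr Q H s - W fr Q H s') =
      (U E f s - Q.index * W fr Q H s) - (U E f s' - Q.index * W fr Q H s') by ring, key s hs, key s' hs',
      ← Finset.sum_sub_distrib]
    apply Finset.sum_congr rfl
    intro p _
    push_cast
    ring
  rw [e]
  refine (norm_sum_le _ _).trans ?_
  rw [mul_assoc, ← nsmul_eq_mul]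
  apply Finset.sum_le_card_nsmul
  intro p hp
  have hpp := Nat.prime_of_mem_primeFactors hp
  rw [norm_mul, Complex.norm_real, Real.norm_eq_abs]
  refine mul_le_mul (uT_le hf p) ((rpow_lip hpp.ne_zero hs.le hs'.le).trans ?_) (abs_nonneg _) (by positivity)
  have hp0 : (0:ℝ) < p := by exact_mod_cast hpp.pos
  have : Real.log p / p ≤ 1 := by
    rw [div_le_one hp0]
    exact (Real.log_le_sub_one_of_pos hp0).trans (by linarith)
  nlinarith [abs_nonneg (s - s')]

end

end Mert


namespace Mert

open NumberField Finset Filter Topology MeasureTheory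

universe u v

theorem Reg.mono {E : Type*} [Field E] [NumberField E] {f : ℕ → ℂ} {ρ C C' : ℝ} {M : ℂ} (r : Reg E f ρ C M)
    (h : C ≤ C') : Reg E f ρ C' M where
  cm := r.cm
  rpos := r.rpos
  C1 := r.C1.trans h
  res s hs hs2 := (r.res s hs hs2).trans (by
    have := r.rpos
    have : 0 ≤ s - 1 := by linarith
    gcongr)
  lip s s' h1 h2 h3 h4 := (r.lip s s' h1 h2 h3 h4).trans (by
    have := r.rpos
    gcongr)
  zero hM s s' h1 h2 h3 h4 := by
    have := r.rpos
    obtain ⟨a, b⟩ := r.zero hM s s' h1 h2 h3 h4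
    exact ⟨a.trans (by gcongr), b.trans (by gcongr)⟩

theorem regN (N : ℕ) : ∃ A : ℕ, ∀ {E : Type v} [Field E] [NumberField E] (_ : Module.finrank ℚ E ≤ N) {X : ℝ}
    (_ : 2 ≤ X) (_ : |(discr E : ℝ)| ≤ X)
    (m : ℕ) (_ : 0 < m) (_ : (m : ℝ) ≤ X) (f : ℕ → ℂ) (_ : Per f m) (_ : CM f),
    ∃ M : ℂ, ((∀ k, f k = 1) → M = 1) ∧ Reg E f (rhoE E) (X ^ A) M := by
  choose a ha using fun d => reg.{v} d
  refine ⟨∑ d ∈ range (N + 1), a d, ?_⟩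
  intro E _ _ hE X hX hD m hm hmX f hf hfc
  obtain ⟨M, h1, h2⟩ := ha _ (E := E) rfl hX hD m hm hmX f hf hfc
  refine ⟨M, h1, h2.mono ?_⟩
  apply pow_le_pow_right₀ (by linarith)
  exact Finset.single_le_sum (f := a) (fun _ _ => Nat.zero_le _) (Finset.mem_range.2 (by omega))

theorem rhoN (N : ℕ) : ∃ K : ℝ, 1 ≤ K ∧ ∀ (E : Type v) [Field E] [NumberField E], Module.finrank ℚ E ≤ N →
    ∀ ρ C : ℝ, Reg E (fun _ => 1) ρ C 1 → ρ ≤ (K * C) ^ (N + 1) := by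
  choose a ha1 ha using fun d => rho_upper.{v} d
  have hle : ∀ d ≤ N, a d ≤ ∑ d ∈ range (N + 1), a d := fun d hd =>
    Finset.single_le_sum (f := a) (fun i _ => by linarith [ha1 i]) (Finset.mem_range.2 (by omega))
  refine ⟨∑ d ∈ range (N + 1), a d, (ha1 0).trans (hle 0 (by omega)), ?_⟩
  intro E _ _ hE ρ C r
  refine (ha _ E rfl ρ C r).trans ?_
  have hC := r.C1
  have h1 : 1 ≤ a (Module.finrank ℚ E) * C := by nlinarith [ha1 (Module.finrank ℚ E)]
  calc _ ≤ (a (Module.finrank ℚ E) * C) ^ (N + 1) := pow_le_pow_right₀ h1 (by omega)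
    _ ≤ _ := by
      gcongr
      exact hle _ hE

theorem extC_one_Per (m : ℕ) : Per (fun _ => (1:ℂ)) m := fun _ _ _ => rfl

section
variable {F : Type u} {K : Type v} [Field F] [NumberField F] [Field K] [NumberField K]
    [Algebra F K] [IsGalois F K]

theorem FD_exists (hab : ∀ σ τ : Gal(K/F), σ * τ = τ * σ)
    (fr : Ideal (𝓞 F) → Gal(K/F))
    (hfr : ∀ 𝔭 : Ideal (𝓞 F), 𝔭.IsPrime → 𝔭 ≠ ⊥ → ∃ 𝔔 : Ideal (𝓞 K), 𝔔.IsPrime ∧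
      𝔔.under (𝓞 F) = 𝔭 ∧ Fr (fr 𝔭) 𝔔 (Ideal.absNorm 𝔭))
    {m : ℕ} [NeZero m] (hm : Nat.Coprime m (discr K).natAbs)
    (Q : Subgroup (Gal(K/F) × (ZMod m)ˣ)) :
    ∃ (E : Type v) (_ : Field E) (_ : NumberField E), FD fr Q E := by
  obtain ⟨E, i1, i2, h1, h2, h3⟩ := field_data hab fr hfr hm Q
  exact ⟨E, i1, i2, h1, h2, h3⟩

variable (F K) in
theorem FD_reg (n : ℕ) (hn : 0 < n) : ∃ A : ℕ, ∀ (fr : Ideal (𝓞 F) → Gal(K/F)) {m : ℕ} [NeZero m] {X : ℝ}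
    (_ : 2 ≤ X) (_ : (m:ℝ) ≤ X) (_ : ((discr K).natAbs : ℝ) ≤ X) (Q : Subgroup (Gal(K/F) × (ZMod m)ˣ))
    (_ : Q.index ≤ n ^ 2) {E : Type v} [Field E] [NumberField E] (_ : FD fr Q E),
    Module.finrank ℚ E ≤ Module.finrank ℚ F * n ^ 2 ∧ Reg E (fun _ => 1) (rhoE E) (X ^ A) 1 ∧
    ∀ χ : (ZMod m)ˣ →* ℂˣ, χ (-1) = 1 → ∃ M, Reg E (extC χ) (rhoE E) (X ^ A) M := by
  obtain ⟨A, hA⟩ := regN.{v} (Module.finrank ℚ F * n ^ 2)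
  set e := (Module.finrank ℚ K + 1) * n ^ 2 with he
  refine ⟨e * A, ?_⟩
  intro fr m _ X hX hm hD Q hQ E _ _ h
  have he1 : 1 ≤ e := by
    rw [he]; exact Nat.one_le_iff_ne_zero.2 (by positivity)
  have hd : Module.finrank ℚ E ≤ Module.finrank ℚ F * n ^ 2 := by
    rw [h.deg]; gcongr
  have hX1 : X ≤ X ^ e := le_self_pow₀ (by linarith) (by omega)
  have hdisc : |(discr E : ℝ)| ≤ X ^ e := by
    have h1 : |(discr E : ℝ)| = ((discr E).natAbs : ℝ) := by
      rw [Nat.cast_natAbs]; push_cast; rfl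
    have h2 : ((discr E).natAbs : ℝ) ≤ ((m:ℝ) ^ Module.finrank ℚ K * ((discr K).natAbs : ℝ)) ^ Q.index := by
      exact_mod_cast h.disc
    rw [h1]
    refine h2.trans ?_
    have h3 : (m:ℝ) ^ Module.finrank ℚ K * ((discr K).natAbs : ℝ) ≤ X ^ (Module.finrank ℚ K + 1) := by
      rw [pow_succ]
      gcongr
    calc _ ≤ (X ^ (Module.finrank ℚ K + 1)) ^ Q.index := by gcongr
      _ ≤ (X ^ (Module.finrank ℚ K + 1)) ^ (n ^ 2) :=
        pow_le_pow_right₀ (one_le_pow₀ (by linarith)) hQ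
      _ = X ^ e := by rw [← pow_mul]
  refine ⟨hd, ?_, ?_⟩
  · obtain ⟨M, h1, h2⟩ := hA (E := E) hd (hX.trans hX1) hdisc m (NeZero.pos m) (hm.trans hX1) (fun _ => 1)
      (extC_one_Per m) CM_one
    rw [h1 (fun _ => rfl), ← pow_mul] at h2
    exact h2
  · intro χ hχ
    obtain ⟨M, h1, h2⟩ := hA (E := E) hd (hX.trans hX1) hdisc m (NeZero.pos m) (hm.trans hX1) (extC χ)
      (extC_Per χ hχ) (extC_CM χ)
    rw [← pow_mul] at h2
    exact ⟨M, h2⟩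

theorem exp_card {m : ℕ} [NeZero m] {X : ℝ} (hX : 2 ≤ X) (hm : (m:ℝ) ≤ X) (hD : ((discr K).natAbs : ℝ) ≤ X) :
    Real.exp ((bad K m).card) ≤ X ^ 4 ∧ ((bad K m).card : ℝ) ≤ X ^ 2 := by
  have h0 : m * (discr K).natAbs ≠ 0 :=
    mul_ne_zero (NeZero.ne m) (Int.natAbs_ne_zero.2 (discr_ne_zero K))
  have h1 : (2:ℝ) ^ (bad K m).card ≤ (m:ℝ) * ((discr K).natAbs : ℝ) := by
    exact_mod_cast card_bad h0
  have h2 : (2:ℝ) ^ (bad K m).card ≤ X ^ 2 := by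
    refine h1.trans ?_
    rw [sq]
    gcongr
  constructor
  · calc Real.exp ((bad K m).card) = Real.exp 1 ^ (bad K m).card := by rw [← Real.exp_nat_mul, mul_one]
      _ ≤ 4 ^ (bad K m).card := by
        gcongr
        linarith [Real.exp_one_lt_d9]
      _ = ((2:ℝ) ^ (bad K m).card) ^ 2 := by rw [← pow_mul, mul_comm, pow_mul]; norm_num
      _ ≤ (X ^ 2) ^ 2 := by gcongr
      _ = _ := by ring
  · refine le_trans ?_ h2
    have : (bad K m).card ≤ 2 ^ (bad K m).card := Nat.lt_two_pow_self.le
    exact_mod_cast this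

end

end Mert


namespace Mert

open NumberField Finset Filter Topology MeasureTheory

universe u v

section
variable {F : Type u} {K : Type v} [Field F] [NumberField F] [Field K] [NumberField K]
    [Algebra F K] [IsGalois F K]

theorem thmU (hab : ∀ σ τ : Gal(K/F), σ * τ = τ * σ)
    (fr : Ideal (𝓞 F) → Gal(K/F))
    (hfr : ∀ 𝔭 : Ideal (𝓞 F), 𝔭.IsPrime → 𝔭 ≠ ⊥ → ∃ 𝔔 : Ideal (𝓞 K), 𝔔.IsPrime ∧
      𝔔.under (𝓞 F) = 𝔭 ∧ Fr (fr 𝔭) 𝔔 (Ideal.absNorm 𝔭)) (n : ℕ) (hn : 0 < n) :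
    ∃ A : ℕ, ∀ {m : ℕ} [NeZero m] {X : ℝ} (_ : Nat.Coprime m (discr K).natAbs)
    (_ : 2 ≤ X) (_ : (m:ℝ) ≤ X) (_ : ((discr K).natAbs : ℝ) ≤ X) (Q : Subgroup (Gal(K/F) × (ZMod m)ˣ))
    (_ : Q.index ≤ n) (s s' : ℝ) (_ : 1 < s) (_ : (s - 1) * X ^ A ≤ 1) (_ : 1 < s') (_ : (s' - 1) * X ^ A ≤ 1),
    ‖Q.index * (W fr Q (fun _ => 1) s - W fr Q (fun _ => 1) s') -
      ((Real.log (1 / (s - 1)) - Real.log (1 / (s' - 1)) : ℝ) : ℂ)‖ ≤ X ^ A * |s - s'| ∧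
    ∀ χ : (ZMod m)ˣ →* ℂˣ, χ (-1) = 1 → χ ^ n = 1 → (∃ g x, (g, x) ∈ Q ∧ χ x ≠ 1) →
      ‖W fr Q (fun u => (χ u : ℂ)) s - W fr Q (fun u => (χ u : ℂ)) s'‖ ≤ X ^ A * |s - s'| := by
  obtain ⟨A, hA⟩ := FD_reg F K n hn
  set N := Module.finrank ℚ F * n ^ 2 with hN
  obtain ⟨Kρ, hK1, hK⟩ := rhoN.{v} N
  set c0 := R0 / Real.log 2 with hc0
  have hR0 := R0_nonneg
  have hc0n : 0 ≤ c0 := div_nonneg hR0 (Real.log_nonneg (by norm_num))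
  obtain ⟨a1, ha1⟩ := pow_bound Kρ
  obtain ⟨a3, ha3⟩ := pow_bound (Real.exp c0)
  obtain ⟨a4, ha4⟩ := pow_bound (N * R0)
  obtain ⟨a5, ha5⟩ := pow_bound N
  set b1 := 4 + A + (A + a1) * (N + 2) * n + (4 + a3) * (2 * N) with hb1
  set T := b1 + a4 + a5 + 4 with hT
  refine ⟨T, ?_⟩
  intro m _ X hcop hX hm hD Q hQ s s' hs hsA hs' hsA'
  have hX1 : 1 ≤ X := by linarith
  have hQn : Q.index ≤ n ^ 2 := hQ.trans (Nat.le_self_pow (by norm_num) n)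
  have hQ1 : 1 ≤ Q.index := Nat.one_le_iff_ne_zero.2 Subgroup.FiniteIndex.index_ne_zero
  obtain ⟨E, _, _, hE⟩ := FD_exists hab fr hfr hcop Q
  obtain ⟨hdE, r1, rχ⟩ := hA fr hX hm hD Q hQn hE
  obtain ⟨hcard1, hcard2⟩ := exp_card (K := K) hX hm hD
  set C := X ^ A with hC
  have hC1 : 1 ≤ C := one_le_pow₀ hX1
  have hdE' : (Module.finrank ℚ E : ℝ) ≤ N := by exact_mod_cast hdE
  have h4C : 4 * C ≤ X ^ T := by
    calc 4 * C ≤ X ^ 4 * X ^ A := by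
          gcongr
          calc (4:ℝ) ≤ 2 ^ 4 := by norm_num
            _ ≤ X ^ 4 := by gcongr
      _ = X ^ (4 + A) := by rw [pow_add]
      _ ≤ _ := pow_le_pow_right₀ hX1 (by rw [hT, hb1]; omega)
  have hrange : ∀ s : ℝ, 1 < s → (s - 1) * X ^ T ≤ 1 → s < 1 + 1 / (2 * C) := by
    intro s hs h
    have h1 : (s - 1) * (4 * C) ≤ 1 := le_trans (by
      have : 0 ≤ s - 1 := by linarith
      gcongr) h
    have h2 : s - 1 < 1 / (2 * C) := by
      rw [lt_div_iff₀ (by positivity)]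
      nlinarith
    linarith
  have hpT : ∀ a, a ≤ T - 2 → X ^ a ≤ X ^ (T - 2) := fun a ha => pow_le_pow_right₀ hX1 ha
  have h3T : 3 * X ^ (T - 2) ≤ X ^ T := by
    have e : X ^ T = X ^ (T - 2) * X ^ 2 := by rw [← pow_add]; congr 1
    rw [e, mul_comm]
    gcongr
    nlinarith
  have hdR : (Module.finrank ℚ E : ℝ) * R0 ≤ X ^ (T - 2) :=
    ((mul_le_mul_of_nonneg_right hdE' hR0).trans (ha4 X hX)).trans (hpT _ (by omega))
  have hbd : ((bad K m).card : ℝ) * Module.finrank ℚ E ≤ X ^ (T - 2) := by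
    calc _ ≤ X ^ 2 * X ^ a5 := by
          gcongr
          exact hdE'.trans (ha5 X hX)
      _ = X ^ (2 + a5) := by rw [pow_add]
      _ ≤ _ := hpT _ (by omega)
  refine ⟨?_, ?_⟩
  · have h1 := U_princ r1 hs (hrange s hs hsA).le hs' (hrange s' hs' hsA').le
    have h2 := W_compare hE (f := fun _ => 1) (fun _ => by simp) (H := fun _ => 1) (fun _ _ _ => rfl) hs hs'
    have h3 : 2 * C ≤ X ^ (T - 2) := by
      calc 2 * C ≤ X ^ 1 * X ^ A := by rw [pow_one, hC]; gcongr
        _ = X ^ (1 + A) := by rw [pow_add]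
        _ ≤ _ := hpT _ (by rw [hT, hb1]; omega)
    rw [show Q.index * (W fr Q (fun _ => 1) s - W fr Q (fun _ => 1) s') -
      ((Real.log (1 / (s - 1)) - Real.log (1 / (s' - 1)) : ℝ) : ℂ) =
      (U E (fun _ => 1) s - U E (fun _ => 1) s' - ((Real.log (1 / (s - 1)) - Real.log (1 / (s' - 1)) : ℝ) : ℂ)) -
      ((U E (fun _ => 1) s - U E (fun _ => 1) s') - Q.index * (W fr Q (fun _ => 1) s - W fr Q (fun _ => 1) s')) by ring]
    refine (norm_sub_le _ _).trans ((add_le_add h1 h2).trans ?_)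
    rw [← add_mul]
    gcongr
    linarith
  · intro χ hχ1 hχn hex
    have hne := (phi_ne Q χ).2 hex
    have hzero : ∀ χ : (ZMod m)ˣ →* ℂˣ, χ (-1) = 1 → χ ^ n = 1 → phi Q χ ≠ 1 →
        Reg E (extC χ) (rhoE E) C 0 := by
      intro χ h1 h2 h3
      obtain ⟨M, hM⟩ := rχ χ h1
      obtain ⟨t1, t2, -⟩ := phi_t Q χ hn h2 h3
      obtain ⟨E', _, _, hE'⟩ := FD_exists hab fr hfr hcop (kerQ Q χ)
      have hQ' : (kerQ Q χ).index ≤ n ^ 2 := by rw [kerQ_index, sq]; gcongr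
      obtain ⟨-, r1', -⟩ := hA fr hX hm hD _ hQ' hE'
      have := no_pole (extC_hz χ) t1 (FD_rel hE hE') r1 hM r1'
      rw [← this]
      exact hM
    obtain ⟨t1, t2, t3⟩ := phi_t Q χ hn hχn hne
    obtain ⟨E', _, _, hE'⟩ := FD_exists hab fr hfr hcop (kerQ Q χ)
    have hQ' : (kerQ Q χ).index ≤ n ^ 2 := by rw [kerQ_index, sq]; gcongr
    obtain ⟨hdE2, r1', -⟩ := hA fr hX hm hD _ hQ' hE'
    set t := (phi Q χ).ker.index with ht
    have hdd : (t:ℝ) * Module.finrank ℚ E = Module.finrank ℚ E' := by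
      have : t * Module.finrank ℚ E = Module.finrank ℚ E' := by
        rw [hE.deg, hE'.deg, kerQ_index]
        ring
      exact_mod_cast this
    have hdE2' : (Module.finrank ℚ E' : ℝ) ≤ N := by exact_mod_cast hdE2
    have hB : ((bad K m).card + c0) * (t * Module.finrank ℚ E + Module.finrank ℚ E' : ℝ) ≤
        ((bad K m).card + c0) * (2 * N : ℕ) := by
      push_cast
      gcongr
      linarith
    have hρ := r1.rpos
    set Λ := 16 * C * (rhoE E * C) ^ t * Real.exp (((bad K m).card + c0) * (2 * N : ℕ)) with hΛ
    have hL : ∀ s : ℝ, 1 < s → s ≤ 1 + 1 / (2 * C) → rhoE E * C ≤ Λ * ‖LSeries (aT E (extC χ)) s‖ := by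
      intro s hs hs1
      refine L_lower t1 (FD_rel hE hE') r1 ?_ r1' hB hs hs1 hs1
      intro j hj hjt
      rw [extC_pow χ hj]
      apply hzero
      · simp [hχ1]
      · refine MonoidHom.ext fun u => ?_
        have h5 : χ u ^ n = 1 := DFunLike.congr_fun hχn u
        change (χ u ^ j) ^ n = 1
        rw [← pow_mul, mul_comm, pow_mul, h5, one_pow]
      · exact t3 j hj hjt
    have hΛX : Λ ≤ X ^ (T - 2) := by
      have e1 : rhoE E * C ≤ (X ^ ((A + a1) * (N + 2))) := by
        have e2 := hK E hdE _ _ r1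
        have e3 : Kρ * C ≤ X ^ (A + a1) := by
          rw [pow_add, mul_comm]
          gcongr
          exact ha1 X hX
        have e4 : 1 ≤ X ^ (A + a1) := one_le_pow₀ hX1
        calc rhoE E * C ≤ (X ^ (A + a1)) ^ (N + 1) * X ^ (A + a1) := by
              refine mul_le_mul (e2.trans ?_) ?_ (by positivity) (by positivity)
              · gcongr
              · exact pow_le_pow_right₀ hX1 (by omega)
          _ = _ := by rw [← pow_succ, ← pow_mul]
      have e5 : (rhoE E * C) ^ t ≤ X ^ ((A + a1) * (N + 2) * n) := by
        calc _ ≤ (X ^ ((A + a1) * (N + 2))) ^ t := by gcongr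
          _ ≤ (X ^ ((A + a1) * (N + 2))) ^ n := pow_le_pow_right₀ (one_le_pow₀ hX1) t2
          _ = _ := by rw [← pow_mul]
      have e6 : Real.exp (((bad K m).card + c0) * (2 * N : ℕ)) ≤ X ^ ((4 + a3) * (2 * N)) := by
        rw [mul_comm, Real.exp_nat_mul, pow_mul X, Real.exp_add, pow_add X]
        gcongr
        exact ha3 X hX
      have e7 : (16:ℝ) ≤ X ^ 4 := by
        calc (16:ℝ) = 2 ^ 4 := by norm_num
          _ ≤ X ^ 4 := by gcongr
      calc Λ ≤ X ^ 4 * X ^ A * X ^ ((A + a1) * (N + 2) * n) * X ^ ((4 + a3) * (2 * N)) := by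
            rw [hΛ]
            gcongr
        _ = X ^ b1 := by rw [← pow_add, ← pow_add, ← pow_add]
        _ ≤ _ := hpT _ (by omega)
    have hS2 : 1 + 1 / (2 * C) ≤ 2 := by
      have : 1 / (2 * C) ≤ 1 := by
        rw [div_le_one (by positivity)]
        linarith
      linarith
    have h1 := U_nonprinc (hzero χ hχ1 hχn hne) hS2 hL hs (hrange s hs hsA) hs' (hrange s' hs' hsA')
    have h2 := W_compare hE (f := extC χ) (extC_CM χ).bd (H := fun u => (χ u : ℂ))
      (fun k u hu => ext0_eq _ u hu) hs hs'
    set w := W fr Q (fun u => (χ u : ℂ)) s - W fr Q (fun u => (χ u : ℂ)) s'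
    have h3 : ‖w‖ ≤ ‖(Q.index : ℂ) * w‖ := by
      rw [norm_mul, Complex.norm_natCast]
      have : (1:ℝ) ≤ Q.index := by exact_mod_cast hQ1
      nlinarith [norm_nonneg w]
    refine h3.trans ?_
    rw [show (Q.index : ℂ) * w = (U E (extC χ) s - U E (extC χ) s') -
      ((U E (extC χ) s - U E (extC χ) s') - Q.index * w) by ring]
    refine (norm_sub_le _ _).trans ((add_le_add h1 h2).trans ?_)
    rw [← add_mul]
    gcongr
    linarith

end

end Mert


namespace Mert

open NumberField Finset Filter Topology MeasureTheory

universe u v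

/-- finite Fourier coefficient on the n-th roots of unity -/
noncomputable def fc (n : ℕ) (h : ℂ → ℂ) (a : ℕ) : ℂ :=
  (1 / n) * ∑ y ∈ Polynomial.nthRootsFinset n (1:ℂ), h y * (y⁻¹) ^ a

theorem mem_mu {n : ℕ} (hn : 0 < n) {z : ℂ} : z ∈ Polynomial.nthRootsFinset n (1:ℂ) ↔ z ^ n = 1 :=
  Polynomial.mem_nthRootsFinset hn 1

theorem card_mu {n : ℕ} (hn : 0 < n) : (Polynomial.nthRootsFinset n (1:ℂ)).card = n :=
  (Complex.isPrimitiveRoot_exp n hn.ne').card_nthRootsFinset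

theorem fc_exp {n : ℕ} (hn : 0 < n) (h : ℂ → ℂ) {z : ℂ} (hz : z ^ n = 1) :
    h z = ∑ a ∈ range n, fc n h a * z ^ a := by
  have hn0 : (n:ℂ) ≠ 0 := by exact_mod_cast hn.ne'
  have key : ∀ y ∈ Polynomial.nthRootsFinset n (1:ℂ), ∑ a ∈ range n, (y⁻¹ * z) ^ a = if y = z then (n:ℂ) else 0 := by
    intro y hy
    rw [mem_mu hn] at hy
    have hy0 : y ≠ 0 := by
      rintro rfl
      rw [zero_pow hn.ne'] at hy
      exact zero_ne_one hy
    split_ifs with hyz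
    · subst hyz
      simp [hy0]
    · have h1 : y⁻¹ * z ≠ 1 := by
        intro h1
        apply hyz
        field_simp at h1
        exact h1.symm
      rw [geom_sum_eq h1, mul_pow, inv_pow, hy, hz]
      simp
  calc h z = (1 / n) * ∑ y ∈ Polynomial.nthRootsFinset n (1:ℂ), h y * (if y = z then (n:ℂ) else 0) := by
        simp only [mul_ite, mul_zero]
        rw [Finset.sum_ite_eq' (Polynomial.nthRootsFinset n (1:ℂ)), if_pos ((mem_mu hn).2 hz)]
        field_simp
    _ = (1 / n) * ∑ y ∈ Polynomial.nthRootsFinset n (1:ℂ), h y * ∑ a ∈ range n, (y⁻¹ * z) ^ a := by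
        congr 1
        exact Finset.sum_congr rfl fun y hy => by rw [key y hy]
    _ = _ := by
        simp only [fc, Finset.mul_sum, Finset.sum_mul]
        rw [Finset.sum_comm]
        refine Finset.sum_congr rfl fun a _ => Finset.sum_congr rfl fun y _ => ?_
        rw [mul_pow]
        ring

theorem fc_le {n : ℕ} (hn : 0 < n) (h : ℂ → ℂ) (hh : ∀ z, z ^ n = 1 → ‖h z‖ ≤ 1) (a : ℕ) : ‖fc n h a‖ ≤ 1 := by
  have hn0 : (0:ℝ) < n := by exact_mod_cast hn
  rw [fc, norm_mul]
  have h1 : ‖∑ y ∈ Polynomial.nthRootsFinset n (1:ℂ), h y * (y⁻¹) ^ a‖ ≤ n := by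
    refine (norm_sum_le _ _).trans ?_
    calc _ ≤ ∑ y ∈ Polynomial.nthRootsFinset n (1:ℂ), (1:ℝ) := by
          apply Finset.sum_le_sum
          intro y hy
          rw [mem_mu hn] at hy
          rw [norm_mul, norm_pow, norm_inv, Complex.norm_eq_one_of_pow_eq_one hy hn.ne']
          simpa using hh y hy
      _ = n := by simp [card_mu hn]
  rw [norm_div, norm_one, Complex.norm_natCast]
  calc _ ≤ 1 / (n:ℝ) * n := by gcongr
    _ = 1 := by field_simp

section
variable {F : Type u} {K : Type v} [Field F] [NumberField F] [Field K] [NumberField K]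
    [Algebra F K] [IsGalois F K]

theorem W_sum (fr : Ideal (𝓞 F) → Gal(K/F)) {m : ℕ} [NeZero m] (Q : Subgroup (Gal(K/F) × (ZMod m)ˣ))
    {ι : Type*} (T : Finset ι) (c : ι → ℂ) (H : ι → (ZMod m)ˣ → ℂ) {s : ℝ} (hs : 1 < s) :
    W fr Q (fun u => ∑ a ∈ T, c a * H a u) s = ∑ a ∈ T, c a * W fr Q (H a) s := by
  unfold W
  simp only [← tsum_mul_left]
  rw [← Summable.tsum_finsetSum]
  · congr 1
    funext p
    by_cases h : p.Prime ∧ p ∉ bad K m ∧ IsUnit (p : ZMod m)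
    · simp only [wT, dif_pos h]
      rw [Finset.mul_sum, Finset.sum_mul]
      refine Finset.sum_congr rfl fun a _ => ?_
      ring
    · simp only [wT, dif_neg h]
      simp
  · intro a _
    exact (W_summable fr Q (H a) hs).mul_left _

theorem W_expand (fr : Ideal (𝓞 F) → Gal(K/F)) {m : ℕ} [NeZero m] (Q : Subgroup (Gal(K/F) × (ZMod m)ˣ))
    {n k : ℕ} (hn : 0 < n) (β : Fin k → ((ZMod m)ˣ →* ℂˣ)) (hβ : ∀ i u, β i u ^ n = 1)
    (h : Fin k → ℂ → ℂ) (hh : ∀ l z, z ^ n = 1 → ‖h l z‖ ≤ 1) {s s' : ℝ} (hs : 1 < s) (hs' : 1 < s') {Y : ℝ}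
    (hY0 : 0 ≤ Y)
    (hY : ∀ a : Fin k → ℕ, (∀ i, a i < n) → a ≠ 0 →
      ‖W fr Q (fun u => ∏ l, (β l u : ℂ) ^ a l) s - W fr Q (fun u => ∏ l, (β l u : ℂ) ^ a l) s'‖ ≤ Y) :
    ‖(W fr Q (fun u => ∏ l, h l (β l u)) s - W fr Q (fun u => ∏ l, h l (β l u)) s') -
      (∏ l, fc n (h l) 0) * (W fr Q (fun _ => 1) s - W fr Q (fun _ => 1) s')‖ ≤ n ^ k * Y := by
  have e : (fun u : (ZMod m)ˣ => ∏ l, h l (β l u)) = fun u =>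
      ∑ a ∈ Fintype.piFinset (fun _ : Fin k => range n), (∏ l, fc n (h l) (a l)) * ∏ l, (β l u : ℂ) ^ a l := by
    funext u
    have h1 : ∀ l, h l (β l u) = ∑ a ∈ range n, fc n (h l) a * (β l u : ℂ) ^ a := fun l =>
      fc_exp hn (h l) (by rw [← Units.val_pow_eq_pow_val, hβ]; simp)
    simp only [h1]
    rw [Finset.prod_univ_sum]
    exact Finset.sum_congr rfl fun a _ => Finset.prod_mul_distrib
  have h0 : (0 : Fin k → ℕ) ∈ Fintype.piFinset (fun _ : Fin k => range n) := by
    simp [Fintype.mem_piFinset, hn]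
  have eW : ∀ s : ℝ, 1 < s → W fr Q (fun u => ∑ a ∈ Fintype.piFinset (fun _ : Fin k => range n),
      (∏ l, fc n (h l) (a l)) * ∏ l, (β l u : ℂ) ^ a l) s = ∑ a ∈ Fintype.piFinset (fun _ : Fin k => range n),
      (∏ l, fc n (h l) (a l)) * W fr Q (fun u => ∏ l, (β l u : ℂ) ^ a l) s := fun s hs =>
    W_sum fr Q (Fintype.piFinset (fun _ : Fin k => range n)) (fun a => ∏ l, fc n (h l) (a l))
      (fun a u => ∏ l, (β l u : ℂ) ^ a l) hs
  rw [e, eW s hs, eW s' hs',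
    ← Finset.sum_sub_distrib, ← Finset.add_sum_erase _ _ h0]
  simp only [Pi.zero_apply, pow_zero, Finset.prod_const_one]
  rw [← mul_sub, add_sub_cancel_left]
  refine (norm_sum_le _ _).trans ?_
  calc _ ≤ ∑ a ∈ (Fintype.piFinset (fun _ : Fin k => range n)).erase 0, Y := by
        apply Finset.sum_le_sum
        intro a ha
        rw [Finset.mem_erase, Fintype.mem_piFinset] at ha
        rw [← mul_sub, norm_mul]
        have h2 : ‖∏ l, fc n (h l) (a l)‖ ≤ 1 := by
          rw [norm_prod]
          exact Finset.prod_le_one (fun _ _ => norm_nonneg _) fun l _ => fc_le hn _ (hh l) _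
        have h3 := hY a (fun i => Finset.mem_range.1 (ha.2 i)) ha.1
        calc _ ≤ 1 * Y := by gcongr
          _ = Y := one_mul _
    _ ≤ ∑ a ∈ (Fintype.piFinset (fun _ : Fin k => range n)), Y :=
        Finset.sum_le_sum_of_subset_of_nonneg (Finset.erase_subset _ _) fun _ _ _ => hY0
    _ = _ := by
        rw [Finset.sum_const, Fintype.card_piFinset]
        simp

end

end Mert


namespace Mert

open NumberField Finset Filter Topology MeasureTheory

universe u v

open Classical in
/-- indicator of primitive n-th roots -/
noncomputable def wp (n : ℕ) (z : ℂ) : ℂ := if IsPrimitiveRoot z n then 1 else 0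

theorem wp_cases (n : ℕ) (z : ℂ) : wp n z = 1 ∨ wp n z = 0 := by
  unfold wp; split_ifs <;> simp

open Classical in
theorem pt {n : ℕ} (hn : 0 < n) {z y : ℂ} (hz : z ^ n = 1) :
    z * wp n y = ∑ j ∈ range n, (if z * y ^ j = 1 then (1:ℂ) else 0) * ((y⁻¹) ^ j * wp n y) := by
  by_cases hp : IsPrimitiveRoot y n
  · have e : wp n y = 1 := if_pos hp
    rw [e]
    have hz0 : z ≠ 0 := by
      rintro rfl
      rw [zero_pow hn.ne'] at hz
      exact zero_ne_one hz
    haveI : NeZero n := ⟨hn.ne'⟩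
    obtain ⟨j, hj, hjz⟩ := hp.eq_pow_of_pow_eq_one (ξ := z⁻¹) (by rw [inv_pow, hz, inv_one])
    rw [Finset.sum_eq_single j]
    · rw [hjz, if_pos (mul_inv_cancel₀ hz0), inv_pow, hjz]
      simp
    · intro i hi hij
      rw [if_neg, zero_mul]
      intro h
      apply hij
      apply hp.pow_inj (Finset.mem_range.1 hi) hj
      rw [hjz]
      exact eq_inv_of_mul_eq_one_right h
    · intro h
      exact absurd (Finset.mem_range.2 hj) h
  · have e : wp n y = 0 := if_neg hp
    simp [e]

theorem sumfc {n : ℕ} (hn : 2 ≤ n) : ∑ j ∈ range n, fc n (fun z => (z⁻¹) ^ j * wp n z) 0 = 0 := by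
  unfold fc
  rw [← Finset.mul_sum, Finset.sum_comm]
  rw [Finset.sum_eq_zero, mul_zero]
  intro y _
  simp only [pow_zero, mul_one]
  rw [← Finset.sum_mul]
  by_cases hp : IsPrimitiveRoot y n
  · have h1 : y⁻¹ ≠ 1 := by
      rw [Ne, inv_eq_one]
      exact hp.ne_one (by omega)
    rw [geom_sum_eq h1, inv_pow, hp.pow_eq_one]
    simp
  · have e : wp n y = 0 := if_neg hp
    simp [e]

theorem qfc {n : ℕ} (hn : 0 < n) : ∃ q : ℝ, 0 ≤ q ∧ q < 1 ∧ fc n (fun z => 1 - wp n z) 0 = q := by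
  classical
  have hn0 : (0:ℝ) < n := by exact_mod_cast hn
  refine ⟨((Polynomial.nthRootsFinset n (1:ℂ)).filter (fun z => ¬ IsPrimitiveRoot z n)).card / n, by positivity, ?_, ?_⟩
  · rw [div_lt_one hn0]
    have h1 : ((Polynomial.nthRootsFinset n (1:ℂ)).filter (fun z => ¬ IsPrimitiveRoot z n)).card <
        (Polynomial.nthRootsFinset n (1:ℂ)).card := by
      apply Finset.card_lt_card
      rw [Finset.filter_ssubset]
      have := Complex.isPrimitiveRoot_exp n hn.ne'
      exact ⟨_, (mem_mu hn).2 this.pow_eq_one, by simpa using this⟩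
    rw [card_mu hn] at h1
    exact_mod_cast h1
  · unfold fc
    rw [Finset.card_filter]
    push_cast
    rw [div_eq_mul_inv, mul_comm]
    congr 1
    rotate_left
    · ring
    refine Finset.sum_congr rfl fun y _ => ?_
    by_cases hp : IsPrimitiveRoot y n
    · have e : wp n y = 1 := if_pos hp
      simp [e, hp]
    · have e : wp n y = 0 := if_neg hp
      simp [e, hp]

/-- sieve factor -/
noncomputable def sf (n : ℕ) {k : ℕ} (i : Fin k) (j : ℕ) (l : Fin k) (z : ℂ) : ℂ :=
  if l = i then (z⁻¹) ^ j * wp n z else if l < i then 1 - wp n z else 1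

theorem wp_le (n : ℕ) (z : ℂ) : ‖1 - wp n z‖ ≤ 1 := by
  rcases wp_cases n z with h | h <;> simp [h]

theorem sf_le {n : ℕ} (hn : 0 < n) {k : ℕ} (i : Fin k) (j : ℕ) (l : Fin k) (z : ℂ) (hz : z ^ n = 1) :
    ‖sf n i j l z‖ ≤ 1 := by
  unfold sf
  split_ifs
  · rw [norm_mul, norm_pow, norm_inv, Complex.norm_eq_one_of_pow_eq_one hz hn.ne']
    rcases wp_cases n z with h | h <;> simp [h]
  · exact wp_le n z
  · simp

theorem sf_prod (n : ℕ) {k : ℕ} (i : Fin k) (j : ℕ) (z : Fin k → ℂ) :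
    ∏ l, sf n i j l (z l) = ((z i)⁻¹) ^ j * wp n (z i) * ∏ l ∈ univ.filter (· < i), (1 - wp n (z l)) := by
  rw [← Finset.mul_prod_erase univ _ (mem_univ i)]
  congr 1
  · simp [sf]
  · have : univ.filter (· < i) = (univ.erase i).filter (· < i) := by
      ext l
      simp only [Finset.mem_filter, Finset.mem_univ, true_and, Finset.mem_erase, and_true]
      constructor
      · intro h; exact ⟨h.ne, h⟩
      · exact fun h => h.2
    rw [this, Finset.prod_filter]
    refine Finset.prod_congr rfl fun l hl => ?_
    rw [Finset.mem_erase] at hl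
    simp [sf, hl.1]

theorem sf_fc {n : ℕ} (hn : 2 ≤ n) {k : ℕ} (i : Fin k) :
    ∑ j ∈ range n, ∏ l, fc n (sf n i j l) 0 = 0 := by
  have h1 : ∀ j, ∏ l, fc n (sf n i j l) 0 = fc n (fun z => (z⁻¹) ^ j * wp n z) 0 *
      ∏ l ∈ univ.erase i, fc n (sf n i 0 l) 0 := by
    intro j
    rw [← Finset.mul_prod_erase univ _ (mem_univ i)]
    congr 1
    · congr 1
      funext z
      simp [sf]
    · refine Finset.prod_congr rfl fun l hl => ?_
      rw [Finset.mem_erase] at hl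
      congr 1
      funext z
      simp [sf, hl.1]
  simp only [h1]
  rw [← Finset.sum_mul, sumfc hn, zero_mul]

open Classical in
/-- pointwise sieve identity -/
theorem sieve_pt {n : ℕ} (hn : 0 < n) {k : ℕ} {x : ℂ} (hx : x ^ n = 1) (z : Fin k → ℂ) :
    x = x * ∏ l, (1 - wp n (z l)) +
      ∑ i, ∑ j ∈ range n, (if x * z i ^ j = 1 then (1:ℂ) else 0) * ∏ l, sf n i j l (z l) := by
  have h1 : ∀ i : Fin k, ∑ j ∈ range n, (if x * z i ^ j = 1 then (1:ℂ) else 0) * ∏ l, sf n i j l (z l) =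
      x * (wp n (z i) * ∏ l ∈ univ.filter (· < i), (1 - wp n (z l))) := by
    intro i
    rw [← mul_assoc, pt hn hx, Finset.sum_mul]
    refine Finset.sum_congr rfl fun j _ => ?_
    rw [sf_prod]
    ring
  simp only [h1]
  rw [← Finset.mul_sum, ← mul_add, Finset.prod_one_sub_ordered]
  ring

end Mert


namespace Mert

open NumberField Finset Filter Topology MeasureTheory

universe u v

section
variable {F : Type u} {K : Type v} [Field F] [NumberField F] [Field K] [NumberField K]
    [Algebra F K] [IsGalois F K]

/-- sum of the character over degree one primes above p -/
noncomputable def gS (fr : Ideal (𝓞 F) → Gal(K/F)) (ψ : Gal(K/F) →* ℂˣ) (p : ℕ) : ℂ :=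
  ∑ 𝔭 ∈ (prm F p).filter (fun 𝔭 => Ideal.absNorm 𝔭 = p), (ψ (fr 𝔭) : ℂ)

open Classical in
/-- twisted coefficients -/
noncomputable def vT (fr : Ideal (𝓞 F) → Gal(K/F)) (ψ : Gal(K/F) →* ℂˣ) {m : ℕ} (H : (ZMod m)ˣ → ℂ) (p : ℕ) : ℂ :=
  if h : p.Prime ∧ p ∉ bad K m ∧ IsUnit (p : ZMod m) then gS fr ψ p * H h.2.2.unit else 0

/-- the subgroup on which two characters cancel -/
noncomputable def Qc (ψ : Gal(K/F) →* ℂˣ) {m : ℕ} (χ : (ZMod m)ˣ →* ℂˣ) : Subgroup (Gal(K/F) × (ZMod m)ˣ) :=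
  (ψ.comp (MonoidHom.fst _ _) * χ.comp (MonoidHom.snd _ _)).ker

theorem mem_Qc (ψ : Gal(K/F) →* ℂˣ) {m : ℕ} (χ : (ZMod m)ˣ →* ℂˣ) (g : Gal(K/F)) (u : (ZMod m)ˣ) :
    (g, u) ∈ Qc ψ χ ↔ ψ g * χ u = 1 := by
  simp [Qc, MonoidHom.mem_ker]

theorem Qc_index (ψ : Gal(K/F) →* ℂˣ) {m : ℕ} (χ : (ZMod m)ˣ →* ℂˣ) {n : ℕ} (hn : Nat.card ψ.range = n)
    (hψn : ∀ g, ψ g ^ n = 1) (hsurj : ∀ z : ℂˣ, z ^ n = 1 → ∃ g, ψ g = z) (hχ : ∀ u, χ u ^ n = 1) :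
    (Qc ψ χ).index = n := by
  rw [Qc, Subgroup.index_ker, ← hn]
  congr 1
  have : (ψ.comp (MonoidHom.fst _ _) * χ.comp (MonoidHom.snd _ _)).range = ψ.range := by
    ext z
    simp only [MonoidHom.mem_range]
    constructor
    · rintro ⟨⟨g, u⟩, rfl⟩
      apply hsurj
      change (ψ g * χ u) ^ n = 1
      rw [mul_pow, hψn, hχ, one_mul]
    · rintro ⟨g, rfl⟩
      exact ⟨(g, 1), by simp⟩
  rw [this]

theorem cnt'_eq (fr : Ideal (𝓞 F) → Gal(K/F)) {m : ℕ} (Q : Subgroup (Gal(K/F) × (ZMod m)ˣ)) (p : ℕ) (u : (ZMod m)ˣ)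
    (P : Ideal (𝓞 F) → Prop) [DecidablePred P] (hP : ∀ 𝔭, (fr 𝔭, u) ∈ Q ↔ P 𝔭) :
    (cnt' fr Q p u : ℂ) = ∑ 𝔭 ∈ (prm F p).filter (fun 𝔭 => Ideal.absNorm 𝔭 = p), if P 𝔭 then (1:ℂ) else 0 := by
  classical
  rw [Finset.sum_boole, Finset.filter_filter]
  unfold cnt'
  congr 2
  ext 𝔭
  simp [hP]

theorem vT_split (fr : Ideal (𝓞 F) → Gal(K/F)) (ψ : Gal(K/F) →* ℂˣ) {m n k : ℕ} (hn : 0 < n)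
    (hψn : ∀ g, ψ g ^ n = 1) (β : Fin k → ((ZMod m)ˣ →* ℂˣ)) (p : ℕ) :
    vT fr ψ (fun _ : (ZMod m)ˣ => 1) p = vT fr ψ (fun u => ∏ l, (1 - wp n (β l u))) p +
      ∑ i, ∑ j ∈ range n, wT fr (Qc ψ (β i ^ j)) (fun u => ∏ l, sf n i j l (β l u)) p := by
  classical
  by_cases h : p.Prime ∧ p ∉ bad K m ∧ IsUnit (p : ZMod m)
  · simp only [vT, wT, dif_pos h]
    set u := h.2.2.unit with hu
    have e : ∀ (i : Fin k) (j : ℕ), (cnt' fr (Qc ψ (β i ^ j)) p u : ℂ) =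
        ∑ 𝔭 ∈ (prm F p).filter (fun 𝔭 => Ideal.absNorm 𝔭 = p),
          if (ψ (fr 𝔭) : ℂ) * (β i u : ℂ) ^ j = 1 then (1:ℂ) else 0 := by
      intro i j
      apply cnt'_eq
      intro 𝔭
      rw [mem_Qc, Units.ext_iff]
      simp
    simp only [e, gS, Finset.sum_mul]
    have e2 : ∀ i : Fin k, (∑ j ∈ range n, ∑ 𝔭 ∈ (prm F p).filter (fun 𝔭 => Ideal.absNorm 𝔭 = p),
          (if (ψ (fr 𝔭) : ℂ) * (β i u : ℂ) ^ j = 1 then (1:ℂ) else 0) * ∏ l, sf n i j l (β l u)) =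
        ∑ 𝔭 ∈ (prm F p).filter (fun 𝔭 => Ideal.absNorm 𝔭 = p), ∑ j ∈ range n,
          (if (ψ (fr 𝔭) : ℂ) * (β i u : ℂ) ^ j = 1 then (1:ℂ) else 0) * ∏ l, sf n i j l (β l u) :=
      fun i => Finset.sum_comm
    simp only [e2]
    rw [Finset.sum_comm, ← Finset.sum_add_distrib]
    refine Finset.sum_congr rfl fun 𝔭 _ => ?_
    rw [mul_one]
    exact sieve_pt hn (by rw [← Units.val_pow_eq_pow_val, hψn]; simp) _
  · simp [vT, wT, dif_neg h]

theorem gS_le_cnt (fr : Ideal (𝓞 F) → Gal(K/F)) (ψ : Gal(K/F) →* ℂˣ) {m n : ℕ} (hn : 0 < n)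
    (hψn : ∀ g, ψ g ^ n = 1) (p : ℕ) (u : (ZMod m)ˣ) : ‖gS fr ψ p‖ ≤ cnt' fr ⊤ p u := by
  classical
  unfold gS
  refine (norm_sum_le _ _).trans ?_
  have : ∀ 𝔭, ‖(ψ (fr 𝔭) : ℂ)‖ = 1 := fun 𝔭 =>
    Complex.norm_eq_one_of_pow_eq_one (n := n) (by rw [← Units.val_pow_eq_pow_val, hψn]; simp) hn.ne'
  simp only [this]
  simp [cnt']

theorem gS_le (fr : Ideal (𝓞 F) → Gal(K/F)) (ψ : Gal(K/F) →* ℂˣ) {n : ℕ} (hn : 0 < n)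
    (hψn : ∀ g, ψ g ^ n = 1) {p : ℕ} (hp : p.Prime) : ‖gS fr ψ p‖ ≤ Module.finrank ℚ F := by
  refine (gS_le_cnt (m := 1) fr ψ hn hψn p 1).trans ?_
  exact_mod_cast cnt'_le fr _ hp _

theorem vT_summable (fr : Ideal (𝓞 F) → Gal(K/F)) (ψ : Gal(K/F) →* ℂˣ) {m n : ℕ} (hn : 0 < n)
    (hψn : ∀ g, ψ g ^ n = 1) (H : (ZMod m)ˣ → ℂ) (hH : ∀ u, ‖H u‖ ≤ 1) {s : ℝ} (hs : 1 < s) :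
    Summable fun p : ℕ => vT fr ψ H p * (((p:ℝ) ^ (-s) : ℝ) : ℂ) := by
  refine Summable.of_norm_bounded (g := fun k : ℕ => (Module.finrank ℚ F : ℝ) * (k:ℝ) ^ (-s))
    ((Real.summable_nat_rpow.2 (by linarith)).mul_left _) fun k => ?_
  rw [norm_mul, Complex.norm_real, Real.norm_of_nonneg (by positivity)]
  gcongr
  by_cases h : k.Prime ∧ k ∉ bad K m ∧ IsUnit (k : ZMod m)
  · rw [vT, dif_pos h, norm_mul]
    have h1 := gS_le fr ψ hn hψn h.1
    have h2 := hH h.2.2.unit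
    calc _ ≤ (Module.finrank ℚ F : ℝ) * 1 := by gcongr
      _ = _ := mul_one _
  · rw [vT, dif_neg h, norm_zero]
    positivity

theorem tail_le (fr : Ideal (𝓞 F) → Gal(K/F)) (ψ : Gal(K/F) →* ℂˣ) {m n : ℕ} [NeZero m] (hn : 0 < n)
    (hψn : ∀ g, ψ g ^ n = 1) (H : (ZMod m)ˣ → ℂ) (hH : ∀ u, H u = 1 ∨ H u = 0) {s s' : ℝ} (hs : 1 < s) (hs' : s ≤ s') :
    ‖(∑' p : ℕ, vT fr ψ H p * (((p:ℝ) ^ (-s) : ℝ) : ℂ)) - ∑' p : ℕ, vT fr ψ H p * (((p:ℝ) ^ (-s') : ℝ) : ℂ)‖ ≤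
      ‖W fr ⊤ H s - W fr ⊤ H s'‖ := by
  have hs1 : 1 < s' := by linarith
  have hH1 : ∀ u, ‖H u‖ ≤ 1 := fun u => by rcases hH u with h | h <;> simp [h]
  have hw : ∀ p, wT fr ⊤ H p = (‖wT fr ⊤ H p‖ : ℂ) := by
    intro p
    by_cases h : p.Prime ∧ p ∉ bad K m ∧ IsUnit (p : ZMod m)
    · rw [wT, dif_pos h]
      rcases hH h.2.2.unit with h | h <;> simp [h]
    · rw [wT, dif_neg h]; simp
  have hv : ∀ p, ‖vT fr ψ H p‖ ≤ ‖wT fr ⊤ H p‖ := by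
    intro p
    by_cases h : p.Prime ∧ p ∉ bad K m ∧ IsUnit (p : ZMod m)
    · rw [wT, dif_pos h, vT, dif_pos h, norm_mul, norm_mul, Complex.norm_natCast]
      gcongr
      exact gS_le_cnt fr ψ hn hψn _ _
    · rw [wT, dif_neg h, vT, dif_neg h]
  have hmono : ∀ p : ℕ, vT fr ψ H p ≠ 0 ∨ wT fr ⊤ H p ≠ 0 → 0 ≤ (p:ℝ) ^ (-s) - (p:ℝ) ^ (-s') := by
    intro p h
    have hp : p.Prime := by
      by_contra hp
      have : ¬ (p.Prime ∧ p ∉ bad K m ∧ IsUnit (p : ZMod m)) := by tauto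
      simp [vT, wT, this] at h
    rw [sub_nonneg]
    exact Real.rpow_le_rpow_of_exponent_le (by exact_mod_cast hp.one_le) (by linarith)
  have sw := (W_summable fr ⊤ H hs).sub (W_summable fr ⊤ H hs1)
  have sv := (vT_summable fr ψ hn hψn H hH1 hs).sub (vT_summable fr ψ hn hψn H hH1 hs1)
  have e1 : W fr ⊤ H s - W fr ⊤ H s' = ((∑' p : ℕ, ‖wT fr ⊤ H p‖ * ((p:ℝ) ^ (-s) - (p:ℝ) ^ (-s')) : ℝ) : ℂ) := by
    rw [W, W, ← (W_summable fr ⊤ H hs).tsum_sub (W_summable fr ⊤ H hs1), Complex.ofReal_tsum]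
    congr 1
    funext p
    rw [← mul_sub]
    push_cast
    rw [← hw]
  have sw' : Summable fun p : ℕ => ‖wT fr ⊤ H p‖ * ((p:ℝ) ^ (-s) - (p:ℝ) ^ (-s')) := by
    rw [← Complex.summable_ofReal]
    refine sw.congr fun p => ?_
    rw [← mul_sub]
    push_cast
    rw [← hw]
  have hnn : ∀ p : ℕ, 0 ≤ ‖wT fr ⊤ H p‖ * ((p:ℝ) ^ (-s) - (p:ℝ) ^ (-s')) := by
    intro p
    by_cases h : wT fr ⊤ H p = 0
    · simp [h]
    · exact mul_nonneg (norm_nonneg _) (hmono p (Or.inr h))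
  rw [e1, Complex.norm_real, Real.norm_of_nonneg (tsum_nonneg hnn),
    ← (vT_summable fr ψ hn hψn H hH1 hs).tsum_sub (vT_summable fr ψ hn hψn H hH1 hs1)]
  refine tsum_of_norm_bounded sw'.hasSum fun p => ?_
  rw [← mul_sub, norm_mul]
  by_cases h : vT fr ψ H p = 0
  · rw [h, norm_zero, zero_mul]; exact hnn p
  · have h2 := hmono p (Or.inl h)
    rw [← Complex.ofReal_sub, Complex.norm_real, Real.norm_of_nonneg h2]
    gcongr
    exact hv p

end

end Mert


namespace Mert

open NumberField Finset Filter Topology MeasureTheory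

universe u v

section
variable {F : Type u} {K : Type v} [Field F] [NumberField F] [Field K] [NumberField K]
    [Algebra F K] [IsGalois F K]

/-- the properties provided by thmU for a fixed modulus and fixed s, s' -/
def UProp (fr : Ideal (𝓞 F) → Gal(K/F)) (n m : ℕ) (s s' Y Λ : ℝ) : Prop :=
  ∀ Q : Subgroup (Gal(K/F) × (ZMod m)ˣ), Q.index ≤ n →
    ‖Q.index * (W fr Q (fun _ => 1) s - W fr Q (fun _ => 1) s') - (Λ : ℂ)‖ ≤ Y ∧
    ∀ χ : (ZMod m)ˣ →* ℂˣ, χ (-1) = 1 → χ ^ n = 1 → (∃ g x, (g, x) ∈ Q ∧ χ x ≠ 1) →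
      ‖W fr Q (fun u => (χ u : ℂ)) s - W fr Q (fun u => (χ u : ℂ)) s'‖ ≤ Y

theorem W_expand' {fr : Ideal (𝓞 F) → Gal(K/F)} {n m k : ℕ} [NeZero m] (hn : 0 < n) {s s' Y Λ : ℝ}
    (hU : UProp fr n m s s' Y Λ) (hs : 1 < s) (hs' : 1 < s') (hY : 0 ≤ Y)
    {β : Fin k → ((ZMod m)ˣ →* ℂˣ)} (hβ : ∀ i u, β i u ^ n = 1) (hβ1 : ∀ i, β i (-1) = 1)
    (hind : ∀ a : Fin k → ℕ, (∀ i, a i < n) → (∀ u, ∏ i, β i u ^ a i = 1) → ∀ i, a i = 0)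
    (Q : Subgroup (Gal(K/F) × (ZMod m)ˣ)) (hQ : Q.index ≤ n) (hQ2 : ∀ u, ∃ g, (g, u) ∈ Q)
    (h : Fin k → ℂ → ℂ) (hh : ∀ l z, z ^ n = 1 → ‖h l z‖ ≤ 1) :
    ‖(W fr Q (fun u => ∏ l, h l (β l u)) s - W fr Q (fun u => ∏ l, h l (β l u)) s') -
      (∏ l, fc n (h l) 0) * (W fr Q (fun _ => 1) s - W fr Q (fun _ => 1) s')‖ ≤ n ^ k * Y := by
  apply W_expand fr Q hn β hβ h hh hs hs' hY
  intro a ha ha0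
  have hv : ∀ u, (∏ l, β l ^ a l : (ZMod m)ˣ →* ℂˣ) u = ∏ l, β l u ^ a l := by
    intro u
    rw [MonoidHom.finset_prod_apply]
    rfl
  have hne : ∃ u, ∏ l, β l u ^ a l ≠ 1 := by
    by_contra hc
    push Not at hc
    exact ha0 (funext (hind a ha hc))
  obtain ⟨u, hu⟩ := hne
  obtain ⟨g, hg⟩ := hQ2 u
  have := (hU Q hQ).2 (∏ l, β l ^ a l) (by rw [hv]; simp [hβ1]) (by
    refine MonoidHom.ext fun u => ?_
    change ((∏ l, β l ^ a l : (ZMod m)ˣ →* ℂˣ) u) ^ n = 1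
    rw [hv, ← Finset.prod_pow]
    apply Finset.prod_eq_one
    intro l _
    rw [← pow_mul, mul_comm, pow_mul, hβ, one_pow]) ⟨g, u, hg, by rw [hv]; exact hu⟩
  simpa [hv] using this

theorem V_bound {fr : Ideal (𝓞 F) → Gal(K/F)} {n m k : ℕ} [NeZero m] (hn : 2 ≤ n) {s s' Y Λ q : ℝ}
    (hU : UProp fr n m s s' Y Λ) (hs : 1 < s) (hss' : s ≤ s') (hY : 0 ≤ Y) (hΛ : 0 ≤ Λ)
    (hq0 : 0 ≤ q) (hq1 : q < 1) (hq : fc n (fun z => 1 - wp n z) 0 = q)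
    {β : Fin k → ((ZMod m)ˣ →* ℂˣ)} (hβ : ∀ i u, β i u ^ n = 1) (hβ1 : ∀ i, β i (-1) = 1)
    (hind : ∀ a : Fin k → ℕ, (∀ i, a i < n) → (∀ u, ∏ i, β i u ^ a i = 1) → ∀ i, a i = 0)
    (ψ : Gal(K/F) →* ℂˣ) (hcard : Nat.card ψ.range = n)
    (hψn : ∀ g, ψ g ^ n = 1) (hsurj : ∀ z : ℂˣ, z ^ n = 1 → ∃ g, ψ g = z) :
    ‖(∑' p : ℕ, vT fr ψ (fun _ : (ZMod m)ˣ => 1) p * (((p:ℝ) ^ (-s) : ℝ) : ℂ)) -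
      ∑' p : ℕ, vT fr ψ (fun _ : (ZMod m)ˣ => 1) p * (((p:ℝ) ^ (-s') : ℝ) : ℂ)‖ ≤
      q ^ k * Λ + (k + 1) * n * (n ^ k + 1) * Y := by
  have hn0 : 0 < n := by omega
  have hs' : 1 < s' := by linarith
  set t : (ZMod m)ˣ → ℂ := fun u => ∏ l, (1 - wp n (β l u)) with ht
  have ht1 : ∀ u, t u = 1 ∨ t u = 0 := by
    intro u
    by_cases h : ∃ l, 1 - wp n (β l u) = 0
    · obtain ⟨l, hl⟩ := h
      right
      exact Finset.prod_eq_zero (mem_univ l) hl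
    · push Not at h
      left
      apply Finset.prod_eq_one
      intro l _
      rcases wp_cases n (β l u : ℂ) with h1 | h1
      · exact absurd (by rw [h1, sub_self]) (h l)
      · rw [h1, sub_zero]
  have htn : ∀ u, ‖t u‖ ≤ 1 := fun u => by rcases ht1 u with h | h <;> simp [h]
  set Hs : Fin k → ℕ → (ZMod m)ˣ → ℂ := fun i j u => ∏ l, sf n i j l (β l u) with hHs
  set Qs : Fin k → ℕ → Subgroup (Gal(K/F) × (ZMod m)ˣ) := fun i j => Qc ψ (β i ^ j) with hQs
  have hsplit : ∀ s : ℝ, 1 < s → (∑' p : ℕ, vT fr ψ (fun _ : (ZMod m)ˣ => 1) p * (((p:ℝ) ^ (-s) : ℝ) : ℂ)) =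
      (∑' p : ℕ, vT fr ψ t p * (((p:ℝ) ^ (-s) : ℝ) : ℂ)) + ∑ i, ∑ j ∈ range n, W fr (Qs i j) (Hs i j) s := by
    intro s hs
    unfold W
    have a1 : ∀ i, ∑ j ∈ range n, (∑' p : ℕ, wT fr (Qs i j) (Hs i j) p * (((p:ℝ) ^ (-s) : ℝ) : ℂ)) =
        ∑' p : ℕ, ∑ j ∈ range n, wT fr (Qs i j) (Hs i j) p * (((p:ℝ) ^ (-s) : ℝ) : ℂ) := fun i =>
      (Summable.tsum_finsetSum fun j _ => W_summable fr _ _ hs).symm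
    simp only [a1]
    rw [← Summable.tsum_finsetSum fun i _ => summable_sum fun j _ => W_summable fr _ _ hs,
      ← (vT_summable fr ψ hn0 hψn t htn hs).tsum_add
        (summable_sum fun i _ => summable_sum fun j _ => W_summable fr _ _ hs)]
    congr 1
    funext p
    rw [vT_split fr ψ hn0 hψn β p]
    simp only [add_mul, Finset.sum_mul]
    rfl
  have hQi : ∀ i j, (Qs i j).index = n := fun i j => Qc_index ψ _ hcard hψn hsurj (fun u => by
    change (β i u ^ j) ^ n = 1
    rw [← pow_mul, mul_comm, pow_mul, hβ, one_pow])
  have hQ2 : ∀ i j u, ∃ g, (g, u) ∈ Qs i j := by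
    intro i j u
    obtain ⟨g, hg⟩ := hsurj ((β i u ^ j)⁻¹) (by
      rw [inv_pow, ← pow_mul, mul_comm, pow_mul, hβ, one_pow, inv_one])
    refine ⟨g, (mem_Qc _ _ _ _).2 ?_⟩
    rw [hg]
    exact inv_mul_cancel _
  -- main terms
  have main : ∀ i, ‖∑ j ∈ range n, (W fr (Qs i j) (Hs i j) s - W fr (Qs i j) (Hs i j) s')‖ ≤ n * (n ^ k + 1) * Y := by
    intro i
    set c : ℕ → ℂ := fun j => ∏ l, fc n (sf n i j l) 0 with hc
    have hc0 : ∑ j ∈ range n, c j = 0 := sf_fc hn i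
    set d : ℕ → ℂ := fun j => W fr (Qs i j) (fun _ => 1) s - W fr (Qs i j) (fun _ => 1) s' with hd
    have e : ∑ j ∈ range n, (W fr (Qs i j) (Hs i j) s - W fr (Qs i j) (Hs i j) s') =
        ∑ j ∈ range n, (((W fr (Qs i j) (Hs i j) s - W fr (Qs i j) (Hs i j) s') - c j * d j) +
          c j * (d j - Λ / n)) := by
      have : ∑ j ∈ range n, c j * ((Λ:ℂ) / n) = 0 := by rw [← Finset.sum_mul, hc0, zero_mul]
      rw [← sub_eq_zero, ← Finset.sum_sub_distrib, ← this]
      refine Finset.sum_congr rfl fun j _ => ?_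
      ring
    rw [e]
    refine (norm_sum_le _ _).trans ?_
    have hb : ∀ j ∈ range n, ‖((W fr (Qs i j) (Hs i j) s - W fr (Qs i j) (Hs i j) s') - c j * d j) +
          c j * (d j - Λ / n)‖ ≤ (n ^ k + 1) * Y := by
      intro j _
      refine (norm_add_le _ _).trans ?_
      rw [add_mul, one_mul]
      gcongr
      · exact W_expand' hn0 hU hs hs' hY hβ hβ1 hind (Qs i j) (hQi i j).le (hQ2 i j) (sf n i j)
          (fun l z hz => sf_le hn0 i j l z hz)
      · have h1 := (hU (Qs i j) (hQi i j).le).1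
        rw [hQi i j] at h1
        have hnC : (n:ℂ) ≠ 0 := by exact_mod_cast hn0.ne'
        have h2 : (n:ℂ) * d j - Λ = n * (d j - Λ / n) := by field_simp
        have h3 : ‖(n:ℂ) * (d j - Λ / n)‖ ≤ Y := by rw [← h2]; exact h1
        rw [norm_mul, Complex.norm_natCast] at h3
        have h4 : (1:ℝ) ≤ n := by exact_mod_cast hn0
        have h5 : ‖c j‖ ≤ 1 := by
          rw [hc, norm_prod]
          exact Finset.prod_le_one (fun _ _ => norm_nonneg _) fun l _ =>
            fc_le hn0 _ (fun z hz => sf_le hn0 i j l z hz) _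
        rw [norm_mul]
        calc ‖c j‖ * ‖d j - Λ / n‖ ≤ n * ‖d j - Λ / n‖ := by gcongr; linarith
          _ ≤ Y := h3
    refine (Finset.sum_le_card_nsmul _ _ _ hb).trans ?_
    rw [Finset.card_range, nsmul_eq_mul]
    exact le_of_eq (by ring)
  have tail : ‖(∑' p : ℕ, vT fr ψ t p * (((p:ℝ) ^ (-s) : ℝ) : ℂ)) - ∑' p : ℕ, vT fr ψ t p * (((p:ℝ) ^ (-s') : ℝ) : ℂ)‖ ≤
      q ^ k * Λ + (n ^ k + 1) * Y := by
    refine (tail_le fr ψ hn0 hψn t ht1 hs hss').trans ?_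
    have hi : (⊤ : Subgroup (Gal(K/F) × (ZMod m)ˣ)).index = 1 := Subgroup.index_top
    have h1 := W_expand' hn0 hU hs hs' hY hβ hβ1 hind ⊤ (by rw [hi]; omega) (fun u => ⟨1, trivial⟩)
      (fun _ z => 1 - wp n z) (fun l z hz => wp_le n z)
    have h2 := (hU ⊤ (by rw [hi]; omega)).1
    rw [hi, Nat.cast_one, one_mul] at h2
    simp only [hq, Finset.prod_const, Finset.card_univ, Fintype.card_fin] at h1
    set w := W fr ⊤ (fun _ : (ZMod m)ˣ => 1) s - W fr ⊤ (fun _ : (ZMod m)ˣ => 1) s'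
    set w2 := W fr ⊤ t s - W fr ⊤ t s' with hw2
    have h1' : ‖w2 - (q:ℂ) ^ k * w‖ ≤ n ^ k * Y := h1
    have h3 : ‖w‖ ≤ Λ + Y := by
      calc ‖w‖ = ‖(Λ:ℂ) + (w - Λ)‖ := by congr 1; ring
        _ ≤ ‖(Λ:ℂ)‖ + ‖w - Λ‖ := norm_add_le _ _
        _ ≤ Λ + Y := by
          rw [Complex.norm_real, Real.norm_of_nonneg hΛ]
          gcongr
    have hqk : q ^ k ≤ 1 := pow_le_one₀ hq0 hq1.le
    calc ‖w2‖ = ‖(w2 - (q:ℂ) ^ k * w) + (q:ℂ) ^ k * w‖ := by congr 1; ring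
      _ ≤ n ^ k * Y + q ^ k * (Λ + Y) := by
        refine (norm_add_le _ _).trans ?_
        gcongr
        rw [norm_mul, norm_pow, Complex.norm_real, Real.norm_of_nonneg hq0]
        gcongr
      _ ≤ _ := by nlinarith [mul_le_mul_of_nonneg_right hqk hY]
  rw [hsplit s hs, hsplit s' hs', add_sub_add_comm, ← Finset.sum_sub_distrib]
  simp only [← Finset.sum_sub_distrib]
  refine (norm_add_le _ _).trans ?_
  have h4 : ‖∑ i, ∑ j ∈ range n, (W fr (Qs i j) (Hs i j) s - W fr (Qs i j) (Hs i j) s')‖ ≤ k * (n * (n ^ k + 1) * Y) := by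
    refine (norm_sum_le _ _).trans ?_
    refine (Finset.sum_le_card_nsmul _ _ _ fun i _ => main i).trans ?_
    simp
  have h5 : (n ^ k + 1 : ℝ) * Y ≤ n * ((n ^ k + 1) * Y) := by
    have h4 : (1:ℝ) ≤ n := by exact_mod_cast hn0
    exact le_mul_of_one_le_left (by positivity) h4
  nlinarith [tail, h4, h5]

/-- coefficients of the prime sum -/
noncomputable def sT (fr : Ideal (𝓞 F) → Gal(K/F)) (ψ : Gal(K/F) →* ℂˣ) (p : ℕ) : ℂ :=
  if p.Prime then gS fr ψ p else 0

theorem sT_le (fr : Ideal (𝓞 F) → Gal(K/F)) (ψ : Gal(K/F) →* ℂˣ) {n : ℕ} (hn : 0 < n)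
    (hψn : ∀ g, ψ g ^ n = 1) (p : ℕ) : ‖sT fr ψ p‖ ≤ Module.finrank ℚ F := by
  unfold sT
  split_ifs with h
  · exact gS_le fr ψ hn hψn h
  · simp

theorem sT_summable (fr : Ideal (𝓞 F) → Gal(K/F)) (ψ : Gal(K/F) →* ℂˣ) {n : ℕ} (hn : 0 < n)
    (hψn : ∀ g, ψ g ^ n = 1) {s : ℝ} (hs : 1 < s) :
    Summable fun p : ℕ => sT fr ψ p * (((p:ℝ) ^ (-s) : ℝ) : ℂ) := by
  refine Summable.of_norm_bounded (g := fun k : ℕ => (Module.finrank ℚ F : ℝ) * (k:ℝ) ^ (-s))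
    ((Real.summable_nat_rpow.2 (by linarith)).mul_left _) fun k => ?_
  rw [norm_mul, Complex.norm_real, Real.norm_of_nonneg (by positivity)]
  gcongr
  exact sT_le fr ψ hn hψn k

theorem sT_vT (fr : Ideal (𝓞 F) → Gal(K/F)) (ψ : Gal(K/F) →* ℂˣ) {n : ℕ} (hn : 0 < n)
    (hψn : ∀ g, ψ g ^ n = 1) {m : ℕ} [NeZero m] {s s' : ℝ} (hs : 1 < s) (hs' : 1 < s') :
    ‖((∑' p : ℕ, sT fr ψ p * (((p:ℝ) ^ (-s) : ℝ) : ℂ)) - ∑' p : ℕ, sT fr ψ p * (((p:ℝ) ^ (-s') : ℝ) : ℂ)) -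
      ((∑' p : ℕ, vT fr ψ (fun _ : (ZMod m)ˣ => 1) p * (((p:ℝ) ^ (-s) : ℝ) : ℂ)) -
      ∑' p : ℕ, vT fr ψ (fun _ : (ZMod m)ˣ => 1) p * (((p:ℝ) ^ (-s') : ℝ) : ℂ))‖ ≤
      (bad K m).card * Module.finrank ℚ F * |s - s'| := by
  have key : ∀ s : ℝ, 1 < s → (∑' p : ℕ, sT fr ψ p * (((p:ℝ) ^ (-s) : ℝ) : ℂ)) -
      (∑' p : ℕ, vT fr ψ (fun _ : (ZMod m)ˣ => 1) p * (((p:ℝ) ^ (-s) : ℝ) : ℂ)) =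
      ∑ p ∈ bad K m, sT fr ψ p * (((p:ℝ) ^ (-s) : ℝ) : ℂ) := by
    intro s hs
    rw [← (sT_summable fr ψ hn hψn hs).tsum_sub (vT_summable fr ψ hn hψn _ (by simp) hs),
      tsum_eq_sum (s := bad K m)]
    · apply Finset.sum_congr rfl
      intro p hp
      rw [vT, dif_neg (by tauto)]
      ring
    · intro p hp
      by_cases hpp : p.Prime
      · obtain ⟨h1, h2⟩ := not_bad hpp hp
        obtain ⟨u, hu⟩ := unit_of_not_dvd hpp h1
        rw [vT, dif_pos ⟨hpp, hp, hu ▸ u.isUnit⟩, sT, if_pos hpp]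
        ring
      · rw [vT, dif_neg (by tauto), sT, if_neg hpp]
        ring
  rw [sub_sub_sub_comm, key s hs, key s' hs', ← Finset.sum_sub_distrib]
  refine (norm_sum_le _ _).trans ?_
  rw [mul_assoc, ← nsmul_eq_mul]
  apply Finset.sum_le_card_nsmul
  intro p hp
  have hpp := Nat.prime_of_mem_primeFactors hp
  rw [← mul_sub, ← Complex.ofReal_sub, norm_mul, Complex.norm_real, Real.norm_eq_abs]
  refine mul_le_mul (sT_le fr ψ hn hψn p) ((rpow_lip hpp.ne_zero hs.le hs'.le).trans ?_) (abs_nonneg _) (by positivity)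
  have hp0 : (0:ℝ) < p := by exact_mod_cast hpp.pos
  have : Real.log p / p ≤ 1 := by
    rw [div_le_one hp0]
    exact (Real.log_le_sub_one_of_pos hp0).trans (by linarith)
  nlinarith [abs_nonneg (s - s')]

end

end Mert


namespace Mert

open NumberField Finset Filter Topology MeasureTheory

theorem window {S : ℝ → ℂ} {q : ℝ} (hq0 : 0 ≤ q) (hq1 : q < 1) {B : ℕ}
    (h : ∀ (k : ℕ) (s s' : ℝ), 1 < s → s ≤ s' → (s' - 1) * (2:ℝ) ^ (B * (k + 1) ^ 4) ≤ 1 →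
      ‖S s - S s'‖ ≤ q ^ k * (Real.log (1 / (s - 1)) - Real.log (1 / (s' - 1))) +
        (2:ℝ) ^ (B * (k + 1) ^ 4) * (s' - s)) :
    ∃ C : ℂ, Tendsto S (𝓝[>] 1) (𝓝 C) := by
  set ε : ℕ → ℝ := fun k => ((2:ℝ) ^ ((B + 1) * (k + 1) ^ 4))⁻¹ with hε
  have hεpos : ∀ k, 0 < ε k := fun k => by positivity
  have hanti : ∀ j k, j ≤ k → ε k ≤ ε j := by
    intro j k hjk
    apply inv_anti₀ (by positivity)
    apply pow_le_pow_right₀ (by norm_num)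
    gcongr
  have hk4 : ∀ k : ℕ, k ≤ (k + 1) ^ 4 := fun k =>
    le_trans (Nat.le_succ k) (Nat.le_self_pow (by norm_num) _)
  have hM : ∀ k, (2:ℝ) ^ (B * (k + 1) ^ 4) * ε k ≤ (1 / 2) ^ k := by
    intro k
    rw [hε]
    simp only
    rw [add_mul, pow_add, one_mul, mul_inv, ← mul_assoc, mul_inv_cancel₀ (by positivity), one_mul, one_div, inv_pow]
    apply inv_anti₀ (by positivity)
    exact pow_le_pow_right₀ (by norm_num) (hk4 k)
  have hε0 : Tendsto ε atTop (𝓝 0) := by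
    refine squeeze_zero (fun k => (hεpos k).le) (fun k => ?_)
      (tendsto_pow_atTop_nhds_zero_of_lt_one (by norm_num : (0:ℝ) ≤ 1 / 2) (by norm_num))
    refine le_trans ?_ (hM k)
    exact le_mul_of_one_le_left (hεpos k).le (one_le_pow₀ (by norm_num))
  set b : ℕ → ℝ := fun k => ((B + 1) * Real.log 2) * (q ^ k * ((k:ℝ) + 2) ^ 4) + (1 / 2) ^ k with hb
  have hl2 : 0 ≤ Real.log 2 := Real.log_nonneg (by norm_num)
  have hbs : Summable b := by
    apply Summable.add
    · apply Summable.mul_left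
      have h1 : ∀ j : ℕ, Summable fun k : ℕ => (k:ℝ) ^ j * q ^ k := fun j =>
        summable_pow_mul_geometric_of_norm_lt_one j (by rw [Real.norm_of_nonneg hq0]; exact hq1)
      have h2 := ((((h1 4).add ((h1 3).mul_left 8)).add ((h1 2).mul_left 24)).add ((h1 1).mul_left 32)).add
        ((h1 0).mul_left 16)
      refine h2.congr fun k => ?_
      ring
    · exact summable_geometric_of_lt_one (by norm_num) (by norm_num)
  have hwin : ∀ (k : ℕ) (s s' : ℝ), 1 + ε (k + 1) ≤ s → s ≤ s' → s' ≤ 1 + ε k → ‖S s - S s'‖ ≤ b k := by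
    intro k s s' h1 h2 h3
    have e1 := hεpos (k + 1)
    have hs : 1 < s := by linarith
    have h4 : (2:ℝ) ^ (B * (k + 1) ^ 4) * (s' - 1) ≤ (1 / 2) ^ k :=
      le_trans (mul_le_mul_of_nonneg_left (by linarith) (by positivity)) (hM k)
    have h5 : ((1:ℝ) / 2) ^ k ≤ 1 := pow_le_one₀ (by norm_num) (by norm_num)
    refine (h k s s' hs h2 (by rw [mul_comm]; exact h4.trans h5)).trans ?_
    rw [hb]
    simp only
    have h6 : Real.log (1 / (s - 1)) ≤ (B + 1) * Real.log 2 * ((k:ℝ) + 2) ^ 4 := by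
      have : 1 / (s - 1) ≤ (2:ℝ) ^ ((B + 1) * (k + 1 + 1) ^ 4) := by
        rw [one_div, inv_le_comm₀ (by linarith) (by positivity)]
        have : ε (k + 1) ≤ s - 1 := by linarith
        exact this
      refine (Real.log_le_log (by apply one_div_pos.2; linarith) this).trans ?_
      rw [Real.log_pow]
      push_cast
      exact le_of_eq (by ring)
    have h7 : 0 ≤ Real.log (1 / (s' - 1)) := by
      apply Real.log_nonneg
      rw [le_div_iff₀ (by linarith), one_mul]
      have := hM k
      have e2 : ε k ≤ (2:ℝ) ^ (B * (k + 1) ^ 4) * ε k :=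
        le_mul_of_one_le_left (hεpos k).le (one_le_pow₀ (by norm_num))
      linarith
    have h8 : (2:ℝ) ^ (B * (k + 1) ^ 4) * (s' - s) ≤ (1 / 2) ^ k :=
      le_trans (mul_le_mul_of_nonneg_left (by linarith) (by positivity)) h4
    have h9 : q ^ k * (Real.log (1 / (s - 1)) - Real.log (1 / (s' - 1))) ≤
        q ^ k * ((B + 1) * Real.log 2 * ((k:ℝ) + 2) ^ 4) :=
      mul_le_mul_of_nonneg_left (by linarith) (by positivity)
    linarith
  have hcs : CauchySeq fun k => S (1 + ε k) := by
    apply cauchySeq_of_dist_le_of_summable b _ hbs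
    intro k
    rw [dist_comm, dist_eq_norm]
    have h0 := hanti k (k + 1) (by omega)
    have h1 : 1 + ε (k + 1) ≤ 1 + ε k := by linarith
    exact hwin k _ _ le_rfl h1 le_rfl
  obtain ⟨C, hC⟩ := cauchySeq_tendsto_of_complete hcs
  refine ⟨C, ?_⟩
  rw [Metric.tendsto_nhds]
  intro δ hδ
  have hb0 := hbs.tendsto_atTop_zero
  obtain ⟨N1, hN1⟩ := Metric.tendsto_atTop.1 hC (δ / 2) (by positivity)
  obtain ⟨N2, hN2⟩ := Metric.tendsto_atTop.1 hb0 (δ / 2) (by positivity)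
  set N := max N1 N2 with hN
  have hmem : Set.Ioo 1 (1 + ε N) ∈ 𝓝[>] (1:ℝ) := Ioo_mem_nhdsGT (by have := hεpos N; linarith)
  filter_upwards [hmem] with s hs
  have hex : ∃ j, 1 + ε j < s := by
    have := (hε0.eventually (gt_mem_nhds (show (0:ℝ) < s - 1 by linarith [hs.1]))).exists
    obtain ⟨j, hj⟩ := this
    exact ⟨j, by linarith⟩
  classical
  have hj := Nat.find_spec hex
  have hmin := fun i hi => Nat.find_min hex (m := i) hi
  set j := Nat.find hex
  have hjN : N < j := by
    by_contra hc
    have := hanti j N (by omega)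
    linarith [hs.2]
  obtain ⟨k, hk⟩ : ∃ k, j = k + 1 := ⟨j - 1, by omega⟩
  have h1 := hwin k s (1 + ε k) (by rw [← hk]; exact hj.le) (not_lt.1 (hmin k (by omega))) le_rfl
  have h2 := hN1 k (by omega)
  have h3 := hN2 k (by omega)
  rw [Real.dist_eq, sub_zero] at h3
  calc dist (S s) C ≤ dist (S s) (S (1 + ε k)) + dist (S (1 + ε k)) C := dist_triangle _ _ _
    _ < δ / 2 + δ / 2 := by
      apply add_lt_add _ h2
      rw [dist_eq_norm]
      exact lt_of_le_of_lt (h1.trans (le_abs_self _)) h3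
    _ = δ := by ring

end Mert


namespace Mert

open NumberField Finset Filter Topology MeasureTheory

universe u v

theorem char_facts {G : Type*} [Group G] [Finite G] (ψ : G →* ℂˣ) (hψ : ψ ≠ 1) :
    2 ≤ Nat.card ψ.range ∧ (∀ g, ψ g ^ Nat.card ψ.range = 1) ∧
      ∀ z : ℂˣ, z ^ Nat.card ψ.range = 1 → ∃ g, ψ g = z := by
  haveI : Finite ψ.range := inferInstanceAs (Finite (Set.range ψ))
  have h1 : ∀ g, ψ g ^ Nat.card ψ.range = 1 := by
    intro g
    have := pow_card_eq_one' (x := (⟨ψ g, g, rfl⟩ : ψ.range))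
    simpa [Subtype.ext_iff] using this
  have hpos : 0 < Nat.card ψ.range := Nat.card_pos
  refine ⟨?_, h1, ?_⟩
  · by_contra hc
    have h2 : Nat.card ψ.range = 1 := by omega
    apply hψ
    ext g
    have := h1 g
    rw [h2, pow_one] at this
    simp [this]
  · intro z hz
    set n := Nat.card ψ.range with hn
    haveI : NeZero n := ⟨hpos.ne'⟩
    have hle : ψ.range ≤ rootsOfUnity n ℂ := by
      rintro _ ⟨g, rfl⟩
      exact (mem_rootsOfUnity n _).2 (h1 g)
    have heq : ψ.range = rootsOfUnity n ℂ := by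
      apply Subgroup.eq_of_le_of_card_ge hle
      rw [Complex.card_rootsOfUnity]
    have : z ∈ ψ.range := by rw [heq]; exact (mem_rootsOfUnity n _).2 hz
    exact this

theorem const_bound (n A d B : ℕ) : ∃ B' : ℕ, ∀ k : ℕ, ((2:ℝ) ^ (B * (k + 1) ^ 4)) ^ A ≤ (2:ℝ) ^ (B' * (k + 1) ^ 4) ∧
    ((k:ℝ) + 1) * n * (n ^ k + 1) * ((2:ℝ) ^ (B * (k + 1) ^ 4)) ^ A + ((2:ℝ) ^ (B * (k + 1) ^ 4)) ^ 2 * d ≤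
      (2:ℝ) ^ (B' * (k + 1) ^ 4) := by
  refine ⟨2 * n + 3 + B * A + B * 2 + d, fun k => ?_⟩
  set T := (k + 1) ^ 4 with hT
  have hT1 : 1 ≤ T := Nat.one_le_pow _ _ (by omega)
  have hk : k + 1 ≤ T := Nat.le_self_pow (by norm_num) _
  have two : ∀ x y : ℕ, x ≤ y → (2:ℝ) ^ x ≤ 2 ^ y := fun x y h => pow_le_pow_right₀ (by norm_num) h
  have hlt : ∀ x : ℕ, (x:ℝ) ≤ 2 ^ x := fun x => by exact_mod_cast (Nat.lt_two_pow_self (n := x)).le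
  have a1 : ((k:ℝ) + 1) ≤ 2 ^ T := by
    calc ((k:ℝ) + 1) = ((k + 1 : ℕ) : ℝ) := by push_cast; ring
      _ ≤ 2 ^ (k + 1) := hlt _
      _ ≤ _ := two _ _ hk
  have a2 : (n:ℝ) ≤ 2 ^ (n * T) := (hlt n).trans (two _ _ (Nat.le_mul_of_pos_right _ (by omega)))
  have a3 : (n:ℝ) ^ k + 1 ≤ 2 ^ (n * T + T) := by
    have : (n:ℝ) ^ k ≤ 2 ^ (n * T) := by
      calc (n:ℝ) ^ k ≤ (2 ^ n) ^ k := by gcongr; exact hlt n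
        _ = 2 ^ (n * k) := by rw [pow_mul]
        _ ≤ _ := two _ _ (Nat.mul_le_mul_left _ (by omega))
    have h1 : (1:ℝ) ≤ 2 ^ (n * T) := one_le_pow₀ (by norm_num)
    calc _ ≤ (2:ℝ) ^ (n * T) * 2 ^ 1 := by linarith
      _ = 2 ^ (n * T + 1) := by rw [pow_add]
      _ ≤ _ := two _ _ (by omega)
  have a4 : (d:ℝ) ≤ 2 ^ (d * T) := (hlt d).trans (two _ _ (Nat.le_mul_of_pos_right _ (by omega)))
  constructor
  · rw [← pow_mul]
    apply two
    nlinarith [Nat.zero_le (n * T), Nat.zero_le T, Nat.zero_le (B * T), Nat.zero_le (d * T)]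
  · have b1 : ((k:ℝ) + 1) * n * (n ^ k + 1) * ((2:ℝ) ^ (B * T)) ^ A ≤ 2 ^ ((2 * n + 2 + B * A) * T) := by
      calc _ ≤ (2:ℝ) ^ T * 2 ^ (n * T) * 2 ^ (n * T + T) * ((2:ℝ) ^ (B * T)) ^ A := by gcongr
        _ = _ := by
          rw [← pow_mul, ← pow_add, ← pow_add, ← pow_add]
          congr 1
          ring
    have b2 : ((2:ℝ) ^ (B * T)) ^ 2 * d ≤ 2 ^ ((B * 2 + d) * T) := by
      calc _ ≤ ((2:ℝ) ^ (B * T)) ^ 2 * 2 ^ (d * T) := by gcongr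
        _ = _ := by
          rw [← pow_mul, ← pow_add]
          congr 1
          ring
    have b3 : (2:ℝ) ^ ((2 * n + 2 + B * A) * T) ≤ 2 ^ ((2 * n + 2 + B * A + B * 2 + d) * T) :=
      two _ _ (Nat.mul_le_mul_right _ (by omega))
    have b4 : (2:ℝ) ^ ((B * 2 + d) * T) ≤ 2 ^ ((2 * n + 2 + B * A + B * 2 + d) * T) :=
      two _ _ (Nat.mul_le_mul_right _ (by omega))
    calc _ ≤ (2:ℝ) ^ ((2 * n + 2 + B * A + B * 2 + d) * T) * 2 ^ 1 := by linarith
      _ = 2 ^ ((2 * n + 2 + B * A + B * 2 + d) * T + 1) := by rw [pow_add]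
      _ ≤ _ := two _ _ (by nlinarith)

section
variable {F : Type u} {K : Type v} [Field F] [NumberField F] [Field K] [NumberField K]
    [Algebra F K] [IsGalois F K]

theorem S_lim (hab : ∀ σ τ : Gal(K/F), σ * τ = τ * σ)
    (fr : Ideal (𝓞 F) → Gal(K/F))
    (hfr : ∀ 𝔭 : Ideal (𝓞 F), 𝔭.IsPrime → 𝔭 ≠ ⊥ → ∃ 𝔔 : Ideal (𝓞 K), 𝔔.IsPrime ∧
      𝔔.under (𝓞 F) = 𝔭 ∧ Fr (fr 𝔭) 𝔔 (Ideal.absNorm 𝔭)) (ψ : Gal(K/F) →* ℂˣ) (hψ : ψ ≠ 1) :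
    ∃ C : ℂ, Tendsto (fun s : ℝ => ∑' p : ℕ, sT fr ψ p * (((p:ℝ) ^ (-s) : ℝ) : ℂ)) (𝓝[>] 1) (𝓝 C) := by
  obtain ⟨hn2, hψn, hsurj⟩ := char_facts ψ hψ
  set n := Nat.card ψ.range with hn
  have hn0 : 0 < n := by omega
  obtain ⟨A, hA⟩ := thmU hab fr hfr n hn0
  set D := (discr K).natAbs with hD
  have hD0 : 0 < D := Int.natAbs_pos.2 (discr_ne_zero K)
  obtain ⟨c, hc⟩ := supply n hn0 D hD0
  obtain ⟨q, hq0, hq1, hq⟩ := qfc hn0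
  set d := Module.finrank ℚ F with hd
  obtain ⟨B', hB'⟩ := const_bound n A d (c + D)
  apply window hq0 hq1 (B := B')
  intro k s s' hs hss' hsB
  obtain ⟨r, hp, h1, hcop, hinj, hprod⟩ := hc k
  obtain ⟨β, hβ, hβ1, hind⟩ := chars n hn0 r hp h1 hinj (m := ∏ i, r i) rfl
  set m := ∏ i, r i with hm
  have hm0 : m ≠ 0 := Finset.prod_ne_zero_iff.2 fun i _ => (hp i).ne_zero
  haveI : NeZero m := ⟨hm0⟩
  set X : ℝ := (2:ℝ) ^ ((c + D) * (k + 1) ^ 4) with hX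
  have hT1 : 1 ≤ (k + 1) ^ 4 := Nat.one_le_pow _ _ (by omega)
  have two : ∀ x y : ℕ, x ≤ y → (2:ℝ) ^ x ≤ 2 ^ y := fun x y h => pow_le_pow_right₀ (by norm_num) h
  have hX2 : 2 ≤ X := by
    calc (2:ℝ) = 2 ^ 1 := by norm_num
      _ ≤ X := two _ _ (by nlinarith)
  have hmX : (m:ℝ) ≤ X := by
    calc (m:ℝ) ≤ 2 ^ (c * (k + 1) ^ 4) := by exact_mod_cast hprod
      _ ≤ X := two _ _ (Nat.mul_le_mul_right _ (by omega))
  have hDX : (D:ℝ) ≤ X := by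
    calc (D:ℝ) ≤ 2 ^ D := by exact_mod_cast (Nat.lt_two_pow_self (n := D)).le
      _ ≤ X := two _ _ (by nlinarith [Nat.zero_le c])
  have hmD : Nat.Coprime m D := Nat.Coprime.prod_left fun i _ => hcop i
  obtain ⟨hB1, hB2⟩ := hB' k
  have hs' : 1 < s' := by linarith
  have hs'A : (s' - 1) * X ^ A ≤ 1 :=
    le_trans (mul_le_mul_of_nonneg_left hB1 (by linarith)) hsB
  have hsA : (s - 1) * X ^ A ≤ 1 :=
    le_trans (mul_le_mul_of_nonneg_right (by linarith) (by positivity)) hs'A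
  have habs : |s - s'| = s' - s := by rw [abs_sub_comm, abs_of_nonneg (by linarith)]
  set Λ := Real.log (1 / (s - 1)) - Real.log (1 / (s' - 1)) with hΛ
  have hΛ0 : 0 ≤ Λ := by
    rw [hΛ, sub_nonneg]
    apply Real.log_le_log (one_div_pos.2 (by linarith))
    apply one_div_le_one_div_of_le <;> linarith
  have hU : UProp fr n m s s' (X ^ A * |s - s'|) Λ := fun Q hQ =>
    hA hmD hX2 hmX hDX Q hQ s s' hs hsA hs' hs'A
  have hV := V_bound hn2 hU hs hss' (by positivity) hΛ0 hq0 hq1 hq hβ hβ1 hind ψ hn.symm hψn hsurj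
  have hS := sT_vT fr ψ hn0 hψn (m := m) hs hs'
  have hcard := (exp_card (K := K) hX2 hmX hDX).2
  have hfin := norm_add_le
    (((∑' p : ℕ, sT fr ψ p * (((p:ℝ) ^ (-s) : ℝ) : ℂ)) - ∑' p : ℕ, sT fr ψ p * (((p:ℝ) ^ (-s') : ℝ) : ℂ)) -
      ((∑' p : ℕ, vT fr ψ (fun _ : (ZMod m)ˣ => 1) p * (((p:ℝ) ^ (-s) : ℝ) : ℂ)) -
      ∑' p : ℕ, vT fr ψ (fun _ : (ZMod m)ˣ => 1) p * (((p:ℝ) ^ (-s') : ℝ) : ℂ)))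
    ((∑' p : ℕ, vT fr ψ (fun _ : (ZMod m)ˣ => 1) p * (((p:ℝ) ^ (-s) : ℝ) : ℂ)) -
      ∑' p : ℕ, vT fr ψ (fun _ : (ZMod m)ˣ => 1) p * (((p:ℝ) ^ (-s') : ℝ) : ℂ))
  rw [sub_add_cancel] at hfin
  refine hfin.trans ((add_le_add hS hV).trans ?_)
  rw [habs]
  have hδ : 0 ≤ s' - s := by linarith
  have e1 : ((bad K m).card : ℝ) * d * (s' - s) ≤ X ^ 2 * d * (s' - s) := by gcongr
  have e2 := mul_le_mul_of_nonneg_right hB2 hδ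
  nlinarith [e1, e2]

end

end Mert


namespace Mert

open NumberField Finset Filter Topology MeasureTheory

theorem block (T : Finset ℕ) (hT : ∀ p ∈ T, p.Prime) (j : ℕ) (hj : ∀ p ∈ T, Nat.log 2 p = j) :
    ∑ p ∈ T, Real.log p / p ≤ 2 * Real.log 4 := by
  have h1 : ∀ p ∈ T, Real.log p / p ≤ Real.log p / 2 ^ j := by
    intro p hp
    have hp0 := (hT p hp).ne_zero
    have h2 : (2:ℝ) ^ j ≤ p := by
      have := Nat.pow_log_le_self 2 hp0
      rw [hj p hp] at this
      exact_mod_cast this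
    have := Real.log_natCast_nonneg p
    gcongr
  refine (Finset.sum_le_sum h1).trans ?_
  rw [← Finset.sum_div, div_le_iff₀ (by positivity)]
  have h3 : ∑ p ∈ T, Real.log p ≤ Chebyshev.theta (2 ^ (j + 1)) := by
    unfold Chebyshev.theta
    apply Finset.sum_le_sum_of_subset_of_nonneg
    · intro p hp
      have h4 : p < 2 ^ (j + 1) := by
        have := Nat.lt_pow_succ_log_self (b := 2) (by norm_num) p
        rwa [hj p hp] at this
      rw [Finset.mem_filter, Finset.mem_Ioc]
      refine ⟨⟨(hT p hp).pos, Nat.le_floor ?_⟩, hT p hp⟩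
      push_cast
      exact_mod_cast h4.le
    · intro p _ _
      exact Real.log_natCast_nonneg p
  refine h3.trans ((Chebyshev.theta_le_log4_mul_x (by positivity)).trans ?_)
  rw [pow_succ]
  exact le_of_eq (by ring)

open Classical in
theorem block_sum {h : ℕ → ℝ} (hh : ∀ j, 0 ≤ h j) (hs : Summable h) :
    Summable (fun p : ℕ => if p.Prime then Real.log p / p * h (Nat.log 2 p) else 0) ∧
    ∑' p : ℕ, (if p.Prime then Real.log p / p * h (Nat.log 2 p) else 0) ≤ 2 * Real.log 4 * ∑' j, h j := by
  have h0 : ∀ p : ℕ, 0 ≤ (if p.Prime then Real.log p / p * h (Nat.log 2 p) else 0) := by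
    intro p
    split_ifs
    · exact mul_nonneg (div_nonneg (Real.log_natCast_nonneg p) (by positivity)) (hh _)
    · exact le_rfl
  have key : ∀ T : Finset ℕ, ∑ p ∈ T, (if p.Prime then Real.log p / p * h (Nat.log 2 p) else 0) ≤
      2 * Real.log 4 * ∑' j, h j := by
    intro T
    rw [← Finset.sum_filter, ← Finset.sum_fiberwise_of_maps_to (g := Nat.log 2)
      (t := (T.filter Nat.Prime).image (Nat.log 2)) (fun p hp => Finset.mem_image_of_mem _ hp)]
    have h1 : ∀ j ∈ (T.filter Nat.Prime).image (Nat.log 2),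
        ∑ p ∈ (T.filter Nat.Prime).filter (fun p => Nat.log 2 p = j), Real.log p / p * h (Nat.log 2 p) ≤
          2 * Real.log 4 * h j := by
      intro j _
      have e : ∑ p ∈ (T.filter Nat.Prime).filter (fun p => Nat.log 2 p = j), Real.log p / p * h (Nat.log 2 p) =
          (∑ p ∈ (T.filter Nat.Prime).filter (fun p => Nat.log 2 p = j), Real.log p / p) * h j := by
        rw [Finset.sum_mul]
        refine Finset.sum_congr rfl fun p hp => ?_
        rw [(Finset.mem_filter.1 hp).2]
      rw [e]
      apply mul_le_mul_of_nonneg_right _ (hh j)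
      apply block _ _ j
      · intro p hp
        exact (Finset.mem_filter.1 hp).2
      · intro p hp
        exact (Finset.mem_filter.1 (Finset.mem_filter.1 hp).1).2
    refine (Finset.sum_le_sum h1).trans ?_
    rw [← Finset.mul_sum]
    have : 0 ≤ Real.log 4 := Real.log_nonneg (by norm_num)
    gcongr
    exact hs.sum_le_tsum _ fun j _ => hh j
  exact ⟨summable_of_sum_le h0 key, Real.tsum_le_of_sum_le h0 key⟩

/-- distance weight -/
noncomputable def dw (ρ : ℝ) (J j : ℕ) : ℝ := ρ ^ ((j - J) + (J - j))

theorem dw_sum {ρ : ℝ} (h0 : 0 ≤ ρ) (h1 : ρ < 1) (J : ℕ) :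
    Summable (dw ρ J) ∧ ∑' j, dw ρ J j ≤ 2 / (1 - ρ) := by
  have hg := summable_geometric_of_lt_one h0 h1
  have e : ∀ i, dw ρ J (i + J) = ρ ^ i := by
    intro i
    unfold dw
    congr 1
    omega
  have hs : Summable (dw ρ J) := by
    rw [← summable_nat_add_iff J]
    exact hg.congr fun i => (e i).symm
  refine ⟨hs, ?_⟩
  rw [← hs.sum_add_tsum_nat_add J]
  simp only [e]
  rw [tsum_geometric_of_lt_one h0 h1]
  have h2 : ∑ i ∈ range J, dw ρ J i ≤ (1 - ρ)⁻¹ := by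
    rw [← Finset.sum_range_reflect]
    calc _ ≤ ∑ i ∈ range J, ρ ^ i := by
          apply Finset.sum_le_sum
          intro i hi
          rw [Finset.mem_range] at hi
          unfold dw
          apply pow_le_pow_of_le_one h0 h1.le
          omega
      _ ≤ ∑' i, ρ ^ i := hg.sum_le_tsum _ fun i _ => by positivity
      _ = _ := tsum_geometric_of_lt_one h0 h1
  have e3 : 2 / (1 - ρ) = (1 - ρ)⁻¹ + (1 - ρ)⁻¹ := by ring
  rw [e3]
  linarith

theorem pw_inv {w : ℝ} (h0 : 0 < w) (h1 : w ≤ 1) {N : ℕ} (hN : 0 < N) : (1 - w) ^ N ≤ 1 / (N * w) := by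
  have hN' : (0:ℝ) < N := by exact_mod_cast hN
  have h2 : (1 - w) ^ N * (1 + w) ^ N ≤ 1 := by
    rw [← mul_pow]
    apply pow_le_one₀
    · apply mul_nonneg <;> linarith
    · nlinarith
  have h3 : 1 + N * w ≤ (1 + w) ^ N := one_add_mul_le_pow (by linarith) N
  have h4 : 0 ≤ (1 - w) ^ N := pow_nonneg (by linarith) _
  rw [le_div_iff₀ (by positivity)]
  nlinarith

set_option maxHeartbeats 1600000 in
/-- pointwise comparison of the cutoff with the Karamata polynomial -/
theorem karamata {M J x p : ℕ} (hM : 2 ≤ M) (hJ : 1 ≤ J) (hxJ : Nat.log 2 x = J) (hp : p.Prime) {δ ρ : ℝ}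
    (hδ0 : 0 < δ) (hδ1 : δ ≤ 1) (hρ : ρ = (2:ℝ) ^ (-δ)) (hρJ : ρ ^ J = 1 / (M:ℝ) ^ 2) :
    |(if p ≤ x then (1:ℝ) else 0) - (1 - (1 - (p:ℝ) ^ (-δ)) ^ (M ^ 2))| ≤
      Real.log p * (4 / (J * Real.log 2) * dw ρ J (Nat.log 2 p) +
        if Nat.log 2 p < J then δ * (2 * M) / ((M:ℝ) ^ 2 - 1) else 0) := by
  set j := Nat.log 2 p with hj
  set w := (p:ℝ) ^ (-δ) with hw
  have hl2 : 0 < Real.log 2 := Real.log_pos (by norm_num)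
  have hp2 := hp.two_le
  have hp0 : (0:ℝ) < p := by exact_mod_cast hp.pos
  have hJ0 : (0:ℝ) < J := by exact_mod_cast hJ
  have hM2 : (2:ℝ) ≤ M := by exact_mod_cast hM
  have hρ0 : 0 < ρ := by rw [hρ]; positivity
  have hρ1 : ρ < 1 := by rw [hρ]; exact Real.rpow_lt_one_of_one_lt_of_neg (by norm_num) (by linarith)
  have hρ2 : 1 / 2 ≤ ρ := by
    rw [hρ, show (1:ℝ) / 2 = (2:ℝ) ^ (-1:ℝ) by rw [Real.rpow_neg_one]; norm_num]
    exact Real.rpow_le_rpow_of_exponent_le (by norm_num) (by linarith)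
  have hjp : 2 ^ j ≤ p := Nat.pow_log_le_self 2 hp.ne_zero
  have hjp' : p < 2 ^ (j + 1) := Nat.lt_pow_succ_log_self (by norm_num) p
  have hρpow : ∀ i : ℕ, ((2:ℝ) ^ i) ^ (-δ) = ρ ^ i := by
    intro i
    rw [hρ, ← Real.rpow_natCast, ← Real.rpow_mul (by norm_num), ← Real.rpow_natCast, ← Real.rpow_mul (by norm_num),
      mul_comm]
  have hw1 : w ≤ ρ ^ j := by
    rw [← hρpow]
    exact Real.rpow_le_rpow_of_nonpos (by positivity) (by exact_mod_cast hjp) (by linarith)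
  have hw2 : ρ ^ (j + 1) ≤ w := by
    rw [← hρpow]
    exact Real.rpow_le_rpow_of_nonpos hp0 (by exact_mod_cast hjp'.le) (by linarith)
  have hw0 : 0 < w := by positivity
  have hwle : w ≤ 1 := hw1.trans (pow_le_one₀ hρ0.le hρ1.le)
  have hlogp : j * Real.log 2 ≤ Real.log p := by
    rw [← Real.log_pow]
    exact Real.log_le_log (by positivity) (by exact_mod_cast hjp)
  have hlog0 : 0 ≤ Real.log p := Real.log_natCast_nonneg p
  have hdw0 : 0 ≤ dw ρ J j := by unfold dw; positivity
  have hβ0 : 0 ≤ δ * (2 * M) / ((M:ℝ) ^ 2 - 1) := by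
    apply div_nonneg (by positivity); nlinarith
  have hβ : 0 ≤ (if j < J then δ * (2 * M) / ((M:ℝ) ^ 2 - 1) else 0) := by
    split_ifs
    · exact hβ0
    · exact le_rfl
  have hN : 0 < M ^ 2 := by positivity
  have hNr : (((M ^ 2 : ℕ) : ℝ)) = (M:ℝ) ^ 2 := by push_cast; ring
  have hpow0 : 0 ≤ (1 - w) ^ (M ^ 2) := pow_nonneg (by linarith) _
  have hpow1 : (1 - w) ^ (M ^ 2) ≤ 1 := pow_le_one₀ (by linarith) (by linarith)
  have hc : ∀ c : ℝ, 0 ≤ c → c * J ≤ 4 * j → c * dw ρ J j ≤ Real.log p * (4 / (J * Real.log 2) * dw ρ J j) := by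
    intro c hc0 hcJ
    rw [← mul_assoc]
    apply mul_le_mul_of_nonneg_right _ hdw0
    rw [mul_div_assoc', le_div_iff₀ (by positivity)]
    nlinarith
  rw [mul_add]
  by_cases hpx : p ≤ x
  · rw [if_pos hpx, sub_sub_cancel, abs_of_nonneg hpow0]
    have hjJ : j ≤ J := by rw [← hxJ]; exact Nat.log_mono_right hpx
    have hdwv : dw ρ J j = ρ ^ (J - j) := by unfold dw; congr 1; omega
    have hsp : ρ ^ j * ρ ^ (J - j) = 1 / (M:ℝ) ^ 2 := by rw [← pow_add, ← hρJ]; congr 1; omega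
    by_cases h2 : J ≤ 2 * j
    · have h3 : (1 - w) ^ (M ^ 2) ≤ 2 * dw ρ J j := by
        refine (pw_inv hw0 hwle hN).trans ?_
        rw [hNr, div_le_iff₀ (by positivity), hdwv]
        have h4 : ρ ^ j ≤ 2 * w := by
          rw [pow_succ] at hw2
          have : 0 < ρ ^ j := by positivity
          nlinarith
        have h5 : (M:ℝ) ^ 2 * (ρ ^ j * ρ ^ (J - j)) = 1 := by
          rw [hsp]; field_simp
        calc (1:ℝ) = (M:ℝ) ^ 2 * (ρ ^ j * ρ ^ (J - j)) := h5.symm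
          _ ≤ (M:ℝ) ^ 2 * ((2 * w) * ρ ^ (J - j)) := by gcongr
          _ = _ := by ring
      have h6 := hc 2 (by norm_num) (by
        have : (J:ℝ) ≤ 2 * j := by exact_mod_cast h2
        linarith)
      have h7 := mul_nonneg hlog0 hβ
      linarith
    · push Not at h2
      have hjlt : j < J := by omega
      rw [if_pos hjlt]
      have h3 : 1 - w ≤ δ * Real.log p := by
        have : w = Real.exp (-(δ * Real.log p)) := by
          rw [hw, Real.rpow_def_of_pos hp0]; congr 1; ring
        have h := Real.add_one_le_exp (-(δ * Real.log p))
        rw [← this] at h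
        linarith
      have hN1 : 0 < M ^ 2 - 1 := by
        have : 4 ≤ M ^ 2 := by nlinarith
        omega
      have hN1r : ((M ^ 2 - 1 : ℕ) : ℝ) = (M:ℝ) ^ 2 - 1 := by
        rw [Nat.cast_sub (by omega)]; push_cast; ring
      have hMpos : (0:ℝ) < (M:ℝ) ^ 2 - 1 := by nlinarith
      have h4 : 1 / w ≤ 2 * M := by
        rw [div_le_iff₀ hw0]
        have h5 : (ρ ^ j) ^ 2 * (M:ℝ) ^ 2 ≥ 1 := by
          have : ρ ^ J ≤ (ρ ^ j) ^ 2 := by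
            rw [← pow_mul]
            exact pow_le_pow_of_le_one hρ0.le hρ1.le (by omega)
          rw [hρJ, div_le_iff₀ (by positivity)] at this
          exact this
        have h6 : 1 ≤ ρ ^ j * M := by
          rw [← mul_pow] at h5
          by_contra hcon
          push Not at hcon
          have : 0 ≤ ρ ^ j * M := by positivity
          nlinarith
        have h7 : ρ ^ j ≤ 2 * w := by
          rw [pow_succ] at hw2
          have : 0 < ρ ^ j := by positivity
          nlinarith
        calc (1:ℝ) ≤ ρ ^ j * M := h6
          _ ≤ (2 * w) * M := by gcongr
          _ = _ := by ring
      have h8 : (1 - w) ^ (M ^ 2) ≤ Real.log p * (δ * (2 * M) / ((M:ℝ) ^ 2 - 1)) := by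
        calc (1 - w) ^ (M ^ 2) = (1 - w) ^ (M ^ 2 - 1) * (1 - w) := by
              rw [← pow_succ]; congr 1; omega
          _ ≤ (1 / (((M ^ 2 - 1 : ℕ) : ℝ) * w)) * (δ * Real.log p) := by
              apply mul_le_mul (pw_inv hw0 hwle hN1) h3 (by linarith)
              positivity
          _ = (1 / w) * (δ * Real.log p / ((M:ℝ) ^ 2 - 1)) := by
              rw [hN1r]; field_simp
          _ ≤ (2 * M) * (δ * Real.log p / ((M:ℝ) ^ 2 - 1)) := by
              gcongr
          _ = _ := by ring
      have h9 : 0 ≤ Real.log p * (4 / (J * Real.log 2) * dw ρ J j) := by positivity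
      linarith
  · rw [if_neg hpx]
    push Not at hpx
    have hjJ : J ≤ j := by rw [← hxJ]; exact Nat.log_mono_right hpx.le
    have hdwv : dw ρ J j = ρ ^ (j - J) := by unfold dw; congr 1; omega
    have hsp : ρ ^ j = 1 / (M:ℝ) ^ 2 * ρ ^ (j - J) := by rw [← hρJ, ← pow_add]; congr 1; omega
    have h1 : 1 - (1 - w) ^ (M ^ 2) ≤ dw ρ J j := by
      have h := one_add_mul_le_pow (show (-2:ℝ) ≤ -w by linarith) (M ^ 2)
      rw [hNr] at h
      have h2 : (M:ℝ) ^ 2 * w ≤ dw ρ J j := by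
        rw [hdwv]
        calc (M:ℝ) ^ 2 * w ≤ (M:ℝ) ^ 2 * ρ ^ j := by gcongr
          _ = _ := by rw [hsp]; field_simp
      have e : (1 + -w) ^ (M ^ 2) = (1 - w) ^ (M ^ 2) := by ring_nf
      rw [e] at h
      linarith
    rw [zero_sub, abs_neg, abs_of_nonneg (by linarith)]
    have h6 := hc 1 (by norm_num) (by
        have : (J:ℝ) ≤ j := by exact_mod_cast hjJ
        linarith)
    have h7 := mul_nonneg hlog0 hβ
    linarith

end Mert


namespace Mert

open NumberField Finset Filter Topology MeasureTheory

theorem kpoly (N : ℕ) (hN : 0 < N) : ∃ c : ℕ → ℝ, (∀ w : ℝ, 1 - (1 - w) ^ N = ∑ i ∈ range N, c i * w ^ (i + 1)) ∧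
    ∑ i ∈ range N, c i = 1 := by
  have h : ∀ w : ℝ, 1 - (1 - w) ^ N = ∑ i ∈ range N, (-((-1) ^ (i + 1) * (N.choose (i + 1) : ℝ))) * w ^ (i + 1) := by
    intro w
    rw [show (1 - w) = (-w + 1) by ring, add_pow, Finset.sum_range_succ']
    simp only [one_pow, mul_one, pow_zero, Nat.choose_zero_right, Nat.cast_one]
    rw [sub_add_eq_sub_sub, sub_right_comm, sub_self, zero_sub, ← Finset.sum_neg_distrib]
    refine Finset.sum_congr rfl fun i _ => ?_
    rw [neg_pow w]
    ring
  refine ⟨_, h, ?_⟩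
  have := h 1
  simpa [hN.ne'] using this.symm

theorem taub_err {a : ℕ → ℂ} {d : ℝ} (hd : 0 ≤ d) (ha : ∀ p, ‖a p‖ ≤ d) (ha0 : ∀ p, ¬ p.Prime → a p = 0)
    {M J x : ℕ} (hM : 2 ≤ M) (hJ : 1 ≤ J) (hxJ : Nat.log 2 x = J) {δ : ℝ} (hδ0 : 0 < δ)
    (hδ : δ = 2 * Real.log M / (J * Real.log 2)) (hδ1 : δ ≤ 1) (c : ℕ → ℝ)
    (hc : ∀ w : ℝ, 1 - (1 - w) ^ (M ^ 2) = ∑ i ∈ range (M ^ 2), c i * w ^ (i + 1)) :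
    ‖(∑ p ∈ range (x + 1), a p / p) - ∑ i ∈ range (M ^ 2), (c i : ℂ) *
      ∑' p : ℕ, a p * (((p:ℝ) ^ (-(1 + (i + 1) * δ)) : ℝ) : ℂ)‖ ≤
      d * (2 * Real.log 4 * ((8 / Real.log 2) * (1 / J + 1 / (2 * Real.log M)) +
        (8 / Real.log 2) * (Real.log M / M))) := by
  classical
  have hl2 : 0 < Real.log 2 := Real.log_pos (by norm_num)
  have hJ0 : (0:ℝ) < J := by exact_mod_cast hJ
  have hM2 : (2:ℝ) ≤ M := by exact_mod_cast hM
  have hlM : 0 < Real.log M := Real.log_pos (by linarith)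
  set ρ := (2:ℝ) ^ (-δ) with hρ
  have hρ0 : 0 < ρ := by positivity
  have hρ1 : ρ < 1 := Real.rpow_lt_one_of_one_lt_of_neg (by norm_num) (by linarith)
  have hρe : ρ = Real.exp (-(δ * Real.log 2)) := by
    rw [hρ, Real.rpow_def_of_pos (by norm_num)]; congr 1; ring
  have hδJ : J * (δ * Real.log 2) = 2 * Real.log M := by rw [hδ]; field_simp
  have hρJ : ρ ^ J = 1 / (M:ℝ) ^ 2 := by
    rw [hρe, ← Real.exp_nat_mul, mul_neg, hδJ, Real.exp_neg, one_div]
    congr 1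
    rw [show 2 * Real.log M = ((2:ℕ):ℝ) * Real.log M by norm_num, Real.exp_nat_mul, Real.exp_log (by linarith)]
  have hinv : 1 / (1 - ρ) ≤ 1 + J / (2 * Real.log M) := by
    have ht : 0 < δ * Real.log 2 := by positivity
    have h1 : (1 + δ * Real.log 2) * ρ ≤ 1 := by
      rw [hρe, Real.exp_neg]
      rw [← div_eq_mul_inv, div_le_one (Real.exp_pos _)]
      linarith [Real.add_one_le_exp (δ * Real.log 2)]
    rw [← hδJ, show (J:ℝ) / (J * (δ * Real.log 2)) = 1 / (δ * Real.log 2) by field_simp,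
      div_le_iff₀ (by linarith), show (1 + 1 / (δ * Real.log 2)) * (1 - ρ) =
        ((1 + δ * Real.log 2) * (1 - ρ)) / (δ * Real.log 2) by field_simp; ring, le_div_iff₀ ht]
    linarith
  set β := δ * (2 * M) / ((M:ℝ) ^ 2 - 1) with hβ
  have hMpos : (0:ℝ) < (M:ℝ) ^ 2 - 1 := by nlinarith
  have hβ0 : 0 ≤ β := by positivity
  set h : ℕ → ℝ := fun j => 4 / (J * Real.log 2) * dw ρ J j + if j < J then β else 0 with hh
  have hh0 : ∀ j, 0 ≤ h j := by
    intro j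
    have : 0 ≤ dw ρ J j := by unfold dw; positivity
    have h2 : 0 ≤ (if j < J then β else 0) := by split_ifs <;> simp [hβ0]
    rw [hh]
    positivity
  obtain ⟨ds, dl⟩ := dw_sum hρ0.le hρ1 J
  have hi : HasSum (fun j => if j < J then β else 0) (J * β) := by
    have : HasSum (fun j => if j < J then β else 0) (∑ j ∈ range J, if j < J then β else 0) :=
      hasSum_sum_of_ne_finset_zero (fun j hj => by rw [if_neg]; simpa using hj)
    convert this using 1
    rw [Finset.sum_congr rfl (fun j hj => if_pos (Finset.mem_range.1 hj))]
    simp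
  have hsm : Summable h := (ds.mul_left _).add hi.summable
  have hst : ∑' j, h j ≤ (8 / Real.log 2) * (1 / J + 1 / (2 * Real.log M)) + (8 / Real.log 2) * (Real.log M / M) := by
    rw [hh, (ds.mul_left _).tsum_add hi.summable, tsum_mul_left, hi.tsum_eq]
    apply add_le_add
    · calc 4 / (J * Real.log 2) * ∑' j, dw ρ J j ≤ 4 / (J * Real.log 2) * (2 / (1 - ρ)) := by gcongr
        _ = 8 / (J * Real.log 2) * (1 / (1 - ρ)) := by ring
        _ ≤ 8 / (J * Real.log 2) * (1 + J / (2 * Real.log M)) := by gcongr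
        _ = _ := by field_simp
    · have e : J * β = (2 * Real.log M / Real.log 2) * (2 * M / ((M:ℝ) ^ 2 - 1)) := by
        rw [hβ, hδ]; field_simp
      have h3 : 2 * M / ((M:ℝ) ^ 2 - 1) ≤ 4 / M := by
        rw [div_le_div_iff₀ hMpos (by linarith)]
        nlinarith
      rw [e]
      calc _ ≤ (2 * Real.log M / Real.log 2) * (4 / M) := by gcongr
        _ = _ := by ring
  obtain ⟨bs, bl⟩ := block_sum hh0 hsm
  have hN : 0 < M ^ 2 := by positivity
  -- rewrite both sides as sums over p
  have e1 : (∑ p ∈ range (x + 1), a p / p) = ∑' p : ℕ, a p / p * ((if p ≤ x then (1:ℝ) else 0 : ℝ) : ℂ) := by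
    rw [tsum_eq_sum (s := range (x + 1))]
    · refine Finset.sum_congr rfl fun p hp => ?_
      rw [if_pos (by rw [Finset.mem_range] at hp; omega)]
      simp
    · intro p hp
      rw [if_neg (by rw [Finset.mem_range] at hp; omega)]
      simp
  have s1 : Summable fun p : ℕ => a p / p * ((if p ≤ x then (1:ℝ) else 0 : ℝ) : ℂ) := by
    apply summable_of_ne_finset_zero (s := range (x + 1))
    intro p hp
    rw [if_neg (by rw [Finset.mem_range] at hp; omega)]
    simp
  have sS : ∀ s : ℝ, 1 < s → Summable fun p : ℕ => a p * (((p:ℝ) ^ (-s) : ℝ) : ℂ) := by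
    intro s hs
    refine Summable.of_norm_bounded (g := fun k : ℕ => d * (k:ℝ) ^ (-s))
      ((Real.summable_nat_rpow.2 (by linarith)).mul_left _) fun k => ?_
    rw [norm_mul, Complex.norm_real, Real.norm_of_nonneg (by positivity)]
    gcongr
    exact ha k
  have hi1 : ∀ i : ℕ, 1 < 1 + ((i:ℝ) + 1) * δ := fun i => by
    have : 0 < ((i:ℝ) + 1) * δ := by positivity
    linarith
  have s2' : Summable fun p : ℕ => ∑ i ∈ range (M ^ 2), (c i : ℂ) * (a p * (((p:ℝ) ^ (-(1 + ((i:ℝ) + 1) * δ)) : ℝ) : ℂ)) :=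
    summable_sum fun i _ => (sS _ (hi1 i)).mul_left _
  have et : ∀ p : ℕ, ∑ i ∈ range (M ^ 2), (c i : ℂ) * (a p * (((p:ℝ) ^ (-(1 + ((i:ℝ) + 1) * δ)) : ℝ) : ℂ)) =
      a p / p * ((1 - (1 - (p:ℝ) ^ (-δ)) ^ (M ^ 2) : ℝ) : ℂ) := by
    intro p
    by_cases hp : p.Prime
    · have hp0 : (0:ℝ) < p := by exact_mod_cast hp.pos
      rw [hc, Complex.ofReal_sum, Finset.mul_sum]
      refine Finset.sum_congr rfl fun i _ => ?_
      have : (p:ℝ) ^ (-(1 + ((i:ℝ) + 1) * δ)) = (p:ℝ)⁻¹ * ((p:ℝ) ^ (-δ)) ^ (i + 1) := by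
        rw [← Real.rpow_natCast, ← Real.rpow_mul hp0.le, ← Real.rpow_neg_one, ← Real.rpow_add hp0]
        congr 1
        push_cast
        ring
      rw [this]
      push_cast
      ring
    · simp [ha0 p hp]
  have e2 : (∑ i ∈ range (M ^ 2), (c i : ℂ) * ∑' p : ℕ, a p * (((p:ℝ) ^ (-(1 + (i + 1) * δ)) : ℝ) : ℂ)) =
      ∑' p : ℕ, a p / p * ((1 - (1 - (p:ℝ) ^ (-δ)) ^ (M ^ 2) : ℝ) : ℂ) := by
    simp only [← tsum_mul_left]
    rw [← Summable.tsum_finsetSum fun i _ => (sS _ (hi1 i)).mul_left _]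
    congr 1
    funext p
    exact et p
  have s2 : Summable fun p : ℕ => a p / p * ((1 - (1 - (p:ℝ) ^ (-δ)) ^ (M ^ 2) : ℝ) : ℂ) :=
    s2'.congr et
  rw [e1, e2, ← s1.tsum_sub s2]
  refine le_trans (tsum_of_norm_bounded (bs.mul_left d).hasSum fun p => ?_) ?_
  · rw [← mul_sub, ← Complex.ofReal_sub, norm_mul, Complex.norm_real, Real.norm_eq_abs]
    by_cases hp : p.Prime
    · rw [if_pos hp, norm_div, Complex.norm_natCast]
      have hk := karamata hM hJ hxJ hp hδ0 hδ1 hρ hρJ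
      have hp0 : (0:ℝ) < p := by exact_mod_cast hp.pos
      calc _ ≤ d / p * (Real.log p * h (Nat.log 2 p)) := by
            apply mul_le_mul _ hk (abs_nonneg _) (by positivity)
            have := ha p
            gcongr
        _ = _ := by ring
    · simp [ha0 p hp, hp]
  · rw [tsum_mul_left]
    apply mul_le_mul_of_nonneg_left _ hd
    refine bl.trans ?_
    have : 0 ≤ Real.log 4 := Real.log_nonneg (by norm_num)
    gcongr

theorem taub {a : ℕ → ℂ} {d : ℝ} (hd : 0 ≤ d) (ha : ∀ p, ‖a p‖ ≤ d) (ha0 : ∀ p, ¬ p.Prime → a p = 0) {C : ℂ}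
    (hS : Tendsto (fun s : ℝ => ∑' p : ℕ, a p * (((p:ℝ) ^ (-s) : ℝ) : ℂ)) (𝓝[>] 1) (𝓝 C)) :
    Tendsto (fun x : ℕ => ∑ p ∈ range (x + 1), a p / p) atTop (𝓝 C) := by
  have hl2 : 0 < Real.log 2 := Real.log_pos (by norm_num)
  have hJt : Tendsto (fun x : ℕ => Nat.log 2 x) atTop atTop := 
    tendsto_atTop_atTop.2 fun b => ⟨2 ^ b, fun x hx => Nat.le_log_of_pow_le (by norm_num) hx⟩
  have hJr : Tendsto (fun x : ℕ => (Nat.log 2 x : ℝ)) atTop atTop := tendsto_natCast_atTop_atTop.comp hJt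
  have hMlim : Tendsto (fun M : ℕ => d * (2 * Real.log 4 * ((8 / Real.log 2) * (0 + 1 / (2 * Real.log M)) +
        (8 / Real.log 2) * (Real.log M / M)))) atTop (𝓝 (d * (2 * Real.log 4 * ((8 / Real.log 2) * (0 + 0) +
        (8 / Real.log 2) * 0)))) := by
    have h1 : Tendsto (fun M : ℕ => Real.log M / M) atTop (𝓝 0) := by
      have := (Real.isLittleO_log_id_atTop.tendsto_div_nhds_zero).comp (tendsto_natCast_atTop_atTop (R := ℝ))
      exact this
    have h2 : Tendsto (fun M : ℕ => 1 / (2 * Real.log M)) atTop (𝓝 0) := by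
      simp only [one_div]
      exact ((Real.tendsto_log_atTop.comp tendsto_natCast_atTop_atTop).const_mul_atTop (by norm_num)).inv_tendsto_atTop
    exact ((((h2.const_add 0).const_mul _).add (h1.const_mul _)).const_mul _).const_mul _
  simp only [add_zero, mul_zero] at hMlim
  rw [Metric.tendsto_nhds]
  intro η hη
  obtain ⟨M, hMη, hM⟩ := ((hMlim.eventually (gt_mem_nhds (show (0:ℝ) < η / 2 by positivity))).and
    (eventually_ge_atTop 2)).exists
  have hM2 : (2:ℝ) ≤ M := by exact_mod_cast hM
  have hlM : 0 < Real.log M := Real.log_pos (by linarith)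
  obtain ⟨c, hc, hc1⟩ := kpoly (M ^ 2) (by positivity)
  set δ : ℕ → ℝ := fun x => 2 * Real.log M / (Nat.log 2 x * Real.log 2) with hδ
  have hδ0 : Tendsto δ atTop (𝓝 0) := by
    apply Tendsto.const_div_atTop
    exact hJr.atTop_mul_const hl2
  have hδpos : ∀ᶠ x in atTop, 0 < δ x := by
    filter_upwards [hJr.eventually_gt_atTop 0] with x hx
    positivity
  have hpoly : Tendsto (fun x : ℕ => ∑ i ∈ range (M ^ 2), (c i : ℂ) *
      ∑' p : ℕ, a p * (((p:ℝ) ^ (-(1 + (i + 1) * δ x)) : ℝ) : ℂ)) atTop (𝓝 C) := by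
    have : C = ∑ i ∈ range (M ^ 2), (c i : ℂ) * C := by
      rw [← Finset.sum_mul, ← Complex.ofReal_sum, hc1]; simp
    rw [this]
    apply tendsto_finset_sum
    intro i _
    apply Tendsto.const_mul
    have h3 : Tendsto (fun x => 1 + ((i:ℝ) + 1) * δ x) atTop (𝓝[>] 1) := by
      rw [tendsto_nhdsWithin_iff]
      constructor
      · have := (hδ0.const_mul ((i:ℝ) + 1)).const_add 1
        simpa using this
      · filter_upwards [hδpos] with x hx
        have : 0 < ((i:ℝ) + 1) * δ x := by positivity
        simp only [Set.mem_Ioi]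
        linarith
    have := hS.comp h3
    exact this
  have herr : Tendsto (fun x : ℕ => d * (2 * Real.log 4 * ((8 / Real.log 2) * (1 / (Nat.log 2 x : ℝ) + 1 / (2 * Real.log M)) +
        (8 / Real.log 2) * (Real.log M / M)))) atTop (𝓝 (d * (2 * Real.log 4 * ((8 / Real.log 2) * (0 + 1 / (2 * Real.log M)) +
        (8 / Real.log 2) * (Real.log M / M))))) := by
    have h2 : Tendsto (fun x : ℕ => 1 / (Nat.log 2 x : ℝ)) atTop (𝓝 0) := by
      simp only [one_div]
      exact hJr.inv_tendsto_atTop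
    exact ((((h2.add_const _).const_mul _).add_const _).const_mul _).const_mul _
  simp only [zero_add] at herr hMη
  filter_upwards [herr.eventually (gt_mem_nhds hMη), (Metric.tendsto_nhds.1 hpoly) (η / 2) (by positivity), hδpos,
    hδ0.eventually (gt_mem_nhds (show (0:ℝ) < 1 by norm_num)), hJt.eventually_ge_atTop 1] with x h1 h2 h3 h4 h5
  have h6 := taub_err hd ha ha0 hM h5 rfl h3 rfl h4.le c hc
  calc dist (∑ p ∈ range (x + 1), a p / p) C ≤ _ + _ := dist_triangle _ (∑ i ∈ range (M ^ 2), (c i : ℂ) *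
      ∑' p : ℕ, a p * (((p:ℝ) ^ (-(1 + (i + 1) * δ x)) : ℝ) : ℂ)) _
    _ < η / 2 + η / 2 := by
      apply add_lt_add _ h2
      rw [dist_eq_norm]
      exact lt_of_le_of_lt h6 h1
    _ = η := by ring

end Mert

namespace Mert
universe u v
open NumberField Finset Filter Topology MeasureTheory

section
variable {F : Type u} {K : Type v} [Field F] [NumberField F] [Field K] [NumberField K]
    [Algebra F K] [IsGalois F K]

theorem cE_lamE (k : ℕ) : (cE F k : ℝ) * Real.log k ≤ lamE F k := by
  classical
  rw [lamE, cE, ← nsmul_eq_mul, ← Finset.sum_const, Finset.sum_filter]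
  refine Finset.sum_le_sum fun P hP => ?_
  obtain ⟨h1, h2, h3⟩ := mem_prm.1 hP
  have h4 := two_le_norm h1 h2
  have hnn : ∀ j ∈ Icc 1 k, 0 ≤ (if Ideal.absNorm P ^ j = k then Real.log (Ideal.absNorm P) else 0) := by
    intro j _
    split_ifs
    · exact Real.log_natCast_nonneg _
    · exact le_rfl
  split_ifs with h
  · have := Finset.single_le_sum hnn (Finset.mem_Icc.2 ⟨le_rfl, (by omega : 1 ≤ k)⟩)
    rw [pow_one, if_pos h] at this
    rw [h] at this ⊢
    exact this
  · exact Finset.sum_nonneg hnn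

theorem gS_cE (fr : Ideal (𝓞 F) → Gal(K/F)) (ψ : Gal(K/F) →* ℂˣ) {n : ℕ} (hn : 0 < n)
    (hψn : ∀ g, ψ g ^ n = 1) (p : ℕ) : ‖gS fr ψ p‖ ≤ cE F p := by
  unfold gS cE
  refine (norm_sum_le _ _).trans ?_
  have : ∀ 𝔭, ‖(ψ (fr 𝔭) : ℂ)‖ = 1 := fun 𝔭 =>
    Complex.norm_eq_one_of_pow_eq_one (n := n) (by rw [← Units.val_pow_eq_pow_val, hψn]; simp) hn.ne'
  simp [this]

theorem np_summable (fr : Ideal (𝓞 F) → Gal(K/F)) (ψ : Gal(K/F) →* ℂˣ) {n : ℕ} (hn : 0 < n)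
    (hψn : ∀ g, ψ g ^ n = 1) :
    Summable fun k : ℕ => (if k.Prime then 0 else gS fr ψ k) / (k : ℂ) := by
  have hl2 : 0 < Real.log 2 := Real.log_pos (by norm_num)
  refine Summable.of_norm_bounded (g := fun k : ℕ => (Module.finrank ℚ F : ℝ) / Real.log 2 *
    ((if k.Prime then 0 else ArithmeticFunction.vonMangoldt k) / (k:ℝ))) (R0_summable.mul_left _) fun k => ?_
  rw [norm_div, Complex.norm_natCast, ← mul_div_assoc]
  apply div_le_div_of_nonneg_right _ (Nat.cast_nonneg k)
  split_ifs with h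
  · simp
  have hb := gS_cE fr ψ hn hψn k
  have hc := (cE_lamE (F := F) k).trans (lamE_le k)
  by_cases hk : 2 ≤ k
  · have hlk : Real.log 2 ≤ Real.log k := Real.log_le_log (by norm_num) (by exact_mod_cast hk)
    rw [div_mul_eq_mul_div, le_div_iff₀ hl2]
    calc ‖gS fr ψ k‖ * Real.log 2 ≤ cE F k * Real.log k := by gcongr
      _ ≤ _ := hc
  · have : gS fr ψ k = 0 := by
      unfold gS
      rw [Finset.sum_eq_zero]
      intro P hP
      obtain ⟨hP, _⟩ := Finset.mem_filter.1 hP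
      obtain ⟨h1, h2, h3⟩ := mem_prm.1 hP
      have h4 := two_le_norm h1 h2
      omega
    rw [this, norm_zero]
    have := ArithmeticFunction.vonMangoldt_nonneg (n := k)
    positivity

theorem gS_lim (hab : ∀ σ τ : Gal(K/F), σ * τ = τ * σ)
    (fr : Ideal (𝓞 F) → Gal(K/F))
    (hfr : ∀ 𝔭 : Ideal (𝓞 F), 𝔭.IsPrime → 𝔭 ≠ ⊥ → ∃ 𝔔 : Ideal (𝓞 K), 𝔔.IsPrime ∧
      𝔔.under (𝓞 F) = 𝔭 ∧ Fr (fr 𝔭) 𝔔 (Ideal.absNorm 𝔭)) (ψ : Gal(K/F) →* ℂˣ) (hψ : ψ ≠ 1) :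
    ∃ C : ℂ, Tendsto (fun x : ℕ => ∑ p ∈ range (x + 1), gS fr ψ p / p) atTop (𝓝 C) := by
  obtain ⟨hn2, hψn, -⟩ := char_facts ψ hψ
  have hn0 : 0 < Nat.card ψ.range := by omega
  obtain ⟨C, hC⟩ := S_lim hab fr hfr ψ hψ
  have h1 := taub (Nat.cast_nonneg _) (sT_le fr ψ hn0 hψn) (fun p hp => by simp [sT, hp]) hC
  have h2 := (np_summable fr ψ hn0 hψn).hasSum.tendsto_sum_nat.comp (tendsto_add_atTop_nat 1)
  refine ⟨_, (h1.add h2).congr fun x => ?_⟩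
  simp only [Function.comp]
  rw [← Finset.sum_add_distrib]
  refine Finset.sum_congr rfl fun p _ => ?_
  rw [← add_div, sT]
  split_ifs <;> simp

open Classical in
theorem final_mertens (hab : ∀ σ τ : Gal(K/F), σ * τ = τ * σ) (ψ : Gal(K/F) →* ℂˣ) (hψ : ψ ≠ 1)
    (Frob : {I : Ideal (𝓞 F) // I.IsPrime ∧ I ≠ ⊥} → Gal(K/F))
    (hFrob : ∀ 𝔭, ∃ 𝔔 : Ideal (𝓞 K), 𝔔.IsPrime ∧
      Ideal.comap (algebraMap (𝓞 F) (𝓞 K)) 𝔔 = 𝔭.1 ∧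
      ∀ x : 𝓞 K, (galRestrict (𝓞 F) F K (𝓞 K) (Frob 𝔭)) x - x ^ Ideal.absNorm 𝔭.1 ∈ 𝔔) :
    ∃ C : ℂ, Tendsto (fun x : ℕ => ∑' 𝔭 : {I : Ideal (𝓞 F) // I.IsPrime ∧ I ≠ ⊥},
          if Ideal.absNorm 𝔭.1 ≤ x then (ψ (Frob 𝔭) : ℂ) / (Ideal.absNorm 𝔭.1 : ℂ) else 0)
      atTop (𝓝 C) := by
  set fr : Ideal (𝓞 F) → Gal(K/F) := fun 𝔭 => if h : 𝔭.IsPrime ∧ 𝔭 ≠ ⊥ then Frob ⟨𝔭, h⟩ else 1 with hfrd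
  have hfre : ∀ 𝔭 : {I : Ideal (𝓞 F) // I.IsPrime ∧ I ≠ ⊥}, fr 𝔭.1 = Frob 𝔭 := fun 𝔭 => by
    rw [hfrd]; exact dif_pos 𝔭.2
  obtain ⟨C, hC⟩ := gS_lim hab fr (fun 𝔭 h1 h2 => by
    obtain ⟨Q, hQ, hc, hx⟩ := hFrob ⟨𝔭, h1, h2⟩
    refine ⟨Q, hQ, hc, fun x => ?_⟩
    rw [hfre ⟨𝔭, h1, h2⟩, smul_eq]
    exact hx x) ψ hψ
  refine ⟨C, hC.congr fun x => ?_⟩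
  have e1 : (∑' 𝔭 : {I : Ideal (𝓞 F) // I.IsPrime ∧ I ≠ ⊥},
          if Ideal.absNorm 𝔭.1 ≤ x then (ψ (Frob 𝔭) : ℂ) / (Ideal.absNorm 𝔭.1 : ℂ) else 0) =
      ∑' 𝔭 : Ideal (𝓞 F), ({I : Ideal (𝓞 F) | I.IsPrime ∧ I ≠ ⊥}).indicator (fun 𝔭 =>
        if Ideal.absNorm 𝔭 ≤ x then (ψ (fr 𝔭) : ℂ) / (Ideal.absNorm 𝔭 : ℂ) else 0) 𝔭 := by
    rw [← tsum_subtype {I : Ideal (𝓞 F) | I.IsPrime ∧ I ≠ ⊥} (fun 𝔭 =>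
        if Ideal.absNorm 𝔭 ≤ x then (ψ (fr 𝔭) : ℂ) / (Ideal.absNorm 𝔭 : ℂ) else 0)]
    refine tsum_congr fun 𝔭 => ?_
    rw [← hfre 𝔭]
  rw [e1, tsum_eq_sum (s := prm F x)]
  · have e2 : ∀ P ∈ prm F x, Ideal.absNorm P ∈ range (x + 1) := fun P hP => by
      have := (mem_prm.1 hP).2.2
      rw [Finset.mem_range]; omega
    rw [← Finset.sum_fiberwise_of_maps_to e2]
    refine Finset.sum_congr rfl fun p hp => ?_
    have hpx : p ≤ x := by rw [Finset.mem_range] at hp; omega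
    rw [gS, Finset.sum_div]
    have e3 : (prm F p).filter (fun 𝔭 => Ideal.absNorm 𝔭 = p) = (prm F x).filter (fun 𝔭 => Ideal.absNorm 𝔭 = p) := by
      ext P
      simp only [Finset.mem_filter, mem_prm]
      constructor
      · rintro ⟨⟨h1, h2, h3⟩, h4⟩
        exact ⟨⟨h1, h2, by omega⟩, h4⟩
      · rintro ⟨⟨h1, h2, h3⟩, h4⟩
        exact ⟨⟨h1, h2, by omega⟩, h4⟩
    rw [e3]
    refine Finset.sum_congr rfl fun P hP => ?_
    obtain ⟨hP, hn⟩ := Finset.mem_filter.1 hP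
    obtain ⟨h1, h2, h3⟩ := mem_prm.1 hP
    rw [Set.indicator_of_mem (show P ∈ {I : Ideal (𝓞 F) | I.IsPrime ∧ I ≠ ⊥} from ⟨h1, h2⟩), if_pos h3, hn]
  · intro P hP
    by_cases h : P ∈ {I : Ideal (𝓞 F) | I.IsPrime ∧ I ≠ ⊥}
    · rw [Set.indicator_of_mem h, if_neg]
      intro h3
      exact hP (mem_prm.2 ⟨h.1, h.2, h3⟩)
    · rw [Set.indicator_of_notMem h]

end

end Mert


open NumberField in
/-- Generalized Mertens theorem for nontrivial characters: let K/F be a finite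
abelian (Galois) extension of number fields, ψ a nontrivial character of
Gal(K/F), and Frob_𝔭 the Artin symbol at 𝔭 (characterized by acting as the
q_𝔭-power map modulo some prime above 𝔭).  Then
∑_{q_𝔭 ≤ x} ψ(Frob_𝔭)/q_𝔭 = C + o(1) as x → ∞ for some constant C. -/
theorem mertens_nontrivial_character
    (F K : Type*) [Field F] [NumberField F] [Field K] [NumberField K]
    [Algebra F K] [IsGalois F K]
    (habelian : ∀ σ τ : K ≃ₐ[F] K, σ * τ = τ * σ)
    (ψ : (K ≃ₐ[F] K) →* ℂˣ) (hψ : ψ ≠ 1)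
    (Frob : {I : Ideal (RingOfIntegers F) // I.IsPrime ∧ I ≠ ⊥} → (K ≃ₐ[F] K))
    (hFrob : ∀ 𝔭, ∃ 𝔔 : Ideal (RingOfIntegers K), 𝔔.IsPrime ∧
      Ideal.comap (algebraMap (RingOfIntegers F) (RingOfIntegers K)) 𝔔 = 𝔭.1 ∧
      ∀ x : RingOfIntegers K,
        (galRestrict (RingOfIntegers F) F K (RingOfIntegers K) (Frob 𝔭)) x
          - x ^ Ideal.absNorm 𝔭.1 ∈ 𝔔) :
    ∃ C : ℂ, Filter.Tendsto (fun x : ℕ =>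
        ∑' 𝔭 : {I : Ideal (RingOfIntegers F) // I.IsPrime ∧ I ≠ ⊥},
          if Ideal.absNorm 𝔭.1 ≤ x then
            (ψ (Frob 𝔭) : ℂ) / (Ideal.absNorm 𝔭.1 : ℂ)
          else 0)
      Filter.atTop (nhds C) := by
  exact Mert.final_mertens habelian ψ hψ Frob hFrob
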